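/- Fix positive constants e, E, d, D, δ and reals r, k, m, s with k > 2, 0 < r < k, s > 2, 0 < m < s. Then there exist constants ℰ₁, ℰ₂ > 0 depending only on e, E, d, D, δ, r, k, m, s, and for every ε > 0 there exist constants ℰ₃, ℰ₄ > 0 additionally depending on ε, such that the following holds. Let n ≥ 2 and let e₁,…,e_n and d₁,…,d_n be reals satisfying: (i) Σ_{i=1}^{n}|e_i − ē|^r ≥ e·n and Σ_{i=1}^{n}|e_i − ē|^k ≤ E·n; (ii) Σ_{j=1}^{n}|d_j − d̄|^m ≥ d·n and Σ_{j=1}^{n}|d_j − d̄|^s ≤ D·n; (iii) λ(∪_{j=1}^{n}{x ∈ ℝ : |x − d_j| < ζ}) ≥ δ·n·ζ for some ζ ≥ n^{-3/2}·log n, where λ is Lebesgue measure. Then for the matrix A = (e_i·d_j): ‖ℱ_A − e_{1,A}‖ ≤ ℰ₁·(log n)²·D_A² ≤ ℰ₂·(log n)²·n^{−1+((4/k)−1)⁺+((4/s)−1)⁺}, and ‖ℱ_A − e_{2,A}‖ ≤ ℰ₃·n^ε·E_A³ ≤ ℰ₄·n^{−3/2+ε+((5/k)−1)⁺+((5/s)−1)⁺}.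 -/

import Mathlib

open Finset MeasureTheory

/-- Density of the standard normal distribution. -/
noncomputable def gaussD (x : ℝ) : ℝ := (Real.sqrt (2 * Real.pi))⁻¹ * Real.exp (-(x ^ 2) / 2)

/-- Distribution function of the standard normal distribution. -/
noncomputable def gaussCDF (x : ℝ) : ℝ := ∫ t in Set.Iic x, gaussD t

section RankDefs

variable {m : ℕ}

/-- Row mean `a_{i·}`. -/
noncomputable def rowMean (A : Matrix (Fin m) (Fin m) ℝ) (i : Fin m) : ℝ := (∑ j, A i j) / (m : ℝ)

/-- Column mean `a_{·j}`. -/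
noncomputable def colMean (A : Matrix (Fin m) (Fin m) ℝ) (j : Fin m) : ℝ := (∑ i, A i j) / (m : ℝ)

/-- Grand mean `a_{··}`. -/
noncomputable def totMean (A : Matrix (Fin m) (Fin m) ℝ) : ℝ := (∑ i, ∑ j, A i j) / (m : ℝ) ^ 2

/-- Centered entries `a_{ij} − a_{i·} − a_{·j} + a_{··}`. -/
noncomputable def ctr (A : Matrix (Fin m) (Fin m) ℝ) (i j : Fin m) : ℝ :=
  A i j - rowMean A i - colMean A j + totMean A

/-- `σ_A²`. -/
noncomputable def sigma2 (A : Matrix (Fin m) (Fin m) ℝ) : ℝ :=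
  (∑ i, ∑ j, ctr A i j ^ 2) / ((m : ℝ) - 1)

/-- `σ_A`. -/
noncomputable def sdev (A : Matrix (Fin m) (Fin m) ℝ) : ℝ := Real.sqrt (sigma2 A)

/-- Standardized matrix `Â = (â_{ij})`. -/
noncomputable def hatM (A : Matrix (Fin m) (Fin m) ℝ) : Matrix (Fin m) (Fin m) ℝ :=
  fun i j => ctr A i j / sdev A

/-- `μ_A = n·a_{··}`. -/
noncomputable def muM (A : Matrix (Fin m) (Fin m) ℝ) : ℝ := (m : ℝ) * totMean A

/-- The linear rank statistic `T_A(π) = Σ_i a_{iπ(i)}`. -/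
noncomputable def rankT (A : Matrix (Fin m) (Fin m) ℝ) (π : Equiv.Perm (Fin m)) : ℝ :=
  ∑ i, A i (π i)

/-- Expectation with respect to the uniform distribution on permutations. -/
noncomputable def permExp (f : Equiv.Perm (Fin m) → ℝ) : ℝ :=
  (∑ π : Equiv.Perm (Fin m), f π) / (Nat.factorial m : ℝ)

/-- The standardized rank statistic `𝒯_A = (T_A − μ_A)/σ_A`. -/
noncomputable def rankTstd (A : Matrix (Fin m) (Fin m) ℝ) (π : Equiv.Perm (Fin m)) : ℝ :=
  (rankT A π - muM A) / sdev A

/-- `F_A`, the distribution function of `T_A`. -/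
noncomputable def Fr (A : Matrix (Fin m) (Fin m) ℝ) (z : ℝ) : ℝ :=
  permExp (fun π => if rankT A π ≤ z then (1 : ℝ) else 0)

/-- `ℱ_A`, the distribution function of `𝒯_A`. -/
noncomputable def Fstd (A : Matrix (Fin m) (Fin m) ℝ) (z : ℝ) : ℝ :=
  permExp (fun π => if rankTstd A π ≤ z then (1 : ℝ) else 0)

/-- `β_A = Σ_{i,j} |â_{ij}|³`. -/
noncomputable def betaM (A : Matrix (Fin m) (Fin m) ℝ) : ℝ := ∑ i, ∑ j, |hatM A i j| ^ 3

/-- `δ_A = Σ_{i,j} |â_{ij}|⁴`. -/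
noncomputable def deltaM (A : Matrix (Fin m) (Fin m) ℝ) : ℝ := ∑ i, ∑ j, |hatM A i j| ^ 4

/-- `η_A = Σ_{i,j} |â_{ij}|⁵`. -/
noncomputable def etaM (A : Matrix (Fin m) (Fin m) ℝ) : ℝ := ∑ i, ∑ j, |hatM A i j| ^ 5

/-- `D_A = (δ_A/n)^{1/2}`. -/
noncomputable def DM (A : Matrix (Fin m) (Fin m) ℝ) : ℝ := Real.sqrt (deltaM A / (m : ℝ))

/-- `E_A = (η_A/n)^{1/3}`. -/
noncomputable def EM (A : Matrix (Fin m) (Fin m) ℝ) : ℝ := (etaM A / (m : ℝ)) ^ ((1 : ℝ) / 3)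

/-- `λ_{1,A} = (1/n)Σ_{i,j} â_{ij}³`. -/
noncomputable def lam1 (A : Matrix (Fin m) (Fin m) ℝ) : ℝ := (∑ i, ∑ j, hatM A i j ^ 3) / (m : ℝ)

/-- `λ_{2,A}`. -/
noncomputable def lam2 (A : Matrix (Fin m) (Fin m) ℝ) : ℝ :=
  (∑ i, ∑ j, hatM A i j ^ 4) / (m : ℝ) + 3 / (m : ℝ)
    - 3 / (m : ℝ) ^ 2 *
        ∑ i, ∑ j, ∑ k, (hatM A i j ^ 2 * hatM A i k ^ 2 + hatM A i j ^ 2 * hatM A k j ^ 2)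

/-- First-order Edgeworth expansion `e_{1,A}`. -/
noncomputable def edge1 (A : Matrix (Fin m) (Fin m) ℝ) (x : ℝ) : ℝ :=
  gaussCDF x - gaussD x * (lam1 A / 6) * (x ^ 2 - 1)

/-- Second-order Edgeworth expansion `e_{2,A}`. -/
noncomputable def edge2 (A : Matrix (Fin m) (Fin m) ℝ) (x : ℝ) : ℝ :=
  gaussCDF x - gaussD x *
    (lam1 A / 6 * (x ^ 2 - 1) + lam2 A / 24 * (x ^ 3 - 3 * x)
      + lam1 A ^ 2 / 72 * (x ^ 5 - 10 * x ^ 3 + 15 * x))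

/-- `k`-th iterated difference `Δ_y^k G`. -/
noncomputable def Δiter (y : ℝ) (k : ℕ) (G : ℝ → ℝ) : ℝ → ℝ :=
  (fun (G : ℝ → ℝ) (z : ℝ) => G (z + y) - G z)^[k] G

/-- The interpolating polynomial `P_y^k(x; z, F)` of `F` at the points `z, z+y, …, z+ky`. -/
noncomputable def interp (y : ℝ) (k : ℕ) (z : ℝ) (F : ℝ → ℝ) (x : ℝ) : ℝ :=
  F z + ∑ s ∈ Finset.Icc 1 k,
    Δiter y s F z * ∏ i ∈ Finset.Icc 1 s, (x - z - ((i : ℝ) - 1) * y) / ((i : ℝ) * y)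

end RankDefs

namespace RankEdge

/-- Complex-valued expectation over uniform permutations. -/
noncomputable def EC {n : ℕ} (f : Equiv.Perm (Fin n) → ℂ) : ℂ :=
  (∑ π, f π) / (Nat.factorial n : ℂ)

section basic
variable {n : ℕ}

lemma fact_pos : (0 : ℝ) < (Nat.factorial n : ℝ) := by exact_mod_cast Nat.factorial_pos n

lemma fact_ne : (Nat.factorial n : ℂ) ≠ 0 := by exact_mod_cast (Nat.factorial_pos n).ne'

lemma EC_add (f g : Equiv.Perm (Fin n) → ℂ) : EC (fun π => f π + g π) = EC f + EC g := by
  simp [EC, Finset.sum_add_distrib, add_div]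

lemma EC_sub (f g : Equiv.Perm (Fin n) → ℂ) : EC (fun π => f π - g π) = EC f - EC g := by
  simp [EC, Finset.sum_sub_distrib, sub_div]

lemma EC_mul (a : ℂ) (f : Equiv.Perm (Fin n) → ℂ) : EC (fun π => a * f π) = a * EC f := by
  simp [EC, ← Finset.mul_sum, mul_div_assoc]

lemma EC_sum {ι : Type*} (s : Finset ι) (f : ι → Equiv.Perm (Fin n) → ℂ) :
    EC (fun π => ∑ i ∈ s, f i π) = ∑ i ∈ s, EC (f i) := by
  simp only [EC]
  rw [Finset.sum_comm, Finset.sum_div]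

lemma EC_comp (f : Equiv.Perm (Fin n) → ℂ) (τ : Equiv.Perm (Fin n)) :
    EC (fun π => f (π * τ)) = EC f := by
  simp only [EC]
  congr 1
  exact Equiv.sum_comp (Equiv.mulRight τ) f

lemma PE_comp (f : Equiv.Perm (Fin n) → ℝ) (τ : Equiv.Perm (Fin n)) :
    permExp (fun π => f (π * τ)) = permExp f := by
  simp only [permExp]
  congr 1
  exact Equiv.sum_comp (Equiv.mulRight τ) f

lemma PE_mono {f g : Equiv.Perm (Fin n) → ℝ} (h : ∀ π, f π ≤ g π) : permExp f ≤ permExp g := by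
  simp only [permExp]
  exact div_le_div_of_nonneg_right (Finset.sum_le_sum fun π _ => h π) fact_pos.le

lemma PE_nonneg {f : Equiv.Perm (Fin n) → ℝ} (h : ∀ π, 0 ≤ f π) : 0 ≤ permExp f := by
  simp only [permExp]
  exact div_nonneg (Finset.sum_nonneg fun π _ => h π) fact_pos.le

lemma PE_const (a : ℝ) : permExp (fun _ : Equiv.Perm (Fin n) => a) = a := by
  simp only [permExp, Finset.sum_const, Finset.card_univ, Fintype.card_perm, Fintype.card_fin,
    nsmul_eq_mul]
  field_simp [fact_pos.ne']

lemma EC_const (a : ℂ) : EC (fun _ : Equiv.Perm (Fin n) => a) = a := by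
  simp only [EC, Finset.sum_const, Finset.card_univ, Fintype.card_perm, Fintype.card_fin,
    nsmul_eq_mul]
  rw [mul_div_cancel_left₀ _ fact_ne]

lemma PE_add (f g : Equiv.Perm (Fin n) → ℝ) :
    permExp (fun π => f π + g π) = permExp f + permExp g := by
  simp [permExp, Finset.sum_add_distrib, add_div]

lemma PE_mul (a : ℝ) (f : Equiv.Perm (Fin n) → ℝ) :
    permExp (fun π => a * f π) = a * permExp f := by
  simp [permExp, ← Finset.mul_sum, mul_div_assoc]

lemma PE_sum {ι : Type*} (s : Finset ι) (f : ι → Equiv.Perm (Fin n) → ℝ) :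
    permExp (fun π => ∑ i ∈ s, f i π) = ∑ i ∈ s, permExp (f i) := by
  simp only [permExp]
  rw [Finset.sum_comm, Finset.sum_div]

lemma norm_EC_le (f : Equiv.Perm (Fin n) → ℂ) : ‖EC f‖ ≤ permExp (fun π => ‖f π‖) := by
  simp only [EC, permExp, norm_div, Complex.norm_natCast]
  exact div_le_div_of_nonneg_right (norm_sum_le _ _) fact_pos.le

lemma norm_EC_le' {f : Equiv.Perm (Fin n) → ℂ} {g : Equiv.Perm (Fin n) → ℝ}
    (h : ∀ π, ‖f π‖ ≤ g π) : ‖EC f‖ ≤ permExp g :=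
  (norm_EC_le f).trans (PE_mono h)

lemma EC_ofReal (f : Equiv.Perm (Fin n) → ℝ) : EC (fun π => (f π : ℂ)) = (permExp f : ℝ) := by
  simp [EC, permExp]

lemma PE_cauchy (f g : Equiv.Perm (Fin n) → ℝ) :
    permExp (fun π => |f π| * |g π|) ≤
      Real.sqrt (permExp (fun π => f π ^ 2)) * Real.sqrt (permExp (fun π => g π ^ 2)) := by
  rw [← Real.sqrt_mul (PE_nonneg fun π => sq_nonneg _)]
  apply Real.le_sqrt_of_sq_le
  simp only [permExp]
  have := Finset.sum_mul_sq_le_sq_mul_sq Finset.univ (fun π => |f π|) (fun π => |g π|)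
  simp only [sq_abs] at this
  rw [div_pow, div_mul_div_comm, ← sq]
  exact div_le_div_of_nonneg_right this (sq_nonneg _)

/-- linear statistic -/
noncomputable def S (x y : Fin n → ℝ) (π : Equiv.Perm (Fin n)) : ℝ := ∑ i, x i * y (π i)

lemma S_swap (x y : Fin n → ℝ) (π : Equiv.Perm (Fin n)) (i k : Fin n) :
    S x y (π * Equiv.swap i k) = S x y π - (x i - x k) * (y (π i) - y (π k)) := by
  by_cases hik : i = k
  · subst hik; simp [Equiv.swap_self, show (Equiv.refl (Fin n) : Equiv.Perm (Fin n)) = 1 from rfl]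
  unfold S
  have h1 : ∀ f : Fin n → ℝ, ∑ q, f q = f i + f k + ∑ q ∈ (univ.erase i).erase k, f q := by
    intro f
    rw [← Finset.add_sum_erase univ f (mem_univ i),
      ← Finset.add_sum_erase (univ.erase i) f (a := k) (by simp [Ne.symm hik])]
    ring
  rw [h1, h1 (fun q => x q * y (π q))]
  have h2 : ∑ q ∈ (univ.erase i).erase k, x q * y ((π * Equiv.swap i k) q)
      = ∑ q ∈ (univ.erase i).erase k, x q * y (π q) := by
    apply Finset.sum_congr rfl
    intro q hq
    simp only [mem_erase, mem_univ, and_true] at hq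
    rw [Equiv.Perm.mul_apply, Equiv.swap_apply_of_ne_of_ne hq.2 hq.1]
  rw [h2]
  simp only [Equiv.Perm.mul_apply, Equiv.swap_apply_left, Equiv.swap_apply_right]
  ring

lemma sum_perm (π : Equiv.Perm (Fin n)) (g : Fin n → ℝ) : ∑ i, g (π i) = ∑ i, g i :=
  Equiv.sum_comp π g

lemma sum_pair (f g : Fin n → ℝ) (hf : ∑ i, f i = 0) (π : Equiv.Perm (Fin n)) :
    ∑ i, ∑ k, (f i - f k) * (g (π i) - g (π k)) = 2 * n * S f g π := by
  have : ∀ i k, (f i - f k) * (g (π i) - g (π k)) =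
      f i * g (π i) - f i * g (π k) - f k * g (π i) + f k * g (π k) := by intros; ring
  simp only [this, Finset.sum_add_distrib, Finset.sum_sub_distrib, ← Finset.mul_sum,
    ← Finset.sum_mul, hf, Finset.sum_const, Finset.card_univ, Fintype.card_fin, nsmul_eq_mul, S]
  have : ∑ i, f i * ↑n * g (π i) = n * ∑ i, f i * g (π i) := by
    rw [Finset.mul_sum]; exact Finset.sum_congr rfl fun i _ => by ring
  ring_nf
  rw [this]
  ring

/-- relabelling permutation: sends `i ↦ r`, `k ↦ s`. -/
def relPerm (i k r s : Fin n) : Equiv.Perm (Fin n) :=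
  Equiv.swap s (Equiv.swap i r k) * Equiv.swap i r

lemma relPerm_left {i k r s : Fin n} (hik : i ≠ k) (hrs : r ≠ s) : relPerm i k r s i = r := by
  simp only [relPerm, Equiv.Perm.mul_apply, Equiv.swap_apply_left]
  apply Equiv.swap_apply_of_ne_of_ne hrs
  intro h
  have := congrArg (Equiv.swap i r) h
  simp at this
  exact hik this

lemma relPerm_right {i k r s : Fin n} : relPerm i k r s k = s := by
  simp [relPerm, Equiv.Perm.mul_apply]

lemma PE_two (h : Fin n → Fin n → ℝ) (hd : ∀ j, h j j = 0) {i k : Fin n} (hik : i ≠ k) :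
    (n : ℝ) * (n - 1) * permExp (fun π => h (π i) (π k)) = ∑ j, ∑ l, h j l := by
  have h1 : ∀ r s, r ≠ s → permExp (fun π => h (π r) (π s)) = permExp (fun π => h (π i) (π k)) := by
    intro r s hrs
    have := PE_comp (fun π => h (π i) (π k)) (relPerm i k r s)
    simpa only [Equiv.Perm.mul_apply, relPerm_left hik hrs, relPerm_right] using this
  have h2 : permExp (fun π => ∑ r, ∑ s, h (π r) (π s)) = ∑ j, ∑ l, h j l := by
    have : ∀ π : Equiv.Perm (Fin n), ∑ r, ∑ s, h (π r) (π s) = ∑ j, ∑ l, h j l := by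
      intro π
      rw [← Equiv.sum_comp π (fun j => ∑ l, h j l)]
      exact Finset.sum_congr rfl fun r _ => Equiv.sum_comp π (fun l => h (π r) l)
    simp only [this, PE_const]
  rw [← h2, PE_sum]
  simp only [PE_sum]
  have h3 : ∀ r, ∑ s, permExp (fun π : Equiv.Perm (Fin n) => h (π r) (π s)) =
      ((n : ℝ) - 1) * permExp (fun π => h (π i) (π k)) := by
    intro r
    rw [← Finset.add_sum_erase univ _ (mem_univ r)]
    simp only [hd, PE_const, zero_add]
    rw [Finset.sum_congr rfl (fun s hs => h1 r s (by simp at hs; exact fun h => hs h.symm))]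
    rw [Finset.sum_const, Finset.card_erase_of_mem (mem_univ r), Finset.card_univ,
      Fintype.card_fin, nsmul_eq_mul, Nat.cast_sub (by have := r.pos; omega)]
    simp
  simp only [h3, Finset.sum_const, Finset.card_univ, Fintype.card_fin, nsmul_eq_mul]
  ring

lemma PE_one (h : Fin n → ℝ) (i : Fin n) :
    (n : ℝ) * permExp (fun π => h (π i)) = ∑ j, h j := by
  have h1 : ∀ r, permExp (fun π => h (π r)) = permExp (fun π => h (π i)) := by
    intro r
    have := PE_comp (fun π => h (π i)) (Equiv.swap i r)
    simpa only [Equiv.Perm.mul_apply, Equiv.swap_apply_left] using this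
  have h2 : permExp (fun π => ∑ r, h (π r)) = ∑ j, h j := by
    simp only [sum_perm, PE_const]
  rw [← h2, PE_sum]
  simp [h1]

/-- majorant `1+|x|` -/
noncomputable def mj (x : Fin n → ℝ) (i : Fin n) : ℝ := 1 + |x i|

/-- power means of the majorant -/
noncomputable def W (p : ℕ) (x : Fin n → ℝ) : ℝ := (∑ i, mj x i ^ p) / n

lemma mj_one (x : Fin n → ℝ) (i : Fin n) : 1 ≤ mj x i := by
  unfold mj; linarith [abs_nonneg (x i)]

lemma mj_nonneg (x : Fin n → ℝ) (i : Fin n) : 0 ≤ mj x i := by linarith [mj_one x i]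

lemma abs_le_mj (x : Fin n → ℝ) (i : Fin n) : |x i| ≤ mj x i := by
  unfold mj; linarith

lemma W_nonneg (p : ℕ) (x : Fin n → ℝ) : 0 ≤ W p x :=
  div_nonneg (Finset.sum_nonneg fun i _ => pow_nonneg (mj_nonneg x i) p) (Nat.cast_nonneg n)

lemma W_mono {p q : ℕ} (h : p ≤ q) (x : Fin n → ℝ) : W p x ≤ W q x :=
  div_le_div_of_nonneg_right (Finset.sum_le_sum fun i _ => pow_le_pow_right₀ (mj_one x i) h)
    (Nat.cast_nonneg n)

lemma W_one (hn : 0 < n) (p : ℕ) (x : Fin n → ℝ) : 1 ≤ W p x := by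
  have hn' : (0 : ℝ) < n := by exact_mod_cast hn
  unfold W
  rw [le_div_iff₀ hn', one_mul]
  calc (n : ℝ) = ∑ i : Fin n, (1 : ℝ) := by simp
    _ ≤ _ := Finset.sum_le_sum fun i _ => one_le_pow₀ (mj_one x i)

lemma sum_mj (hn : 0 < n) (p : ℕ) (x : Fin n → ℝ) : ∑ i, mj x i ^ p = n * W p x := by
  have hn' : (n : ℝ) ≠ 0 := by exact_mod_cast hn.ne'
  unfold W; field_simp

lemma PE_mj (hn : 0 < n) (p : ℕ) (y : Fin n → ℝ) (q : Fin n) :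
    permExp (fun π => mj y (π q) ^ p) = W p y := by
  have := PE_one (fun j => mj y j ^ p) q
  rw [sum_mj hn] at this
  have hn' : (n : ℝ) ≠ 0 := by exact_mod_cast hn.ne'
  exact mul_left_cancel₀ hn' this

lemma four_pow {a b c d : ℝ} (ha : 0 ≤ a) (hb : 0 ≤ b) (hc : 0 ≤ c) (hd : 0 ≤ d) (p : ℕ) :
    (a + b + c + d) ^ p ≤ 4 ^ p * (a ^ p + b ^ p + c ^ p + d ^ p) := by
  have key : ∀ m, a ≤ m → b ≤ m → c ≤ m → d ≤ m → 0 ≤ m → (a + b + c + d) ^ p ≤ 4 ^ p * m ^ p := by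
    intro m h1 h2 h3 h4 _
    rw [← mul_pow]
    exact pow_le_pow_left₀ (by positivity) (by linarith) p
  have e1 := pow_nonneg ha p
  have e2 := pow_nonneg hb p
  have e3 := pow_nonneg hc p
  have e4 := pow_nonneg hd p
  have h4 : (0 : ℝ) < 4 ^ p := by positivity
  have fin : ∀ z, z ^ p ≤ a ^ p + b ^ p + c ^ p + d ^ p →
      (a + b + c + d) ^ p ≤ 4 ^ p * z ^ p → (a + b + c + d) ^ p ≤
      4 ^ p * (a ^ p + b ^ p + c ^ p + d ^ p) := by
    intro z h h'
    exact h'.trans (mul_le_mul_of_nonneg_left h h4.le)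
  rcases le_total a b with h1 | h1 <;> rcases le_total c d with h2 | h2
  · rcases le_total b d with h3 | h3
    · exact fin d (by linarith) (key d (by linarith) h3 h2 le_rfl hd)
    · exact fin b (by linarith) (key b h1 le_rfl (by linarith) h3 hb)
  · rcases le_total b c with h3 | h3
    · exact fin c (by linarith) (key c (by linarith) h3 le_rfl h2 hc)
    · exact fin b (by linarith) (key b h1 le_rfl h3 (by linarith) hb)
  · rcases le_total a d with h3 | h3
    · exact fin d (by linarith) (key d h3 (by linarith) h2 le_rfl hd)
    · exact fin a (by linarith) (key a le_rfl h1 (by linarith) h3 ha)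
  · rcases le_total a c with h3 | h3
    · exact fin c (by linarith) (key c h3 (by linarith) le_rfl h2 hc)
    · exact fin a (by linarith) (key a le_rfl h1 h3 (by linarith) ha)

/-- constant used in the bounds -/
noncomputable def KK (p : ℕ) : ℝ := 4 ^ (2 * p + 3)

lemma PE_four (hn : 0 < n) (p : ℕ) (y : Fin n → ℝ) (i k r s : Fin n) :
    permExp (fun π => (mj y (π i) + mj y (π k) + mj y (π r) + mj y (π s)) ^ p)
      ≤ 4 ^ (p + 1) * W p y := by
  refine (PE_mono fun π => four_pow (mj_nonneg _ _) (mj_nonneg _ _) (mj_nonneg _ _)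
    (mj_nonneg _ _) p).trans ?_
  rw [PE_mul, PE_add, PE_add, PE_add, PE_mj hn, PE_mj hn, PE_mj hn, PE_mj hn]
  apply le_of_eq; ring

lemma sum_four (hn : 0 < n) (p : ℕ) (x : Fin n → ℝ) :
    ∑ i, ∑ k, ∑ r, ∑ s, (mj x i + mj x k + mj x r + mj x s) ^ p ≤ 4 ^ (p + 1) * n ^ 4 * W p x := by
  have : ∀ i k r s, (mj x i + mj x k + mj x r + mj x s) ^ p ≤
      4 ^ p * (mj x i ^ p + mj x k ^ p + mj x r ^ p + mj x s ^ p) := fun i k r s =>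
    four_pow (mj_nonneg _ _) (mj_nonneg _ _) (mj_nonneg _ _) (mj_nonneg _ _) p
  refine (Finset.sum_le_sum fun i _ => Finset.sum_le_sum fun k _ => Finset.sum_le_sum fun r _ =>
    Finset.sum_le_sum fun s _ => this i k r s).trans ?_
  simp only [← Finset.mul_sum, Finset.sum_add_distrib, sum_mj hn, Finset.sum_const,
    Finset.card_univ, Fintype.card_fin, nsmul_eq_mul]
  apply le_of_eq; ring

/-- two-index bound -/
lemma bound_two (hn : 0 < n) (p : ℕ) (x y : Fin n → ℝ) (B : ℝ) (hB : 0 ≤ B)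
    (H : Fin n → Fin n → Fin n → Fin n → ℝ)
    (hH : ∀ i k j l, |H i k j l| ≤ B * ((mj x i + mj x k) ^ p * (mj y j + mj y l) ^ p)) :
    ∑ i, ∑ k, permExp (fun π => |H i k (π i) (π k)|) ≤ B * (KK p * n ^ 2 * (W p x * W p y)) := by
  have two : ∀ a b : ℝ, 0 ≤ a → 0 ≤ b → (a + b) ^ p ≤ 4 ^ p * (a ^ p + b ^ p) := by
    intro a b ha hb
    calc (a + b) ^ p ≤ 2 ^ (p - 1) * (a ^ p + b ^ p) := add_pow_le ha hb p
      _ ≤ _ := by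
        gcongr
        calc (2 : ℝ) ^ (p - 1) ≤ 2 ^ p := pow_le_pow_right₀ (by norm_num) (by omega)
          _ ≤ 4 ^ p := pow_le_pow_left₀ (by norm_num) (by norm_num) p
  have h1 : ∀ i k, permExp (fun π => |H i k (π i) (π k)|) ≤
      B * ((4 ^ p * (mj x i ^ p + mj x k ^ p)) * (4 ^ p * (2 * W p y))) := by
    intro i k
    have : permExp (fun π => (mj y (π i) + mj y (π k)) ^ p) ≤ 4 ^ p * (2 * W p y) := by
      refine (PE_mono fun π => two _ _ (mj_nonneg _ _) (mj_nonneg _ _)).trans ?_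
      rw [PE_mul, PE_add, PE_mj hn, PE_mj hn]
      apply le_of_eq; ring
    refine (PE_mono fun π => hH i k (π i) (π k)).trans ?_
    rw [PE_mul, PE_mul]
    apply mul_le_mul_of_nonneg_left _ hB
    apply mul_le_mul (two _ _ (mj_nonneg _ _) (mj_nonneg _ _)) this
    · exact PE_nonneg fun π => pow_nonneg (add_nonneg (mj_nonneg _ _) (mj_nonneg _ _)) p
    · have := mj_nonneg x i
      have := mj_nonneg x k
      positivity
  refine (Finset.sum_le_sum fun i _ => Finset.sum_le_sum fun k _ => h1 i k).trans ?_
  simp only [← Finset.mul_sum, ← Finset.sum_mul, Finset.sum_add_distrib, sum_mj hn,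
    Finset.sum_const, Finset.card_univ, Fintype.card_fin, nsmul_eq_mul]
  apply mul_le_mul_of_nonneg_left _ hB
  have hW := W_nonneg p x
  have hW' := W_nonneg p y
  have : KK p * n ^ 2 * (W p x * W p y) - 4 ^ p * (n * (n * W p x) + n * W p x * n) *
      (4 ^ p * (2 * W p y)) = 4 ^ (2 * p) * (60 * n ^ 2 * (W p x * W p y)) := by
    unfold KK; ring
  have h0 : (0 : ℝ) ≤ 4 ^ (2 * p) * (60 * n ^ 2 * (W p x * W p y)) := by positivity
  nlinarith

end basic
end RankEdge

namespace RankEdge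
section decouple
variable {n : ℕ}

lemma swap_mem (a b q : Fin n) : Equiv.swap a b q = q ∨ Equiv.swap a b q = a ∨
    Equiv.swap a b q = b := by
  rw [Equiv.swap_apply_def]; split_ifs <;> simp

lemma relPerm_dist (x y : Fin n → ℝ) (π : Equiv.Perm (Fin n)) (i k r s : Fin n) :
    |S x y (π * relPerm i k r s) - S x y π| ≤
      8 * ((mj x i + mj x k + mj x r + mj x s) *
        (mj y (π i) + mj y (π k) + mj y (π r) + mj y (π s))) := by
  set k' := Equiv.swap i r k with hk'
  have hk'm : k' = k ∨ k' = i ∨ k' = r := swap_mem i r k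
  have hi := swap_mem s k' i
  have hr := swap_mem s k' r
  have e : S x y (π * relPerm i k r s) - S x y π =
      -((x s - x k') * (y (π s) - y (π k'))) - (x i - x r) *
        (y (π (Equiv.swap s k' i)) - y (π (Equiv.swap s k' r))) := by
    unfold relPerm
    rw [← mul_assoc, S_swap, S_swap]
    simp only [Equiv.Perm.mul_apply, ← hk']
    ring
  set X := mj x i + mj x k + mj x r + mj x s with hX
  set Y := mj y (π i) + mj y (π k) + mj y (π r) + mj y (π s) with hY
  have a1 := mj_nonneg x i
  have a2 := mj_nonneg x k
  have a3 := mj_nonneg x r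
  have a4 := mj_nonneg x s
  have b1 := mj_nonneg y (π i)
  have b2 := mj_nonneg y (π k)
  have b3 := mj_nonneg y (π r)
  have b4 := mj_nonneg y (π s)
  have hx : ∀ q, (q = i ∨ q = k ∨ q = r ∨ q = s) → |x q| ≤ X := by
    intro q hq
    have := abs_le_mj x q
    rcases hq with h | h | h | h <;> rw [h] at this ⊢ <;> linarith
  have hy : ∀ q, (q = i ∨ q = k ∨ q = r ∨ q = s) → |y (π q)| ≤ Y := by
    intro q hq
    have := abs_le_mj y (π q)
    rcases hq with h | h | h | h <;> rw [h] at this ⊢ <;> linarith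
  have X0 : 0 ≤ X := by positivity
  have Y0 : 0 ≤ Y := by positivity
  have sub : ∀ {a b M : ℝ}, |a| ≤ M → |b| ≤ M → |a - b| ≤ 2 * M := by
    intro a b M h1 h2
    have := abs_sub a b
    linarith
  have hk2 : k' = i ∨ k' = k ∨ k' = r ∨ k' = s := by
    rcases hk'm with h | h | h
    · exact Or.inr (Or.inl h)
    · exact Or.inl h
    · exact Or.inr (Or.inr (Or.inl h))
  have hi2 : ∀ q, q = Equiv.swap s k' i → (q = i ∨ q = k ∨ q = r ∨ q = s) := by
    intro q hq
    rw [← hq] at hi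
    rcases hi with h | h | h
    · exact Or.inl h
    · exact Or.inr (Or.inr (Or.inr h))
    · rw [h]; exact hk2
  have hr2 : ∀ q, q = Equiv.swap s k' r → (q = i ∨ q = k ∨ q = r ∨ q = s) := by
    intro q hq
    rw [← hq] at hr
    rcases hr with h | h | h
    · exact Or.inr (Or.inr (Or.inl h))
    · exact Or.inr (Or.inr (Or.inr h))
    · rw [h]; exact hk2
  have t1 := sub (hx s (Or.inr (Or.inr (Or.inr rfl)))) (hx k' hk2)
  have t2 := sub (hy s (Or.inr (Or.inr (Or.inr rfl)))) (hy k' hk2)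
  have t3 := sub (hx i (Or.inl rfl)) (hx r (Or.inr (Or.inr (Or.inl rfl))))
  have t4 := sub (hy _ (hi2 _ rfl)) (hy _ (hr2 _ rfl))
  rw [e]
  have m1 := mul_le_mul t1 t2 (abs_nonneg _) (by positivity)
  have m2 := mul_le_mul t3 t4 (abs_nonneg _) (by positivity)
  rw [← abs_mul] at m1 m2
  have := abs_sub (-((x s - x k') * (y (π s) - y (π k')))) ((x i - x r) *
        (y (π (Equiv.swap s k' i)) - y (π (Equiv.swap s k' r))))
  rw [abs_neg] at this
  have e8 : 2 * X * (2 * Y) = 4 * (X * Y) := by ring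
  linarith

lemma decouple_one (x y : Fin n → ℝ) (h : Fin n → Fin n → ℝ) (hd : ∀ j, h j j = 0)
    (u : ℝ → ℂ) (K : ℝ) (hu : ∀ a b, ‖u a - u b‖ ≤ K * |a - b|) {i k : Fin n} (hik : i ≠ k) :
    ‖(n : ℂ) * (n - 1) * EC (fun π => (h (π i) (π k) : ℂ) * u (S x y π)) -
      (∑ j, ∑ l, h j l : ℝ) * EC (fun π => u (S x y π))‖ ≤
    ∑ r, ∑ s, permExp (fun π => |h (π r) (π s)| * (K * (8 *
      ((mj x i + mj x k + mj x r + mj x s) *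
        (mj y (π i) + mj y (π k) + mj y (π r) + mj y (π s)))))) := by
  have hK : 0 ≤ K := by
    have := (norm_nonneg _).trans (hu 1 0)
    simpa using this
  have h1 : (n : ℂ) * (n - 1) * EC (fun π => (h (π i) (π k) : ℂ) * u (S x y π)) =
      ∑ r, ∑ s, EC (fun π => (h (π r) (π s) : ℂ) * u (S x y (π * relPerm i k r s))) := by
    have e : ∀ r s, r ≠ s →
        EC (fun π => (h (π r) (π s) : ℂ) * u (S x y (π * relPerm i k r s))) =
        EC (fun π => (h (π i) (π k) : ℂ) * u (S x y π)) := by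
      intro r s hrs
      have := EC_comp (fun π => (h (π i) (π k) : ℂ) * u (S x y π)) (relPerm i k r s)
      simpa only [Equiv.Perm.mul_apply, relPerm_left hik hrs, relPerm_right] using this
    have e2 : ∀ r, ∑ s, EC (fun π => (h (π r) (π s) : ℂ) * u (S x y (π * relPerm i k r s))) =
        ((n : ℂ) - 1) * EC (fun π => (h (π i) (π k) : ℂ) * u (S x y π)) := by
      intro r
      rw [← Finset.add_sum_erase univ _ (mem_univ r)]
      simp only [hd, Complex.ofReal_zero, zero_mul, EC_const, zero_add]
      rw [Finset.sum_congr rfl (fun s hs => e r s (by simp at hs; exact fun h => hs h.symm))]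
      rw [Finset.sum_const, Finset.card_erase_of_mem (mem_univ r), Finset.card_univ,
        Fintype.card_fin, nsmul_eq_mul, Nat.cast_sub (by have := r.pos; omega)]
      simp
    simp only [e2, Finset.sum_const, Finset.card_univ, Fintype.card_fin, nsmul_eq_mul]
    ring
  have h2 : (∑ j, ∑ l, h j l : ℝ) * EC (fun π => u (S x y π)) =
      ∑ r, ∑ s, EC (fun π => (h (π r) (π s) : ℂ) * u (S x y π)) := by
    simp only [← EC_sum]
    rw [← EC_mul]
    congr 1
    funext π
    have : ∑ j, ∑ l, h j l = ∑ r, ∑ s, h (π r) (π s) := by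
      rw [← Equiv.sum_comp π (fun j => ∑ l, h j l)]
      exact Finset.sum_congr rfl fun r _ => (Equiv.sum_comp π (fun l => h (π r) l)).symm
    rw [this]
    push_cast
    simp only [Finset.sum_mul]
  rw [h1, h2, ← Finset.sum_sub_distrib]
  simp only [← Finset.sum_sub_distrib, ← EC_sub]
  refine (norm_sum_le _ _).trans (Finset.sum_le_sum fun r _ => ?_)
  refine (norm_sum_le _ _).trans (Finset.sum_le_sum fun s _ => ?_)
  apply norm_EC_le'
  intro π
  rw [← mul_sub, norm_mul, Complex.norm_real, Real.norm_eq_abs]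
  apply mul_le_mul_of_nonneg_left _ (abs_nonneg _)
  exact (hu _ _).trans (mul_le_mul_of_nonneg_left (relPerm_dist x y π i k r s) hK)

/-- The decoupling lemma. -/
lemma decouple (hn : 2 ≤ n) (p : ℕ) (x y : Fin n → ℝ) (B : ℝ) (hB : 0 ≤ B)
    (H : Fin n → Fin n → Fin n → Fin n → ℝ)
    (hH : ∀ i k j l, |H i k j l| ≤ B * ((mj x i + mj x k) ^ p * (mj y j + mj y l) ^ p))
    (hi : ∀ i j l, H i i j l = 0) (hj : ∀ i k j, H i k j j = 0)
    (u : ℝ → ℂ) (K : ℝ) (hu : ∀ a b, ‖u a - u b‖ ≤ K * |a - b|) :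
    ‖∑ i, ∑ k, EC (fun π => (H i k (π i) (π k) : ℂ) * u (S x y π)) -
      ((∑ i, ∑ k, ∑ j, ∑ l, H i k j l) / (n * (n - 1)) : ℝ) * EC (fun π => u (S x y π))‖ ≤
    K * B * (4 * KK (p + 1) * n ^ 2 * (W (p + 1) x * W (p + 1) y)) := by
  have hK : 0 ≤ K := by
    have := (norm_nonneg _).trans (hu 1 0)
    simpa using this
  have hn2 : (2 : ℝ) ≤ n := by exact_mod_cast hn
  have hnn : (0 : ℝ) < n * (n - 1) := by nlinarith
  have hn0 : 0 < n := by omega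
  have key : ∀ i k, ‖(n : ℂ) * (n - 1) * EC (fun π => (H i k (π i) (π k) : ℂ) * u (S x y π)) -
      (∑ j, ∑ l, H i k j l : ℝ) * EC (fun π => u (S x y π))‖ ≤
      ∑ r, ∑ s, (8 * K * B * 4 ^ (p + 2) * W (p + 1) y) *
        (mj x i + mj x k + mj x r + mj x s) ^ (p + 1) := by
    intro i k
    have pos : ∀ r s, 0 ≤ (mj x i + mj x k + mj x r + mj x s) := fun r s =>
      add_nonneg (add_nonneg (add_nonneg (mj_nonneg x i) (mj_nonneg x k)) (mj_nonneg x r))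
        (mj_nonneg x s)
    by_cases hik : i = k
    · subst hik
      simp only [hi, Finset.sum_const_zero, Complex.ofReal_zero, zero_mul, EC_const, mul_zero,
        sub_zero, norm_zero]
      have := W_nonneg (p + 1) y
      exact Finset.sum_nonneg fun r _ => Finset.sum_nonneg fun s _ =>
        mul_nonneg (by positivity) (pow_nonneg (pos r s) _)
    · refine (decouple_one x y (H i k) (hj i k) u K hu hik).trans ?_
      refine Finset.sum_le_sum fun r _ => Finset.sum_le_sum fun s _ => ?_
      set X := mj x i + mj x k + mj x r + mj x s with hX
      have hle : ∀ π : Equiv.Perm (Fin n), |H i k (π r) (π s)| * (K * (8 * (X *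
          (mj y (π i) + mj y (π k) + mj y (π r) + mj y (π s))))) ≤
          (8 * K * B * X ^ (p + 1)) *
          (mj y (π i) + mj y (π k) + mj y (π r) + mj y (π s)) ^ (p + 1) := by
        intro π
        set Y := mj y (π i) + mj y (π k) + mj y (π r) + mj y (π s) with hY
        have a1 := mj_nonneg x i
        have a2 := mj_nonneg x k
        have a3 := mj_nonneg x r
        have a4 := mj_nonneg x s
        have b1 := mj_nonneg y (π i)
        have b2 := mj_nonneg y (π k)
        have b3 := mj_nonneg y (π r)
        have b4 := mj_nonneg y (π s)
        have X0 : 0 ≤ X := by positivity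
        have Y0 : 0 ≤ Y := by positivity
        have h1 : (mj x i + mj x k) ^ p ≤ X ^ p :=
          pow_le_pow_left₀ (by positivity) (by rw [hX]; linarith) p
        have h2 : (mj y (π r) + mj y (π s)) ^ p ≤ Y ^ p :=
          pow_le_pow_left₀ (by positivity) (by rw [hY]; linarith) p
        calc |H i k (π r) (π s)| * (K * (8 * (X * Y)))
            ≤ (B * (X ^ p * Y ^ p)) * (K * (8 * (X * Y))) := by
              apply mul_le_mul_of_nonneg_right _ (by positivity)
              refine (hH i k _ _).trans (mul_le_mul_of_nonneg_left ?_ hB)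
              exact mul_le_mul h1 h2 (by positivity) (by positivity)
          _ = _ := by ring
      refine (PE_mono hle).trans ?_
      rw [PE_mul]
      have h8 : 0 ≤ 8 * K * B * X ^ (p + 1) := by
        have := pos r s
        positivity
      calc _ ≤ (8 * K * B * X ^ (p + 1)) * (4 ^ (p + 2) * W (p + 1) y) :=
            mul_le_mul_of_nonneg_left (PE_four hn0 (p + 1) y i k r s) h8
        _ = _ := by ring
  have e : ∑ i, ∑ k, EC (fun π => (H i k (π i) (π k) : ℂ) * u (S x y π)) -
      ((∑ i, ∑ k, ∑ j, ∑ l, H i k j l) / (n * (n - 1)) : ℝ) * EC (fun π => u (S x y π)) =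
      (1 / (n * (n - 1)) : ℝ) *
      ∑ i, ∑ k, ((n : ℂ) * (n - 1) * EC (fun π => (H i k (π i) (π k) : ℂ) * u (S x y π)) -
      (∑ j, ∑ l, H i k j l : ℝ) * EC (fun π => u (S x y π))) := by
    have hc : ((n : ℂ) * (n - 1)) ≠ 0 := by
      have := hnn.ne'
      exact_mod_cast this
    simp only [Finset.sum_sub_distrib, ← Finset.mul_sum, ← Finset.sum_mul, ← Complex.ofReal_sum]
    generalize ∑ i, ∑ k, EC (fun π => (H i k (π i) (π k) : ℂ) * u (S x y π)) = a
    generalize EC (fun π => u (S x y π)) = b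
    generalize ∑ i, ∑ k, ∑ j, ∑ l, H i k j l = d
    have e1 : ((1 / (n * (n - 1)) : ℝ) : ℂ) * ((n : ℂ) * (n - 1)) = 1 := by
      push_cast
      rw [one_div, inv_mul_cancel₀ hc]
    have e2 : ((d / (n * (n - 1)) : ℝ) : ℂ) = ((1 / (n * (n - 1)) : ℝ) : ℂ) * d := by
      rw [← Complex.ofReal_mul]; congr 1; ring
    rw [e2]
    linear_combination (-a) * e1
  rw [e, norm_mul, Complex.norm_real, Real.norm_eq_abs, abs_of_pos (by positivity)]
  have hs : ‖∑ i, ∑ k, ((n : ℂ) * (n - 1) * EC (fun π => (H i k (π i) (π k) : ℂ) * u (S x y π)) -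
      (∑ j, ∑ l, H i k j l : ℝ) * EC (fun π => u (S x y π)))‖ ≤
      (8 * K * B * 4 ^ (p + 2) * W (p + 1) y) * (4 ^ (p + 2) * n ^ 4 * W (p + 1) x) := by
    refine (norm_sum_le _ _).trans ((Finset.sum_le_sum fun i _ => (norm_sum_le _ _).trans
      (Finset.sum_le_sum fun k _ => key i k)).trans ?_)
    simp only [← Finset.mul_sum]
    apply mul_le_mul_of_nonneg_left (sum_four hn0 (p + 1) x)
    have := W_nonneg (p + 1) y
    positivity
  have hW := W_nonneg (p + 1) y
  have hW' := W_nonneg (p + 1) x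
  rw [one_div, inv_mul_le_iff₀ hnn]
  refine hs.trans ?_
  have : (n : ℝ) * (n - 1) ≥ n ^ 2 / 2 := by nlinarith
  have hK2 : 4 * KK (p + 1) = 4 ^ (p + 2) * 4 ^ (p + 2) * 16 := by unfold KK; ring
  rw [hK2]
  have : (0:ℝ) ≤ K * B * (4 ^ (p + 2) * 4 ^ (p + 2) * 16 * n ^ 2 * (W (p + 1) x * W (p + 1) y)) := by
    positivity
  nlinarith

end decouple
end RankEdge

namespace RankEdge
section trig

lemma abs_le_of_deriv (f f' : ℝ → ℝ) (hf : ∀ v, HasDerivAt f (f' v) v) (h0 : f 0 = 0) (C : ℝ)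
    (p : ℕ) (hb : ∀ v, |f' v| ≤ (p + 1) * C * |v| ^ p) (v : ℝ) : |f v| ≤ C * |v| ^ (p + 1) := by
  have main : ∀ (g g' : ℝ → ℝ), (∀ v, HasDerivAt g (g' v) v) → g 0 = 0 →
      (∀ v, |g' v| ≤ (p + 1) * C * |v| ^ p) → ∀ v, 0 ≤ v → |g v| ≤ C * v ^ (p + 1) := by
    intro g g' hg hg0 hgb v hv
    have := image_norm_le_of_norm_deriv_right_le_deriv_boundary (f := g) (f' := g') (a := 0)
      (b := v) (B := fun v => C * v ^ (p + 1)) (B' := fun v => C * ((p + 1) * v ^ p))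
      (fun w _ => (hg w).continuousAt.continuousWithinAt) (fun w _ => (hg w).hasDerivWithinAt)
      (by simp [hg0])
      (fun w => by
        have := (hasDerivAt_pow (p + 1) w).const_mul C
        simpa using this)
      (fun w hw => by
        have := hgb w
        rw [abs_of_nonneg hw.1] at this
        rw [Real.norm_eq_abs]
        linarith)
      (x := v) ⟨hv, le_rfl⟩
    simpa using this
  rcases le_total 0 v with hv | hv
  · have := main f f' hf h0 hb v hv
    rwa [abs_of_nonneg hv]
  · have := main (fun v => f (-v)) (fun v => -f' (-v)) (fun w => by
        have := (hf (-w)).comp w (hasDerivAt_neg w)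
        rw [mul_neg_one] at this
        exact this) (by simpa using h0) (fun w => by
        have := hb (-w)
        rw [abs_neg] at this ⊢
        exact this) (-v) (by linarith)
    simp only [neg_neg] at this
    rwa [abs_of_nonpos hv]

lemma trigA_deriv (v : ℝ) : HasDerivAt (fun v : ℝ => Real.sin v - v * Real.cos v)
    (v * Real.sin v) v := by
  have := (Real.hasDerivAt_sin v).sub ((hasDerivAt_id' v).mul (Real.hasDerivAt_cos v))
  exact this.congr_deriv (by ring)

lemma trigA3 (v : ℝ) : |Real.sin v - v * Real.cos v| ≤ |v| ^ 3 := by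
  refine abs_le_of_deriv _ _ trigA_deriv (by simp) 1 2 (fun v => ?_) v |>.trans (by simp)
  rw [abs_mul]
  have := Real.abs_sin_le_one v
  have h2 : |Real.sin v| ≤ |v| := Real.abs_sin_le_abs
  have := abs_nonneg v
  push_cast
  nlinarith

lemma trigA2 (v : ℝ) : |Real.sin v - v * Real.cos v| ≤ |v| ^ 2 := by
  refine abs_le_of_deriv _ _ trigA_deriv (by simp) 1 1 (fun v => ?_) v |>.trans (by simp)
  rw [abs_mul]
  have := Real.abs_sin_le_one v
  have := abs_nonneg v
  push_cast
  nlinarith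

lemma trigB (v : ℝ) : |Real.sin v - (v + v ^ 3 / 3) * Real.cos v| ≤ |v| ^ 4 := by
  have hd : ∀ v : ℝ, HasDerivAt (fun v : ℝ => Real.sin v - (v + v ^ 3 / 3) * Real.cos v)
      (v * (Real.sin v - v * Real.cos v) + v ^ 3 / 3 * Real.sin v) v := by
    intro v
    have := (Real.hasDerivAt_sin v).sub (((hasDerivAt_id' v).add
      ((hasDerivAt_pow 3 v).div_const 3)).mul (Real.hasDerivAt_cos v))
    refine this.congr_deriv ?_
    simp only [Pi.add_apply]
    push_cast
    ring
  refine abs_le_of_deriv _ _ hd (by simp) 1 3 (fun v => ?_) v |>.trans (by simp)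
  refine (abs_add_le _ _).trans ?_
  rw [abs_mul, abs_mul, abs_div, abs_pow]
  have h1 := Real.abs_sin_le_one v
  have h2 := trigA2 v
  have h3 := abs_nonneg v
  have e1 := mul_le_mul_of_nonneg_left h2 h3
  have e2 := mul_le_mul_of_nonneg_left h1 (show 0 ≤ |v| ^ 3 / |3| by positivity)
  rw [abs_of_pos (by norm_num : (0:ℝ) < 3)] at e2 ⊢
  push_cast
  nlinarith [pow_nonneg h3 3]

lemma symker (q w : ℝ) : ‖(1 - Complex.exp (-(Complex.I * w)) -
    1 / 2 * Complex.I * q * (1 + Complex.exp (-(Complex.I * w))) : ℂ)‖ =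
    |2 * Real.sin (w / 2) - q * Real.cos (w / 2)| := by
  have h : (1 - Complex.exp (-(Complex.I * w)) -
    1 / 2 * Complex.I * q * (1 + Complex.exp (-(Complex.I * w))) : ℂ) =
    Complex.exp (-(Complex.I * (w / 2 : ℝ))) * (Complex.I *
      ((2 * Real.sin (w / 2) - q * Real.cos (w / 2) : ℝ) : ℂ)) := by
    have e1 : Complex.exp (-(Complex.I * w)) = Complex.exp (-(Complex.I * (w / 2 : ℝ))) *
        Complex.exp (-(Complex.I * (w / 2 : ℝ))) := by
      rw [← Complex.exp_add]; congr 1; push_cast; ring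
    have e2 : Complex.exp (-(Complex.I * (w / 2 : ℝ))) * Complex.exp ((Complex.I * (w / 2 : ℝ))) = 1 := by
      rw [← Complex.exp_add]; simp
    have e3 : Complex.exp ((Complex.I * (w / 2 : ℝ))) = Real.cos (w/2) + Real.sin (w/2) * Complex.I := by
      rw [mul_comm, Complex.exp_mul_I, Complex.ofReal_cos, Complex.ofReal_sin]
    have e4 : Complex.exp (-(Complex.I * (w / 2 : ℝ))) = Real.cos (w/2) - Real.sin (w/2) * Complex.I := by
      rw [show -(Complex.I * ((w / 2 : ℝ):ℂ)) = ((-(w/2) : ℝ) : ℂ) * Complex.I by push_cast; ring,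
        Complex.exp_mul_I, ← Complex.ofReal_cos, ← Complex.ofReal_sin, Real.cos_neg, Real.sin_neg]
      push_cast; ring
    rw [e1]
    set z := Complex.exp (-(Complex.I * (w / 2 : ℝ))) with hz
    rw [e3] at e2
    push_cast at e2 e4 ⊢
    linear_combination (1 / 2 * Complex.I * q - 1) * e2 + (-z - 1 / 2 * Complex.I * q * z) * e4
  rw [h, norm_mul, norm_mul, Complex.norm_I, one_mul, Complex.norm_real, Real.norm_eq_abs]
  rw [show -(Complex.I * ((w / 2 : ℝ):ℂ)) = ((-(w/2) : ℝ) : ℂ) * Complex.I by push_cast; ring,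
    Complex.norm_exp_ofReal_mul_I, one_mul]

lemma symker3 (w : ℝ) : ‖(1 - Complex.exp (-(Complex.I * w)) -
    1 / 2 * Complex.I * w * (1 + Complex.exp (-(Complex.I * w))) : ℂ)‖ ≤ |w| ^ 3 := by
  rw [symker]
  have h := trigA3 (w / 2)
  have : 2 * Real.sin (w / 2) - w * Real.cos (w / 2) =
    2 * (Real.sin (w / 2) - w / 2 * Real.cos (w / 2)) := by ring
  rw [this, abs_mul]
  rw [abs_div, div_pow] at h
  simp only [Nat.abs_ofNat] at *
  have := pow_nonneg (abs_nonneg w) 3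
  linarith

lemma symker2 (w : ℝ) : ‖(1 - Complex.exp (-(Complex.I * w)) -
    1 / 2 * Complex.I * w * (1 + Complex.exp (-(Complex.I * w))) : ℂ)‖ ≤ |w| ^ 2 := by
  rw [symker]
  have h := trigA2 (w / 2)
  have : 2 * Real.sin (w / 2) - w * Real.cos (w / 2) =
    2 * (Real.sin (w / 2) - w / 2 * Real.cos (w / 2)) := by ring
  rw [this, abs_mul]
  rw [abs_div, div_pow] at h
  simp only [Nat.abs_ofNat] at *
  have := pow_nonneg (abs_nonneg w) 2
  linarith

lemma symker4 (w : ℝ) : ‖(1 - Complex.exp (-(Complex.I * w)) -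
    1 / 2 * Complex.I * (w + w ^ 3 / 12 : ℝ) * (1 + Complex.exp (-(Complex.I * w))) : ℂ)‖
      ≤ |w| ^ 4 := by
  rw [symker]
  have h := trigB (w / 2)
  have : 2 * Real.sin (w / 2) - (w + w ^ 3 / 12) * Real.cos (w / 2) =
    2 * (Real.sin (w / 2) - (w / 2 + (w / 2) ^ 3 / 3) * Real.cos (w / 2)) := by ring
  rw [this, abs_mul]
  rw [abs_div, div_pow |w|] at h
  simp only [Nat.abs_ofNat] at *
  have := pow_nonneg (abs_nonneg w) 4
  linarith

end trig

section symm
variable {n : ℕ}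

/-- characteristic-function kernel -/
noncomputable def ex (τ : ℝ) (x y : Fin n → ℝ) (π : Equiv.Perm (Fin n)) : ℂ :=
  Complex.exp (Complex.I * (τ * S x y π : ℝ))

lemma norm_ex (τ : ℝ) (x y : Fin n → ℝ) (π : Equiv.Perm (Fin n)) : ‖ex τ x y π‖ = 1 := by
  unfold ex
  rw [mul_comm, Complex.norm_exp_ofReal_mul_I]

/-- exchange increment -/
def XX (x y : Fin n → ℝ) (i k j l : Fin n) : ℝ := (x i - x k) * (y j - y l)

lemma ex_swap (τ : ℝ) (x y : Fin n → ℝ) (π : Equiv.Perm (Fin n)) (i k : Fin n) :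
    ex τ x y (π * Equiv.swap i k) =
      Complex.exp (-(Complex.I * (τ * XX x y i k (π i) (π k) : ℝ))) * ex τ x y π := by
  unfold ex
  rw [← Complex.exp_add, S_swap]
  congr 1
  unfold XX
  push_cast; ring

lemma EC_half (f : Equiv.Perm (Fin n) → ℂ) (i k : Fin n) :
    EC f = 1 / 2 * EC (fun π => f π + f (π * Equiv.swap i k)) := by
  rw [EC_add, EC_comp f]; ring

lemma swap_app (π : Equiv.Perm (Fin n)) (i k : Fin n) :
    (π * Equiv.swap i k) i = π k ∧ (π * Equiv.swap i k) k = π i := by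
  simp [Equiv.Perm.mul_apply]

lemma sym_gen (x y : Fin n → ℝ) (τ : ℝ) (i k : Fin n) (F : Fin n → Fin n → ℝ)
    (hF : ∀ j l, F l j = -F j l) (q b : ℝ → ℝ) (hq : ∀ w, q (-w) = -q w)
    (hb : ∀ w : ℝ, ‖(1 - Complex.exp (-(Complex.I * w)) -
      1 / 2 * Complex.I * q w * (1 + Complex.exp (-(Complex.I * w))) : ℂ)‖ ≤ b w) :
    ‖EC (fun π => (F (π i) (π k) : ℂ) * ex τ x y π) - Complex.I / 2 *
      EC (fun π => ((F (π i) (π k) * q (τ * XX x y i k (π i) (π k)) : ℝ) : ℂ) * ex τ x y π)‖ ≤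
    permExp (fun π => |F (π i) (π k)| * b (τ * XX x y i k (π i) (π k))) := by
  have hX : ∀ π : Equiv.Perm (Fin n), XX x y i k (π k) (π i) = - XX x y i k (π i) (π k) := by
    intro π; unfold XX; ring
  rw [EC_half (fun π => (F (π i) (π k) : ℂ) * ex τ x y π) i k,
    EC_half (fun π => ((F (π i) (π k) * q (τ * XX x y i k (π i) (π k)) : ℝ) : ℂ) * ex τ x y π) i k]
  simp only [(swap_app _ i k).1, (swap_app _ i k).2, ex_swap, hX, mul_neg, hq]
  rw [← EC_mul, ← EC_mul, ← EC_mul, ← EC_sub]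
  apply norm_EC_le'
  intro π
  have hb0 : ∀ w, 0 ≤ b w := fun w => (norm_nonneg _).trans (hb w)
  have : ∀ (E F q e: ℂ), 1 / 2 * (F * e + -F * (E * e)) - Complex.I / 2 * (1 / 2 * (F * q * e + F * q * (E * e)))
    = 1 / 2 * F * (1 - E - 1 / 2 * Complex.I * q * (1 + E)) * e := by intros; ring
  rw [hF (π i) (π k)]
  have h2 : -(-F (π i) (π k) * q (τ * XX x y i k (π i) (π k))) =
    F (π i) (π k) * q (τ * XX x y i k (π i) (π k)) := by ring
  rw [h2]
  push_cast
  rw [this, norm_mul, norm_ex, mul_one, norm_mul, norm_mul, Complex.norm_real, Real.norm_eq_abs]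
  have h3 := hb (τ * XX x y i k (π i) (π k))
  have h4 := mul_le_mul_of_nonneg_left h3 (abs_nonneg (F (π i) (π k)))
  have h5 : ‖(1/2 : ℂ)‖ = 1 / 2 := by simp
  rw [h5]
  push_cast at h4
  have := mul_nonneg (abs_nonneg (F (π i) (π k))) (hb0 (τ * XX x y i k (π i) (π k)))
  refine le_trans (le_of_eq (mul_assoc _ _ _)) ?_
  refine (mul_le_mul_of_nonneg_left h4 (by norm_num)).trans ?_
  linarith

end symm
end RankEdge

namespace RankEdge
section expand
variable {n : ℕ}

/-- standardised vector -/
structure Nrm (x : Fin n → ℝ) : Prop where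
  s1 : ∑ i, x i = 0
  s2 : ∑ i, x i ^ 2 = n

/-- moments -/
noncomputable def mm (p : ℕ) (x : Fin n → ℝ) : ℝ := (∑ i, x i ^ p) / n

/-- centred square -/
noncomputable def f2 (x : Fin n → ℝ) (i : Fin n) : ℝ := x i ^ 2 - 1

/-- centred cube -/
noncomputable def f3 (x : Fin n → ℝ) (i : Fin n) : ℝ := x i ^ 3 - x i - mm 3 x

lemma sum_pow_mm (hn : 2 ≤ n) (p : ℕ) (x : Fin n → ℝ) : ∑ i, x i ^ p = n * mm p x := by
  have : (n : ℝ) ≠ 0 := by positivity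
  unfold mm; field_simp

lemma sum_f2 {x : Fin n → ℝ} (hx : Nrm x) : ∑ i, f2 x i = 0 := by
  simp [f2, Finset.sum_sub_distrib, hx.s2]

lemma sum_f3 (hn : 2 ≤ n) {x : Fin n → ℝ} (hx : Nrm x) : ∑ i, f3 x i = 0 := by
  simp [f3, Finset.sum_sub_distrib, hx.s1, sum_pow_mm hn 3]

lemma dx1 (x : Fin n → ℝ) (i k : Fin n) : |x i - x k| ≤ mj x i + mj x k :=
  (abs_sub _ _).trans (add_le_add (abs_le_mj _ _) (abs_le_mj _ _))

lemma dx2 (x : Fin n → ℝ) (i k : Fin n) : |f2 x i - f2 x k| ≤ (mj x i + mj x k) ^ 2 := by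
  have : f2 x i - f2 x k = (x i - x k) * (x i + x k) := by unfold f2; ring
  rw [this, abs_mul, sq]
  have h1 := mj_nonneg x i
  have h2 := mj_nonneg x k
  exact mul_le_mul (dx1 x i k) ((abs_add_le _ _).trans (add_le_add (abs_le_mj _ _) (abs_le_mj _ _)))
    (abs_nonneg _) (by positivity)

lemma dx3 (x : Fin n → ℝ) (i k : Fin n) : |f3 x i - f3 x k| ≤ (mj x i + mj x k) ^ 3 := by
  have : f3 x i - f3 x k = (x i - x k) * (x i ^ 2 + x i * x k + x k ^ 2 - 1) := by unfold f3; ring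
  rw [this, abs_mul, pow_succ' _ 2]
  have h1 := mj_nonneg x i
  have h2 := mj_nonneg x k
  refine mul_le_mul (dx1 x i k) ?_ (abs_nonneg _) (by positivity)
  unfold mj
  have a1 := abs_nonneg (x i)
  have a2 := abs_nonneg (x k)
  have e1 := sq_abs (x i)
  have e2 := sq_abs (x k)
  have e3 : |x i * x k| = |x i| * |x k| := abs_mul _ _
  have e4 := abs_le.1 (le_refl |x i * x k|)
  rw [abs_le]
  constructor <;> nlinarith [mul_nonneg a1 a2]

/-- product increment -/
def FF (f g : Fin n → ℝ) (i k j l : Fin n) : ℝ := (f i - f k) * (g j - g l)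

lemma FF_bound {x y f g : Fin n → ℝ} {p : ℕ} (hf : ∀ i k, |f i - f k| ≤ (mj x i + mj x k) ^ p)
    (hg : ∀ i k, |g i - g k| ≤ (mj y i + mj y k) ^ p) (i k j l : Fin n) :
    |FF f g i k j l| ≤ (mj x i + mj x k) ^ p * (mj y j + mj y l) ^ p := by
  unfold FF
  rw [abs_mul]
  exact mul_le_mul (hf i k) (hg j l) (abs_nonneg _)
    (pow_nonneg (add_nonneg (mj_nonneg _ _) (mj_nonneg _ _)) _)

lemma XX_bound (x y : Fin n → ℝ) (i k j l : Fin n) :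
    |XX x y i k j l| ≤ (mj x i + mj x k) * (mj y j + mj y l) := by
  have := FF_bound (x := x) (y := y) (f := x) (g := y) (p := 1) (by simpa using dx1 x)
    (by simpa using dx1 y) i k j l
  simpa [FF, XX] using this

lemma FFXX_bound {x y f g : Fin n → ℝ} {p : ℕ} (hf : ∀ i k, |f i - f k| ≤ (mj x i + mj x k) ^ p)
    (hg : ∀ i k, |g i - g k| ≤ (mj y i + mj y k) ^ p) (s : ℕ) (i k j l : Fin n) :
    |FF f g i k j l * XX x y i k j l ^ s| ≤
      (mj x i + mj x k) ^ (p + s) * (mj y j + mj y l) ^ (p + s) := by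
  rw [abs_mul, abs_pow]
  have h1 := FF_bound hf hg i k j l
  have h2 := pow_le_pow_left₀ (abs_nonneg _) (XX_bound x y i k j l) s
  have a := add_nonneg (mj_nonneg x i) (mj_nonneg x k)
  have b := add_nonneg (mj_nonneg y j) (mj_nonneg y l)
  calc _ ≤ _ := mul_le_mul h1 h2 (by positivity) (by positivity)
    _ = _ := by rw [mul_pow, pow_add, pow_add]; ring

lemma S_eq_sum (hn : 2 ≤ n) (f g : Fin n → ℝ) (hf : ∑ i, f i = 0) (π : Equiv.Perm (Fin n)) :
    S f g π = 1 / (2 * n) * ∑ i, ∑ k, FF f g i k (π i) (π k) := by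
  have : (n : ℝ) ≠ 0 := by positivity
  unfold FF
  rw [sum_pair f g hf]; field_simp

lemma EC_S (hn : 2 ≤ n) (f g : Fin n → ℝ) (hf : ∑ i, f i = 0) (e : Equiv.Perm (Fin n) → ℂ) :
    EC (fun π => (S f g π : ℂ) * e π) =
      1 / (2 * n) * ∑ i, ∑ k, EC (fun π => (FF f g i k (π i) (π k) : ℂ) * e π) := by
  simp only [← EC_sum, ← EC_mul]
  congr 1; funext π
  rw [S_eq_sum hn f g hf]
  push_cast
  simp only [Finset.sum_mul, Finset.mul_sum, mul_assoc]

lemma sum_sep (f g : Fin n → ℝ) : ∑ i, ∑ k, f i * g k = (∑ i, f i) * ∑ k, g k := by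
  rw [Finset.sum_mul_sum]

lemma norm_dsum {a b : Fin n → Fin n → ℂ} {c : Fin n → Fin n → ℝ}
    (h : ∀ i k, ‖a i k - b i k‖ ≤ c i k) :
    ‖∑ i, ∑ k, a i k - ∑ i, ∑ k, b i k‖ ≤ ∑ i, ∑ k, c i k := by
  rw [← Finset.sum_sub_distrib]
  refine (norm_sum_le _ _).trans (Finset.sum_le_sum fun i _ => ?_)
  rw [← Finset.sum_sub_distrib]
  exact (norm_sum_le _ _).trans (Finset.sum_le_sum fun k _ => h i k)

lemma norm_half_n (hn : 2 ≤ n) : ‖(1 / (2 * n) : ℂ)‖ = 1 / (2 * n) := by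
  simp

lemma lin_exp (hn : 2 ≤ n) (τ : ℝ) (x y f g : Fin n → ℝ) (hf : ∑ i, f i = 0) (p s : ℕ)
    (hs : s = 2 ∨ s = 3)
    (hF : ∀ i k, |f i - f k| ≤ (mj x i + mj x k) ^ p)
    (hG : ∀ i k, |g i - g k| ≤ (mj y i + mj y k) ^ p) :
    ‖EC (fun π => (S f g π : ℂ) * ex τ x y π) - Complex.I * τ / (4 * n) *
      ∑ i, ∑ k, EC (fun π => ((FF f g i k (π i) (π k) * XX x y i k (π i) (π k) : ℝ) : ℂ) *
        ex τ x y π)‖ ≤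
    |τ| ^ s * (KK (p + s) * n * (W (p + s) x * W (p + s) y)) := by
  have hn0 : (0 : ℝ) < n := by positivity
  have hn0' : (n : ℂ) ≠ 0 := by exact_mod_cast hn0.ne'
  rw [EC_S hn f g hf]
  have hk : ∀ w : ℝ, ‖(1 - Complex.exp (-(Complex.I * w)) -
      1 / 2 * Complex.I * w * (1 + Complex.exp (-(Complex.I * w))) : ℂ)‖ ≤ |w| ^ s := by
    intro w
    rcases hs with h | h <;> subst h
    · exact symker2 w
    · exact symker3 w
  have h1 : ∀ i k, _ := fun i k => sym_gen x y τ i k (FF f g i k) (fun j l => by unfold FF; ring)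
    (fun w => w) (fun w => |w| ^ s) (fun w => rfl) hk
  have h2 := norm_dsum h1
  have e1 : Complex.I * τ / (4 * n) *
      ∑ i, ∑ k, EC (fun π => ((FF f g i k (π i) (π k) * XX x y i k (π i) (π k) : ℝ) : ℂ) *
        ex τ x y π) = 1 / (2 * n) * ∑ i, ∑ k, Complex.I / 2 *
      EC (fun π => ((FF f g i k (π i) (π k) * (τ * XX x y i k (π i) (π k)) : ℝ) : ℂ) *
        ex τ x y π) := by
    rw [Finset.mul_sum, Finset.mul_sum]
    refine Finset.sum_congr rfl fun i _ => ?_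
    rw [Finset.mul_sum, Finset.mul_sum]
    refine Finset.sum_congr rfl fun k _ => ?_
    rw [← EC_mul, ← EC_mul, ← EC_mul]
    congr 1; funext π
    push_cast; field_simp; ring
  rw [e1, ← mul_sub, norm_mul, norm_half_n hn]
  have h3 : ∑ i, ∑ k, permExp (fun π => |FF f g i k (π i) (π k)| *
      |τ * XX x y i k (π i) (π k)| ^ s) = |τ| ^ s * ∑ i, ∑ k, permExp (fun π =>
      |FF f g i k (π i) (π k) * XX x y i k (π i) (π k) ^ s|) := by
    rw [Finset.mul_sum]
    refine Finset.sum_congr rfl fun i _ => ?_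
    rw [Finset.mul_sum]
    refine Finset.sum_congr rfl fun k _ => ?_
    rw [← PE_mul]
    congr 1; funext π
    rw [abs_mul, mul_pow, abs_mul, abs_pow]; ring
  have h4 := bound_two (by omega) (p + s) x y 1 zero_le_one
    (fun i k j l => FF f g i k j l * XX x y i k j l ^ s)
    (fun i k j l => by rw [one_mul]; exact FFXX_bound hF hG s i k j l)
  rw [h3] at h2
  rw [one_mul] at h4
  have h5 := h2.trans (mul_le_mul_of_nonneg_left h4 (by positivity))
  refine (mul_le_mul_of_nonneg_left h5 (by positivity)).trans ?_
  have hW := W_nonneg (p + s) x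
  have hW' := W_nonneg (p + s) y
  have hK : 0 ≤ KK (p + s) := by unfold KK; positivity
  have e6 : 1 / (2 * (n:ℝ)) * (|τ| ^ s * (KK (p + s) * n ^ 2 * (W (p + s) x * W (p + s) y))) =
    1 / 2 * (|τ| ^ s * (KK (p + s) * n * (W (p + s) x * W (p + s) y))) := by
    field_simp
  rw [e6]
  have : 0 ≤ |τ| ^ s * (KK (p + s) * n * (W (p + s) x * W (p + s) y)) := by positivity
  linarith

lemma lin_exp4 (hn : 2 ≤ n) (τ : ℝ) (x y : Fin n → ℝ) (hx : ∑ i, x i = 0) :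
    ‖EC (fun π => (S x y π : ℂ) * ex τ x y π) - (Complex.I * τ / (4 * n) *
      ∑ i, ∑ k, EC (fun π => ((XX x y i k (π i) (π k) ^ 2 : ℝ) : ℂ) * ex τ x y π) +
      Complex.I * τ ^ 3 / (48 * n) *
      ∑ i, ∑ k, EC (fun π => ((XX x y i k (π i) (π k) ^ 4 : ℝ) : ℂ) * ex τ x y π))‖ ≤
    |τ| ^ 4 * (KK 5 * n * (W 5 x * W 5 y)) := by
  have hn0 : (0 : ℝ) < n := by positivity
  have hn0' : (n : ℂ) ≠ 0 := by exact_mod_cast hn0.ne'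
  rw [EC_S hn x y hx]
  have h1 : ∀ i k, _ := fun i k => sym_gen x y τ i k (FF x y i k) (fun j l => by unfold FF; ring)
    (fun w => w + w ^ 3 / 12) (fun w => |w| ^ 4) (fun w => by ring) symker4
  have h2 := norm_dsum h1
  have e1 : (Complex.I * τ / (4 * n) *
      ∑ i, ∑ k, EC (fun π => ((XX x y i k (π i) (π k) ^ 2 : ℝ) : ℂ) * ex τ x y π) +
      Complex.I * τ ^ 3 / (48 * n) *
      ∑ i, ∑ k, EC (fun π => ((XX x y i k (π i) (π k) ^ 4 : ℝ) : ℂ) * ex τ x y π)) =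
      1 / (2 * n) * ∑ i, ∑ k, Complex.I / 2 *
      EC (fun π => ((FF x y i k (π i) (π k) * (τ * XX x y i k (π i) (π k) +
        (τ * XX x y i k (π i) (π k)) ^ 3 / 12) : ℝ) : ℂ) *
        ex τ x y π) := by
    rw [Finset.mul_sum, Finset.mul_sum, Finset.mul_sum, ← Finset.sum_add_distrib]
    refine Finset.sum_congr rfl fun i _ => ?_
    rw [Finset.mul_sum, Finset.mul_sum, Finset.mul_sum, ← Finset.sum_add_distrib]
    refine Finset.sum_congr rfl fun k _ => ?_
    rw [← EC_mul, ← EC_mul, ← EC_mul, ← EC_mul, ← EC_add]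
    congr 1; funext π
    have : FF x y i k (π i) (π k) = XX x y i k (π i) (π k) := rfl
    rw [this]
    push_cast; field_simp; ring
  rw [e1, ← mul_sub, norm_mul, norm_half_n hn]
  have h3 : ∑ i, ∑ k, permExp (fun π => |FF x y i k (π i) (π k)| *
      |τ * XX x y i k (π i) (π k)| ^ 4) = |τ| ^ 4 * ∑ i, ∑ k, permExp (fun π =>
      |FF x y i k (π i) (π k) * XX x y i k (π i) (π k) ^ 4|) := by
    rw [Finset.mul_sum]
    refine Finset.sum_congr rfl fun i _ => ?_
    rw [Finset.mul_sum]
    refine Finset.sum_congr rfl fun k _ => ?_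
    rw [← PE_mul]
    congr 1; funext π
    rw [abs_mul τ, mul_pow, abs_mul, abs_pow]; ring
  have h4 := bound_two (by omega) 5 x y 1 zero_le_one
    (fun i k j l => FF x y i k j l * XX x y i k j l ^ 4)
    (fun i k j l => by
      rw [one_mul]; exact FFXX_bound (p := 1) (by simpa using dx1 x) (by simpa using dx1 y) 4 i k j l)
  rw [h3] at h2
  rw [one_mul] at h4
  have h5 := h2.trans (mul_le_mul_of_nonneg_left h4 (by positivity))
  refine (mul_le_mul_of_nonneg_left h5 (by positivity)).trans ?_
  have hW := W_nonneg 5 x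
  have hW' := W_nonneg 5 y
  have hK : 0 ≤ KK 5 := by unfold KK; positivity
  have e6 : 1 / (2 * (n:ℝ)) * (|τ| ^ 4 * (KK 5 * n ^ 2 * (W 5 x * W 5 y))) =
    1 / 2 * (|τ| ^ 4 * (KK 5 * n * (W 5 x * W 5 y))) := by
    field_simp
  rw [e6]
  have : 0 ≤ |τ| ^ 4 * (KK 5 * n * (W 5 x * W 5 y)) := by positivity
  linarith

/-- sum of squared increments -/
lemma sum_XX2 {x y : Fin n → ℝ} (hx : Nrm x) (hy : Nrm y) (π : Equiv.Perm (Fin n)) :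
    ∑ i, ∑ k, XX x y i k (π i) (π k) ^ 2 =
      4 * (n : ℝ) ^ 2 + 2 * n * S (f2 x) (f2 y) π + 4 * S x y π ^ 2 := by
  have h : ∀ i k, XX x y i k (π i) (π k) ^ 2 =
      (x i ^ 2 * y (π i) ^ 2) * 1 + 1 * (x k ^ 2 * y (π k) ^ 2) + x i ^ 2 * y (π k) ^ 2
      + y (π i) ^ 2 * x k ^ 2 + 4 * ((x i * y (π i)) * (x k * y (π k)))
      - 2 * ((x i ^ 2 * y (π i)) * y (π k)) - 2 * (y (π i) * (x k ^ 2 * y (π k)))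
      - 2 * ((x i * y (π i) ^ 2) * x k) - 2 * (x i * (x k * y (π k) ^ 2)) := by
    intro i k; unfold XX; ring
  have hy1 : ∑ i, y (π i) = 0 := by rw [sum_perm π y, hy.s1]
  have hy2 : ∑ i, y (π i) ^ 2 = n := by rw [sum_perm π (fun j => y j ^ 2), hy.s2]
  have e2 : S (f2 x) (f2 y) π = ∑ i, x i ^ 2 * y (π i) ^ 2 - n := by
    have : ∀ i, f2 x i * f2 y (π i) = x i ^ 2 * y (π i) ^ 2 - x i ^ 2 - y (π i) ^ 2 + 1 := by
      intro i; unfold f2; ring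
    unfold S
    simp only [this, Finset.sum_add_distrib, Finset.sum_sub_distrib, hx.s2, hy2]
    simp
  rw [e2]
  have m1 := sum_sep (fun i => x i ^ 2 * y (π i) ^ 2) (fun _ => (1:ℝ))
  have m2 := sum_sep (fun _ => (1:ℝ)) (fun i => x i ^ 2 * y (π i) ^ 2)
  have m3 := sum_sep (fun i => x i ^ 2) (fun i => y (π i) ^ 2)
  have m4 := sum_sep (fun i => y (π i) ^ 2) (fun i => x i ^ 2)
  have m5 := sum_sep (fun i => x i * y (π i)) (fun i => x i * y (π i))
  have m6 := sum_sep (fun i => x i ^ 2 * y (π i)) (fun i => y (π i))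
  have m7 := sum_sep (fun i => y (π i)) (fun i => x i ^ 2 * y (π i))
  have m8 := sum_sep (fun i => x i * y (π i) ^ 2) (fun i => x i)
  have m9 := sum_sep (fun i => x i) (fun i => x i * y (π i) ^ 2)
  have e5 : S x y π = ∑ i, x i * y (π i) := rfl
  rw [e5]
  clear e2 e5
  have p5 : ∀ f : Fin n → Fin n → ℝ, ∀ a : ℝ, ∑ i, ∑ k, a * f i k = a * ∑ i, ∑ k, f i k := by
    intro f a; simp only [Finset.mul_sum]
  simp only [h, Finset.sum_add_distrib, Finset.sum_sub_distrib, p5]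
  simp only [m1, m2, m3, m4, m5, m6, m7, m8, m9]
  simp only [hx.s1, hx.s2, hy1, hy2, Finset.sum_const,
    Finset.card_univ, Fintype.card_fin, nsmul_eq_mul]
  ring

/-- cross increments -/
lemma sum_FX2 (hn : 2 ≤ n) {x y : Fin n → ℝ} (hx : Nrm x) (hy : Nrm y) (π : Equiv.Perm (Fin n)) :
    ∑ i, ∑ k, FF (f2 x) (f2 y) i k (π i) (π k) * XX x y i k (π i) (π k) =
      4 * (n : ℝ) ^ 2 * (mm 3 x * mm 3 y) + 2 * n * S (f3 x) (f3 y) π +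
        2 * (S (f2 x) (f2 y) π * S x y π + S (f2 x) y π * S x (f2 y) π) := by
  obtain ⟨z, hz⟩ : ∃ z : Fin n → ℝ, z = fun i => y (π i) := ⟨_, rfl⟩
  have hzi : ∀ i, y (π i) = z i := fun i => by rw [hz]
  have h : ∀ i k, FF (f2 x) (f2 y) i k (π i) (π k) * XX x y i k (π i) (π k) =
      (x i ^ 3 * z i ^ 3) * 1 + 1 * (x k ^ 3 * z k ^ 3) + x i ^ 3 * z k ^ 3 + z i ^ 3 * x k ^ 3
      - (x i ^ 3 * z i ^ 2) * z k - (x i ^ 3 * z i) * z k ^ 2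
      - z i ^ 2 * (x k ^ 3 * z k) - z i * (x k ^ 3 * z k ^ 2)
      - (z i ^ 3 * x i ^ 2) * x k - (z i ^ 3 * x i) * x k ^ 2
      - x i ^ 2 * (z k ^ 3 * x k) - x i * (z k ^ 3 * x k ^ 2)
      + (x i ^ 2 * z i ^ 2) * (x k * z k) + (x i ^ 2 * z i) * (x k * z k ^ 2)
      + (x i * z i ^ 2) * (x k ^ 2 * z k) + (x i * z i) * (x k ^ 2 * z k ^ 2) := by
    intro i k; unfold XX FF f2; rw [hzi, hzi]; ring
  have hy1 : ∑ i, z i = 0 := by rw [hz]; rw [sum_perm π y, hy.s1]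
  have hy2 : ∑ i, z i ^ 2 = n := by rw [hz]; rw [sum_perm π (fun j => y j ^ 2), hy.s2]
  have hy3 : ∑ i, z i ^ 3 = n * mm 3 y := by
    rw [hz]; rw [sum_perm π (fun j => y j ^ 3), sum_pow_mm hn]
  have hx3 := sum_pow_mm hn 3 x
  have e2 : S (f2 x) (f2 y) π = ∑ i, x i ^ 2 * z i ^ 2 - n := by
    have : ∀ i, f2 x i * f2 y (π i) = x i ^ 2 * z i ^ 2 - x i ^ 2 - z i ^ 2 + 1 := by
      intro i; unfold f2; rw [hzi]; ring
    unfold S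
    simp only [this, Finset.sum_add_distrib, Finset.sum_sub_distrib, hx.s2, hy2]
    simp
  have e3 : S (f2 x) y π = ∑ i, x i ^ 2 * z i := by
    have : ∀ i, f2 x i * y (π i) = x i ^ 2 * z i - z i := by
      intro i; unfold f2; rw [hzi]; ring
    unfold S
    simp only [this, Finset.sum_sub_distrib, hy1]
    simp
  have e4 : S x (f2 y) π = ∑ i, x i * z i ^ 2 := by
    have : ∀ i, x i * f2 y (π i) = x i * z i ^ 2 - x i := by
      intro i; unfold f2; rw [hzi]; ring
    unfold S
    simp only [this, Finset.sum_sub_distrib, hx.s1]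
    simp
  have e5 : S x y π = ∑ i, x i * z i := by unfold S; simp only [hzi]
  have e6 : S (f3 x) (f3 y) π = ∑ i, x i ^ 3 * z i ^ 3 - ∑ i, x i ^ 3 * z i - ∑ i, z i ^ 3 * x i
      + ∑ i, x i * z i - n * (mm 3 x * mm 3 y) := by
    have : ∀ i, f3 x i * f3 y (π i) = x i ^ 3 * z i ^ 3 - x i ^ 3 * z i - z i ^ 3 * x i + x i * z i
        - mm 3 y * x i ^ 3 - mm 3 x * z i ^ 3 + mm 3 y * x i + mm 3 x * z i
        + mm 3 x * mm 3 y := by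
      intro i; unfold f3; rw [hzi]; ring
    unfold S
    simp only [this, Finset.sum_add_distrib, Finset.sum_sub_distrib, ← Finset.mul_sum, hx3, hy3,
      hx.s1, hy1, Finset.sum_const, Finset.card_univ, Fintype.card_fin, nsmul_eq_mul]
    ring
  rw [e2, e3, e4, e5, e6]
  have m1 := sum_sep (fun i => x i ^ 3 * z i ^ 3) (fun _ => (1:ℝ))
  have m2 := sum_sep (fun _ => (1:ℝ)) (fun i => x i ^ 3 * z i ^ 3)
  have m3 := sum_sep (fun i => x i ^ 3) (fun i => z i ^ 3)
  have m4 := sum_sep (fun i => z i ^ 3) (fun i => x i ^ 3)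
  have m5 := sum_sep (fun i => x i ^ 3 * z i ^ 2) (fun i => z i)
  have m6 := sum_sep (fun i => x i ^ 3 * z i) (fun i => z i ^ 2)
  have m7 := sum_sep (fun i => z i ^ 2) (fun i => x i ^ 3 * z i)
  have m8 := sum_sep (fun i => z i) (fun i => x i ^ 3 * z i ^ 2)
  have m9 := sum_sep (fun i => z i ^ 3 * x i ^ 2) (fun i => x i)
  have m10 := sum_sep (fun i => z i ^ 3 * x i) (fun i => x i ^ 2)
  have m11 := sum_sep (fun i => x i ^ 2) (fun i => z i ^ 3 * x i)
  have m12 := sum_sep (fun i => x i) (fun i => z i ^ 3 * x i ^ 2)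
  have m13 := sum_sep (fun i => x i ^ 2 * z i ^ 2) (fun i => x i * z i)
  have m14 := sum_sep (fun i => x i ^ 2 * z i) (fun i => x i * z i ^ 2)
  have m15 := sum_sep (fun i => x i * z i ^ 2) (fun i => x i ^ 2 * z i)
  have m16 := sum_sep (fun i => x i * z i) (fun i => x i ^ 2 * z i ^ 2)
  clear e2 e3 e4 e5 e6 hz hzi
  simp only [h, Finset.sum_add_distrib, Finset.sum_sub_distrib]
  simp only [m1, m2, m3, m4, m5, m6, m7, m8, m9, m10, m11, m12, m13, m14, m15, m16]
  simp only [hx.s1, hx.s2, hy1, hy2, hx3, hy3, Finset.sum_const, Finset.card_univ, Fintype.card_fin, nsmul_eq_mul]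
  ring

/-- second moment of a linear statistic -/
lemma PE_SS (hn : 2 ≤ n) (f g : Fin n → ℝ) (hf : ∑ i, f i = 0) (hg : ∑ i, g i = 0) :
    permExp (fun π => S f g π ^ 2) = (∑ i, f i ^ 2) * (∑ i, g i ^ 2) / (n - 1) := by
  have hn0 : (0 : ℝ) < n := by positivity
  have hn2 : (2 : ℝ) ≤ n := by exact_mod_cast hn
  have hn1 : (n : ℝ) - 1 ≠ 0 := by linarith
  have h1 : ∀ i k, permExp (fun π => FF f g i k (π i) (π k) * S f g π) =
      1 / 2 * permExp (fun π => FF f g i k (π i) (π k) ^ 2) := by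
    intro i k
    have := PE_comp (fun π => FF f g i k (π i) (π k) * S f g π) (Equiv.swap i k)
    have e : permExp (fun π => FF f g i k (π i) (π k) * S f g π) +
        permExp (fun π => FF f g i k (π i) (π k) * S f g π) =
        permExp (fun π => FF f g i k (π i) (π k) ^ 2) := by
      nth_rw 2 [← this]
      rw [← PE_add]
      congr 1; funext π
      rw [(swap_app π i k).1, (swap_app π i k).2, S_swap]
      unfold FF; ring
    linarith
  have h2 : ∀ i k, permExp (fun π => FF f g i k (π i) (π k) ^ 2) =
      (f i - f k) ^ 2 * ((2 * n * ∑ i, g i ^ 2) / (n * (n - 1))) := by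
    intro i k
    by_cases hik : i = k
    · subst hik; simp [FF, PE_const]
    · have := PE_two (fun j l => FF f g i k j l ^ 2) (fun j => by simp [FF]) hik
      have e3 : ∑ j, ∑ l, FF f g i k j l ^ 2 = (f i - f k) ^ 2 * (2 * n * ∑ i, g i ^ 2) := by
        have : ∀ j l, FF f g i k j l ^ 2 = (f i - f k) ^ 2 * (g j ^ 2 * 1 + 1 * g l ^ 2
          - 2 * (g j * g l)) := by intro j l; unfold FF; ring
        simp only [this, ← Finset.mul_sum, Finset.sum_add_distrib, Finset.sum_sub_distrib,
          ← Finset.sum_mul, hg]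
        simp only [Finset.sum_const, Finset.card_univ, Fintype.card_fin, nsmul_eq_mul]
        ring
      rw [e3] at this
      have hnn : (n : ℝ) * (n - 1) ≠ 0 := mul_ne_zero hn0.ne' hn1
      rw [mul_div_assoc', eq_div_iff hnn, ← this]; ring
  have h3 : permExp (fun π => S f g π ^ 2) =
      1 / (2 * n) * ∑ i, ∑ k, permExp (fun π => FF f g i k (π i) (π k) * S f g π) := by
    simp only [← PE_sum, ← PE_mul]
    congr 1; funext π
    rw [sq]
    nth_rw 1 [S_eq_sum hn f g hf]
    simp only [Finset.sum_mul, Finset.mul_sum, mul_assoc]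
  rw [h3]
  simp only [h1, h2]
  have : ∀ i k, 1 / 2 * ((f i - f k) ^ 2 * ((2 * n * ∑ i, g i ^ 2) / (n * (n - 1)))) =
    (1 / 2 * ((2 * n * ∑ i, g i ^ 2) / (n * (n - 1)))) * (f i ^ 2 * 1 + 1 * f k ^ 2
          - 2 * (f i * f k)) := by intro i k; ring
  simp only [this, ← Finset.mul_sum, Finset.sum_add_distrib, Finset.sum_sub_distrib,
          ← Finset.sum_mul, hf]
  simp
  field_simp
  ring

end expand
end RankEdge

namespace RankEdge
section expand2
variable {n : ℕ}

/-- characteristic function -/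
noncomputable def ph (τ : ℝ) (x y : Fin n → ℝ) : ℂ := EC (ex τ x y)

/-- weighted linear statistic -/
noncomputable def LE (f g : Fin n → ℝ) (τ : ℝ) (x y : Fin n → ℝ) : ℂ :=
  EC (fun π => (S f g π : ℂ) * ex τ x y π)

/-- weighted second moment -/
noncomputable def QQ (τ : ℝ) (x y : Fin n → ℝ) : ℂ :=
  EC (fun π => ((S x y π ^ 2 : ℝ) : ℂ) * ex τ x y π)

lemma norm_exp_sub (τ a b : ℝ) : ‖Complex.exp (Complex.I * (τ * a : ℝ)) -
    Complex.exp (Complex.I * (τ * b : ℝ))‖ ≤ |τ| * |a - b| := by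
  have e : Complex.exp (Complex.I * (τ * a : ℝ)) - Complex.exp (Complex.I * (τ * b : ℝ)) =
      Complex.exp (Complex.I * (τ * b : ℝ)) * (Complex.exp (Complex.I * (τ * (a - b) : ℝ)) - 1) := by
    rw [mul_sub, ← Complex.exp_add]
    congr 2
    · push_cast; ring
    · simp
  rw [e, norm_mul, mul_comm Complex.I, Complex.norm_exp_ofReal_mul_I, one_mul, ← abs_mul]
  exact Real.norm_exp_I_mul_ofReal_sub_one_le

lemma norm_one_sub_exp (w : ℝ) :
    ‖(1 - Complex.exp (-(Complex.I * w)) - Complex.I * w : ℂ)‖ ≤ |w| ^ 2 := by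
  have h := symker2 w
  have h1 : ‖(Complex.exp (-(Complex.I * w)) - 1 : ℂ)‖ ≤ |w| := by
    have := Real.norm_exp_I_mul_ofReal_sub_one_le (x := -w)
    rw [Real.norm_eq_abs, abs_neg] at this
    convert this using 4
    push_cast; ring
  have hA : ‖(1 - Complex.exp (-(Complex.I * w)) -
      1 / 2 * Complex.I * w * (1 + Complex.exp (-(Complex.I * w))) : ℂ)‖ ≤ |w| ^ 2 / 2 := by
    rw [symker]
    have h := trigA2 (w / 2)
    have : 2 * Real.sin (w / 2) - w * Real.cos (w / 2) =
      2 * (Real.sin (w / 2) - w / 2 * Real.cos (w / 2)) := by ring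
    rw [this, abs_mul]
    rw [abs_div, div_pow] at h
    simp only [Nat.abs_ofNat] at *
    linarith
  have e : (1 - Complex.exp (-(Complex.I * w)) - Complex.I * w : ℂ) =
      (1 - Complex.exp (-(Complex.I * w)) -
      1 / 2 * Complex.I * w * (1 + Complex.exp (-(Complex.I * w)))) +
      1 / 2 * Complex.I * w * (Complex.exp (-(Complex.I * w)) - 1) := by ring
  rw [e]
  refine (norm_add_le _ _).trans ?_
  have h2 : ‖1 / 2 * Complex.I * w * (Complex.exp (-(Complex.I * w)) - 1)‖ ≤ 1 / 2 * |w| * |w| := by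
    rw [norm_mul, norm_mul, norm_mul, Complex.norm_I, Complex.norm_real, Real.norm_eq_abs]
    have : ‖(1 / 2 : ℂ)‖ = 1 / 2 := by simp
    rw [this, mul_one]
    exact mul_le_mul_of_nonneg_left h1 (by positivity)
  nlinarith

lemma dec_ex (hn : 2 ≤ n) (p : ℕ) (x y : Fin n → ℝ) (τ : ℝ)
    (H : Fin n → Fin n → Fin n → Fin n → ℝ)
    (hH : ∀ i k j l, |H i k j l| ≤ (mj x i + mj x k) ^ p * (mj y j + mj y l) ^ p)
    (hi : ∀ i j l, H i i j l = 0) (hj : ∀ i k j, H i k j j = 0) :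
    ‖∑ i, ∑ k, EC (fun π => (H i k (π i) (π k) : ℂ) * ex τ x y π) -
      ((∑ i, ∑ k, ∑ j, ∑ l, H i k j l) / (n * (n - 1)) : ℝ) * ph τ x y‖ ≤
    |τ| * (4 * KK (p + 1) * n ^ 2 * (W (p + 1) x * W (p + 1) y)) := by
  have := decouple hn p x y 1 zero_le_one H (by simpa using hH) hi hj
    (fun a => Complex.exp (Complex.I * (τ * a : ℝ))) |τ| (norm_exp_sub τ)
  rw [mul_one] at this
  exact this

lemma sum_prod4 (α β : Fin n → Fin n → ℝ) :
    ∑ i, ∑ k, ∑ j, ∑ l, α i k * β j l = (∑ i, ∑ k, α i k) * ∑ j, ∑ l, β j l := by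
  simp only [← Finset.mul_sum, ← Finset.sum_mul]

lemma sum_diff (f x : Fin n → ℝ) (hx : ∑ i, x i = 0) :
    ∑ i, ∑ k, (f i - f k) * (x i - x k) = 2 * n * ∑ i, f i * x i := by
  have : ∀ i k, (f i - f k) * (x i - x k) = (f i * x i) * 1 + 1 * (f k * x k) - f i * x k
      - x i * f k := by intros; ring
  simp only [this, Finset.sum_add_distrib, Finset.sum_sub_distrib, sum_sep, hx]
  simp only [Finset.sum_const, Finset.card_univ, Fintype.card_fin, nsmul_eq_mul, mul_one]
  ring

lemma sum_f2x (hn : 2 ≤ n) {x : Fin n → ℝ} (hx : Nrm x) : ∑ i, f2 x i * x i = n * mm 3 x := by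
  have : ∀ i, f2 x i * x i = x i ^ 3 - x i := by intro i; unfold f2; ring
  simp only [this, Finset.sum_sub_distrib, hx.s1, sum_pow_mm hn 3]; ring

lemma sum_f3x (hn : 2 ≤ n) {x : Fin n → ℝ} (hx : Nrm x) :
    ∑ i, f3 x i * x i = n * (mm 4 x - 1) := by
  have : ∀ i, f3 x i * x i = x i ^ 4 - x i ^ 2 - mm 3 x * x i := by intro i; unfold f3; ring
  simp only [this, Finset.sum_sub_distrib, ← Finset.mul_sum, hx.s1, hx.s2, sum_pow_mm hn 4]; ring

lemma sum_d4 (hn : 2 ≤ n) {x : Fin n → ℝ} (hx : Nrm x) :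
    ∑ i, ∑ k, (x i - x k) ^ 4 = (n : ℝ) ^ 2 * (2 * mm 4 x + 6) := by
  have : ∀ i k, (x i - x k) ^ 4 = x i ^ 4 * 1 + 1 * x k ^ 4 - (4 * x i ^ 3) * x k
      - x i * (4 * x k ^ 3) + (6 * x i ^ 2) * x k ^ 2 := by intros; ring
  have m1 := sum_sep (fun i => x i ^ 4) (fun _ => (1:ℝ))
  have m2 := sum_sep (fun _ => (1:ℝ)) (fun i => x i ^ 4)
  have m3 := sum_sep (fun i => 4 * x i ^ 3) (fun i => x i)
  have m4 := sum_sep (fun i => x i) (fun i => 4 * x i ^ 3)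
  have m5 := sum_sep (fun i => 6 * x i ^ 2) (fun i => x i ^ 2)
  have m6 : ∑ i, 6 * x i ^ 2 = 6 * (n : ℝ) := by rw [← Finset.mul_sum, hx.s2]
  simp only [this, Finset.sum_add_distrib, Finset.sum_sub_distrib]
  simp only [m1, m2, m3, m4, m5, m6]
  simp only [hx.s1, hx.s2, sum_pow_mm hn 4, Finset.sum_const,
    Finset.card_univ, Fintype.card_fin, nsmul_eq_mul]
  ring

lemma X2sum {x y : Fin n → ℝ} (hx : Nrm x) (hy : Nrm y) (e : Equiv.Perm (Fin n) → ℂ) :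
    ∑ i, ∑ k, EC (fun π => ((XX x y i k (π i) (π k) ^ 2 : ℝ) : ℂ) * e π) =
      4 * n ^ 2 * EC e + 2 * n * EC (fun π => (S (f2 x) (f2 y) π : ℂ) * e π) +
      4 * EC (fun π => ((S x y π ^ 2 : ℝ) : ℂ) * e π) := by
  simp only [← EC_sum, ← EC_mul, ← EC_add, ← Finset.sum_mul, ← Complex.ofReal_sum]
  congr 1; funext π
  rw [sum_XX2 hx hy π]
  push_cast; ring

lemma dn (hn : 2 ≤ n) : (n : ℂ) ≠ 0 := by
  have : n ≠ 0 := by omega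
  exact_mod_cast this

lemma E1 (hn : 2 ≤ n) {x y : Fin n → ℝ} (hx : Nrm x) (hy : Nrm y) (τ : ℝ) :
    ‖LE x y τ x y - (Complex.I * τ * (n * ph τ x y + 1 / 2 * LE (f2 x) (f2 y) τ x y +
      1 / n * QQ τ x y) + Complex.I * τ ^ 3 / (48 * n) *
      ∑ i, ∑ k, EC (fun π => ((XX x y i k (π i) (π k) ^ 4 : ℝ) : ℂ) * ex τ x y π))‖ ≤
    |τ| ^ 4 * (KK 5 * n * (W 5 x * W 5 y)) := by
  have := lin_exp4 hn τ x y hx.s1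
  rw [X2sum hx hy] at this
  have hn' := dn hn
  unfold LE ph QQ
  convert this using 4
  · field_simp; ring

lemma E1' (hn : 2 ≤ n) {x y : Fin n → ℝ} (hx : Nrm x) (hy : Nrm y) (τ : ℝ) (s : ℕ)
    (hs : s = 2 ∨ s = 3) :
    ‖LE x y τ x y - (Complex.I * τ * (n * ph τ x y + 1 / 2 * LE (f2 x) (f2 y) τ x y +
      1 / n * QQ τ x y))‖ ≤
    |τ| ^ s * (KK (1 + s) * n * (W (1 + s) x * W (1 + s) y)) := by
  have := lin_exp hn τ x y x y hx.s1 1 s hs (by simpa using dx1 x) (by simpa using dx1 y)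
  have e : ∀ i k j l, FF x y i k j l * XX x y i k j l = XX x y i k j l ^ 2 := by
    intro i k j l; unfold FF XX; ring
  simp only [e] at this
  rw [X2sum hx hy] at this
  have hn' := dn hn
  unfold LE ph QQ
  convert this using 3
  · field_simp; ring

lemma E2 (hn : 2 ≤ n) {x y : Fin n → ℝ} (hx : Nrm x) (hy : Nrm y) (τ : ℝ) :
    ‖LE (f2 x) (f2 y) τ x y - (Complex.I * τ * (n * (mm 3 x * mm 3 y : ℝ) * ph τ x y +
      1 / 2 * LE (f3 x) (f3 y) τ x y +
      1 / (2 * n) * EC (fun π => ((S (f2 x) (f2 y) π * S x y π + S (f2 x) y π * S x (f2 y) π : ℝ) : ℂ)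
        * ex τ x y π)))‖ ≤
    |τ| ^ 3 * (KK 5 * n * (W 5 x * W 5 y)) := by
  have := lin_exp hn τ x y (f2 x) (f2 y) (sum_f2 hx) 2 3 (Or.inr rfl) (dx2 x) (dx2 y)
  have e : ∑ i, ∑ k, EC (fun π => ((FF (f2 x) (f2 y) i k (π i) (π k) * XX x y i k (π i) (π k) : ℝ)
      : ℂ) * ex τ x y π) = 4 * n ^ 2 * (mm 3 x * mm 3 y : ℝ) * ph τ x y +
      2 * n * LE (f3 x) (f3 y) τ x y + 2 * EC (fun π => ((S (f2 x) (f2 y) π * S x y π +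
        S (f2 x) y π * S x (f2 y) π : ℝ) : ℂ) * ex τ x y π) := by
    unfold ph LE
    simp only [← EC_sum, ← EC_mul, ← EC_add, ← Finset.sum_mul, ← Complex.ofReal_sum]
    congr 1; funext π
    rw [sum_FX2 hn hx hy π]
    push_cast; ring
  rw [e] at this
  have hn' := dn hn
  refine le_trans (le_of_eq ?_) this
  congr 2
  generalize EC _ = Z
  field_simp; ring

lemma comb {A B C D : ℂ} {a b c : ℝ} (h1 : ‖A - D * B‖ ≤ a) (h2 : ‖B - C‖ ≤ b) (h3 : ‖D‖ ≤ c) :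
    ‖A - D * C‖ ≤ a + c * b := by
  have : A - D * C = (A - D * B) + D * (B - C) := by ring
  rw [this]
  refine (norm_add_le _ _).trans (add_le_add h1 ?_)
  rw [norm_mul]
  exact mul_le_mul h3 h2 (norm_nonneg _) ((norm_nonneg _).trans h3)

lemma norm_Itn (_hn : 2 ≤ n) (τ : ℝ) : ‖(Complex.I * τ / (4 * n) : ℂ)‖ ≤ |τ| / (4 * n) := by
  simp

lemma FXzero (f g x y : Fin n → ℝ) : (∀ i j l, FF f g i i j l * XX x y i i j l = 0) ∧
    (∀ i k j, FF f g i k j j * XX x y i k j j = 0) := by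
  constructor <;> intros <;> simp [FF, XX]

lemma sum_FXg (f g x y : Fin n → ℝ) (hx : ∑ i, x i = 0) (hy : ∑ i, y i = 0) :
    ∑ i, ∑ k, ∑ j, ∑ l, FF f g i k j l * XX x y i k j l =
      (2 * n * ∑ i, f i * x i) * (2 * n * ∑ i, g i * y i) := by
  rw [← sum_diff f x hx, ← sum_diff g y hy, ← sum_prod4]
  refine Finset.sum_congr rfl fun i _ => Finset.sum_congr rfl fun k _ =>
    Finset.sum_congr rfl fun j _ => Finset.sum_congr rfl fun l _ => ?_
  unfold FF XX; ring

lemma E_dec (hn : 2 ≤ n) {x y : Fin n → ℝ} (hx : Nrm x) (hy : Nrm y) (τ : ℝ) (p : ℕ)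
    (f g : Fin n → ℝ) (hf0 : ∑ i, f i = 0) (hf : ∀ i k, |f i - f k| ≤ (mj x i + mj x k) ^ p)
    (hg : ∀ i k, |g i - g k| ≤ (mj y i + mj y k) ^ p) :
    ‖LE f g τ x y - Complex.I * τ * (((∑ i, f i * x i) * (∑ i, g i * y i) / (n - 1) : ℝ)
      * ph τ x y)‖ ≤ |τ| ^ 2 * (2 * KK (p + 2) * n * (W (p + 2) x * W (p + 2) y)) := by
  have h1 := lin_exp hn τ x y f g hf0 p 2 (Or.inl rfl) hf hg
  have h2 := dec_ex hn (p + 1) x y τ (fun i k j l => FF f g i k j l * XX x y i k j l)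
    (fun i k j l => by simpa using FFXX_bound hf hg 1 i k j l) (FXzero f g x y).1 (FXzero f g x y).2
  have h3 := comb h1 h2 (norm_Itn hn τ)
  rw [sum_FXg f g x y hx.s1 hy.s1] at h3
  have hn' := dn hn
  have hn0 : (0 : ℝ) < n := by positivity
  have hn2 : (2 : ℝ) ≤ n := by exact_mod_cast hn
  have hn1 : (n : ℝ) - 1 ≠ 0 := by linarith
  unfold LE
  refine le_trans (le_of_eq ?_) (h3.trans (le_of_eq ?_))
  · congr 2
    have : (2 * n * ∑ i, f i * x i) * (2 * n * ∑ i, g i * y i) / (n * (n - 1)) =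
      4 * n * ((∑ i, f i * x i) * (∑ i, g i * y i) / (n - 1)) := by field_simp; ring
    rw [this]
    push_cast
    field_simp
  · field_simp; ring

lemma E2' (hn : 2 ≤ n) {x y : Fin n → ℝ} (hx : Nrm x) (hy : Nrm y) (τ : ℝ) :
    ‖LE (f2 x) (f2 y) τ x y - Complex.I * τ * (((n : ℝ) ^ 2 * (mm 3 x * mm 3 y) / (n - 1) : ℝ)
      * ph τ x y)‖ ≤ |τ| ^ 2 * (2 * KK 4 * n * (W 4 x * W 4 y)) := by
  have := E_dec hn hx hy τ 2 (f2 x) (f2 y) (sum_f2 hx) (dx2 x) (dx2 y)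
  rw [sum_f2x hn hx, sum_f2x hn hy] at this
  convert this using 6
  ring

lemma E3 (hn : 2 ≤ n) {x y : Fin n → ℝ} (hx : Nrm x) (hy : Nrm y) (τ : ℝ) :
    ‖LE (f3 x) (f3 y) τ x y - Complex.I * τ * (((n : ℝ) ^ 2 * ((mm 4 x - 1) * (mm 4 y - 1)) / (n - 1) : ℝ)
      * ph τ x y)‖ ≤ |τ| ^ 2 * (2 * KK 5 * n * (W 5 x * W 5 y)) := by
  have := E_dec hn hx hy τ 3 (f3 x) (f3 y) (sum_f3 hn hx) (dx3 x) (dx3 y)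
  rw [sum_f3x hn hx, sum_f3x hn hy] at this
  convert this using 6
  ring

lemma E4 (hn : 2 ≤ n) {x y : Fin n → ℝ} (hx : Nrm x) (hy : Nrm y) (τ : ℝ) :
    ‖∑ i, ∑ k, EC (fun π => ((XX x y i k (π i) (π k) ^ 4 : ℝ) : ℂ) * ex τ x y π) -
      ((4 * (n : ℝ) ^ 3 * ((mm 4 x + 3) * (mm 4 y + 3)) / (n - 1) : ℝ) : ℂ) * ph τ x y‖ ≤
      |τ| * (4 * KK 5 * n ^ 2 * (W 5 x * W 5 y)) := by
  have h2 := dec_ex hn 4 x y τ (fun i k j l => XX x y i k j l ^ 4)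
    (fun i k j l => by
      rw [abs_pow, ← mul_pow]
      exact pow_le_pow_left₀ (abs_nonneg _) (XX_bound x y i k j l) 4)
    (fun i j l => by simp [XX]) (fun i j l => by simp [XX])
  have e : ∑ i, ∑ k, ∑ j, ∑ l, XX x y i k j l ^ 4 =
      ((n : ℝ) ^ 2 * (2 * mm 4 x + 6)) * ((n : ℝ) ^ 2 * (2 * mm 4 y + 6)) := by
    rw [← sum_d4 hn hx, ← sum_d4 hn hy, ← sum_prod4]
    simp only [XX, mul_pow]
  rw [e] at h2
  have hn0 : (0 : ℝ) < n := by positivity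
  convert h2 using 5
  field_simp; ring

end expand2
end RankEdge

namespace RankEdge
section expand3
variable {n : ℕ}

lemma n_facts (hn : 2 ≤ n) : (2 : ℝ) ≤ n ∧ (0 : ℝ) < n ∧ (n : ℝ) / 2 ≤ n - 1 ∧ 0 < (n : ℝ) - 1 := by
  have hn2 : (2 : ℝ) ≤ n := by exact_mod_cast hn
  refine ⟨hn2, ?_, ?_, ?_⟩ <;> linarith

lemma sum_f2sq (hn : 2 ≤ n) {x : Fin n → ℝ} (_hx : Nrm x) : ∑ i, f2 x i ^ 2 ≤ n * W 4 x := by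
  have e : ∀ i, f2 x i ^ 2 = x i ^ 4 - 2 * x i ^ 2 + 1 := by intro i; unfold f2; ring
  rw [← sum_mj (by omega) 4 x]
  refine Finset.sum_le_sum fun i _ => ?_
  rw [e]
  unfold mj
  have := abs_nonneg (x i)
  have h2 := sq_abs (x i)
  have h3 : x i ^ 4 = |x i| ^ 4 := by rw [show x i ^ 4 = (x i ^ 2) ^ 2 by ring, ← h2]; ring
  rw [h3, ← h2]
  have : 0 ≤ |x i| ^ 3 := by positivity
  nlinarith [sq_nonneg |x i|]

lemma quot_bound (hn : 2 ≤ n) {a b A B : ℝ} (ha : 0 ≤ a) (hb : 0 ≤ b) (hA : a ≤ n * A) (hB : b ≤ n * B) :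
    a * b / (n - 1) ≤ 2 * n * (A * B) := by
  obtain ⟨h2, h0, h1, h3⟩ := n_facts hn
  rw [div_le_iff₀ h3]
  have hA0 : 0 ≤ A := by
    by_contra h; push Not at h; nlinarith [mul_neg_of_pos_of_neg h0 h]
  have hB0 : 0 ≤ B := by
    by_contra h; push Not at h; nlinarith [mul_neg_of_pos_of_neg h0 h]
  have : a * b ≤ (n * A) * (n * B) := mul_le_mul hA hB hb (by positivity)
  have h5 : 0 ≤ 2 * n * (A * B) := by positivity
  nlinarith [mul_le_mul_of_nonneg_left h1 h5]

lemma ES2 (hn : 2 ≤ n) {x y : Fin n → ℝ} (hx : Nrm x) (hy : Nrm y) :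
    permExp (fun π => S x y π ^ 2) ≤ 2 * n := by
  rw [PE_SS hn x y hx.s1 hy.s1]
  have := quot_bound hn (A := 1) (B := 1) (Finset.sum_nonneg fun i _ => sq_nonneg (x i))
    (Finset.sum_nonneg fun i _ => sq_nonneg (y i)) (by rw [hx.s2]; linarith) (by rw [hy.s2]; linarith)
  linarith

lemma EL22 (hn : 2 ≤ n) {x y : Fin n → ℝ} (hx : Nrm x) (hy : Nrm y) :
    permExp (fun π => S (f2 x) (f2 y) π ^ 2) ≤ 2 * n * (W 4 x * W 4 y) := by
  rw [PE_SS hn _ _ (sum_f2 hx) (sum_f2 hy)]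
  exact quot_bound hn (Finset.sum_nonneg fun i _ => sq_nonneg (f2 x i))
    (Finset.sum_nonneg fun i _ => sq_nonneg (f2 y i)) (sum_f2sq hn hx) (sum_f2sq hn hy)

lemma EL21 (hn : 2 ≤ n) {x y : Fin n → ℝ} (hx : Nrm x) (hy : Nrm y) :
    permExp (fun π => S (f2 x) y π ^ 2) ≤ 2 * n * (W 4 x * W 4 y) := by
  rw [PE_SS hn _ _ (sum_f2 hx) hy.s1]
  refine (quot_bound hn (B := 1) (Finset.sum_nonneg fun i _ => sq_nonneg (f2 x i))
    (Finset.sum_nonneg fun i _ => sq_nonneg (y i)) (sum_f2sq hn hx) (by rw [hy.s2]; linarith)).trans ?_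
  have := W_one (by omega : 0 < n) 4 y
  have h2 := W_nonneg 4 x
  gcongr

lemma EL12 (hn : 2 ≤ n) {x y : Fin n → ℝ} (hx : Nrm x) (hy : Nrm y) :
    permExp (fun π => S x (f2 y) π ^ 2) ≤ 2 * n * (W 4 x * W 4 y) := by
  rw [PE_SS hn _ _ hx.s1 (sum_f2 hy)]
  refine (quot_bound hn (A := 1) (Finset.sum_nonneg fun i _ => sq_nonneg (x i))
    (Finset.sum_nonneg fun i _ => sq_nonneg (f2 y i)) (by rw [hx.s2]; linarith) (sum_f2sq hn hy)).trans ?_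
  have := W_one (by omega : 0 < n) 4 x
  have h2 := W_nonneg 4 y
  gcongr

lemma w_one (hn : 2 ≤ n) (p : ℕ) (x y : Fin n → ℝ) : 1 ≤ W p x * W p y := by
  have := W_one (by omega : 0 < n) p y
  have h2 := W_one (by omega : 0 < n) p x
  nlinarith

lemma w_mono {p q : ℕ} (h : p ≤ q) (x y : Fin n → ℝ) : W p x * W p y ≤ W q x * W q y :=
  mul_le_mul (W_mono h x) (W_mono h y) (W_nonneg _ _) (W_nonneg _ _)

lemma prod_bound {f g : Equiv.Perm (Fin n) → ℝ} {B : ℝ} (hB : 0 ≤ B)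
    (hf : permExp (fun π => f π ^ 2) ≤ B) (hg : permExp (fun π => g π ^ 2) ≤ B) :
    permExp (fun π => |f π| * |g π|) ≤ B := by
  refine (PE_cauchy f g).trans ?_
  calc _ ≤ Real.sqrt B * Real.sqrt B := by gcongr
    _ = B := Real.mul_self_sqrt hB

lemma E_abs {f : Equiv.Perm (Fin n) → ℝ} {B : ℝ}
    (hf : permExp (fun π => f π ^ 2) ≤ B) : permExp (fun π => |f π|) ≤ Real.sqrt B := by
  have := PE_cauchy f (fun _ => 1)
  simp only [one_pow, PE_const, abs_one, mul_one, Real.sqrt_one] at this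
  exact this.trans (Real.sqrt_le_sqrt hf)

lemma sqrt_2n (hn : 2 ≤ n) {w : ℝ} (hw : 1 ≤ w) : Real.sqrt (2 * n * w) ≤ 2 * Real.sqrt n * w := by
  obtain ⟨h2, h0, h1, h3⟩ := n_facts hn
  rw [show 2 * Real.sqrt n * w = Real.sqrt ((2 * Real.sqrt n * w) ^ 2) by
    rw [Real.sqrt_sq]; positivity]
  apply Real.sqrt_le_sqrt
  rw [mul_pow, mul_pow, Real.sq_sqrt h0.le]
  nlinarith [mul_le_mul_of_nonneg_left hw h0.le, mul_le_mul_of_nonneg_left hw (by positivity : 0 ≤ n * w)]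

lemma norm_LE22 (hn : 2 ≤ n) {x y : Fin n → ℝ} (hx : Nrm x) (hy : Nrm y) (τ : ℝ) :
    ‖LE (f2 x) (f2 y) τ x y‖ ≤ 2 * Real.sqrt n * (W 4 x * W 4 y) := by
  unfold LE
  refine (norm_EC_le' (g := fun π => |S (f2 x) (f2 y) π|) fun π => ?_).trans
    ((E_abs (EL22 hn hx hy)).trans (sqrt_2n hn (w_one hn 4 x y)))
  rw [norm_mul, norm_ex, mul_one, Complex.norm_real, Real.norm_eq_abs]

lemma norm_QQ (hn : 2 ≤ n) {x y : Fin n → ℝ} (hx : Nrm x) (hy : Nrm y) (τ : ℝ) :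
    ‖QQ τ x y‖ ≤ 2 * n := by
  unfold QQ
  refine (norm_EC_le' (g := fun π => S x y π ^ 2) fun π => ?_).trans (ES2 hn hx hy)
  rw [norm_mul, norm_ex, mul_one, Complex.norm_real, Real.norm_eq_abs, abs_of_nonneg (sq_nonneg _)]

lemma ES2' (hn : 2 ≤ n) {x y : Fin n → ℝ} (hx : Nrm x) (hy : Nrm y) :
    permExp (fun π => S x y π ^ 2) ≤ 2 * n * (W 4 x * W 4 y) := by
  obtain ⟨h2, h0, h1, h3⟩ := n_facts hn
  refine (ES2 hn hx hy).trans ?_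
  nlinarith [w_one hn 4 x y]

lemma norm_L22S (hn : 2 ≤ n) {x y : Fin n → ℝ} (hx : Nrm x) (hy : Nrm y) (τ : ℝ) :
    ‖EC (fun π => (S (f2 x) (f2 y) π : ℂ) * ((S x y π : ℂ) * ex τ x y π))‖ ≤
      2 * n * (W 4 x * W 4 y) := by
  have hw := w_one hn 4 x y
  refine (norm_EC_le' (g := fun π => |S (f2 x) (f2 y) π| * |S x y π|) fun π => ?_).trans
    (prod_bound (by positivity) (EL22 hn hx hy) (ES2' hn hx hy))
  rw [norm_mul, norm_mul, norm_ex, mul_one, Complex.norm_real, Real.norm_eq_abs,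
    Complex.norm_real, Real.norm_eq_abs]

lemma norm_LL (hn : 2 ≤ n) {x y : Fin n → ℝ} (hx : Nrm x) (hy : Nrm y) (τ : ℝ) :
    ‖EC (fun π => ((S (f2 x) (f2 y) π * S x y π + S (f2 x) y π * S x (f2 y) π : ℝ) : ℂ)
        * ex τ x y π)‖ ≤ 4 * n * (W 4 x * W 4 y) := by
  have hw := w_one hn 4 x y
  refine (norm_EC_le' (g := fun π => |S (f2 x) (f2 y) π| * |S x y π| + |S (f2 x) y π| * |S x (f2 y) π|)
    fun π => ?_).trans ?_
  · rw [norm_mul, norm_ex, mul_one, Complex.norm_real, Real.norm_eq_abs, ← abs_mul, ← abs_mul]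
    exact abs_add_le _ _
  · rw [PE_add]
    have h1 := prod_bound (by positivity) (EL22 hn hx hy) (ES2' hn hx hy)
    have h2 := prod_bound (by positivity) (EL21 hn hx hy) (EL12 hn hx hy)
    linarith

lemma abs_S_le {x y : Fin n → ℝ} (hx : Nrm x) (hy : Nrm y) (π : Equiv.Perm (Fin n)) :
    |S x y π| ≤ n := by
  have h := Finset.sum_mul_sq_le_sq_mul_sq Finset.univ x (fun i => y (π i))
  rw [hx.s2, sum_perm π (fun j => y j ^ 2), hy.s2] at h
  apply abs_le_of_sq_le_sq _ (Nat.cast_nonneg n)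
  unfold S; nlinarith

lemma norm_S3 (hn : 2 ≤ n) {x y : Fin n → ℝ} (hx : Nrm x) (hy : Nrm y) (τ : ℝ) :
    ‖EC (fun π => ((S x y π ^ 2 : ℝ) : ℂ) * ((S x y π : ℂ) * ex τ x y π))‖ ≤ n * (2 * n) := by
  obtain ⟨h2, h0, h1, h3⟩ := n_facts hn
  refine (norm_EC_le' (g := fun π => n * S x y π ^ 2) fun π => ?_).trans ?_
  · rw [norm_mul, norm_mul, norm_ex, mul_one, Complex.norm_real, Real.norm_eq_abs,
      Complex.norm_real, Real.norm_eq_abs, abs_of_nonneg (sq_nonneg _), mul_comm]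
    exact mul_le_mul_of_nonneg_right (abs_S_le hx hy π) (sq_nonneg _)
  · rw [PE_mul]
    exact mul_le_mul_of_nonneg_left (ES2 hn hx hy) h0.le

lemma KK_mono {p q : ℕ} (h : p ≤ q) : KK p ≤ KK q := by
  unfold KK; gcongr; norm_num
lemma KK_one (p : ℕ) : 1 ≤ KK p := by
  unfold KK; exact one_le_pow₀ (by norm_num)

lemma X3S (hn : 2 ≤ n) {x y : Fin n → ℝ} (hx : Nrm x) (hy : Nrm y) :
    ∑ i, ∑ k, permExp (fun π => |XX x y i k (π i) (π k)| ^ 3 * |S x y π|) ≤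
      8 * KK 4 * n ^ 2 * (W 4 x * W 4 y) * Real.sqrt n := by
  obtain ⟨h2, h0, h1, h3⟩ := n_facts hn
  have hw := w_one hn 4 x y
  have hH : ∀ i k j l, |(|XX x y i k j l| ^ 3)| ≤ 1 * ((mj x i + mj x k) ^ 3 * (mj y j + mj y l) ^ 3) := by
    intro i k j l
    rw [abs_of_nonneg (by positivity), one_mul, ← mul_pow]
    exact pow_le_pow_left₀ (abs_nonneg _) (XX_bound x y i k j l) 3
  have d1 := decouple hn 3 x y 1 zero_le_one (fun i k j l => |XX x y i k j l| ^ 3) hH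
    (fun i j l => by simp [XX]) (fun i j l => by simp [XX]) (fun a => ((|a| : ℝ) : ℂ)) 1
    (fun a b => by
      rw [← Complex.ofReal_sub, Complex.norm_real, one_mul]
      exact abs_abs_sub_abs_le _ _)
  have d2 := decouple hn 3 x y 1 zero_le_one (fun i k j l => |XX x y i k j l| ^ 3) hH
    (fun i j l => by simp [XX]) (fun i j l => by simp [XX]) (fun a => (1 : ℂ)) 0
    (fun a b => by simp)
  set Z : ℝ := (∑ i, ∑ k, ∑ j, ∑ l, |XX x y i k j l| ^ 3) / (n * (n - 1)) with hZ
  have c1 : ∀ i k, EC (fun π => ((|XX x y i k (π i) (π k)| ^ 3 : ℝ) : ℂ) * ((|S x y π| : ℝ) : ℂ)) =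
      (permExp (fun π => |XX x y i k (π i) (π k)| ^ 3 * |S x y π|) : ℝ) := by
    intro i k; rw [← EC_ofReal]; congr 1; funext π; push_cast; rfl
  have c2 : ∀ i k, EC (fun π => ((|XX x y i k (π i) (π k)| ^ 3 : ℝ) : ℂ) * (1 : ℂ)) =
      (permExp (fun π => |XX x y i k (π i) (π k)| ^ 3) : ℝ) := by
    intro i k; rw [← EC_ofReal]; congr 1; funext π; push_cast; ring
  simp only [c1, EC_ofReal, ← Complex.ofReal_sum, ← Complex.ofReal_mul, ← Complex.ofReal_sub,
    Complex.norm_real, Real.norm_eq_abs] at d1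
  simp only [c2, EC_const, zero_mul] at d2
  have b := bound_two (by omega : 0 < n) 3 x y 1 zero_le_one (fun i k j l => |XX x y i k j l| ^ 3) hH
  simp only [abs_pow, abs_abs, one_mul] at b
  have d2' : ∑ i, ∑ k, permExp (fun π => |XX x y i k (π i) (π k)| ^ 3) = Z := by
    have := norm_le_zero_iff.1 d2
    rw [mul_one, sub_eq_zero] at this
    exact_mod_cast this
  rw [d2'] at b
  set Y := ∑ i, ∑ k, permExp (fun π => |XX x y i k (π i) (π k)| ^ 3 * |S x y π|) with hY
  have d1' : |Y - Z * permExp (fun π => |S x y π|)| ≤ 1 * 1 * (4 * KK (3 + 1) * n ^ 2 * (W (3 + 1) x * W (3 + 1) y)) := by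
    exact d1
  have hS := (E_abs (ES2 hn hx hy)).trans (by simpa using sqrt_2n hn (le_refl (1:ℝ)))
  have hZ0 : 0 ≤ Z := by
    rw [← d2']
    exact Finset.sum_nonneg fun i _ => Finset.sum_nonneg fun k _ => PE_nonneg fun π => by positivity
  have hb2 : KK 3 * n ^ 2 * (W 3 x * W 3 y) ≤ KK 4 * n ^ 2 * (W 4 x * W 4 y) := by
    have := w_mono (by norm_num : 3 ≤ 4) x y
    have h5 := KK_mono (by norm_num : 3 ≤ 4)
    have h6 := KK_one 4
    have h7 := w_one hn 3 x y
    gcongr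
  have h4 := (abs_le.1 d1').2
  have h5 : Z * permExp (fun π => |S x y π|) ≤ (KK 4 * n ^ 2 * (W 4 x * W 4 y)) * (2 * Real.sqrt n) :=
    mul_le_mul (b.trans hb2) hS (PE_nonneg fun π => abs_nonneg _) (by have := KK_one 4; positivity)
  have h6 : 1 ≤ Real.sqrt n := Real.one_le_sqrt.2 (by linarith)
  have h7 : 0 ≤ KK 4 * n ^ 2 * (W 4 x * W 4 y) := by have := KK_one 4; positivity
  rw [show 3 + 1 = 4 from rfl] at h4
  have h8 := mul_le_mul_of_nonneg_left h6 h7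
  clear_value Y Z
  clear d1 d2 d1' c1 c2 hH b d2' hS
  linarith

lemma swapXS (x y : Fin n → ℝ) (τ : ℝ) (i k : Fin n) :
    ‖EC (fun π => (FF x y i k (π i) (π k) : ℂ) * ((S x y π : ℂ) * ex τ x y π)) -
      (1 / 2 * EC (fun π => ((XX x y i k (π i) (π k) ^ 2 : ℝ) : ℂ) * ex τ x y π) +
       Complex.I * τ / 2 * EC (fun π => ((XX x y i k (π i) (π k) ^ 2 : ℝ) : ℂ) *
        ((S x y π : ℂ) * ex τ x y π)))‖ ≤
    τ ^ 2 / 2 * permExp (fun π => |XX x y i k (π i) (π k)| ^ 3 * |S x y π|) := by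
  have hX : ∀ π : Equiv.Perm (Fin n), XX x y i k (π k) (π i) = - XX x y i k (π i) (π k) := by
    intro π; unfold XX; ring
  have hF : ∀ a b c d, FF x y a b c d = XX x y a b c d := fun _ _ _ _ => rfl
  have hSw : ∀ π, S x y (π * Equiv.swap i k) = S x y π - XX x y i k (π i) (π k) := by
    intro π; rw [S_swap]; rfl
  have e1 := EC_comp (fun π => ((XX x y i k (π i) (π k) ^ 2 : ℝ) : ℂ) * ex τ x y π) (Equiv.swap i k)
  simp only [(swap_app _ i k).1, (swap_app _ i k).2, ex_swap, hX, neg_sq] at e1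
  rw [EC_half (fun π => (FF x y i k (π i) (π k) : ℂ) * ((S x y π : ℂ) * ex τ x y π)) i k, ← e1]
  simp only [(swap_app _ i k).1, (swap_app _ i k).2, ex_swap, hF, hX, hSw]
  rw [← EC_mul, ← EC_mul, ← EC_mul, ← EC_add, ← EC_sub, ← PE_mul]
  refine norm_EC_le' fun π => ?_
  have h := norm_one_sub_exp (τ * XX x y i k (π i) (π k))
  set X := XX x y i k (π i) (π k)
  set ee := Complex.exp (-(Complex.I * ((τ * X : ℝ) : ℂ))) with hee
  have : (1 / 2 * ((X : ℂ) * ((S x y π : ℂ) * ex τ x y π) +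
      ((-X : ℝ) : ℂ) * (((S x y π - X : ℝ) : ℂ) * (ee * ex τ x y π))) -
      (1 / 2 * (((X ^ 2 : ℝ) : ℂ) * (ee * ex τ x y π)) +
        Complex.I * τ / 2 * (((X ^ 2 : ℝ) : ℂ) * ((S x y π : ℂ) * ex τ x y π)))) =
      1 / 2 * (X : ℂ) * (S x y π : ℂ) * ex τ x y π * (1 - ee - Complex.I * ((τ * X : ℝ) : ℂ)) := by
    push_cast; ring
  rw [this]
  rw [norm_mul, norm_mul, norm_mul, norm_mul, norm_ex, Complex.norm_real, Complex.norm_real,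
    Real.norm_eq_abs, Real.norm_eq_abs]
  calc _ ≤ ‖(1/2 : ℂ)‖ * |X| * |S x y π| * 1 * |τ * X| ^ 2 := by gcongr
    _ = _ := by rw [abs_mul, mul_pow, sq_abs τ, show ‖(1/2 : ℂ)‖ = 1 / 2 by norm_num]; ring

end expand3
end RankEdge

namespace RankEdge
section expand4
variable {n : ℕ}

lemma norm_ph (τ : ℝ) (x y : Fin n → ℝ) : ‖ph τ x y‖ ≤ 1 := by
  unfold ph
  refine (norm_EC_le' (g := fun _ => 1) fun π => by rw [norm_ex]).trans (by rw [PE_const])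

lemma A0_bound (hn : 2 ≤ n) {x y : Fin n → ℝ} (hx : Nrm x) (hy : Nrm y) {τ q : ℝ} (hq1 : 1 ≤ q)
    (hq : |τ| * Real.sqrt n ≤ q) :
    ‖LE x y τ x y - Complex.I * τ * (n * ph τ x y)‖ ≤ (KK 4 + 3) * q ^ 2 * (W 4 x * W 4 y) := by
  obtain ⟨h2, h0, h1, h3⟩ := n_facts hn
  have hw := w_one hn 4 x y
  have hs : 0 < Real.sqrt n := Real.sqrt_pos.2 h0
  have hss : Real.sqrt n * Real.sqrt n = n := Real.mul_self_sqrt h0.le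
  have hs1 : 1 ≤ Real.sqrt n := Real.one_le_sqrt.2 (by linarith)
  have a := E1' hn hx hy τ 2 (Or.inl rfl)
  have b := norm_LE22 hn hx hy τ
  have c := norm_QQ hn hx hy τ
  have e : LE x y τ x y - Complex.I * τ * (n * ph τ x y) =
    (LE x y τ x y - (Complex.I * τ * (n * ph τ x y + 1 / 2 * LE (f2 x) (f2 y) τ x y +
      1 / n * QQ τ x y))) + Complex.I * τ * (1 / 2 * LE (f2 x) (f2 y) τ x y) +
      Complex.I * τ * (1 / n * QQ τ x y) := by ring
  rw [e]
  refine (norm_add₃_le).trans ?_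
  have n1 : ‖Complex.I * τ * (1 / 2 * LE (f2 x) (f2 y) τ x y)‖ ≤ q * (W 4 x * W 4 y) := by
    rw [norm_mul, norm_mul, norm_mul, Complex.norm_I, Complex.norm_real, Real.norm_eq_abs,
      show ‖(1/2 : ℂ)‖ = 1 / 2 by norm_num]
    calc _ ≤ 1 * |τ| * (1 / 2 * (2 * Real.sqrt n * (W 4 x * W 4 y))) := by gcongr
      _ = (|τ| * Real.sqrt n) * (W 4 x * W 4 y) := by ring
      _ ≤ _ := by gcongr
  have n2 : ‖Complex.I * τ * (1 / n * QQ τ x y)‖ ≤ 2 * q := by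
    rw [norm_mul, norm_mul, norm_mul, Complex.norm_I, Complex.norm_real, Real.norm_eq_abs,
      norm_div, norm_one, Complex.norm_natCast]
    calc _ ≤ 1 * |τ| * (1 / n * (2 * n)) := by gcongr
      _ = 2 * (|τ| * 1) := by field_simp
      _ ≤ 2 * (|τ| * Real.sqrt n) := by gcongr
      _ ≤ _ := by gcongr
  have n0 : |τ| ^ 2 * (KK (1 + 2) * n * (W (1 + 2) x * W (1 + 2) y)) ≤ KK 4 * q ^ 2 * (W 4 x * W 4 y) := by
    have k3 := KK_mono (by norm_num : 3 ≤ 4)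
    have k0 := KK_one 3
    have k4 := KK_one 4
    have w3 := w_mono (by norm_num : 3 ≤ 4) x y
    have w30 := w_one hn 3 x y
    calc _ = KK 3 * (|τ| * Real.sqrt n) ^ 2 * (W 3 x * W 3 y) := by
          rw [mul_pow, sq (Real.sqrt n), hss]; ring
      _ ≤ _ := by gcongr
  have q2 : q ≤ q ^ 2 := by nlinarith
  have q3 : q * 1 ≤ q ^ 2 * (W 4 x * W 4 y) := by gcongr
  have q4 : q * (W 4 x * W 4 y) ≤ q ^ 2 * (W 4 x * W 4 y) := by gcongr
  linarith

lemma EC_S_Q (hn : 2 ≤ n) {x y : Fin n → ℝ} (hx : Nrm x) (hy : Nrm y) (τ : ℝ) :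
    ‖QQ τ x y - (n * ph τ x y + 1 / 2 * LE (f2 x) (f2 y) τ x y + 1 / n * QQ τ x y +
      Complex.I * τ * (n * LE x y τ x y +
        1 / 2 * EC (fun π => (S (f2 x) (f2 y) π : ℂ) * ((S x y π : ℂ) * ex τ x y π)) +
        1 / n * EC (fun π => ((S x y π ^ 2 : ℝ) : ℂ) * ((S x y π : ℂ) * ex τ x y π))))‖ ≤
      τ ^ 2 * n * (2 * KK 4 * (W 4 x * W 4 y) * Real.sqrt n) := by
  obtain ⟨h2, h0, h1, h3⟩ := n_facts hn
  have hn' := dn hn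
  have e := EC_S hn x y hx.s1 (fun π => (S x y π : ℂ) * ex τ x y π)
  have eQ : QQ τ x y = EC (fun π => (S x y π : ℂ) * ((S x y π : ℂ) * ex τ x y π)) := by
    unfold QQ; congr 1; funext π; push_cast; ring
  have s := norm_dsum (fun i k => swapXS x y τ i k)
  simp only [Finset.sum_add_distrib, ← Finset.mul_sum] at s
  rw [X2sum hx hy, X2sum hx hy] at s
  have s2 := s.trans (mul_le_mul_of_nonneg_left (X3S hn hx hy) (by positivity))
  have e2 : QQ τ x y - (n * ph τ x y + 1 / 2 * LE (f2 x) (f2 y) τ x y + 1 / n * QQ τ x y +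
      Complex.I * τ * (n * LE x y τ x y +
        1 / 2 * EC (fun π => (S (f2 x) (f2 y) π : ℂ) * ((S x y π : ℂ) * ex τ x y π)) +
        1 / n * EC (fun π => ((S x y π ^ 2 : ℝ) : ℂ) * ((S x y π : ℂ) * ex τ x y π)))) =
      1 / (2 * n) * (∑ i, ∑ k, EC (fun π => (FF x y i k (π i) (π k) : ℂ) * ((S x y π : ℂ) * ex τ x y π)) -
      (1 / 2 * (4 * n ^ 2 * EC (ex τ x y) + 2 * n * EC (fun π => (S (f2 x) (f2 y) π : ℂ) * ex τ x y π) +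
      4 * EC (fun π => ((S x y π ^ 2 : ℝ) : ℂ) * ex τ x y π)) +
       Complex.I * τ / 2 * (4 * n ^ 2 * EC (fun π => (S x y π : ℂ) * ex τ x y π) +
        2 * n * EC (fun π => (S (f2 x) (f2 y) π : ℂ) * ((S x y π : ℂ) * ex τ x y π)) +
      4 * EC (fun π => ((S x y π ^ 2 : ℝ) : ℂ) * ((S x y π : ℂ) * ex τ x y π))))) := by
    rw [mul_sub, ← e, ← eQ]
    unfold ph LE QQ
    field_simp; ring
  rw [e2, norm_mul, norm_half_n hn]
  refine (mul_le_mul_of_nonneg_left s2 (by positivity)).trans (le_of_eq ?_)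
  field_simp; ring

lemma Q_bound (hn : 2 ≤ n) {x y : Fin n → ℝ} (hx : Nrm x) (hy : Nrm y) {τ q : ℝ} (hq1 : 1 ≤ q)
    (hq : |τ| * Real.sqrt n ≤ q) :
    ‖QQ τ x y - (n - τ ^ 2 * n ^ 2) * ph τ x y‖ ≤
      (3 * KK 4 + 10) * q ^ 3 * Real.sqrt n * (W 4 x * W 4 y) := by
  obtain ⟨h2, h0, h1, h3⟩ := n_facts hn
  have hn' := dn hn
  have hw := w_one hn 4 x y
  have hs : 0 < Real.sqrt n := Real.sqrt_pos.2 h0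
  have hss : Real.sqrt n * Real.sqrt n = n := Real.mul_self_sqrt h0.le
  have hs1 : 1 ≤ Real.sqrt n := Real.one_le_sqrt.2 (by linarith)
  have hτ : |τ| * n ≤ q * Real.sqrt n := by
    calc |τ| * n = (|τ| * Real.sqrt n) * Real.sqrt n := by rw [mul_assoc, hss]
      _ ≤ _ := by gcongr
  have a := EC_S_Q hn hx hy τ
  have b := norm_LE22 hn hx hy τ
  have c := norm_QQ hn hx hy τ
  have d := A0_bound hn hx hy hq1 hq
  have f := norm_L22S hn hx hy τ
  have g := norm_S3 hn hx hy τ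
  set Z1 := EC (fun π => (S (f2 x) (f2 y) π : ℂ) * ((S x y π : ℂ) * ex τ x y π))
  set Z2 := EC (fun π => ((S x y π ^ 2 : ℝ) : ℂ) * ((S x y π : ℂ) * ex τ x y π))
  set R := QQ τ x y - (n * ph τ x y + 1 / 2 * LE (f2 x) (f2 y) τ x y + 1 / n * QQ τ x y +
      Complex.I * τ * (n * LE x y τ x y + 1 / 2 * Z1 + 1 / n * Z2)) with hR
  have e : QQ τ x y - (n - τ ^ 2 * n ^ 2) * ph τ x y = R + 1 / 2 * LE (f2 x) (f2 y) τ x y +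
      1 / n * QQ τ x y + Complex.I * τ * n * (LE x y τ x y - Complex.I * τ * (n * ph τ x y)) +
      Complex.I * τ * (1 / 2 * Z1) + Complex.I * τ * (1 / n * Z2) := by
    rw [hR]; ring_nf; rw [Complex.I_sq]; ring
  rw [e]
  clear_value R Z1 Z2
  have n0 : ‖(1 / 2 : ℂ)‖ = 1 / 2 := by norm_num
  have b' : ‖1 / 2 * LE (f2 x) (f2 y) τ x y‖ ≤ Real.sqrt n * (W 4 x * W 4 y) := by
    rw [norm_mul, n0]; linarith
  have c' : ‖1 / n * QQ τ x y‖ ≤ 2 := by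
    rw [norm_mul, norm_div, norm_one, Complex.norm_natCast]
    calc _ ≤ 1 / (n : ℝ) * (2 * n) := by gcongr
      _ = 2 := by field_simp
  have d' : ‖Complex.I * τ * n * (LE x y τ x y - Complex.I * τ * (n * ph τ x y))‖ ≤
      (q * Real.sqrt n) * ((KK 4 + 3) * q ^ 2 * (W 4 x * W 4 y)) := by
    rw [norm_mul, norm_mul, norm_mul, Complex.norm_I, Complex.norm_real, Real.norm_eq_abs,
      Complex.norm_natCast, one_mul]
    gcongr
  have f' : ‖Complex.I * τ * (1 / 2 * Z1)‖ ≤ (q * Real.sqrt n) * (W 4 x * W 4 y) := by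
    rw [norm_mul, norm_mul, norm_mul, Complex.norm_I, Complex.norm_real, Real.norm_eq_abs, n0, one_mul]
    calc _ ≤ |τ| * (1 / 2 * (2 * n * (W 4 x * W 4 y))) := by gcongr
      _ = (|τ| * n) * (W 4 x * W 4 y) := by ring
      _ ≤ _ := by gcongr
  have g' : ‖Complex.I * τ * (1 / n * Z2)‖ ≤ 2 * (q * Real.sqrt n) := by
    rw [norm_mul, norm_mul, norm_mul, Complex.norm_I, Complex.norm_real, Real.norm_eq_abs,
      norm_div, norm_one, Complex.norm_natCast, one_mul]
    calc _ ≤ |τ| * (1 / n * (n * (2 * n))) := by gcongr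
      _ = 2 * (|τ| * n) := by field_simp
      _ ≤ _ := by gcongr
  have a' : τ ^ 2 * n * (2 * KK 4 * (W 4 x * W 4 y) * Real.sqrt n) ≤
      q ^ 2 * (2 * KK 4 * (W 4 x * W 4 y) * Real.sqrt n) := by
    have := KK_one 4
    have : τ ^ 2 * n = (|τ| * Real.sqrt n) ^ 2 := by rw [mul_pow, sq_abs, sq (Real.sqrt n), hss]
    rw [this]; gcongr
  have t := norm_add₃_le (a := R + 1 / 2 * LE (f2 x) (f2 y) τ x y + 1 / n * QQ τ x y +
    Complex.I * τ * n * (LE x y τ x y - Complex.I * τ * (n * ph τ x y)))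
    (b := Complex.I * τ * (1 / 2 * Z1)) (c := Complex.I * τ * (1 / n * Z2))
  have t2 := norm_add_le (R + 1 / 2 * LE (f2 x) (f2 y) τ x y + 1 / n * QQ τ x y)
    (Complex.I * τ * n * (LE x y τ x y - Complex.I * τ * (n * ph τ x y)))
  have t3 := norm_add₃_le (a := R) (b := 1 / 2 * LE (f2 x) (f2 y) τ x y) (c := 1 / n * QQ τ x y)
  have k4 := KK_one 4
  set w := W 4 x * W 4 y
  set sn := Real.sqrt n
  have q3 : 1 ≤ q ^ 3 := one_le_pow₀ hq1
  have q23 : q ^ 2 ≤ q ^ 3 := pow_le_pow_right₀ hq1 (by norm_num)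
  have q13 : q ≤ q ^ 3 := by simpa using pow_le_pow_right₀ hq1 (by norm_num : 1 ≤ 3)
  have m1 : sn * w ≤ q ^ 3 * sn * w := by
    have : 0 ≤ sn * w := by positivity
    nlinarith
  have m2 : (1:ℝ) ≤ q ^ 3 * sn * w := by
    have : 1 ≤ sn * w := by nlinarith
    nlinarith
  have m3 : q * sn * w ≤ q ^ 3 * sn * w := by gcongr
  have m4 : q * sn * 1 ≤ q ^ 3 * sn * w := by gcongr
  have m5 : q ^ 2 * (2 * KK 4 * w * sn) ≤ q ^ 3 * (2 * KK 4 * w * sn) := by gcongr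
  linarith [a.trans a']

end expand4
end RankEdge

namespace RankEdge
section expand5
variable {n : ℕ}

/-- scaling constant -/
noncomputable def cn (n : ℕ) : ℝ := Real.sqrt (n - 1) / n

/-- third cumulant -/
noncomputable def l1 (x y : Fin n → ℝ) : ℝ := n * cn n ^ 3 * (mm 3 x * mm 3 y)

/-- fourth cumulant -/
noncomputable def l2 (x y : Fin n → ℝ) : ℝ :=
  n * cn n ^ 4 * (mm 4 x * mm 4 y - 3 * mm 4 x - 3 * mm 4 y) + 3 / n

lemma cn_facts (hn : 2 ≤ n) : 0 < cn n ∧ cn n ^ 2 = (n - 1) / n ^ 2 ∧ cn n ≤ 1 / Real.sqrt n ∧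
    (n : ℝ) * (1 / Real.sqrt n) ^ 2 = 1 ∧ 0 < 1 / Real.sqrt n ∧ 1 / Real.sqrt n ≤ 1 := by
  obtain ⟨h2, h0, h1, h3⟩ := n_facts hn
  have hs : 0 < Real.sqrt n := Real.sqrt_pos.2 h0
  have hss : Real.sqrt n ^ 2 = n := Real.sq_sqrt h0.le
  have hs1 : 1 ≤ Real.sqrt n := Real.one_le_sqrt.2 (by linarith)
  have a : 0 < cn n := div_pos (Real.sqrt_pos.2 h3) h0
  have b : cn n ^ 2 = (n - 1) / n ^ 2 := by unfold cn; rw [div_pow, Real.sq_sqrt h3.le]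
  refine ⟨a, b, ?_, ?_, by positivity, ?_⟩
  · apply le_of_sq_le_sq _ (by positivity)
    rw [b, div_pow, hss, div_le_div_iff₀ (by positivity) h0]
    nlinarith
  · rw [div_pow, hss]; field_simp
  · rw [div_le_one hs]; exact hs1
  
lemma abs_mm_le (hn : 2 ≤ n) {p q : ℕ} (h : p ≤ q) (x : Fin n → ℝ) : |mm p x| ≤ W q x := by
  obtain ⟨h2, h0, h1, h3⟩ := n_facts hn
  refine le_trans ?_ (W_mono h x)
  unfold mm W
  rw [abs_div, abs_of_pos h0]
  refine div_le_div_of_nonneg_right ((Finset.abs_sum_le_sum_abs _ _).trans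
    (Finset.sum_le_sum fun i _ => ?_)) h0.le
  rw [abs_pow]
  exact pow_le_pow_left₀ (abs_nonneg _) (abs_le_mj x i) p

/-- the characteristic function of the standardised statistic -/
noncomputable def cf (x y : Fin n → ℝ) (t : ℝ) : ℂ := ph (t * cn n) x y

lemma cf_deriv (x y : Fin n → ℝ) (t : ℝ) :
    HasDerivAt (cf x y) (Complex.I * cn n * LE x y (t * cn n) x y) t := by
  unfold cf ph LE EC
  rw [← mul_div_assoc]
  apply HasDerivAt.div_const
  rw [Finset.mul_sum]
  apply HasDerivAt.fun_sum
  intro π _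
  unfold ex
  have h : HasDerivAt (fun s : ℝ => Complex.I * ((s * cn n * S x y π : ℝ) : ℂ))
      (Complex.I * ((cn n * S x y π : ℝ) : ℂ)) t := by
    apply HasDerivAt.const_mul
    apply HasDerivAt.ofReal_comp
    have := ((hasDerivAt_id' t).mul_const (cn n)).mul_const (S x y π)
    simpa using this
  refine h.cexp.congr_deriv ?_
  push_cast; ring

lemma nI (a : ℝ) (R : ℂ) {B : ℝ} (h : ‖R‖ ≤ B) : ‖Complex.I * a * R‖ ≤ |a| * B := by
  rw [norm_mul, norm_mul, Complex.norm_I, Complex.norm_real, one_mul, Real.norm_eq_abs]; gcongr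

lemma nR (a : ℝ) (R : ℂ) {B : ℝ} (h : ‖R‖ ≤ B) : ‖(a : ℂ) * R‖ ≤ |a| * B := by
  rw [norm_mul, Complex.norm_real, Real.norm_eq_abs]; gcongr

set_option maxHeartbeats 1000000 in
lemma ode1 (hn : 2 ≤ n) {x y : Fin n → ℝ} (hx : Nrm x) (hy : Nrm y) (t : ℝ) :
    ‖Complex.I * cn n * LE x y (t * cn n) x y - (-t - Complex.I * l1 x y * t ^ 2 / 2) * cf x y t‖ ≤
      (2 * KK 4 + 4) * (1 + |t|) ^ 3 * (W 4 x * W 4 y / n) := by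
  obtain ⟨h2, h0, h1, h3⟩ := n_facts hn
  obtain ⟨c0, c2, cr, nr, r0, r1⟩ := cn_facts hn
  have hn' := dn hn
  have hw := w_one hn 4 x y
  set r := 1 / Real.sqrt n
  set c := cn n with hc
  have hph := norm_ph (t * c) x y
  have a := E1' hn hx hy (t * c) 3 (Or.inr rfl)
  have b := E2' hn hx hy (t * c)
  have d := norm_QQ hn hx hy (t * c)
  have m3 : |mm 3 x * mm 3 y| ≤ W 4 x * W 4 y := by
    rw [abs_mul]
    exact mul_le_mul (abs_mm_le hn (by norm_num) x) (abs_mm_le hn (by norm_num) y) (abs_nonneg _)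
      (W_nonneg _ _)
  set L := LE x y (t * c) x y
  set L2 := LE (f2 x) (f2 y) (t * c) x y
  set Q := QQ (t * c) x y
  have hcf : cf x y t = ph (t * c) x y := rfl
  rw [hcf]
  set φ := ph (t * c) x y
  have hl : l1 x y = n * c ^ 3 * (mm 3 x * mm 3 y) := rfl
  set M := mm 3 x * mm 3 y
  set w := W 4 x * W 4 y
  have hnw : 0 ≤ w / n := by positivity
  set s1 : ℝ := t - c * (t * c) * n with hs1
  set s2 : ℝ := l1 x y * t ^ 2 / 2 - c * (t * c) ^ 2 * (n ^ 2 * M / (n - 1)) / 2 with hs2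
  set R1 : ℂ := L - (Complex.I * (t * c : ℝ) * (n * φ + 1 / 2 * L2 + 1 / n * Q)) with hR1
  set R2 : ℂ := L2 - Complex.I * (t * c : ℝ) * (((n : ℝ) ^ 2 * M / (n - 1) : ℝ) * φ) with hR2
  have key : Complex.I * c * L - (-t - Complex.I * l1 x y * t ^ 2 / 2) * φ =
      Complex.I * c * R1 + ((-(c * (t * c)) / 2 : ℝ) : ℂ) * R2 + ((-(c * (t * c)) / n : ℝ) : ℂ) * Q +
      (s1 : ℂ) * φ + Complex.I * s2 * φ := by
    rw [hR1, hR2, hs1, hs2]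
    push_cast
    have hI := Complex.I_sq
    linear_combination ((c:ℂ) * (t * c) * (n * φ + 1 / 2 * L2 + 1 / n * Q)) * hI
  have cc : c ^ 2 ≤ 1 / n := by
    have : c ^ 2 ≤ r ^ 2 := pow_le_pow_left₀ c0.le cr 2
    rw [le_div_iff₀ h0]; nlinarith
  have c1 : c ≤ 1 := cr.trans r1
  have c4 : c ^ 4 * n ≤ 1 / n := by
    calc c ^ 4 * (n:ℝ) = c ^ 2 * c ^ 2 * (n:ℝ) := by ring
      _ ≤ (1 / (n:ℝ)) * (1 / (n:ℝ)) * n := by gcongr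
      _ = 1 / n := by field_simp
  have b1 := nI c R1 a
  have b2 := nR (-(c * (t * c)) / 2) R2 b
  have b3 := nR (-(c * (t * c)) / n) Q d
  have b4 := nR s1 φ hph
  have b5 := nI s2 φ hph
  have k4 := KK_one 4
  have t0 := abs_nonneg t
  have e1 : |c| * (|t * c| ^ 3 * (KK (1 + 3) * n * (W (1 + 3) x * W (1 + 3) y))) ≤
      |t| ^ 3 * KK 4 * (w / n) := by
    rw [abs_mul, abs_of_pos c0]
    calc _ = |t| ^ 3 * KK 4 * ((c ^ 4 * n) * w) := by ring
      _ ≤ |t| ^ 3 * KK 4 * ((1 / n) * w) := by gcongr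
      _ = _ := by ring
  have e2 : |(-(c * (t * c)) / 2)| * (|t * c| ^ 2 * (2 * KK 4 * n * w)) ≤ |t| ^ 3 * KK 4 * (w / n) := by
    rw [abs_div, abs_neg, abs_mul, abs_mul, abs_of_pos c0, abs_of_pos (by norm_num : (0:ℝ) < 2)]
    calc _ = |t| ^ 3 * KK 4 * ((c ^ 4 * n) * w) := by ring
      _ ≤ |t| ^ 3 * KK 4 * ((1 / n) * w) := by gcongr
      _ = _ := by ring
  have e3 : |(-(c * (t * c)) / n)| * (2 * n) ≤ 2 * |t| * (w / n) := by
    rw [abs_div, abs_neg, abs_mul, abs_mul, abs_of_pos c0, abs_of_pos h0]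
    calc _ = 2 * |t| * (c ^ 2 * 1) := by field_simp
      _ ≤ 2 * |t| * ((1 / n) * w) := by gcongr
      _ = _ := by ring
  have e4 : |s1| ≤ |t| * (w / n) := by
    have : s1 = t * (1 / n) := by
      rw [hs1, show c * (t * c) * n = t * (c ^ 2 * n) by ring, c2]; field_simp; ring
    rw [this, abs_mul, abs_of_pos (by positivity : (0:ℝ) < 1 / n)]
    gcongr
  have e5 : |s2| ≤ |t| ^ 2 * (w / n) := by
    have : s2 = - (t ^ 2 * c ^ 3 * M * (n / (2 * (n - 1)))) := by
      rw [hs2, hl]; field_simp; ring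
    rw [this, abs_neg, abs_mul, abs_mul, abs_mul, abs_of_pos (by positivity : (0:ℝ) < n / (2 * (n - 1))),
      abs_pow, abs_pow, abs_of_pos c0]
    have h5 : (n : ℝ) / (2 * (n - 1)) ≤ 1 := by
      rw [div_le_one (by positivity)]; linarith
    calc _ ≤ |t| ^ 2 * c ^ 3 * w * 1 := by gcongr
      _ = |t| ^ 2 * (c ^ 2 * c * w) := by ring
      _ ≤ |t| ^ 2 * ((1 / n) * 1 * w) := by gcongr
      _ = _ := by ring
  rw [key]
  have T1 := norm_add₃_le (a := Complex.I * c * R1 + ((-(c * (t * c)) / 2 : ℝ) : ℂ) * R2 +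
    ((-(c * (t * c)) / n : ℝ) : ℂ) * Q) (b := (s1 : ℂ) * φ) (c := Complex.I * s2 * φ)
  have T2 := norm_add₃_le (a := Complex.I * c * R1) (b := ((-(c * (t * c)) / 2 : ℝ) : ℂ) * R2)
    (c := ((-(c * (t * c)) / n : ℝ) : ℂ) * Q)
  have F : ‖Complex.I * c * R1 + ((-(c * (t * c)) / 2 : ℝ) : ℂ) * R2 + ((-(c * (t * c)) / n : ℝ) : ℂ) * Q +
      (s1 : ℂ) * φ + Complex.I * s2 * φ‖ ≤
      (2 * KK 4 * |t| ^ 3 + 3 * |t| + |t| ^ 2) * (w / n) := by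
    linarith
  refine F.trans (mul_le_mul_of_nonneg_right ?_ hnw)
  have p2 := pow_nonneg t0 2
  have p3 := pow_nonneg t0 3
  have p4 := mul_nonneg (by linarith : 0 ≤ KK 4) t0
  have p5 := mul_nonneg (by linarith : 0 ≤ KK 4) p2
  have : (2 * KK 4 + 4) * (1 + |t|) ^ 3 = 2 * KK 4 + 6 * (KK 4 * |t|) + 6 * (KK 4 * |t| ^ 2) +
    2 * KK 4 * |t| ^ 3 + 4 + 12 * |t| + 12 * |t| ^ 2 + 4 * |t| ^ 3 := by ring
  rw [this]
  linarith

end expand5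
end RankEdge

namespace RankEdge
section expand6
variable {n : ℕ}

set_option maxHeartbeats 2000000 in
lemma ode2 (hn : 2 ≤ n) {x y : Fin n → ℝ} (hx : Nrm x) (hy : Nrm y) (t : ℝ) :
    ‖Complex.I * cn n * LE x y (t * cn n) x y -
      (-t - Complex.I * l1 x y * t ^ 2 / 2 + l2 x y * t ^ 3 / 6) * cf x y t‖ ≤
      (6 * KK 5 + 20) * (1 + |t|) ^ 4 * (W 5 x * W 5 y * (1 / Real.sqrt n) ^ 3) := by
  obtain ⟨h2, h0, h1, h3⟩ := n_facts hn
  obtain ⟨c0, c2, cr, nr, r0, r1⟩ := cn_facts hn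
  have hn' := dn hn
  have t0 := abs_nonneg t
  have hw := w_one hn 4 x y
  have hw5 := w_one hn 5 x y
  have hw45 := w_mono (by norm_num : 4 ≤ 5) x y
  have m4x : 0 ≤ mm 4 x := div_nonneg (Finset.sum_nonneg fun i _ => by positivity) h0.le
  have m4y : 0 ≤ mm 4 y := div_nonneg (Finset.sum_nonneg fun i _ => by positivity) h0.le
  have m4x' : mm 4 x ≤ W 4 x := (le_abs_self _).trans (abs_mm_le hn le_rfl x)
  have m4y' : mm 4 y ≤ W 4 y := (le_abs_self _).trans (abs_mm_le hn le_rfl y)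
  have wx1 := W_one (by omega : 0 < n) 4 x
  have wy1 := W_one (by omega : 0 < n) 4 y
  have P1 : mm 4 x * mm 4 y ≤ W 4 x * W 4 y := mul_le_mul m4x' m4y' m4y (by linarith)
  have P2 : mm 4 x ≤ W 4 x * W 4 y := m4x'.trans (le_mul_of_one_le_right (by linarith) wy1)
  have P3 : mm 4 y ≤ W 4 x * W 4 y := m4y'.trans (le_mul_of_one_le_left (by linarith) wx1)
  have rs : Real.sqrt n = n * (1 / Real.sqrt n) := by
    have hs : 0 < Real.sqrt n := Real.sqrt_pos.2 h0
    have hss : Real.sqrt n * Real.sqrt n = n := Real.mul_self_sqrt h0.le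
    field_simp; nlinarith
  have hq : |t * cn n| * Real.sqrt n ≤ 1 + |t| := by
    rw [abs_mul, abs_of_pos c0, rs]
    have : cn n * (n * (1 / Real.sqrt n)) ≤ 1 := by
      calc _ ≤ (1 / Real.sqrt n) * (n * (1 / Real.sqrt n)) := by gcongr
        _ = n * (1 / Real.sqrt n) ^ 2 := by ring
        _ = 1 := nr
    nlinarith
  have hq1 : 1 ≤ 1 + |t| := by linarith
  have a := E1 hn hx hy (t * cn n)
  have b := E2 hn hx hy (t * cn n)
  have d := E3 hn hx hy (t * cn n)
  have f := E4 hn hx hy (t * cn n)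
  have g := norm_LL hn hx hy (t * cn n)
  have j := Q_bound hn hx hy hq1 hq
  rw [rs] at j
  have hl1 : l1 x y = n * cn n ^ 3 * (mm 3 x * mm 3 y) := rfl
  have hl2 : l2 x y = n * cn n ^ 4 * (mm 4 x * mm 4 y - 3 * mm 4 x - 3 * mm 4 y) + 3 / n := rfl
  have hcf : cf x y t = ph (t * cn n) x y := rfl
  rw [hcf]
  generalize LE x y (t * cn n) x y = L at *
  generalize LE (f2 x) (f2 y) (t * cn n) x y = L2 at *
  generalize LE (f3 x) (f3 y) (t * cn n) x y = L3 at *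
  generalize QQ (t * cn n) x y = Q at *
  have hph := norm_ph (t * cn n) x y
  generalize ph (t * cn n) x y = φ at *
  generalize EC (fun π => ((S (f2 x) (f2 y) π * S x y π + S (f2 x) y π * S x (f2 y) π : ℝ) : ℂ)
        * ex (t * cn n) x y π) = LL at *
  generalize ∑ i, ∑ k, EC (fun π => ((XX x y i k (π i) (π k) ^ 4 : ℝ) : ℂ) * ex (t * cn n) x y π) = X4 at *
  generalize W 4 x * W 4 y = w at *
  generalize W 5 x * W 5 y = w5 at *
  generalize l1 x y = g1 at *
  generalize l2 x y = g2 at *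
  generalize 1 / Real.sqrt n = r at *
  generalize cn n = c at *
  generalize mm 3 x * mm 3 y = M at *
  generalize mm 4 x = u at *
  generalize mm 4 y = v at *
  have k5 := KK_one 5
  have k4 := KK_one 4
  have k45 := KK_mono (by norm_num : 4 ≤ 5)
  generalize KK 5 = K5 at *
  generalize KK 4 = K4 at *
  clear rs hx hy
  set κ3 : ℝ := (n:ℝ) ^ 2 * ((u - 1) * (v - 1)) / (n - 1) with hκ3
  set κ4 : ℝ := 4 * (n:ℝ) ^ 3 * ((u + 3) * (v + 3)) / (n - 1) with hκ4
  set s1 : ℝ := t - c * (t * c) * (n + 1) with hs1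
  set s2 : ℝ := c * (t * c) ^ 3 * n + c * (t * c) ^ 3 * κ3 / 4 - c * (t * c) ^ 3 * κ4 / (48 * n)
    - g2 * t ^ 3 / 6 with hs2
  set R1 : ℂ := L - (Complex.I * (t * c : ℝ) * (n * φ + 1 / 2 * L2 + 1 / n * Q) +
    Complex.I * (t * c : ℝ) ^ 3 / (48 * n) * X4) with hR1
  set R2 : ℂ := L2 - Complex.I * (t * c : ℝ) * (n * M * φ + 1 / 2 * L3 + 1 / (2 * n) * LL) with hR2
  set R3 : ℂ := L3 - Complex.I * (t * c : ℝ) * (κ3 * φ) with hR3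
  set R4 : ℂ := Q - (n - (t * c : ℝ) ^ 2 * n ^ 2) * φ with hR4
  set R5 : ℂ := X4 - κ4 * φ with hR5
  have key : Complex.I * c * L - (-t - Complex.I * g1 * t ^ 2 / 2 + g2 * t ^ 3 / 6) * φ =
      Complex.I * c * R1 + ((-(c * (t * c)) / 2 : ℝ) : ℂ) * R2 +
      Complex.I * (-(c * (t * c) ^ 2) / 4 : ℝ) * R3 +
      Complex.I * (-(c * (t * c) ^ 2) / (4 * n) : ℝ) * LL + ((-(c * (t * c)) / n : ℝ) : ℂ) * R4
      + ((-(c * (t * c) ^ 3) / (48 * n) : ℝ) : ℂ) * R5 + ((s1 + s2 : ℝ) : ℂ) * φ := by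
    rw [hR1, hR2, hR3, hR4, hR5, hs1, hs2, hl1]
    have hI := Complex.I_sq
    push_cast
    have nn : (n:ℂ)⁻¹ * n = 1 := inv_mul_cancel₀ hn'
    ring_nf
    simp only [hI]
    ring_nf
    linear_combination (-(c:ℂ)^2*t*φ + c^4*t^3*φ*n) * nn
  have b1 := nI c R1 a
  have b2 := nR (-(c * (t * c)) / 2) R2 b
  have b3 := nI (-(c * (t * c) ^ 2) / 4) R3 d
  have b4 := nI (-(c * (t * c) ^ 2) / (4 * n)) LL g
  have b5 := nR (-(c * (t * c)) / n) R4 j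
  have b6 := nR (-(c * (t * c) ^ 3) / (48 * n)) R5 f
  have b7 := nR (s1 + s2) φ hph
  rw [key]
  clear_value R1 R2 R3 R4 R5
  clear a b d f g j key hph hR1 hR2 hR3 hR4 hR5
  have w0 : 0 ≤ w5 := by linarith
  have r4 : r ^ 4 ≤ r ^ 3 := pow_le_pow_of_le_one r0.le r1 (by norm_num)
  have c3r : c ^ 3 ≤ r ^ 3 := pow_le_pow_left₀ c0.le cr 3
  have c5r : c ^ 5 ≤ r ^ 5 := pow_le_pow_left₀ c0.le cr 5
  have c2r : c ^ 2 ≤ r ^ 2 := pow_le_pow_left₀ c0.le cr 2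
  have c5n : c ^ 5 * n ≤ r ^ 3 := by
    calc c ^ 5 * (n:ℝ) ≤ r ^ 5 * n := by gcongr
      _ = r ^ 3 * (n * r ^ 2) := by ring
      _ = _ := by rw [nr, mul_one]
  have hr4n : r ^ 4 = 1 / (n:ℝ) ^ 2 := by
    rw [eq_div_iff (by positivity)]
    calc r ^ 4 * (n:ℝ) ^ 2 = (n * r ^ 2) ^ 2 := by ring
      _ = 1 := by rw [nr]; norm_num
  set q := 1 + |t| with hqd
  have tq : |t| ≤ q := by linarith
  have q4 : 1 ≤ q ^ 4 := one_le_pow₀ hq1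
  have t4 : |t| ^ 4 ≤ q ^ 4 := pow_le_pow_left₀ t0 tq 4
  have t2 : |t| ^ 2 ≤ q ^ 4 := (pow_le_pow_left₀ t0 tq 2).trans (pow_le_pow_right₀ hq1 (by norm_num))
  have t3 : |t| ^ 3 ≤ q ^ 4 := (pow_le_pow_left₀ t0 tq 3).trans (pow_le_pow_right₀ hq1 (by norm_num))
  have t1 : |t| ≤ q ^ 4 := tq.trans (le_self_pow₀ hq1 (by norm_num))
  have B0 : 0 ≤ w5 * r ^ 3 := by positivity
  have main5 : |t| ^ 4 * (K5 * w5 * (c ^ 5 * n)) ≤ q ^ 4 * (K5 * w5 * r ^ 3) := by gcongr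
  have e1 : |c| * (|t * c| ^ 4 * (K5 * n * w5)) ≤ K5 * (q ^ 4 * (w5 * r ^ 3)) := by
    rw [abs_mul, abs_of_pos c0]; linarith
  have e2 : |-(c * (t * c)) / 2| * (|t * c| ^ 3 * (K5 * n * w5)) ≤ K5 * (q ^ 4 * (w5 * r ^ 3)) / 2 := by
    rw [abs_div, abs_neg, abs_mul, abs_mul, abs_of_pos c0, abs_of_pos (by norm_num : (0:ℝ) < 2)]
    linarith
  have e3 : |-(c * (t * c) ^ 2) / 4| * (|t * c| ^ 2 * (2 * K5 * n * w5)) ≤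
      K5 * (q ^ 4 * (w5 * r ^ 3)) / 2 := by
    rw [abs_div, abs_neg, abs_mul, abs_pow, abs_mul, abs_of_pos c0, abs_of_pos (by norm_num : (0:ℝ) < 4)]
    linarith
  have e4 : |-(c * (t * c) ^ 2) / (4 * n)| * (4 * n * w) ≤ q ^ 4 * (w5 * r ^ 3) := by
    rw [abs_div, abs_neg, abs_mul, abs_pow, abs_mul, abs_of_pos c0,
      abs_of_pos (by positivity : (0:ℝ) < 4 * n)]
    calc _ = |t| ^ 2 * (w * c ^ 3) := by field_simp
      _ ≤ q ^ 4 * (w5 * r ^ 3) := by gcongr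
  have e5 : |-(c * (t * c)) / n| * ((3 * K4 + 10) * q ^ 3 * (n * r) * w) ≤
      (3 * K5 + 10) * (q ^ 4 * (w5 * r ^ 3)) := by
    rw [abs_div, abs_neg, abs_mul, abs_mul, abs_of_pos c0, abs_of_pos h0]
    calc _ = (3 * K4 + 10) * ((|t| * q ^ 3) * (w * (c ^ 2 * r))) := by field_simp
      _ ≤ (3 * K5 + 10) * ((q * q ^ 3) * (w5 * (r ^ 2 * r))) := by gcongr
      _ = _ := by ring
  have e6 : |-(c * (t * c) ^ 3) / (48 * n)| * (|t * c| * (4 * K5 * n ^ 2 * w5)) ≤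
      K5 * (q ^ 4 * (w5 * r ^ 3)) / 12 := by
    rw [abs_div, abs_neg, abs_mul, abs_pow, abs_mul, abs_of_pos c0,
      abs_of_pos (by positivity : (0:ℝ) < 48 * n)]
    calc _ = |t| ^ 4 * (K5 * w5 * (c ^ 5 * n)) / 12 := by field_simp; ring
      _ ≤ q ^ 4 * (K5 * w5 * r ^ 3) / 12 := by linarith
      _ = _ := by ring
  have r4w : r ^ 4 ≤ w5 * r ^ 3 := r4.trans (le_mul_of_one_le_left (pow_pos r0 3).le (by linarith))
  have e7 : |s1| ≤ q ^ 4 * (w5 * r ^ 3) := by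
    have : s1 = t * r ^ 4 := by
      rw [hs1, show c * (t * c) * (n+1) = t * (c ^ 2 * (n+1)) by ring, c2, hr4n]; field_simp; ring
    rw [this, abs_mul, abs_of_pos (by positivity : (0:ℝ) < r ^ 4)]
    gcongr
  have e8 : |s2| ≤ 3 * (q ^ 4 * (w5 * r ^ 3)) := by
    have c4 : c ^ 4 = (n - 1) ^ 2 / (n:ℝ) ^ 4 := by
      rw [show c ^ 4 = (c ^ 2) ^ 2 by ring, c2]; field_simp
    have : s2 = t ^ 3 * (((u * v - 3 * (u + v)) * ((n - 1) / n) / 6 + (2 - 3 * n) / (2 * n)) * r ^ 4) := by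
      rw [hs2, hl2, hκ3, hκ4, hr4n,
        show c * (t * c) ^ 3 * n + c * (t * c) ^ 3 * (↑n ^ 2 * ((u - 1) * (v - 1)) / (↑n - 1)) / 4 -
        c * (t * c) ^ 3 * (4 * ↑n ^ 3 * ((u + 3) * (v + 3)) / (↑n - 1)) / (48 * ↑n) =
        c ^ 4 * (t ^ 3 * (n + (n ^ 2 * ((u - 1) * (v - 1)) / (n - 1)) / 4 -
        (4 * (n:ℝ) ^ 3 * ((u + 3) * (v + 3)) / (n - 1)) / (48 * n))) by ring, c4]
      field_simp
      ring
    have hz : |(u * v - 3 * (u + v)) * ((n - 1) / n) / 6 + (2 - 3 * n) / (2 * n)| ≤ 3 * w5 := by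
      have a1 : ((n:ℝ) - 1) / n ≤ 1 := by rw [div_le_one h0]; linarith
      have a0 : 0 ≤ ((n:ℝ) - 1) / n := by positivity
      have a2 : (2 - 3 * (n:ℝ)) / (2 * n) = -3/2 + 1 / n := by field_simp; ring
      have a3 : 1 / (n:ℝ) ≤ 1 := by rw [div_le_one h0]; linarith
      have a4 : 0 < 1 / (n:ℝ) := by positivity
      rw [a2]
      have huv : 0 ≤ u * v := by positivity
      generalize ((n:ℝ) - 1) / n = z at *
      have z1 : u * v * z ≤ w5 := (mul_le_of_le_one_right huv a1).trans (P1.trans hw45)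
      have z2 : (u + v) * z ≤ 2 * w5 := (mul_le_of_le_one_right (by positivity) a1).trans (by linarith)
      have z3 : 0 ≤ u * v * z := by positivity
      have z4 : 0 ≤ (u + v) * z := by positivity
      rw [abs_le]
      constructor <;> linarith
    rw [this, abs_mul, abs_mul, abs_pow, abs_of_pos (by positivity : (0:ℝ) < r ^ 4)]
    calc _ ≤ q ^ 4 * (3 * w5 * r ^ 3) := by gcongr
      _ = _ := by ring
  have T1 := norm_add₃_le (a := Complex.I * c * R1 + ((-(c * (t * c)) / 2 : ℝ) : ℂ) * R2 +
      Complex.I * (-(c * (t * c) ^ 2) / 4 : ℝ) * R3 +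
      Complex.I * (-(c * (t * c) ^ 2) / (4 * n) : ℝ) * LL + ((-(c * (t * c)) / n : ℝ) : ℂ) * R4)
      (b := ((-(c * (t * c) ^ 3) / (48 * n) : ℝ) : ℂ) * R5) (c := ((s1 + s2 : ℝ) : ℂ) * φ)
  have T2 := norm_add₃_le (a := Complex.I * c * R1 + ((-(c * (t * c)) / 2 : ℝ) : ℂ) * R2 +
      Complex.I * (-(c * (t * c) ^ 2) / 4 : ℝ) * R3)
      (b := Complex.I * (-(c * (t * c) ^ 2) / (4 * n) : ℝ) * LL) (c := ((-(c * (t * c)) / n : ℝ) : ℂ) * R4)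
  have T3 := norm_add₃_le (a := Complex.I * c * R1) (b := ((-(c * (t * c)) / 2 : ℝ) : ℂ) * R2)
    (c := Complex.I * (-(c * (t * c) ^ 2) / 4 : ℝ) * R3)
  have e9 := abs_add_le s1 s2
  have QB : 0 ≤ q ^ 4 * (w5 * r ^ 3) := by positivity
  have KQ : 0 ≤ K5 * (q ^ 4 * (w5 * r ^ 3)) := by positivity
  linarith

end expand6
end RankEdge

namespace RankEdge
section odeint

lemma ode_pos (f f' : ℝ → ℂ) (a b R T : ℝ) (hf : ∀ t, HasDerivAt f (f' t) t) (h0 : f 0 = 0)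
    (hT : 0 ≤ T) (hb : |b| * T ^ 2 ≤ 6)
    (hR : ∀ t, 0 ≤ t → t ≤ T → ‖f' t - (-t - Complex.I * a * t ^ 2 / 2 + b * t ^ 3 / 6) * f t‖ ≤ R) :
    ‖f T‖ ≤ T * R := by
  set M : ℝ → ℂ := fun t => (t:ℂ) ^ 2 / 2 + Complex.I * a * (t:ℂ) ^ 3 / 6 - b * (t:ℂ) ^ 4 / 24 with hM
  have hM' : ∀ t : ℝ, HasDerivAt M (t + Complex.I * a * (t:ℂ) ^ 2 / 2 - b * (t:ℂ) ^ 3 / 6) t := by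
    intro t
    have hid : HasDerivAt (fun s : ℝ => (s : ℂ)) 1 t := Complex.ofRealCLM.hasDerivAt (x := t)
    have := (((hid.pow 2).div_const 2).add
      (((hid.pow 3).const_mul (Complex.I * a)).div_const 6)).sub
      (((hid.pow 4).const_mul (b:ℂ)).div_const 24)
    refine this.congr_deriv ?_
    norm_num
    ring
  have hre : ∀ t : ℝ, (M t).re = t ^ 2 / 2 - b * t ^ 4 / 24 := by
    intro t
    have : M t = ((t ^ 2 / 2 - b * t ^ 4 / 24 : ℝ) : ℂ) + ((a * t ^ 3 / 6 : ℝ) : ℂ) * Complex.I := by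
      simp only [hM]; push_cast; ring
    rw [this]; simp only [Complex.add_re, Complex.ofReal_re, Complex.re_ofReal_mul, Complex.I_re,
      mul_zero, add_zero]
  have hmono : ∀ t, 0 ≤ t → t ≤ T → (M t).re ≤ (M T).re := by
    intro t h1 h2
    rw [hre, hre]
    have : (T ^ 2 / 2 - b * T ^ 4 / 24) - (t ^ 2 / 2 - b * t ^ 4 / 24) =
      (T ^ 2 - t ^ 2) * (1 / 2 - b * (T ^ 2 + t ^ 2) / 24) := by ring
    have q : t ^ 2 ≤ T ^ 2 := by nlinarith
    have q2 : b * (T ^ 2 + t ^ 2) ≤ 12 := by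
      calc b * (T ^ 2 + t ^ 2) ≤ |b| * (T ^ 2 + t ^ 2) := by gcongr; exact le_abs_self b
        _ ≤ |b| * (T ^ 2 + T ^ 2) := by gcongr
        _ ≤ 12 := by linarith
    have : 0 ≤ (T ^ 2 - t ^ 2) * (1 / 2 - b * (T ^ 2 + t ^ 2) / 24) :=
      mul_nonneg (by linarith) (by linarith)
    linarith
  have key : ∀ t ∈ Set.Icc 0 T, HasDerivWithinAt (fun t => f t * Complex.exp (M t))
      ((f' t - (-t - Complex.I * a * t ^ 2 / 2 + b * t ^ 3 / 6) * f t) * Complex.exp (M t))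
      (Set.Icc 0 T) t := by
    intro t _
    refine (((hf t).mul (hM' t).cexp).congr_deriv ?_).hasDerivWithinAt
    ring
  have := norm_image_sub_le_of_norm_deriv_le_segment' (C := R * Real.exp (M T).re) key (by
    intro t ht
    rw [norm_mul, Complex.norm_exp]
    have h1 := hR t ht.1 ht.2.le
    have h2 := Real.exp_le_exp.2 (hmono t ht.1 ht.2.le)
    exact mul_le_mul h1 h2 (Real.exp_pos _).le ((norm_nonneg _).trans h1)) T ⟨hT, le_rfl⟩
  rw [h0, zero_mul, sub_zero, norm_mul, Complex.norm_exp, sub_zero] at this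
  have e0 := Real.exp_pos (M T).re
  refine le_of_mul_le_mul_right (this.trans_eq ?_) e0
  ring

lemma ode_gen (f f' : ℝ → ℂ) (a b R T : ℝ) (hf : ∀ t, HasDerivAt f (f' t) t) (h0 : f 0 = 0)
    (hb : |b| * T ^ 2 ≤ 6)
    (hR : ∀ t, |t| ≤ |T| → ‖f' t - (-t - Complex.I * a * t ^ 2 / 2 + b * t ^ 3 / 6) * f t‖ ≤ R) :
    ‖f T‖ ≤ |T| * R := by
  rcases le_total 0 T with h | h
  · rw [abs_of_nonneg h]
    refine ode_pos f f' a b R T hf h0 h hb fun t h1 h2 => hR t ?_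
    rw [abs_of_nonneg h, abs_of_nonneg h1]; exact h2
  · rw [abs_of_nonpos h]
    have := ode_pos (fun t => f (-t)) (fun t => - f' (-t)) (-a) b R (-T) (fun t => by
      have := (hf (-t)).scomp t ((hasDerivAt_id' t).neg)
      refine this.congr_deriv ?_
      simp) (by simp [h0]) (by linarith) (by simpa using hb) (by
      intro t h1 h2
      have := hR (-t) (by rw [abs_neg, abs_of_nonneg h1, abs_of_nonpos h]; exact h2)
      rw [← norm_neg] at this
      refine le_trans (le_of_eq ?_) this
      congr 1
      push_cast
      ring)
    simpa using this

variable {n : ℕ}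

/-- approximating transforms -/
noncomputable def g2 (a b c : ℝ) (t : ℝ) : ℂ :=
  (Real.exp (-(t ^ 2) / 2) : ℂ) * (1 - Complex.I * a * t ^ 3 / 6 + b * t ^ 4 / 24 - c * t ^ 6 / 72)

lemma g2_deriv (a b c t : ℝ) : HasDerivAt (g2 a b c)
    (-t * g2 a b c t + (Real.exp (-(t ^ 2) / 2) : ℂ) *
      (- Complex.I * a * t ^ 2 / 2 + b * t ^ 3 / 6 - c * t ^ 5 / 12)) t := by
  have hid : HasDerivAt (fun s : ℝ => (s : ℂ)) 1 t := Complex.ofRealCLM.hasDerivAt (x := t)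
  have h1 : HasDerivAt (fun s : ℝ => (Real.exp (-(s ^ 2) / 2) : ℂ))
      ((Real.exp (-(t ^ 2) / 2) * (-t) : ℝ) : ℂ) t := by
    apply HasDerivAt.ofReal_comp
    have := ((((hasDerivAt_id' t).pow 2).neg).div_const 2).exp
    refine this.congr_deriv ?_
    norm_num
    ring
  have h2 := ((((hid.pow 3).const_mul (Complex.I * a)).div_const 6).const_sub 1).add
    (((hid.pow 4).const_mul (b:ℂ)).div_const 24)
  have h3 := h2.sub (((hid.pow 6).const_mul (c:ℂ)).div_const 72)
  refine (h1.mul h3).congr_deriv ?_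
  unfold g2
  push_cast
  norm_num
  ring

lemma g2_zero (a b c : ℝ) : g2 a b c 0 = 1 := by simp [g2]
lemma cf_zero (x y : Fin n → ℝ) : cf x y 0 = 1 := by
  unfold cf ph
  have : ex (0 * cn n) x y = fun _ => (1:ℂ) := by funext π; simp [ex]
  rw [this, EC_const]

lemma exp_bd (t : ℝ) : t ^ 2 * Real.exp (-(t ^ 2) / 2) ≤ 1 := by
  have := Real.add_one_le_exp (t ^ 2 / 2 - 1)
  have h : t ^ 2 * Real.exp (-(t^2)/2) ≤ 2 * Real.exp (-1) := by
    have e : Real.exp (t ^ 2 / 2 - 1) = Real.exp (-1) * Real.exp (t ^ 2 / 2) := by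
      rw [← Real.exp_add]; ring_nf
    have e2 : Real.exp (t ^ 2 / 2) * Real.exp (-(t^2)/2) = 1 := by
      rw [← Real.exp_add]; ring_nf; simp
    have p := Real.exp_pos (-(t^2)/2)
    calc t ^ 2 * Real.exp (-(t^2)/2) = 2 * ((t ^ 2 / 2 - 1 + 1) * Real.exp (-(t^2)/2)) := by ring
      _ ≤ 2 * (Real.exp (t ^ 2 / 2 - 1) * Real.exp (-(t^2)/2)) := by gcongr
      _ = 2 * (Real.exp (-1) * (Real.exp (t ^ 2 / 2) * Real.exp (-(t^2)/2))) := by rw [e]; ring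
      _ = _ := by rw [e2]; ring
  have h1 : Real.exp (-1) ≤ 1 / 2 := by
    rw [Real.exp_neg, ← one_div]
    have := Real.add_one_le_exp (1:ℝ)
    apply one_div_le_one_div_of_le (by norm_num); linarith
  linarith

lemma cf_approx1 (hn : 2 ≤ n) {x y : Fin n → ℝ} (hx : Nrm x) (hy : Nrm y) (T : ℝ) :
    ‖cf x y T - g2 (l1 x y) 0 0 T‖ ≤
      |T| * ((1 + |T|) ^ 3 * ((2 * KK 4 + 4) * (W 4 x * W 4 y / n) + l1 x y ^ 2)) := by
  set a := l1 x y with ha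
  have hw : 0 ≤ W 4 x * W 4 y / n := div_nonneg (mul_nonneg (W_nonneg _ _) (W_nonneg _ _)) (by positivity)
  have k4 := KK_one 4
  refine ode_gen (fun t => cf x y t - g2 a 0 0 t) _ a 0 _ T
    (fun t => (cf_deriv x y t).sub (g2_deriv a 0 0 t)) (by simp [cf_zero, g2_zero]) (by simp) ?_
  intro t ht
  have o := ode1 hn hx hy t
  have id : Complex.I * cn n * LE x y (t * cn n) x y - (-t * g2 a 0 0 t + (Real.exp (-(t ^ 2) / 2) : ℂ) *
      (- Complex.I * a * t ^ 2 / 2 + (0:ℝ) * t ^ 3 / 6 - (0:ℝ) * t ^ 5 / 12)) -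
      (-t - Complex.I * a * t ^ 2 / 2 + (0:ℝ) * t ^ 3 / 6) * (cf x y t - g2 a 0 0 t) =
      (Complex.I * cn n * LE x y (t * cn n) x y - (-t - Complex.I * a * t ^ 2 / 2) * cf x y t) -
      ((Real.exp (-(t ^ 2) / 2) * a ^ 2 * t ^ 5 / 12 : ℝ) : ℂ) := by
    unfold g2
    generalize Real.exp (-(t ^ 2) / 2) = X
    push_cast
    linear_combination ((X : ℂ) * a ^ 2 * t ^ 5 / 12) * Complex.I_sq
  rw [id]
  have t0 := abs_nonneg t
  have e3 : (1 + |t|) ^ 3 ≤ (1 + |T|) ^ 3 := by gcongr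
  have d : ‖((Real.exp (-(t ^ 2) / 2) * a ^ 2 * t ^ 5 / 12 : ℝ) : ℂ)‖ ≤ (1 + |T|) ^ 3 * a ^ 2 := by
    rw [Complex.norm_real, Real.norm_eq_abs, abs_div, abs_mul, abs_mul, abs_of_pos (Real.exp_pos _),
      abs_of_nonneg (sq_nonneg a), abs_pow, abs_of_pos (by norm_num : (0:ℝ) < 12)]
    have := exp_bd t
    have e5 : |t| ^ 5 = t ^ 2 * |t| ^ 3 := by rw [← sq_abs]; ring
    have e6 : |t| ^ 3 ≤ (1 + |t|) ^ 3 := by gcongr; linarith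
    have p := pow_nonneg t0 3
    calc _ = (t ^ 2 * Real.exp (-(t ^ 2) / 2)) * (a ^ 2 * |t| ^ 3) / 12 := by rw [e5]; ring
      _ ≤ 1 * (a ^ 2 * |t| ^ 3) / 12 := by gcongr
      _ ≤ a ^ 2 * |t| ^ 3 := by have := mul_nonneg (sq_nonneg a) p; linarith
      _ ≤ a ^ 2 * (1 + |T|) ^ 3 := mul_le_mul_of_nonneg_left (e6.trans e3) (sq_nonneg a)
      _ = _ := by ring
  refine (norm_sub_le _ _).trans ((add_le_add o d).trans ?_)
  have : (2 * KK 4 + 4) * (1 + |t|) ^ 3 * (W 4 x * W 4 y / n) ≤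
    (2 * KK 4 + 4) * (1 + |T|) ^ 3 * (W 4 x * W 4 y / n) := by gcongr
  linarith

lemma cf_approx2 (hn : 2 ≤ n) {x y : Fin n → ℝ} (hx : Nrm x) (hy : Nrm y) (T : ℝ)
    (hb : |l2 x y| * T ^ 2 ≤ 6) :
    ‖cf x y T - g2 (l1 x y) (l2 x y) (l1 x y ^ 2) T‖ ≤
      |T| * ((1 + |T|) ^ 9 * ((6 * KK 5 + 20) * (W 5 x * W 5 y * (1 / Real.sqrt n) ^ 3)
        + |l1 x y| * |l2 x y| + |l1 x y| ^ 3 + |l2 x y| ^ 2 + |l1 x y| ^ 2 * |l2 x y|)) := by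
  set a := l1 x y with ha
  set b := l2 x y with hbd
  have hw : 0 ≤ W 5 x * W 5 y * (1 / Real.sqrt n) ^ 3 :=
    mul_nonneg (mul_nonneg (W_nonneg _ _) (W_nonneg _ _)) (by positivity)
  have k5 := KK_one 5
  refine ode_gen (fun t => cf x y t - g2 a b (a ^ 2) t) _ a b _ T
    (fun t => (cf_deriv x y t).sub (g2_deriv a b (a ^ 2) t)) (by simp [cf_zero, g2_zero]) hb ?_
  intro t ht
  have o := ode2 hn hx hy t
  rw [← ha, ← hbd] at o
  set X := Real.exp (-(t ^ 2) / 2) with hX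
  have X0 : 0 < X := Real.exp_pos _
  have X1 : X ≤ 1 := Real.exp_le_one_iff.2 (by nlinarith [sq_nonneg t])
  set α : ℝ := X * (- b ^ 2 * t ^ 7 / 144 + a ^ 2 * b * t ^ 9 / 432) with hα
  set β : ℝ := X * (a * b * t ^ 6 * 7 / 144 - a ^ 3 * t ^ 8 / 144) with hβ
  have id : Complex.I * cn n * LE x y (t * cn n) x y - (-t * g2 a b (a^2) t + (X : ℂ) *
      (- Complex.I * a * t ^ 2 / 2 + b * t ^ 3 / 6 - (a^2:ℝ) * t ^ 5 / 12)) -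
      (-t - Complex.I * a * t ^ 2 / 2 + b * t ^ 3 / 6) * (cf x y t - g2 a b (a^2) t) =
      (Complex.I * cn n * LE x y (t * cn n) x y -
      (-t - Complex.I * a * t ^ 2 / 2 + b * t ^ 3 / 6) * cf x y t) -
      ((α : ℂ) + (β : ℂ) * Complex.I) := by
    unfold g2
    rw [hα, hβ, ← hX]
    push_cast
    linear_combination ((X : ℂ) * a ^ 2 * t ^ 5 / 12) * Complex.I_sq
  rw [id]
  have t0 := abs_nonneg t
  have e9 : (1 + |t|) ^ 9 ≤ (1 + |T|) ^ 9 := by gcongr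
  have pk : ∀ k, k ≤ 9 → |t| ^ k ≤ (1 + |T|) ^ 9 := by
    intro k hk
    calc |t| ^ k ≤ (1 + |t|) ^ k := by gcongr; linarith
      _ ≤ (1 + |t|) ^ 9 := pow_le_pow_right₀ (by linarith) hk
      _ ≤ _ := e9
  have dα : |α| ≤ (1 + |T|) ^ 9 * (|b| ^ 2 + |a| ^ 2 * |b|) := by
    rw [hα, abs_mul, abs_of_pos X0]
    calc _ ≤ 1 * (|- b ^ 2 * t ^ 7 / 144| + |a ^ 2 * b * t ^ 9 / 432|) := by
          gcongr; exact abs_add_le _ _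
      _ = |b| ^ 2 * |t| ^ 7 / 144 + |a| ^ 2 * |b| * |t| ^ 9 / 432 := by
          simp [abs_div, abs_mul]
      _ ≤ |b| ^ 2 * (1 + |T|) ^ 9 / 144 + |a| ^ 2 * |b| * (1 + |T|) ^ 9 / 432 := by
          gcongr ?_ * ?_ / ?_ + ?_ * ?_ / ?_
          · exact pk 7 (by norm_num)
          · exact pk 9 (by norm_num)
      _ ≤ _ := by
          have q1 : 0 ≤ |b| ^ 2 * (1 + |T|) ^ 9 := by positivity
          have q2 : 0 ≤ |a| ^ 2 * |b| * (1 + |T|) ^ 9 := by positivity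
          linarith
  have dβ : |β| ≤ (1 + |T|) ^ 9 * (|a| * |b| + |a| ^ 3) := by
    rw [hβ, abs_mul, abs_of_pos X0]
    calc _ ≤ 1 * (|a * b * t ^ 6 * 7 / 144| + |a ^ 3 * t ^ 8 / 144|) := by
          gcongr; exact abs_sub _ _
      _ = |a| * |b| * |t| ^ 6 * 7 / 144 + |a| ^ 3 * |t| ^ 8 / 144 := by
          simp [abs_div, abs_mul]
      _ ≤ |a| * |b| * (1 + |T|) ^ 9 * 7 / 144 + |a| ^ 3 * (1 + |T|) ^ 9 / 144 := by
          gcongr ?_ * ?_ * 7 / ?_ + ?_ * ?_ / ?_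
          · exact pk 6 (by norm_num)
          · exact pk 8 (by norm_num)
      _ ≤ _ := by
          have q1 : 0 ≤ |a| * |b| * (1 + |T|) ^ 9 := by positivity
          have q2 : 0 ≤ |a| ^ 3 * (1 + |T|) ^ 9 := by positivity
          linarith
  have d : ‖(α : ℂ) + (β : ℂ) * Complex.I‖ ≤ |α| + |β| := by
    refine (norm_add_le _ _).trans ?_
    rw [norm_mul, Complex.norm_I, Complex.norm_real, Complex.norm_real]; simp
  have e4 : (1 + |t|) ^ 4 ≤ (1 + |T|) ^ 9 :=
    (pow_le_pow_right₀ (by linarith) (by norm_num)).trans e9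
  refine (norm_sub_le _ _).trans ((add_le_add o d).trans ?_)
  have : (6 * KK 5 + 20) * (1 + |t|) ^ 4 * (W 5 x * W 5 y * (1 / Real.sqrt n) ^ 3) ≤
      (6 * KK 5 + 20) * (1 + |T|) ^ 9 * (W 5 x * W 5 y * (1 / Real.sqrt n) ^ 3) := by gcongr
  linarith

end odeint
end RankEdge

namespace RankEdge
section mom
variable {n : ℕ}

lemma mm3_sq (hn : 2 ≤ n) {x : Fin n → ℝ} (hx : Nrm x) : mm 3 x ^ 2 ≤ W 4 x := by
  obtain ⟨h2, h0, h1, h3⟩ := n_facts hn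
  have a : mm 3 x ^ 2 ≤ mm 4 x := by
    unfold mm
    have := Finset.sum_mul_sq_le_sq_mul_sq Finset.univ x (fun i => x i ^ 2)
    rw [hx.s2] at this
    have e1 : ∑ i, x i * x i ^ 2 = ∑ i, x i ^ 3 := Finset.sum_congr rfl fun i _ => by ring
    have e2 : ∑ i, (x i ^ 2) ^ 2 = ∑ i, x i ^ 4 := Finset.sum_congr rfl fun i _ => by ring
    rw [e1, e2] at this
    rw [div_pow, div_le_div_iff₀ (by positivity) h0]
    nlinarith
  exact a.trans ((le_abs_self _).trans (abs_mm_le hn le_rfl x))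

lemma l1_sq (hn : 2 ≤ n) {x y : Fin n → ℝ} (hx : Nrm x) (hy : Nrm y) :
    l1 x y ^ 2 ≤ W 4 x * W 4 y / n := by
  obtain ⟨h2, h0, h1, h3⟩ := n_facts hn
  obtain ⟨c0, c2, cr, nr, r0, r1⟩ := cn_facts hn
  have a := mm3_sq hn hx
  have b := mm3_sq hn hy
  have c : cn n ^ 2 ≤ 1 / n := by
    rw [c2, div_le_div_iff₀ (by positivity) h0]; nlinarith
  have d : (n:ℝ) ^ 2 * (cn n ^ 2) ^ 3 ≤ 1 / n := by
    calc (n:ℝ) ^ 2 * (cn n ^ 2) ^ 3 ≤ (n:ℝ) ^ 2 * (1 / (n:ℝ)) ^ 3 := by gcongr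
      _ = 1 / (n:ℝ) := by field_simp
  calc l1 x y ^ 2 = ((n:ℝ) ^ 2 * (cn n ^ 2) ^ 3) * (mm 3 x ^ 2 * mm 3 y ^ 2) := by unfold l1; ring
    _ ≤ (1 / n) * (W 4 x * W 4 y) := by
        have := W_nonneg 4 x
        gcongr
    _ = _ := by ring

lemma l2_abs (hn : 2 ≤ n) {x y : Fin n → ℝ} : |l2 x y| ≤ 10 * (W 4 x * W 4 y / n) := by
  obtain ⟨h2, h0, h1, h3⟩ := n_facts hn
  obtain ⟨c0, c2, cr, nr, r0, r1⟩ := cn_facts hn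
  have m4x := abs_mm_le hn (le_refl 4) x
  have m4y := abs_mm_le hn (le_refl 4) y
  have wx1 := W_one (by omega : 0 < n) 4 x
  have wy1 := W_one (by omega : 0 < n) 4 y
  have c : cn n ^ 2 ≤ 1 / n := by
    rw [c2, div_le_div_iff₀ (by positivity) h0]; nlinarith
  have d : (n:ℝ) * cn n ^ 4 ≤ 1 / n := by
    calc (n:ℝ) * cn n ^ 4 = n * (cn n ^ 2) ^ 2 := by ring
      _ ≤ (n:ℝ) * (1 / n) ^ 2 := by gcongr
      _ = 1 / n := by field_simp
  have e : |mm 4 x * mm 4 y - 3 * mm 4 x - 3 * mm 4 y| ≤ 7 * (W 4 x * W 4 y) := by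
    have p := abs_sub (mm 4 x * mm 4 y - 3 * mm 4 x) (3 * mm 4 y)
    have q := abs_sub (mm 4 x * mm 4 y) (3 * mm 4 x)
    rw [abs_mul] at q p
    rw [abs_mul] at q
    rw [show |(3:ℝ)| = 3 by norm_num] at p q
    have : |mm 4 x| * |mm 4 y| ≤ W 4 x * W 4 y := by gcongr
    nlinarith
  unfold l2
  have nc : 0 ≤ (n:ℝ) * cn n ^ 4 := by positivity
  have p3 : (0:ℝ) ≤ 3 / n := by positivity
  have ww : 1 ≤ W 4 x * W 4 y := by nlinarith
  calc _ ≤ |(n:ℝ) * cn n ^ 4 * (mm 4 x * mm 4 y - 3 * mm 4 x - 3 * mm 4 y)| + |(3:ℝ) / n| := abs_add_le _ _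
    _ = (n:ℝ) * cn n ^ 4 * |(mm 4 x * mm 4 y - 3 * mm 4 x - 3 * mm 4 y)| + 3 / n := by
        rw [abs_mul, abs_of_nonneg nc, abs_of_nonneg p3]
    _ ≤ 1 / n * (7 * (W 4 x * W 4 y)) + 3 * (W 4 x * W 4 y) / n := by
        gcongr
        linarith
    _ = _ := by ring

lemma W_two {x : Fin n → ℝ} (hn : 2 ≤ n) (hx : Nrm x) : W 2 x ≤ 4 := by
  obtain ⟨h2, h0, h1, h3⟩ := n_facts hn
  unfold W
  rw [div_le_iff₀ h0]
  calc ∑ i, mj x i ^ 2 ≤ ∑ i, (2 + 2 * x i ^ 2) := by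
        apply Finset.sum_le_sum; intro i _; unfold mj; nlinarith [sq_nonneg (1 - |x i|), sq_abs (x i)]
    _ = 4 * n := by
        rw [Finset.sum_add_distrib, ← Finset.mul_sum, hx.s2]; simp; ring

lemma W_cs (p q : ℕ) (x : Fin n → ℝ) : W (p + q) x ^ 2 ≤ W (2 * p) x * W (2 * q) x := by
  unfold W
  have := Finset.sum_mul_sq_le_sq_mul_sq Finset.univ (fun i => mj x i ^ p) (fun i => mj x i ^ q)
  rw [div_pow, div_mul_div_comm, ← sq]
  apply div_le_div_of_nonneg_right _ (by positivity)
  simpa only [← pow_add, ← pow_mul, mul_comm] using this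

lemma W_hol (x : Fin n → ℝ) : W 4 x ^ 2 ≤ W 3 x * W 5 x := by
  unfold W
  have := Finset.sum_sq_le_sum_mul_sum_of_sq_le_mul Finset.univ (f := fun i => mj x i ^ 3)
    (g := fun i => mj x i ^ 5) (r := fun i => mj x i ^ 4)
    (fun i _ => pow_nonneg (mj_nonneg x i) _) (fun i _ => pow_nonneg (mj_nonneg x i) _) (fun i _ => le_of_eq (by ring))
  rw [div_pow, div_mul_div_comm, ← sq]
  exact div_le_div_of_nonneg_right this (by positivity)

lemma W_43 (hn : 2 ≤ n) {x : Fin n → ℝ} (hx : Nrm x) : W 4 x ^ 3 ≤ 4 * W 5 x ^ 2 := by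
  have a := W_two hn hx
  have b := W_cs 1 2 x
  have c := W_hol x
  norm_num at b
  have w3 := W_nonneg 3 x
  have w2 := W_nonneg 2 x
  have w5 := W_nonneg 5 x
  have w4 : 0 < W 4 x := lt_of_lt_of_le one_pos (W_one (by omega) 4 x)
  have : W 4 x * W 4 x ^ 3 ≤ W 4 x * (4 * W 5 x ^ 2) := by
    calc W 4 x * W 4 x ^ 3 = (W 4 x ^ 2) ^ 2 := by ring
      _ ≤ (W 3 x * W 5 x) ^ 2 := by gcongr
      _ = W 3 x ^ 2 * W 5 x ^ 2 := by ring
      _ ≤ (W 2 x * W 4 x) * W 5 x ^ 2 := by gcongr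
      _ ≤ (4 * W 4 x) * W 5 x ^ 2 := by gcongr
      _ = _ := by ring
  exact le_of_mul_le_mul_left this w4

/-- the two error scales -/
noncomputable def B4 (x y : Fin n → ℝ) : ℝ := W 4 x * W 4 y / n
/-- second order scale -/
noncomputable def B5 (x y : Fin n → ℝ) : ℝ := W 5 x * W 5 y * (1 / Real.sqrt n) ^ 3

lemma B5_nonneg (x y : Fin n → ℝ) : 0 ≤ B5 x y :=
  mul_nonneg (mul_nonneg (W_nonneg _ _) (W_nonneg _ _)) (by positivity)
lemma B4_nonneg (x y : Fin n → ℝ) : 0 ≤ B4 x y :=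
  div_nonneg (mul_nonneg (W_nonneg _ _) (W_nonneg _ _)) (by positivity)

lemma B4_cube (hn : 2 ≤ n) {x y : Fin n → ℝ} (hx : Nrm x) (hy : Nrm y) :
    B4 x y ^ 3 ≤ (4 * B5 x y) ^ 2 := by
  obtain ⟨h2, h0, h1, h3⟩ := n_facts hn
  have a := W_43 hn hx
  have b := W_43 hn hy
  have hs : Real.sqrt n ^ 2 = n := Real.sq_sqrt h0.le
  have hss : 0 < Real.sqrt n := Real.sqrt_pos.2 h0
  unfold B4 B5
  have w4 := W_nonneg 4 x
  have w4' := W_nonneg 4 y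
  calc (W 4 x * W 4 y / (n:ℝ)) ^ 3 = W 4 x ^ 3 * W 4 y ^ 3 / (n:ℝ) ^ 3 := by rw [div_pow, mul_pow]
    _ ≤ (4 * W 5 x ^ 2) * (4 * W 5 y ^ 2) / (n:ℝ) ^ 3 := by gcongr
    _ = (4 * W 5 x ^ 2) * (4 * W 5 y ^ 2) / (Real.sqrt n ^ 2) ^ 3 := by rw [hs]
    _ = _ := by field_simp

lemma cf_fin1 (hn : 2 ≤ n) {x y : Fin n → ℝ} (hx : Nrm x) (hy : Nrm y) (T : ℝ) :
    ‖cf x y T - g2 (l1 x y) 0 0 T‖ ≤ |T| * ((1 + |T|) ^ 3 * ((2 * KK 4 + 5) * B4 x y)) := by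
  refine (cf_approx1 hn hx hy T).trans ?_
  have := l1_sq hn hx hy
  change _ ≤ B4 x y at this
  change _ * (_ * (_ * B4 x y + _)) ≤ _
  gcongr
  linarith

lemma B4_small (hn : 2 ≤ n) {x y : Fin n → ℝ} (hx : Nrm x) (hy : Nrm y) (hB : B4 x y ≤ 1) :
    |l1 x y| * |l2 x y| + |l1 x y| ^ 3 + |l2 x y| ^ 2 + |l1 x y| ^ 2 * |l2 x y| ≤ 500 * B5 x y := by
  have h1 := l1_sq hn hx hy
  have h2 := l2_abs hn (x := x) (y := y)
  have h3 := B4_cube hn hx hy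
  have h5 := B5_nonneg x y
  have h4 := B4_nonneg x y
  change _ ≤ B4 x y at h1
  change _ ≤ 10 * B4 x y at h2
  have hs : Real.sqrt (B4 x y) ^ 2 = B4 x y := Real.sq_sqrt h4
  have hs0 := Real.sqrt_nonneg (B4 x y)
  have hs1 : Real.sqrt (B4 x y) ≤ 1 := Real.sqrt_le_one.2 hB
  set q := Real.sqrt (B4 x y)
  have ha : |l1 x y| ≤ q := by
    apply abs_le_of_sq_le_sq' _ hs0 |> abs_le.2
    rw [hs]; exact h1
  have q3 : q ^ 3 ≤ 4 * B5 x y := by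
    apply le_of_sq_le_sq _ (by positivity)
    calc (q ^ 3) ^ 2 = (q ^ 2) ^ 3 := by ring
      _ = _ := by rw [hs]
      _ ≤ _ := h3
  rw [← hs] at h2
  have a0 := abs_nonneg (l1 x y)
  have b0 := abs_nonneg (l2 x y)
  have q4 : q ^ 4 ≤ q ^ 3 := by nlinarith [pow_nonneg hs0 3]
  have e1 : |l1 x y| * |l2 x y| ≤ q * (10 * q ^ 2) := by gcongr
  have e2 : |l1 x y| ^ 3 ≤ q ^ 3 := by gcongr
  have e3 : |l2 x y| ^ 2 ≤ (10 * q ^ 2) ^ 2 := by gcongr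
  have e4 : |l1 x y| ^ 2 * |l2 x y| ≤ q ^ 2 * (10 * q ^ 2) := by gcongr
  nlinarith

lemma cf_fin2 (hn : 2 ≤ n) {x y : Fin n → ℝ} (hx : Nrm x) (hy : Nrm y) (T : ℝ)
    (hb : 10 * B4 x y * T ^ 2 ≤ 6) (hB : B4 x y ≤ 1) :
    ‖cf x y T - g2 (l1 x y) (l2 x y) (l1 x y ^ 2) T‖ ≤
      |T| * ((1 + |T|) ^ 9 * ((6 * KK 5 + 520) * B5 x y)) := by
  have h2 := l2_abs hn (x := x) (y := y)
  change _ ≤ 10 * B4 x y at h2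
  refine (cf_approx2 hn hx hy T (le_trans (by gcongr) hb)).trans ?_
  have := B4_small hn hx hy hB
  change _ * (_ * (_ * B5 x y + _ + _ + _ + _)) ≤ _
  gcongr
  linarith

end mom
end RankEdge

namespace RankEdge
section gauss

lemma int_pow_gauss {b : ℝ} (hb : 0 < b) (k : ℕ) :
    Integrable fun t : ℝ => t ^ k * Real.exp (-b * t ^ 2) := by
  have := integrable_rpow_mul_exp_neg_mul_sq hb (s := (k:ℝ)) (by have : (0:ℝ) ≤ k := Nat.cast_nonneg k
                                                                 linarith)
  simpa using this

/-- the weight -/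
noncomputable def gw (v : ℝ) (k : ℕ) (t : ℝ) : ℂ :=
  Complex.exp (-(Complex.I * v * t)) * (t : ℂ) ^ k * (Real.exp (-(1 / 2) * t ^ 2) : ℂ)

lemma norm_gw (v : ℝ) (k : ℕ) (t : ℝ) : ‖gw v k t‖ = |t| ^ k * Real.exp (-(1 / 2) * t ^ 2) := by
  unfold gw
  rw [norm_mul, norm_mul, Complex.norm_exp, norm_pow, Complex.norm_real, Complex.norm_real,
    Real.norm_eq_abs, Real.norm_eq_abs, abs_of_pos (Real.exp_pos _)]
  have : (-(Complex.I * v * t)).re = 0 := by simp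
  rw [this]; simp

lemma cont_gw (v : ℝ) (k : ℕ) : Continuous (gw v k) := by
  unfold gw; fun_prop

lemma int_gw (v : ℝ) (k : ℕ) : Integrable (gw v k) := by
  refine (int_pow_gauss (b := 1/2) (by norm_num) k).mono (cont_gw v k).aestronglyMeasurable
    (ae_of_all _ fun t => ?_)
  rw [norm_gw]; simp

/-- moments -/
noncomputable def JJ (v : ℝ) (k : ℕ) : ℂ := ∫ t, gw v k t

lemma gw_deriv (v : ℝ) (k : ℕ) (t : ℝ) : HasDerivAt (gw v (k+1))
    (-(Complex.I * v) * gw v (k+1) t + (k+1) * gw v k t - gw v (k + 2) t) t := by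
  have hid : HasDerivAt (fun s : ℝ => (s : ℂ)) 1 t := Complex.ofRealCLM.hasDerivAt (x := t)
  have h1 : HasDerivAt (fun s : ℝ => (Real.exp (-(1/2) * s ^ 2) : ℂ))
      ((Real.exp (-(1/2) * t ^ 2) * (-t) : ℝ) : ℂ) t := by
    apply HasDerivAt.ofReal_comp
    have := (((hasDerivAt_id' t).pow 2).const_mul (-(1/2))).exp
    refine this.congr_deriv ?_
    simp
  have h2 := ((hid.const_mul (Complex.I * v)).neg).cexp
  have h3 := hid.pow (k+1)
  refine ((h2.mul h3).mul h1).congr_deriv ?_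
  unfold gw
  generalize Real.exp (-(1/2) * t ^ 2) = X
  simp only [Pi.mul_apply, Pi.pow_apply, Pi.neg_apply]
  push_cast
  ring_nf

lemma gw_deriv0 (v : ℝ) (t : ℝ) : HasDerivAt (gw v 0)
    (-(Complex.I * v) * gw v 0 t - gw v 1 t) t := by
  have hid : HasDerivAt (fun s : ℝ => (s : ℂ)) 1 t := Complex.ofRealCLM.hasDerivAt (x := t)
  have h1 : HasDerivAt (fun s : ℝ => (Real.exp (-(1/2) * s ^ 2) : ℂ))
      ((Real.exp (-(1/2) * t ^ 2) * (-t) : ℝ) : ℂ) t := by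
    apply HasDerivAt.ofReal_comp
    have := (((hasDerivAt_id' t).pow 2).const_mul (-(1/2))).exp
    refine this.congr_deriv ?_
    simp
  have h2 := ((hid.const_mul (Complex.I * v)).neg).cexp
  have h3 := hid.pow 0
  refine ((h2.mul h3).mul h1).congr_deriv ?_
  unfold gw
  generalize Real.exp (-(1/2) * t ^ 2) = X
  simp only [Pi.mul_apply, Pi.pow_apply, Pi.neg_apply]
  push_cast
  ring_nf

lemma JJ_rec0 (v : ℝ) : JJ v 1 = -(Complex.I * v) * JJ v 0 := by
  have := integral_eq_zero_of_hasDerivAt_of_integrable (gw_deriv0 v)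
    (((int_gw v 0).const_mul _).sub (int_gw v 1)) (int_gw v 0)
  rw [integral_sub ((int_gw v 0).const_mul _) (int_gw v 1), integral_const_mul] at this
  unfold JJ
  linear_combination -this

lemma JJ_rec (v : ℝ) (k : ℕ) : JJ v (k+2) = -(Complex.I * v) * JJ v (k+1) + (k+1) * JJ v k := by
  have := integral_eq_zero_of_hasDerivAt_of_integrable (gw_deriv v k)
    ((((int_gw v (k+1)).const_mul _).add ((int_gw v k).const_mul _)).sub (int_gw v (k+2))) (int_gw v (k+1))
  have hi : Integrable (fun t => -(Complex.I * v) * gw v (k+1) t + (k+1) * gw v k t) :=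
    ((int_gw v (k+1)).const_mul _).add ((int_gw v k).const_mul _)
  rw [integral_sub hi (int_gw v (k+2)),
    integral_add ((int_gw v (k+1)).const_mul _) ((int_gw v k).const_mul _),
    integral_const_mul, integral_const_mul] at this
  unfold JJ
  linear_combination -this

lemma sqrt2pi_pos : 0 < Real.sqrt (2 * Real.pi) := Real.sqrt_pos.2 (by positivity)

lemma JJ_zero (v : ℝ) : JJ v 0 = ((2 * Real.pi * gaussD v : ℝ) : ℂ) := by
  have h := fourierIntegral_gaussian (b := 1/2) (by norm_num) (-v : ℂ)
  have e : JJ v 0 = ∫ x : ℝ, Complex.exp (Complex.I * (-v) * x) * Complex.exp (-(1/2) * x ^ 2) := by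
    unfold JJ gw
    congr 1; funext t
    push_cast
    rw [pow_zero, mul_one]
    congr 2
    ring
  rw [e, h]
  unfold gaussD
  have hp := sqrt2pi_pos
  have hs : Real.sqrt (2 * Real.pi) ^ 2 = 2 * Real.pi := Real.sq_sqrt (by positivity)
  have h1 : ((Real.pi:ℂ) / (1/2)) ^ (1/2 : ℂ) = ((Real.sqrt (2 * Real.pi) : ℝ) : ℂ) := by
    rw [Real.sqrt_eq_rpow, Complex.ofReal_cpow (by positivity)]
    push_cast
    congr 1
    ring
  rw [h1]
  have h2 : 2 * Real.pi * ((Real.sqrt (2 * Real.pi))⁻¹ * Real.exp (-(v^2)/2)) =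
    Real.sqrt (2 * Real.pi) * Real.exp (-(v^2)/2) := by
    field_simp; rw [hs]
  rw [h2]
  push_cast
  congr 2
  ring

lemma norm_JJ (v : ℝ) (k : ℕ) : ‖JJ v k‖ ≤ ∫ t : ℝ, |t| ^ k * Real.exp (-(1/2) * t ^ 2) := by
  unfold JJ
  refine (norm_integral_le_integral_norm _).trans (le_of_eq ?_)
  simp only [norm_gw]

end gauss
end RankEdge

namespace RankEdge
section gaussb
open Filter Topology

lemma gaussD_eq : gaussD = ProbabilityTheory.gaussianPDFReal 0 1 := by
  funext x
  simp [gaussD, ProbabilityTheory.gaussianPDFReal]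

lemma int_gaussD : Integrable gaussD := by
  rw [gaussD_eq]; exact ProbabilityTheory.integrable_gaussianPDFReal 0 1

lemma integral_gaussD : ∫ t, gaussD t = 1 := by
  rw [gaussD_eq]; exact ProbabilityTheory.integral_gaussianPDFReal_eq_one 0 one_ne_zero

lemma gaussD_pos (x : ℝ) : 0 < gaussD x := mul_pos (inv_pos.2 sqrt2pi_pos) (Real.exp_pos _)

lemma gaussD_deriv (x : ℝ) : HasDerivAt gaussD (-x * gaussD x) x := by
  unfold gaussD
  have := ((((hasDerivAt_id' x).pow 2).neg).div_const 2).exp.const_mul (Real.sqrt (2 * Real.pi))⁻¹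
  refine this.congr_deriv ?_
  simp
  ring

lemma cont_gaussD : Continuous gaussD :=
  continuous_iff_continuousAt.2 fun x => (gaussD_deriv x).continuousAt

lemma gaussCDF_deriv (x : ℝ) : HasDerivAt gaussCDF (gaussD x) x := by
  have e : gaussCDF = fun x => (∫ t in (0:ℝ)..x, gaussD t) + gaussCDF 0 := by
    funext x
    rw [← intervalIntegral.integral_Iic_sub_Iic int_gaussD.integrableOn int_gaussD.integrableOn]
    unfold gaussCDF; ring
  rw [e]
  exact (intervalIntegral.integral_hasDerivAt_right (int_gaussD.intervalIntegrable)
    (cont_gaussD.stronglyMeasurableAtFilter _ _) cont_gaussD.continuousAt).add_const _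

lemma gaussCDF_mono : Monotone gaussCDF :=
  monotone_of_deriv_nonneg (fun x => (gaussCDF_deriv x).differentiableAt)
    (fun x => by rw [(gaussCDF_deriv x).deriv]; exact (gaussD_pos x).le)

lemma gaussCDF_nonneg (x : ℝ) : 0 ≤ gaussCDF x :=
  setIntegral_nonneg measurableSet_Iic fun t _ => (gaussD_pos t).le

lemma gaussCDF_add (x : ℝ) : gaussCDF x + ∫ t in Set.Ioi x, gaussD t = 1 := by
  unfold gaussCDF
  rw [← Set.compl_Iic, integral_add_compl measurableSet_Iic int_gaussD, integral_gaussD]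

lemma gaussCDF_le_one (x : ℝ) : gaussCDF x ≤ 1 := by
  have := gaussCDF_add x
  have h : 0 ≤ ∫ t in Set.Ioi x, gaussD t :=
    setIntegral_nonneg measurableSet_Ioi fun t _ => (gaussD_pos t).le
  linarith

lemma tail_aux (S : Set ℝ) (hS : MeasurableSet S) (u : ℝ) (hu : ∀ t ∈ S, u ^ 2 ≤ t ^ 2) :
    ∫ t in S, gaussD t ≤ 2 * Real.exp (-(u ^ 2) / 4) := by
  have i1 : Integrable fun t : ℝ => Real.exp (-(u^2)/4) * ((Real.sqrt (2 * Real.pi))⁻¹ * Real.exp (-(1/4) * t ^ 2)) :=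
    ((integrable_exp_neg_mul_sq (by norm_num : (0:ℝ) < 1/4)).const_mul _).const_mul _
  have p := sqrt2pi_pos
  calc ∫ t in S, gaussD t ≤ ∫ t in S, Real.exp (-(u^2)/4) *
      ((Real.sqrt (2 * Real.pi))⁻¹ * Real.exp (-(1/4) * t ^ 2)) := by
        apply setIntegral_mono_on int_gaussD.integrableOn i1.integrableOn hS
        intro t ht
        unfold gaussD
        have := hu t ht
        have : Real.exp (-(t^2)/2) ≤ Real.exp (-(u^2)/4) * Real.exp (-(1/4) * t ^ 2) := by
          rw [← Real.exp_add]; apply Real.exp_le_exp.2; linarith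
        calc _ ≤ (Real.sqrt (2 * Real.pi))⁻¹ * (Real.exp (-(u^2)/4) * Real.exp (-(1/4) * t ^ 2)) := by gcongr
          _ = _ := by ring
    _ ≤ ∫ t, Real.exp (-(u^2)/4) * ((Real.sqrt (2 * Real.pi))⁻¹ * Real.exp (-(1/4) * t ^ 2)) :=
        setIntegral_le_integral i1 (ae_of_all _ fun t => by positivity)
    _ = Real.exp (-(u^2)/4) * ((Real.sqrt (2 * Real.pi))⁻¹ * Real.sqrt (Real.pi / (1/4))) := by
        rw [integral_const_mul, integral_const_mul, integral_gaussian]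
    _ ≤ Real.exp (-(u^2)/4) * 2 := by
        gcongr
        rw [inv_mul_le_iff₀ p, show (2:ℝ) = Real.sqrt 4 by rw [show (4:ℝ) = 2 ^ 2 by norm_num]; simp,
          ← Real.sqrt_mul (by positivity)]
        apply Real.sqrt_le_sqrt
        have := Real.pi_pos
        rw [show Real.sqrt 4 = 2 by rw [show (4:ℝ) = 2 ^ 2 by norm_num]; simp]
        linarith
    _ = _ := by ring

lemma tail_left {u : ℝ} (hu : 0 ≤ u) : gaussCDF (-u) ≤ 2 * Real.exp (-(u^2)/4) :=
  tail_aux _ measurableSet_Iic u fun t ht => by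
    have : t ≤ -u := ht
    nlinarith

lemma tail_right {u : ℝ} (hu : 0 ≤ u) : 1 - gaussCDF u ≤ 2 * Real.exp (-(u^2)/4) := by
  have := gaussCDF_add u
  have h := tail_aux _ measurableSet_Ioi u fun t (ht : u < t) => by nlinarith
  linarith

/-- generic expansion -/
noncomputable def GG (a b c x : ℝ) : ℝ := gaussCDF x - gaussD x *
    (a / 6 * (x ^ 2 - 1) + b / 24 * (x ^ 3 - 3 * x) + c / 72 * (x ^ 5 - 10 * x ^ 3 + 15 * x))

/-- its density -/
noncomputable def gd (a b c x : ℝ) : ℝ := gaussD x *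
    (1 + a / 6 * (x ^ 3 - 3 * x) + b / 24 * (x ^ 4 - 6 * x ^ 2 + 3)
      + c / 72 * (x ^ 6 - 15 * x ^ 4 + 45 * x ^ 2 - 15))

lemma GG_deriv (a b c x : ℝ) : HasDerivAt (GG a b c) (gd a b c x) x := by
  have hid := hasDerivAt_id' x
  have p1 := (((hid.pow 2).sub_const 1).const_mul (a/6))
  have p2 := (((hid.pow 3).sub (hid.const_mul 3)).const_mul (b/24))
  have p3 := ((((hid.pow 5).sub ((hid.pow 3).const_mul 10)).add (hid.const_mul 15)).const_mul (c/72))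
  have := (gaussCDF_deriv x).sub ((gaussD_deriv x).mul ((p1.add p2).add p3))
  refine this.congr_deriv ?_
  unfold gd
  simp
  ring

lemma cont_gd (a b c : ℝ) : Continuous (gd a b c) := by
  unfold gd
  have := cont_gaussD
  fun_prop

lemma JJ_vals (v : ℝ) :
    JJ v 2 = ((-(2 * Real.pi * gaussD v * (v ^ 2 - 1)) : ℝ) : ℂ) ∧
    JJ v 3 = Complex.I * ((2 * Real.pi * gaussD v * (v ^ 3 - 3 * v) : ℝ) : ℂ) ∧
    JJ v 4 = ((2 * Real.pi * gaussD v * (v ^ 4 - 6 * v ^ 2 + 3) : ℝ) : ℂ) ∧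
    JJ v 5 = Complex.I * ((-(2 * Real.pi * gaussD v * (v ^ 5 - 10 * v ^ 3 + 15 * v)) : ℝ) : ℂ) ∧
    JJ v 6 = ((-(2 * Real.pi * gaussD v * (v ^ 6 - 15 * v ^ 4 + 45 * v ^ 2 - 15)) : ℝ) : ℂ) := by
  have h0 := JJ_zero v
  have h1 := JJ_rec0 v
  have h2 := JJ_rec v 0
  have h3 := JJ_rec v 1
  have h4 := JJ_rec v 2
  have h5 := JJ_rec v 3
  have h6 := JJ_rec v 4
  norm_num at h2 h3 h4 h5 h6
  have hI := Complex.I_sq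
  rw [h0] at h1
  push_cast at h0 h1 ⊢
  set q : ℂ := 2 * Real.pi * gaussD v
  have r2 : JJ v 2 = -(q * (v ^ 2 - 1)) := by
    rw [h2, h1, h0]; linear_combination (q * v ^ 2) * hI
  have r3 : JJ v 3 = Complex.I * (q * (v ^ 3 - 3 * v)) := by
    rw [h3, r2, h1]; ring
  have r4 : JJ v 4 = q * (v ^ 4 - 6 * v ^ 2 + 3) := by
    rw [h4, r3, r2]; linear_combination (-q * v * (v ^ 3 - 3 * v)) * hI
  have r5 : JJ v 5 = Complex.I * -(q * (v ^ 5 - 10 * v ^ 3 + 15 * v)) := by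
    rw [h5, r4, r3]; ring
  have r6 : JJ v 6 = -(q * (v ^ 6 - 15 * v ^ 4 + 45 * v ^ 2 - 15)) := by
    rw [h6, r5, r4]; linear_combination (q * v * (v ^ 5 - 10 * v ^ 3 + 15 * v)) * hI
  exact ⟨r2, r3, r4, r5, r6⟩

lemma gd_four (a b c v : ℝ) : ((2 * Real.pi * gd a b c v : ℝ) : ℂ) =
    ∫ t : ℝ, Complex.exp (-(Complex.I * v * t)) * g2 a b c t := by
  obtain ⟨r2, r3, r4, r5, r6⟩ := JJ_vals v
  have h0 := JJ_zero v
  have e : (fun t : ℝ => Complex.exp (-(Complex.I * v * t)) * g2 a b c t) =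
      fun t => gw v 0 t + (-(Complex.I * a / 6)) * gw v 3 t + (b / 24 : ℂ) * gw v 4 t
        + (-(c / 72 : ℂ)) * gw v 6 t := by
    funext t
    unfold g2 gw
    rw [show -(t^2)/2 = -(1/2) * t ^ 2 by ring]
    ring
  have i1 := int_gw v 0
  have i3 := (int_gw v 3).const_mul (-(Complex.I * a / 6))
  have i4 := (int_gw v 4).const_mul (b / 24 : ℂ)
  have i6 := (int_gw v 6).const_mul (-(c / 72 : ℂ))
  have j1 : Integrable fun t => gw v 0 t + (-(Complex.I * a / 6)) * gw v 3 t := i1.add i3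
  have j2 : Integrable fun t => gw v 0 t + (-(Complex.I * a / 6)) * gw v 3 t + (b / 24 : ℂ) * gw v 4 t :=
    j1.add i4
  rw [e, integral_add j2 i6, integral_add j1 i4, integral_add i1 i3, integral_const_mul, integral_const_mul,
    integral_const_mul]
  change _ = JJ v 0 + _ * JJ v 3 + _ * JJ v 4 + _ * JJ v 6
  rw [h0, r3, r4, r6]
  unfold gd
  push_cast
  linear_combination (2 * Real.pi * gaussD v * (a * (v ^ 3 - 3 * v)) / 6) * Complex.I_sq

/-- universal Gaussian constant -/
noncomputable def CG : ℝ := ∫ t : ℝ, (1 + |t|) ^ 6 * Real.exp (-(1/4) * t ^ 2)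

lemma int_CG (b : ℝ) (hb : 0 < b) : Integrable fun t : ℝ => (1 + |t|) ^ 6 * Real.exp (-b * t ^ 2) := by
  have h0 := (integrable_exp_neg_mul_sq hb)
  have h6 := int_pow_gauss hb 6
  have := (h0.add h6).const_mul (2 ^ 6)
  refine this.mono (by fun_prop) (ae_of_all _ fun t => ?_)
  have e : (1 + |t|) ^ 6 ≤ 2 ^ 6 * (1 + t ^ 6) := by
    have t0 := abs_nonneg t
    have e6 : t ^ 6 = |t| ^ 6 := by rw [← abs_pow, abs_of_nonneg (by positivity)]
    rw [e6]
    rcases le_total |t| 1 with h | h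
    · calc (1 + |t|) ^ 6 ≤ (1 + 1) ^ 6 := by gcongr
        _ ≤ _ := by have := pow_nonneg t0 6; linarith
    · calc (1 + |t|) ^ 6 ≤ (|t| + |t|) ^ 6 := by gcongr
        _ = 2 ^ 6 * |t| ^ 6 := by ring
        _ ≤ _ := by linarith
  have x0 := Real.exp_pos (-b * t ^ 2)
  have hL : ‖(1 + |t|) ^ 6 * Real.exp (-b * t ^ 2)‖ = (1 + |t|) ^ 6 * Real.exp (-b * t ^ 2) :=
    Real.norm_of_nonneg (by positivity)
  simp only [Pi.add_apply]
  rw [hL]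
  refine le_trans ?_ (Real.le_norm_self _)
  have := mul_le_mul_of_nonneg_right e x0.le
  linarith

lemma pow_CG (k : ℕ) (hk : k ≤ 6) : ∫ t : ℝ, |t| ^ k * Real.exp (-(1/2) * t ^ 2) ≤ CG := by
  unfold CG
  apply integral_mono_of_nonneg (ae_of_all _ fun t => by positivity) (int_CG _ (by norm_num))
  refine ae_of_all _ fun t => ?_
  have t0 := abs_nonneg t
  have e1 : |t| ^ k ≤ (1 + |t|) ^ 6 :=
    (pow_le_pow_left₀ t0 (by linarith) k).trans (pow_le_pow_right₀ (by linarith) hk)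
  have e2 : Real.exp (-(1/2) * t^2) ≤ Real.exp (-(1/4) * t ^ 2) :=
    Real.exp_le_exp.2 (by nlinarith [sq_nonneg t])
  simp only
  gcongr

lemma CG_nonneg : 0 ≤ CG := integral_nonneg fun t => by positivity

lemma herm_bd {k : ℕ} (hk : k ≤ 6) {v P : ℝ} (h : ‖JJ v k‖ = |2 * Real.pi * gaussD v * P|) :
    |gaussD v * P| ≤ CG := by
  have a := (norm_JJ v k).trans (pow_CG k hk)
  rw [h, mul_assoc, abs_mul, abs_of_pos (by positivity : 0 < 2 * Real.pi)] at a
  have := Real.pi_gt_three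
  nlinarith [abs_nonneg (gaussD v * P)]

lemma herm (v : ℝ) : |gaussD v * (v ^ 2 - 1)| ≤ CG ∧ |gaussD v * (v ^ 3 - 3 * v)| ≤ CG ∧
    |gaussD v * (v ^ 4 - 6 * v ^ 2 + 3)| ≤ CG ∧ |gaussD v * (v ^ 5 - 10 * v ^ 3 + 15 * v)| ≤ CG ∧
    |gaussD v * (v ^ 6 - 15 * v ^ 4 + 45 * v ^ 2 - 15)| ≤ CG ∧ |gaussD v * 1| ≤ CG := by
  obtain ⟨r2, r3, r4, r5, r6⟩ := JJ_vals v
  have h0 := JJ_zero v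
  refine ⟨herm_bd (k := 2) (by norm_num) ?_, herm_bd (k := 3) (by norm_num) ?_,
    herm_bd (k := 4) (by norm_num) ?_, herm_bd (k := 5) (by norm_num) ?_,
    herm_bd (k := 6) (by norm_num) ?_, herm_bd (k := 0) (by norm_num) ?_⟩
  · rw [r2, Complex.norm_real, norm_neg, Real.norm_eq_abs]
  · rw [r3, norm_mul, Complex.norm_I, one_mul, Complex.norm_real, Real.norm_eq_abs]
  · rw [r4, Complex.norm_real, Real.norm_eq_abs]
  · rw [r5, norm_mul, Complex.norm_I, one_mul, Complex.norm_real, norm_neg, Real.norm_eq_abs]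
  · rw [r6, Complex.norm_real, norm_neg, Real.norm_eq_abs]
  · rw [h0, Complex.norm_real, Real.norm_eq_abs, mul_one]

lemma gd_bd (a b c v : ℝ) : |gd a b c v| ≤ CG * (1 + |a| + |b| + |c|) := by
  obtain ⟨h2, h3, h4, h5, h6, h0⟩ := herm v
  have : gd a b c v = gaussD v * 1 + a * ((gaussD v * (v ^ 3 - 3 * v)) / 6) +
    b * ((gaussD v * (v ^ 4 - 6 * v ^ 2 + 3)) / 24) +
    c * ((gaussD v * (v ^ 6 - 15 * v ^ 4 + 45 * v ^ 2 - 15)) / 72) := by unfold gd; ring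
  rw [this]
  have C0 := CG_nonneg
  have f : ∀ (s X N : ℝ), 1 ≤ N → |X| ≤ CG → |s * (X / N)| ≤ CG * |s| := by
    intro s X N hN hX
    rw [abs_mul, abs_div, abs_of_pos (by linarith : 0 < N), mul_comm]
    gcongr
    exact (div_le_self (abs_nonneg _) hN).trans hX
  have a1 := f a _ 6 (by norm_num) h3
  have a2 := f b _ 24 (by norm_num) h4
  have a3 := f c _ 72 (by norm_num) h6
  have t1 := abs_add_three (gaussD v * 1) (a * ((gaussD v * (v ^ 3 - 3 * v)) / 6))
    (b * ((gaussD v * (v ^ 4 - 6 * v ^ 2 + 3)) / 24))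
  refine (abs_add_le _ _).trans ?_
  linarith

lemma GG_bd (a b c v : ℝ) : |GG a b c v| ≤ 1 + CG * (|a| + |b| + |c|) := by
  obtain ⟨h2, h3, h4, h5, h6, h0⟩ := herm v
  have : GG a b c v = gaussCDF v - (a * ((gaussD v * (v ^ 2 - 1)) / 6) +
    b * ((gaussD v * (v ^ 3 - 3 * v)) / 24) +
    c * ((gaussD v * (v ^ 5 - 10 * v ^ 3 + 15 * v)) / 72)) := by unfold GG; ring
  rw [this]
  have C0 := CG_nonneg
  have f : ∀ (s X N : ℝ), 1 ≤ N → |X| ≤ CG → |s * (X / N)| ≤ CG * |s| := by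
    intro s X N hN hX
    rw [abs_mul, abs_div, abs_of_pos (by linarith : 0 < N), mul_comm]
    gcongr
    exact (div_le_self (abs_nonneg _) hN).trans hX
  have a1 := f a _ 6 (by norm_num) h2
  have a2 := f b _ 24 (by norm_num) h3
  have a3 := f c _ 72 (by norm_num) h5
  have t1 := abs_add_three (a * ((gaussD v * (v ^ 2 - 1)) / 6))
    (b * ((gaussD v * (v ^ 3 - 3 * v)) / 24)) (c * ((gaussD v * (v ^ 5 - 10 * v ^ 3 + 15 * v)) / 72))
  have p1 := gaussCDF_nonneg v
  have p2 := gaussCDF_le_one v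
  refine (abs_sub _ _).trans ?_
  rw [abs_of_nonneg p1]
  linarith

lemma GG_lip (a b c u v : ℝ) : |GG a b c u - GG a b c v| ≤ CG * (1 + |a| + |b| + |c|) * |u - v| := by
  have := Convex.norm_image_sub_le_of_norm_hasDerivWithin_le (f := GG a b c) (f' := gd a b c)
    (s := Set.univ) (x := v) (y := u) (C := CG * (1 + |a| + |b| + |c|))
    (fun x _ => (GG_deriv a b c x).hasDerivWithinAt) (fun x _ => gd_bd a b c x) convex_univ
    trivial trivial
  simpa using this

lemma gaussCDF_atBot : Tendsto gaussCDF atBot (𝓝 0) := by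
  have h : Tendsto (fun x : ℝ => 2 * Real.exp (-(x^2)/4)) atBot (𝓝 0) := by
    have : Tendsto (fun x : ℝ => -(x^2)/4) atBot atBot := by
      have h1 : Tendsto (fun x : ℝ => x ^ 2) atBot atTop := by
        have := (tendsto_pow_atTop (α := ℝ) (n := 2) (by norm_num)).comp tendsto_neg_atBot_atTop
        refine this.congr fun x => ?_
        simp
      exact (tendsto_neg_atTop_atBot.comp h1).atBot_div_const (by norm_num)
    have := (Real.tendsto_exp_atBot.comp this).const_mul 2
    simpa using this
  refine squeeze_zero' (Eventually.of_forall gaussCDF_nonneg) ?_ h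
  filter_upwards [eventually_le_atBot 0] with x hx
  have := tail_left (u := -x) (by linarith)
  simpa using this

lemma pow_gaussD_atBot (k : ℕ) : Tendsto (fun x => x ^ k * gaussD x) atBot (𝓝 0) := by
  have h := tendsto_rpow_abs_mul_exp_neg_mul_sq_cocompact (a := 1/2) (by norm_num) (k:ℝ)
  have h' := (h.mono_left _root_.atBot_le_cocompact).const_mul (Real.sqrt (2 * Real.pi))⁻¹
  rw [mul_zero] at h'
  rw [tendsto_zero_iff_abs_tendsto_zero]
  refine h'.congr fun x => ?_
  have := sqrt2pi_pos
  simp only [Function.comp, Real.rpow_natCast]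
  rw [abs_mul, abs_pow, abs_of_pos (gaussD_pos x)]
  unfold gaussD
  rw [show -(x^2)/2 = -(1/2) * x ^ 2 by ring]
  ring

lemma GG_atBot (a b c : ℝ) : Tendsto (GG a b c) atBot (𝓝 0) := by
  have h0 := pow_gaussD_atBot 0
  have h1 := pow_gaussD_atBot 1
  have h2 := pow_gaussD_atBot 2
  have h3 := pow_gaussD_atBot 3
  have h5 := pow_gaussD_atBot 5
  have := gaussCDF_atBot.sub (((h2.sub h0).const_mul (a/6)).add ((h3.sub (h1.const_mul 3)).const_mul (b/24))
    |>.add (((h5.sub (h3.const_mul 10)).add (h1.const_mul 15)).const_mul (c/72)))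
  simp only [mul_zero, sub_zero, add_zero] at this
  refine this.congr fun x => ?_
  unfold GG
  ring

end gaussb
end RankEdge

namespace RankEdge

lemma inv_bound {D D' : ℝ → ℝ} {w : ℝ → ℂ} {m : ℝ → ℝ} (hd : ∀ v, HasDerivAt D (D' v) v)
    (hc : Continuous D') (hw : Integrable w)
    (hf : ∀ v : ℝ, ((2 * Real.pi * D' v : ℝ) : ℂ) = ∫ t : ℝ, Complex.exp (-(Complex.I * v * t)) * w t)
    (hm : Integrable m) (hm0 : ∀ t, 0 ≤ m t) (hb : ∀ t, ‖w t‖ ≤ |t| * m t)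
    (h0 : Filter.Tendsto D Filter.atBot (nhds 0)) (z : ℝ) :
    |D z| ≤ (∫ t, m t) / Real.pi := by
  have key : ∀ z', |D z - D z'| ≤ (∫ t, m t) / Real.pi := by
    intro z'
    have e1 : ∫ v in z'..z, D' v = D z - D z' :=
      intervalIntegral.integral_eq_sub_of_hasDerivAt (fun v _ => hd v) (hc.intervalIntegrable _ _)
    have e2 : ((2 * Real.pi * (D z - D z') : ℝ) : ℂ) =
        ∫ v in z'..z, ∫ t : ℝ, Complex.exp (-(Complex.I * v * t)) * w t := by
      rw [← e1, ← intervalIntegral.integral_const_mul, ← intervalIntegral.integral_ofReal]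
      exact intervalIntegral.integral_congr fun v _ => hf v
    have hI : Integrable (Function.uncurry fun (v t : ℝ) => Complex.exp (-(Complex.I * v * t)) * w t)
        ((volume.restrict (Set.uIoc z' z)).prod volume) := by
      have : IsFiniteMeasure (volume.restrict (Set.uIoc z' z)) := ⟨by simp [Set.uIoc]⟩
      have i1 : Integrable (fun _ : ℝ => (1:ℂ)) (volume.restrict (Set.uIoc z' z)) :=
        integrable_const _
      have i2 := i1.mul_prod hw
      refine i2.bdd_mul (c := 1) (f := fun p : ℝ × ℝ => Complex.exp (-(Complex.I * p.1 * p.2))) ?_ ?_ |>.congr ?_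
      · exact (by fun_prop : Continuous fun p : ℝ × ℝ => Complex.exp (-(Complex.I * p.1 * p.2))).aestronglyMeasurable
      · refine ae_of_all _ fun p => ?_
        rw [show -(Complex.I * p.1 * p.2) = ((-(p.1 * p.2) : ℝ) : ℂ) * Complex.I by push_cast; ring,
          Complex.norm_exp_ofReal_mul_I]
      · refine ae_of_all _ fun p => ?_
        simp [Function.uncurry]
    rw [intervalIntegral_integral_swap hI] at e2
    have e3 : ‖((2 * Real.pi * (D z - D z') : ℝ) : ℂ)‖ ≤ ∫ t, 2 * m t := by
      rw [e2]
      refine norm_integral_le_of_norm_le (hm.const_mul 2) (ae_of_all _ fun t => ?_)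
      rw [intervalIntegral.integral_mul_const, norm_mul]
      by_cases ht : t = 0
      · have : w t = 0 := by
          have := hb t
          rw [ht] at this ⊢
          simpa using this
        rw [this]; simpa using hm0 t
      · have e4 : ∫ v in z'..z, Complex.exp (-(Complex.I * v * t)) =
            (Complex.exp (-(Complex.I * t) * z) - Complex.exp (-(Complex.I * t) * z')) / (-(Complex.I * t)) := by
          rw [← integral_exp_mul_complex (by simp [ht])]
          refine intervalIntegral.integral_congr fun v _ => ?_
          congr 1; ring
        have nn : ∀ u : ℝ, ‖Complex.exp (-(Complex.I * t) * u)‖ = 1 := fun u => by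
          rw [show -(Complex.I * t) * u = ((-(t * u) : ℝ) : ℂ) * Complex.I by push_cast; ring,
            Complex.norm_exp_ofReal_mul_I]
        have e5 : ‖∫ v in z'..z, Complex.exp (-(Complex.I * v * t))‖ ≤ 2 / |t| := by
          rw [e4, norm_div, norm_neg, norm_mul, Complex.norm_I, one_mul, Complex.norm_real, Real.norm_eq_abs]
          have := norm_sub_le (Complex.exp (-(Complex.I * t) * z)) (Complex.exp (-(Complex.I * t) * z'))
          rw [nn, nn] at this
          gcongr; linarith
        have tp : 0 < |t| := abs_pos.2 ht
        calc _ ≤ 2 / |t| * (|t| * m t) := mul_le_mul e5 (hb t) (norm_nonneg _) (by positivity)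
          _ = 2 * m t := by field_simp
    rw [Complex.norm_real, Real.norm_eq_abs, abs_mul, abs_of_pos (by positivity : 0 < 2 * Real.pi),
      integral_const_mul] at e3
    rw [le_div_iff₀ Real.pi_pos]
    linarith
  have lim : Filter.Tendsto (fun z' => |D z - D z'|) Filter.atBot (nhds |D z - 0|) :=
    (tendsto_const_nhds.sub h0).abs
  rw [sub_zero] at lim
  exact le_of_tendsto' lim key

lemma gauss_four_scaled {h : ℝ} (hh : 0 < h) (u : ℝ) :
    ∫ t : ℝ, Complex.exp (-(Complex.I * u * t)) * (Real.exp (-(h ^ 2 / 2) * t ^ 2) : ℂ) =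
      ((2 * Real.pi * (gaussD (u / h) / h) : ℝ) : ℂ) := by
  have e := Measure.integral_comp_mul_left (gw (u / h) 0) h
  have e0 : ∫ y, gw (u / h) 0 y = ((2 * Real.pi * gaussD (u / h) : ℝ) : ℂ) := JJ_zero _
  rw [e0, abs_of_pos (by positivity)] at e
  have e1 : (fun t : ℝ => Complex.exp (-(Complex.I * u * t)) * (Real.exp (-(h ^ 2 / 2) * t ^ 2) : ℂ)) =
      fun t => gw (u / h) 0 (h * t) := by
    funext t
    unfold gw
    rw [pow_zero, mul_one]
    congr 2
    · push_cast
      have : (h : ℂ) ≠ 0 := by exact_mod_cast hh.ne'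
      field_simp
    · congr 1; ring
  rw [e1, e, Complex.real_smul]
  push_cast
  field_simp

lemma norm_g2 (a b c t : ℝ) : ‖g2 a b c t‖ ≤ (1 + |a| + |b| + |c|) * ((1 + |t|) ^ 6 * Real.exp (-(1/2) * t ^ 2)) := by
  unfold g2
  rw [norm_mul, Complex.norm_real, Real.norm_of_nonneg (Real.exp_pos _).le,
    show -(t^2)/2 = -(1/2) * t ^ 2 by ring]
  have t0 := abs_nonneg t
  have p : ∀ k ≤ 6, |t| ^ k ≤ (1 + |t|) ^ 6 := fun k hk =>
    (pow_le_pow_left₀ t0 (by linarith) k).trans (pow_le_pow_right₀ (by linarith) hk)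
  have q : ‖(1 - Complex.I * a * t ^ 3 / 6 + b * t ^ 4 / 24 - c * t ^ 6 / 72 : ℂ)‖ ≤
      1 + |a| * |t| ^ 3 + |b| * |t| ^ 4 + |c| * |t| ^ 6 := by
    have n1 : ‖(Complex.I * a * t ^ 3 / 6 : ℂ)‖ ≤ |a| * |t| ^ 3 := by
      simp only [norm_div, norm_mul, norm_pow, Complex.norm_I, Complex.norm_real, Real.norm_eq_abs]
      norm_num
      have := mul_nonneg (abs_nonneg a) (pow_nonneg t0 3)
      linarith
    have n2 : ‖(b * t ^ 4 / 24 : ℂ)‖ ≤ |b| * |t| ^ 4 := by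
      simp only [norm_div, norm_mul, norm_pow, Complex.norm_real, Real.norm_eq_abs, Complex.norm_ofNat]
      have := mul_nonneg (abs_nonneg b) (pow_nonneg t0 4)
      linarith
    have n3 : ‖(c * t ^ 6 / 72 : ℂ)‖ ≤ |c| * |t| ^ 6 := by
      simp only [norm_div, norm_mul, norm_pow, Complex.norm_real, Real.norm_eq_abs, Complex.norm_ofNat]
      have := mul_nonneg (abs_nonneg c) (pow_nonneg t0 6)
      linarith
    refine (norm_sub_le _ _).trans (add_le_add ((norm_add_le _ _).trans (add_le_add ((norm_sub_le _ _).trans (add_le_add ?_ n1)) n2)) n3)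
    simp
  have p0 := p 0 (by norm_num)
  have p3 := mul_le_mul_of_nonneg_left (p 3 (by norm_num)) (abs_nonneg a)
  have p4 := mul_le_mul_of_nonneg_left (p 4 (by norm_num)) (abs_nonneg b)
  have p6 := mul_le_mul_of_nonneg_left (p 6 (by norm_num)) (abs_nonneg c)
  rw [pow_zero] at p0
  have := mul_le_mul_of_nonneg_left (q.trans (by linarith : _ ≤ (1 + |a| + |b| + |c|) * (1 + |t|) ^ 6))
    (Real.exp_pos (-(1/2) * t ^ 2)).le
  linarith

/-- the majorant -/
noncomputable def maj (t0 t1 h M η L : ℝ) (t : ℝ) : ℝ :=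
  (Set.Icc (-t0) t0).indicator (fun _ => M + h ^ 2 * t0) t + (Set.Icc (-t1) t1).indicator (fun _ => η) t
    + Real.exp (-(h ^ 2 * t1 ^ 2 / 4)) * Real.exp (-(h ^ 2 / 4) * t ^ 2)
    + L * Real.exp (-(t0 ^ 2 / 4)) * ((1 + |t|) ^ 6 * Real.exp (-(1/4) * t ^ 2))

lemma maj_bd {t0 t1 h M η a b c : ℝ} {φ : ℝ → ℂ} (h0 : 1 ≤ t0) (h1' : 0 ≤ t1) (hM : 0 ≤ M) (hη : 0 ≤ η)
    (hφ : ∀ t, ‖φ t‖ ≤ 1) (H1 : ∀ t, |t| ≤ t0 → ‖φ t - g2 a b c t‖ ≤ |t| * M)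
    (H2 : ∀ t, t0 ≤ |t| → |t| ≤ t1 → ‖φ t‖ ≤ η) (t : ℝ) :
    ‖φ t * (Real.exp (-(h ^ 2 / 2) * t ^ 2) : ℂ) - g2 a b c t‖ ≤
      |t| * maj t0 t1 h M η (1 + |a| + |b| + |c|) t := by
  have tn := abs_nonneg t
  have ts : t ^ 2 = |t| ^ 2 := (sq_abs t).symm
  set L := 1 + |a| + |b| + |c| with hL
  have L0 : 0 ≤ L := by positivity
  have A3 : 0 ≤ Real.exp (-(h ^ 2 * t1 ^ 2 / 4)) * Real.exp (-(h ^ 2 / 4) * t ^ 2) := by positivity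
  have A4 : 0 ≤ L * Real.exp (-(t0 ^ 2 / 4)) * ((1 + |t|) ^ 6 * Real.exp (-(1/4) * t ^ 2)) := by positivity
  have A2 : 0 ≤ (Set.Icc (-t1) t1).indicator (fun _ => η) t := Set.indicator_nonneg (fun _ _ => hη) t
  have A1 : 0 ≤ (Set.Icc (-t0) t0).indicator (fun _ => M + h ^ 2 * t0) t :=
    Set.indicator_nonneg (fun _ _ => by positivity) t
  unfold maj
  by_cases ht : |t| ≤ t0
  · rw [Set.indicator_of_mem (Set.mem_Icc.2 (abs_le.1 ht))]
    refine le_trans ?_ (mul_le_mul_of_nonneg_left (by linarith : M + h ^ 2 * t0 ≤ _) tn)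
    have e : φ t * (Real.exp (-(h ^ 2 / 2) * t ^ 2) : ℂ) - g2 a b c t =
      (φ t - g2 a b c t) + φ t * ((Real.exp (-(h ^ 2 / 2) * t ^ 2) - 1 : ℝ) : ℂ) := by push_cast; ring
    rw [e]
    refine (norm_add_le _ _).trans ?_
    rw [norm_mul, Complex.norm_real, Real.norm_eq_abs]
    have x1 : Real.exp (-(h ^ 2 / 2) * t ^ 2) ≤ 1 := Real.exp_le_one_iff.2 (by nlinarith [mul_nonneg (sq_nonneg h) (sq_nonneg t)])
    have x2 := Real.add_one_le_exp (-(h ^ 2 / 2) * t ^ 2)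
    rw [abs_of_nonpos (by linarith)]
    have x3 : ‖φ t‖ * -(Real.exp (-(h ^ 2 / 2) * t ^ 2) - 1) ≤ 1 * (h ^ 2 / 2 * t ^ 2) :=
      mul_le_mul (hφ t) (by linarith) (by linarith) zero_le_one
    have x4 : h ^ 2 * t ^ 2 ≤ h ^ 2 * (|t| * t0) := by
      refine mul_le_mul_of_nonneg_left ?_ (sq_nonneg h)
      rw [ts, sq]; exact mul_le_mul_of_nonneg_left ht tn
    have x5 : 0 ≤ h ^ 2 * (|t| * t0) := by positivity
    have := H1 t ht
    nlinarith
  · push Not at ht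
    have t1' : 1 ≤ |t| := by linarith
    have g := norm_g2 a b c t
    have ge : Real.exp (-(1/2) * t ^ 2) ≤ Real.exp (-(t0 ^ 2 / 4)) * Real.exp (-(1/4) * t ^ 2) := by
      rw [← Real.exp_add]; apply Real.exp_le_exp.2; rw [ts]; nlinarith
    have g' : ‖g2 a b c t‖ ≤ L * Real.exp (-(t0 ^ 2 / 4)) * ((1 + |t|) ^ 6 * Real.exp (-(1/4) * t ^ 2)) := by
      refine g.trans ?_
      calc _ ≤ L * ((1 + |t|) ^ 6 * (Real.exp (-(t0 ^ 2 / 4)) * Real.exp (-(1/4) * t ^ 2))) := by gcongr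
        _ = _ := by ring
    have ex : ‖φ t * (Real.exp (-(h ^ 2 / 2) * t ^ 2) : ℂ)‖ ≤ (Set.Icc (-t1) t1).indicator (fun _ => η) t
       + Real.exp (-(h ^ 2 * t1 ^ 2 / 4)) * Real.exp (-(h ^ 2 / 4) * t ^ 2) := by
      rw [norm_mul, Complex.norm_real, Real.norm_of_nonneg (Real.exp_pos _).le]
      by_cases h1 : |t| ≤ t1
      · rw [Set.indicator_of_mem (Set.mem_Icc.2 (abs_le.1 h1))]
        have x1 : Real.exp (-(h ^ 2 / 2) * t ^ 2) ≤ 1 := Real.exp_le_one_iff.2 (by nlinarith [mul_nonneg (sq_nonneg h) (sq_nonneg t)])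
        have := mul_le_mul (H2 t ht.le h1) x1 (Real.exp_pos _).le hη
        linarith
      · push Not at h1
        have x1 : Real.exp (-(h ^ 2 / 2) * t ^ 2) ≤ Real.exp (-(h ^ 2 * t1 ^ 2 / 4)) * Real.exp (-(h ^ 2 / 4) * t ^ 2) := by
          rw [← Real.exp_add]; apply Real.exp_le_exp.2
          have : h ^ 2 * t1 ^ 2 ≤ h ^ 2 * t ^ 2 := by
            rw [ts]; gcongr
          linarith
        have := mul_le_mul (hφ t) x1 (Real.exp_pos _).le zero_le_one
        linarith
    have tot := (norm_sub_le (φ t * (Real.exp (-(h ^ 2 / 2) * t ^ 2) : ℂ)) (g2 a b c t)).trans (add_le_add ex g')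
    refine (tot.trans ?_).trans (le_mul_of_one_le_left (by linarith) t1')
    linarith

end RankEdge

namespace RankEdge

lemma maj_int {t0 t1 h M η L : ℝ} (hh : 0 < h) : Integrable (maj t0 t1 h M η L) := by
  unfold maj
  have i1 : Integrable (fun t => (Set.Icc (-t0) t0).indicator (fun _ => M + h ^ 2 * t0) t) :=
    (integrable_indicator_iff measurableSet_Icc).2 (integrableOn_const (by simp))
  have i2 : Integrable (fun t => (Set.Icc (-t1) t1).indicator (fun _ => η) t) :=
    (integrable_indicator_iff measurableSet_Icc).2 (integrableOn_const (by simp))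
  have i3 : Integrable (fun t : ℝ => Real.exp (-(h ^ 2 * t1 ^ 2 / 4)) * Real.exp (-(h ^ 2 / 4) * t ^ 2)) :=
    (integrable_exp_neg_mul_sq (by positivity)).const_mul _
  have i4 : Integrable (fun t : ℝ => L * Real.exp (-(t0 ^ 2 / 4)) * ((1 + |t|) ^ 6 * Real.exp (-(1/4) * t ^ 2))) :=
    (int_CG _ (by norm_num)).const_mul _
  exact ((i1.add i2).add i3).add i4

lemma maj_nonneg {t0 t1 h M η L : ℝ} (h0 : 0 ≤ t0) (hM : 0 ≤ M) (hη : 0 ≤ η) (hL : 0 ≤ L) (t : ℝ) :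
    0 ≤ maj t0 t1 h M η L t := by
  have A2 : 0 ≤ (Set.Icc (-t1) t1).indicator (fun _ => η) t := Set.indicator_nonneg (fun _ _ => hη) t
  have A1 : 0 ≤ (Set.Icc (-t0) t0).indicator (fun _ => M + h ^ 2 * t0) t :=
    Set.indicator_nonneg (fun _ _ => by positivity) t
  unfold maj
  positivity

lemma maj_integral {t0 t1 h M η L : ℝ} (hh : 0 < h) (h0 : 0 ≤ t0) (h1 : 0 ≤ t1) :
    ∫ t, maj t0 t1 h M η L t = 2 * t0 * (M + h ^ 2 * t0) + 2 * t1 * η +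
      Real.exp (-(h ^ 2 * t1 ^ 2 / 4)) * (2 * Real.sqrt Real.pi / h) + L * Real.exp (-(t0 ^ 2 / 4)) * CG := by
  unfold maj
  have i1 : Integrable (fun t => (Set.Icc (-t0) t0).indicator (fun _ => M + h ^ 2 * t0) t) :=
    (integrable_indicator_iff measurableSet_Icc).2 (integrableOn_const (by simp))
  have i2 : Integrable (fun t => (Set.Icc (-t1) t1).indicator (fun _ => η) t) :=
    (integrable_indicator_iff measurableSet_Icc).2 (integrableOn_const (by simp))
  have i3 : Integrable (fun t : ℝ => Real.exp (-(h ^ 2 * t1 ^ 2 / 4)) * Real.exp (-(h ^ 2 / 4) * t ^ 2)) :=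
    (integrable_exp_neg_mul_sq (by positivity)).const_mul _
  have i4 : Integrable (fun t : ℝ => L * Real.exp (-(t0 ^ 2 / 4)) * ((1 + |t|) ^ 6 * Real.exp (-(1/4) * t ^ 2))) :=
    (int_CG _ (by norm_num)).const_mul _
  have i12 : Integrable (fun t => (Set.Icc (-t0) t0).indicator (fun _ => M + h ^ 2 * t0) t +
    (Set.Icc (-t1) t1).indicator (fun _ => η) t) := i1.add i2
  have i123 : Integrable (fun t => (Set.Icc (-t0) t0).indicator (fun _ => M + h ^ 2 * t0) t +
    (Set.Icc (-t1) t1).indicator (fun _ => η) t + Real.exp (-(h ^ 2 * t1 ^ 2 / 4)) * Real.exp (-(h ^ 2 / 4) * t ^ 2)) := i12.add i3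
  rw [integral_add i123 i4, integral_add i12 i3, integral_add i1 i2, integral_const_mul, integral_const_mul,
    integral_indicator measurableSet_Icc, integral_indicator measurableSet_Icc, setIntegral_const, setIntegral_const,
    integral_gaussian]
  have e : Real.sqrt (Real.pi / (h ^ 2 / 4)) = 2 * Real.sqrt Real.pi / h := by
    rw [show Real.pi / (h ^ 2 / 4) = Real.pi * (2 / h) ^ 2 by field_simp; ring, Real.sqrt_mul Real.pi_pos.le,
      Real.sqrt_sq (by positivity)]
    ring
  rw [e]
  have v : ∀ u : ℝ, 0 ≤ u → volume.real (Set.Icc (-u) u) = 2 * u := fun u hu => by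
    rw [Measure.real, Real.volume_Icc, ENNReal.toReal_ofReal (by linarith)]; ring
  rw [v _ h0, v _ h1]
  simp only [smul_eq_mul]
  unfold CG
  ring

variable {n : ℕ}

/-- characteristic function -/
noncomputable def chf (T : Equiv.Perm (Fin n) → ℝ) (t : ℝ) : ℂ :=
  EC (fun π => Complex.exp (Complex.I * ((t * T π : ℝ) : ℂ)))

lemma norm_chf (T : Equiv.Perm (Fin n) → ℝ) (t : ℝ) : ‖chf T t‖ ≤ 1 := by
  refine (norm_EC_le' (g := fun _ => 1) fun π => ?_).trans (PE_const 1).le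
  rw [mul_comm, Complex.norm_exp_ofReal_mul_I]

/-- smoothed distribution function -/
noncomputable def Hs (T : Equiv.Perm (Fin n) → ℝ) (h z : ℝ) : ℝ := permExp fun π => gaussCDF ((z - T π) / h)

lemma Hs_deriv (T : Equiv.Perm (Fin n) → ℝ) {h : ℝ} (hh : 0 < h) (z : ℝ) :
    HasDerivAt (Hs T h) (permExp fun π => gaussD ((z - T π) / h) / h) z := by
  unfold Hs permExp
  refine HasDerivAt.div_const (HasDerivAt.fun_sum fun π _ => ?_) _
  have := (gaussCDF_deriv ((z - T π) / h)).comp z (((hasDerivAt_id z).sub_const (T π)).div_const h)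
  rw [mul_one_div] at this
  exact this

lemma Hs_four (T : Equiv.Perm (Fin n) → ℝ) {h : ℝ} (hh : 0 < h) (v : ℝ) :
    ((2 * Real.pi * permExp (fun π => gaussD ((v - T π) / h) / h) : ℝ) : ℂ) =
      ∫ t : ℝ, Complex.exp (-(Complex.I * v * t)) * (chf T t * (Real.exp (-(h ^ 2 / 2) * t ^ 2) : ℂ)) := by
  have ig : ∀ u : ℝ, Integrable (fun t : ℝ => Complex.exp (-(Complex.I * u * t)) * (Real.exp (-(h ^ 2 / 2) * t ^ 2) : ℂ)) := by
    intro u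
    have i0 := (integrable_exp_neg_mul_sq (b := h ^ 2 / 2) (by positivity)).ofReal (𝕜 := ℂ)
    refine i0.bdd_mul (c := 1) (by fun_prop) (ae_of_all _ fun t => ?_)
    rw [show -(Complex.I * u * t) = ((-(u * t) : ℝ) : ℂ) * Complex.I by push_cast; ring,
      Complex.norm_exp_ofReal_mul_I]
  have e : (fun t : ℝ => Complex.exp (-(Complex.I * v * t)) * (chf T t * (Real.exp (-(h ^ 2 / 2) * t ^ 2) : ℂ))) =
      fun t : ℝ => (∑ π, Complex.exp (-(Complex.I * ((v - T π : ℝ) : ℂ) * t)) * (Real.exp (-(h ^ 2 / 2) * t ^ 2) : ℂ)) / (Nat.factorial n : ℂ) := by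
    funext t
    unfold chf EC
    rw [← Finset.sum_mul, div_mul_eq_mul_div, ← mul_div_assoc, ← mul_assoc, Finset.mul_sum]
    congr 2
    refine Finset.sum_congr rfl fun π _ => ?_
    rw [← Complex.exp_add]
    congr 1
    push_cast; ring
  rw [e, integral_div, integral_finsetSum _ fun π _ => ig _]
  simp only [gauss_four_scaled hh]
  rw [← PE_mul, ← EC_ofReal]
  rfl

lemma Hs_atBot (T : Equiv.Perm (Fin n) → ℝ) {h : ℝ} (hh : 0 < h) :
    Filter.Tendsto (Hs T h) Filter.atBot (nhds 0) := by
  have : Filter.Tendsto (Hs T h) Filter.atBot (nhds ((∑ _π : Equiv.Perm (Fin n), (0:ℝ)) / (Nat.factorial n : ℝ))) := by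
    unfold Hs permExp
    refine Filter.Tendsto.div_const (tendsto_finsetSum _ fun π _ => ?_) _
    exact gaussCDF_atBot.comp ((Filter.tendsto_atBot_add_const_right _ (-T π) Filter.tendsto_id).atBot_div_const hh)
  simpa using this

lemma cont_chf (T : Equiv.Perm (Fin n) → ℝ) : Continuous (chf T) := by
  unfold chf EC
  fun_prop

lemma cont_g2 (a b c : ℝ) : Continuous (g2 a b c) := by
  unfold g2
  fun_prop

lemma int_g2 (a b c : ℝ) : Integrable (fun t : ℝ => g2 a b c t) :=
  ((int_CG (1/2) (by norm_num)).const_mul _).mono' (cont_g2 a b c).aestronglyMeasurable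
    (ae_of_all _ fun t => norm_g2 a b c t)

lemma Hs_bound (T : Equiv.Perm (Fin n) → ℝ) {t0 t1 h M η a b c : ℝ} (hh : 0 < h) (h0 : 1 ≤ t0) (h1 : 0 ≤ t1)
    (hM : 0 ≤ M) (hη : 0 ≤ η)
    (H1 : ∀ t, |t| ≤ t0 → ‖chf T t - g2 a b c t‖ ≤ |t| * M)
    (H2 : ∀ t, t0 ≤ |t| → |t| ≤ t1 → ‖chf T t‖ ≤ η) (z : ℝ) :
    |Hs T h z - GG a b c z| ≤ 2 * t0 * (M + h ^ 2 * t0) + 2 * t1 * η +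
      (4 / h) * Real.exp (-(h ^ 2 * t1 ^ 2 / 4)) + CG * (1 + |a| + |b| + |c|) * Real.exp (-(t0 ^ 2 / 4)) := by
  have i1 : Integrable (fun t : ℝ => chf T t * (Real.exp (-(h ^ 2 / 2) * t ^ 2) : ℂ)) := by
    have i0 := (integrable_exp_neg_mul_sq (b := h ^ 2 / 2) (by positivity)).ofReal (𝕜 := ℂ)
    exact i0.bdd_mul (c := 1) (cont_chf T).aestronglyMeasurable (ae_of_all _ fun t => norm_chf T t)
  have bm : ∀ (v : ℝ) {w : ℝ → ℂ}, Integrable w → Integrable (fun t : ℝ => Complex.exp (-(Complex.I * v * t)) * w t) := by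
    intro v w hw
    refine hw.bdd_mul (c := 1) (by fun_prop) (ae_of_all _ fun t => ?_)
    rw [show -(Complex.I * v * t) = ((-(v * t) : ℝ) : ℂ) * Complex.I by push_cast; ring,
      Complex.norm_exp_ofReal_mul_I]
  have key := inv_bound (D := fun z => Hs T h z - GG a b c z)
    (w := fun t => chf T t * (Real.exp (-(h ^ 2 / 2) * t ^ 2) : ℂ) - g2 a b c t)
    (fun v => (Hs_deriv T hh v).sub (GG_deriv a b c v))
    (by
      refine Continuous.sub ?_ (cont_gd a b c)
      unfold permExp
      have := cont_gaussD
      fun_prop)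
    (i1.sub (int_g2 a b c))
    (fun v => by
      have e := integral_sub (bm v i1) (bm v (int_g2 a b c))
      rw [← gd_four, ← Hs_four T hh] at e
      simp only [mul_sub]
      rw [e]; push_cast; ring)
    (maj_int (t0 := t0) (t1 := t1) (M := M) (η := η) (L := 1 + |a| + |b| + |c|) hh)
    (maj_nonneg (by linarith) hM hη (by positivity))
    (maj_bd h0 h1 hM hη (norm_chf T) H1 H2)
    (by simpa using (Hs_atBot T hh).sub (GG_atBot a b c)) z
  rw [maj_integral hh (by linarith) h1] at key
  have t00 : 0 ≤ t0 := by linarith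
  have C0 := CG_nonneg
  refine key.trans ((div_le_self (by positivity) (by linarith [Real.pi_gt_three])).trans ?_)
  have sp : Real.sqrt Real.pi ≤ 2 := Real.sqrt_le_iff.2 ⟨by norm_num, by linarith [Real.pi_lt_four]⟩
  have : 2 * Real.sqrt Real.pi / h ≤ 4 / h := by gcongr; linarith
  have := mul_le_mul_of_nonneg_left this (Real.exp_pos (-(h ^ 2 * t1 ^ 2 / 4))).le
  linarith

theorem smoothing (T : Equiv.Perm (Fin n) → ℝ) {t0 t1 h ℓ M η a b c : ℝ} (hh : 0 < h) (hl : 0 < ℓ) (h0 : 1 ≤ t0) (h1 : 0 ≤ t1)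
    (hM : 0 ≤ M) (hη : 0 ≤ η)
    (H1 : ∀ t, |t| ≤ t0 → ‖chf T t - g2 a b c t‖ ≤ |t| * M)
    (H2 : ∀ t, t0 ≤ |t| → |t| ≤ t1 → ‖chf T t‖ ≤ η) (z : ℝ) :
    |permExp (fun π => if T π ≤ z then (1 : ℝ) else 0) - GG a b c z| ≤ 2 * t0 * (M + h ^ 2 * t0) + 2 * t1 * η +
      (4 / h) * Real.exp (-(h ^ 2 * t1 ^ 2 / 4)) + CG * (1 + |a| + |b| + |c|) * (Real.exp (-(t0 ^ 2 / 4)) + ℓ)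
      + 2 * Real.exp (-((ℓ / h)^2) / 4) := by
  have B := Hs_bound T hh h0 h1 hM hη H1 H2
  have tl := tail_left (u := ℓ / h) (by positivity)
  have tr := tail_right (u := ℓ / h) (by positivity)
  have up : permExp (fun π => if T π ≤ z then (1 : ℝ) else 0) ≤ Hs T h (z + ℓ) + (1 - gaussCDF (ℓ / h)) := by
    unfold Hs
    rw [← PE_const (n := n) (1 - gaussCDF (ℓ / h)), ← PE_add]
    refine PE_mono fun π => ?_
    split_ifs with q
    · have := gaussCDF_mono (show ℓ / h ≤ (z + ℓ - T π) / h by gcongr; linarith)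
      linarith
    · have := gaussCDF_nonneg ((z + ℓ - T π) / h)
      have := gaussCDF_le_one (ℓ / h)
      linarith
  have dn : Hs T h (z - ℓ) ≤ permExp (fun π => if T π ≤ z then (1 : ℝ) else 0) + gaussCDF (-(ℓ / h)) := by
    unfold Hs
    rw [← PE_const (n := n) (gaussCDF (-(ℓ / h))), ← PE_add]
    refine PE_mono fun π => ?_
    split_ifs with q
    · have := gaussCDF_nonneg (-(ℓ / h))
      have := gaussCDF_le_one ((z - ℓ - T π) / h)
      linarith
    · have := gaussCDF_mono (show (z - ℓ - T π) / h ≤ -(ℓ / h) by rw [← neg_div]; gcongr; linarith)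
      linarith
  have B1 := abs_le.1 (B (z + ℓ))
  have B2 := abs_le.1 (B (z - ℓ))
  have L1 := abs_le.1 (GG_lip a b c (z + ℓ) z)
  have L2 := abs_le.1 (GG_lip a b c (z - ℓ) z)
  rw [add_sub_cancel_left, abs_of_pos hl] at L1
  rw [sub_sub_cancel_left, abs_neg, abs_of_pos hl] at L2
  rw [abs_le]
  constructor <;> linarith [B1.1, B1.2, B2.1, B2.2, L1.1, L1.2, L2.1, L2.2]

end RankEdge

namespace RankEdge
variable {n p : ℕ}

/-- swap increment -/
noncomputable def dl (x y : Fin n → ℝ) (f g : Fin p → Fin n) (l : Fin p) (π : Equiv.Perm (Fin n)) : ℝ :=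
  (x (f l) - x (g l)) * (y (π (f l)) - y (π (g l)))

lemma cos_avg (τ r d : ℝ) : Complex.exp (Complex.I * ((τ * r : ℝ) : ℂ)) + Complex.exp (Complex.I * ((τ * (r - d) : ℝ) : ℂ)) =
    2 * (((Real.cos (τ * d / 2) : ℝ) : ℂ) * Complex.exp (Complex.I * ((τ * (r - d / 2) : ℝ) : ℂ))) := by
  have e1 : Complex.I * ((τ * r : ℝ) : ℂ) = ((τ * d / 2 : ℝ) : ℂ) * Complex.I + Complex.I * ((τ * (r - d / 2) : ℝ) : ℂ) := by
    push_cast; ring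
  have e2 : Complex.I * ((τ * (r - d) : ℝ) : ℂ) = -((τ * d / 2 : ℝ) : ℂ) * Complex.I + Complex.I * ((τ * (r - d / 2) : ℝ) : ℂ) := by
    push_cast; ring
  rw [Complex.ofReal_cos, Complex.cos, e1, e2, Complex.exp_add, Complex.exp_add]
  ring

lemma sym_step (x y : Fin n → ℝ) (τ : ℝ) (f g : Fin p → Fin n) (hf : Function.Injective f)
    (hg : Function.Injective g) (hfg : ∀ l l', f l ≠ g l') (s : Finset (Fin p)) :
    ph τ x y = EC (fun π => ((∏ l ∈ s, Real.cos (τ * dl x y f g l π / 2) : ℝ) : ℂ) *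
      Complex.exp (Complex.I * ((τ * (S x y π - ∑ l ∈ s, dl x y f g l π / 2) : ℝ) : ℂ))) := by
  induction s using Finset.induction_on with
  | empty => simp [ph]; congr 1; funext π; simp [ex]
  | insert a s ha ih =>
    set F := fun π : Equiv.Perm (Fin n) => ((∏ l ∈ s, Real.cos (τ * dl x y f g l π / 2) : ℝ) : ℂ) *
      Complex.exp (Complex.I * ((τ * (S x y π - ∑ l ∈ s, dl x y f g l π / 2) : ℝ) : ℂ)) with hF
    have h1 := EC_comp F (Equiv.swap (f a) (g a))
    have inv : ∀ l ∈ s, ∀ π : Equiv.Perm (Fin n), dl x y f g l (π * Equiv.swap (f a) (g a)) = dl x y f g l π := by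
      intro l hl π
      have hne : l ≠ a := fun h => ha (h ▸ hl)
      unfold dl
      rw [Equiv.Perm.mul_apply, Equiv.Perm.mul_apply,
        Equiv.swap_apply_of_ne_of_ne (hf.ne hne) (hfg l a),
        Equiv.swap_apply_of_ne_of_ne (hfg a l).symm (hg.ne hne)]
    have h2 : 2 * ph τ x y = EC (fun π => F π + F (π * Equiv.swap (f a) (g a))) := by
      rw [EC_add, h1, ← ih]; ring
    have h3 : (fun π => F π + F (π * Equiv.swap (f a) (g a))) = fun π => 2 *
      (((∏ l ∈ insert a s, Real.cos (τ * dl x y f g l π / 2) : ℝ) : ℂ) *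
      Complex.exp (Complex.I * ((τ * (S x y π - ∑ l ∈ insert a s, dl x y f g l π / 2) : ℝ) : ℂ))) := by
      funext π
      simp only [hF]
      have p1 : ∏ l ∈ s, Real.cos (τ * dl x y f g l (π * Equiv.swap (f a) (g a)) / 2) =
          ∏ l ∈ s, Real.cos (τ * dl x y f g l π / 2) := Finset.prod_congr rfl fun l hl => by rw [inv l hl π]
      have p2 : ∑ l ∈ s, dl x y f g l (π * Equiv.swap (f a) (g a)) / 2 =
          ∑ l ∈ s, dl x y f g l π / 2 := Finset.sum_congr rfl fun l hl => by rw [inv l hl π]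
      rw [p1, p2, S_swap, Finset.prod_insert ha, Finset.sum_insert ha, ← mul_add]
      have := cos_avg τ (S x y π - ∑ l ∈ s, dl x y f g l π / 2) (dl x y f g a π)
      have e1 : S x y π - (x (f a) - x (g a)) * (y (π (f a)) - y (π (g a))) - ∑ l ∈ s, dl x y f g l π / 2 =
        S x y π - ∑ l ∈ s, dl x y f g l π / 2 - dl x y f g a π := by unfold dl; ring
      have e2 : S x y π - (dl x y f g a π / 2 + ∑ l ∈ s, dl x y f g l π / 2) =
        S x y π - ∑ l ∈ s, dl x y f g l π / 2 - dl x y f g a π / 2 := by ring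
      rw [e1, e2, this]
      push_cast
      ring
    rw [h3, EC_mul] at h2
    exact mul_left_cancel₀ two_ne_zero h2

lemma seq_step (x y : Fin n → ℝ) (τ ρ : ℝ) (f g : Fin p → Fin n) (hf : Function.Injective f)
    (hg : Function.Injective g) (hfg : ∀ l l', f l ≠ g l') (hρ0 : 0 ≤ ρ) (hρ1 : ρ ≤ 1)
    (hρ : ∀ l, ∀ J : Finset (Fin n), n ≤ #J + 2 * p → ρ * (n : ℝ) ^ 2 ≤
      ∑ a ∈ J, ∑ b ∈ J, (1 - |Real.cos (τ * ((x (f l) - x (g l)) * (y a - y b)) / 2)|))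
    (s : Finset (Fin p)) :
    permExp (fun π => ∏ l ∈ s, |Real.cos (τ * dl x y f g l π / 2)|) ≤ (1 - ρ) ^ #s := by
  induction s using Finset.induction_on with
  | empty => simp [PE_const]
  | insert a s ha ih =>
    set P := fun π : Equiv.Perm (Fin n) => ∏ l ∈ s, |Real.cos (τ * dl x y f g l π / 2)| with hP
    have P0 : ∀ π, 0 ≤ P π := fun π => Finset.prod_nonneg fun _ _ => abs_nonneg _
    set R : Finset (Fin n) := univ \ (s.image f ∪ s.image g) with hR
    set G := fun u v : Fin n => |Real.cos (τ * ((x (f a) - x (g a)) * (y u - y v)) / 2)| with hG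
    have G1 : ∀ u v, G u v ≤ 1 := fun u v => Real.abs_cos_le_one _
    have Gd : ∀ u, G u u = 1 := fun u => by simp [hG]
    have fa : f a ∈ R := by
      simp only [hR, mem_sdiff, mem_univ, mem_union, mem_image, true_and, not_or, not_exists, not_and]
      exact ⟨fun l hl h => ha (hf h ▸ hl), fun l hl h => hfg _ _ h.symm⟩
    have ga : g a ∈ R := by
      simp only [hR, mem_sdiff, mem_univ, mem_union, mem_image, true_and, not_or, not_exists, not_and]
      exact ⟨fun l hl h => hfg _ _ h, fun l hl h => ha (hg h ▸ hl)⟩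
    have fR : ∀ l ∈ s, f l ∉ R := fun l hl => by
      simp only [hR, mem_sdiff, mem_univ, mem_union, mem_image, true_and, not_not]
      exact Or.inl ⟨l, hl, rfl⟩
    have gR : ∀ l ∈ s, g l ∉ R := fun l hl => by
      simp only [hR, mem_sdiff, mem_univ, mem_union, mem_image, true_and, not_not]
      exact Or.inr ⟨l, hl, rfl⟩
    have cR : n ≤ #R + 2 * p := by
      have h1 : #(s.image f ∪ s.image g) ≤ 2 * p := by
        have := Finset.card_union_le (s.image f) (s.image g)
        have := Finset.card_image_le (s := s) (f := f)
        have := Finset.card_image_le (s := s) (f := g)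
        have := s.card_le_univ
        rw [Fintype.card_fin] at this
        omega
      have h2 := Finset.card_sdiff_add_card_eq_card (Finset.subset_univ (s.image f ∪ s.image g))
      rw [← hR, Finset.card_univ, Fintype.card_fin] at h2
      omega
    have fixed : ∀ r ∈ R, ∀ q ∈ R, ∀ i, i ∉ R → relPerm (f a) (g a) r q i = i := by
      intro r hr q hq i hi
      have n1 : i ≠ f a := fun h => hi (h ▸ fa)
      have n2 : i ≠ r := fun h => hi (h ▸ hr)
      have n3 : i ≠ q := fun h => hi (h ▸ hq)
      have n4 : i ≠ g a := fun h => hi (h ▸ ga)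
      simp only [relPerm, Equiv.Perm.mul_apply]
      rw [Equiv.swap_apply_of_ne_of_ne n1 n2, Equiv.swap_apply_of_ne_of_ne n3]
      rw [Equiv.swap_apply_def]
      split_ifs <;> assumption
    have eqv : ∀ r ∈ R, ∀ q ∈ R, r ≠ q →
        permExp (fun π => P π * G (π r) (π q)) = permExp (fun π => P π * G (π (f a)) (π (g a))) := by
      intro r hr q hq hrq
      rw [← PE_comp (fun π => P π * G (π (f a)) (π (g a))) (relPerm (f a) (g a) r q)]
      congr 1
      funext π
      congr 1
      · refine Finset.prod_congr rfl fun l hl => ?_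
        unfold dl
        rw [Equiv.Perm.mul_apply, Equiv.Perm.mul_apply, fixed r hr q hq _ (fR l hl), fixed r hr q hq _ (gR l hl)]
      · rw [Equiv.Perm.mul_apply, Equiv.Perm.mul_apply, relPerm_left (hfg a a) hrq, relPerm_right]
    set X := permExp (fun π => P π * G (π (f a)) (π (g a))) with hX
    have tot : permExp (fun π => ∑ r ∈ R, ∑ q ∈ R, P π * G (π r) (π q)) =
        ((#R : ℝ) ^ 2 - #R) * X + #R * permExp P := by
      rw [PE_sum]
      have : ∀ r ∈ R, permExp (fun π => ∑ q ∈ R, P π * G (π r) (π q)) = ((#R : ℝ) - 1) * X + permExp P := by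
        intro r hr
        rw [PE_sum, ← Finset.add_sum_erase R _ hr]
        simp only [Gd, mul_one]
        rw [Finset.sum_congr rfl fun q hq => eqv r hr q (Finset.mem_of_mem_erase hq) (Finset.ne_of_mem_erase hq).symm,
          Finset.sum_const, Finset.card_erase_of_mem hr, nsmul_eq_mul,
          Nat.cast_sub (Finset.card_pos.2 ⟨r, hr⟩), Nat.cast_one]
        exact add_comm _ _
      rw [Finset.sum_congr rfl this, Finset.sum_const, nsmul_eq_mul]
      ring
    have bd : permExp (fun π => ∑ r ∈ R, ∑ q ∈ R, P π * G (π r) (π q)) ≤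
        ((#R : ℝ) ^ 2 - ρ * (n : ℝ) ^ 2) * permExp P := by
      rw [← PE_mul]
      refine PE_mono fun π => ?_
      simp only [← Finset.mul_sum]
      rw [mul_comm]
      refine mul_le_mul_of_nonneg_right ?_ (P0 π)
      have h := hρ a (R.map π.toEmbedding) (by rw [Finset.card_map]; exact cR)
      rw [Finset.sum_map] at h
      simp only [Finset.sum_map, Equiv.coe_toEmbedding] at h
      have e : ∑ r ∈ R, ∑ q ∈ R, (1 - G (π r) (π q)) = (#R : ℝ) ^ 2 - ∑ r ∈ R, ∑ q ∈ R, G (π r) (π q) := by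
        simp only [Finset.sum_sub_distrib, Finset.sum_const, nsmul_eq_mul, mul_one]
        ring
      have h' : ρ * (n : ℝ) ^ 2 ≤ ∑ r ∈ R, ∑ q ∈ R, (1 - G (π r) (π q)) := h
      rw [e] at h'
      linarith
    rw [tot] at bd
    have r2 : (2 : ℝ) ≤ #R := by
      have : 2 ≤ #R := by
        rw [← Finset.card_pair (hfg a a)]
        exact Finset.card_le_card (by intro i hi; rcases Finset.mem_insert.1 hi with h | h; exact h ▸ fa; exact (Finset.mem_singleton.1 h) ▸ ga)
      exact_mod_cast this
    have rn : (#R : ℝ) ≤ n := by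
      have := R.card_le_univ
      rw [Fintype.card_fin] at this
      exact_mod_cast this
    have PP : 0 ≤ permExp P := PE_nonneg P0
    have key : X ≤ (1 - ρ) * permExp P := by
      have q0 : (0:ℝ) < (#R : ℝ) ^ 2 - #R := by nlinarith
      have q1 : (#R : ℝ) ^ 2 - #R ≤ (n : ℝ) ^ 2 := by nlinarith
      refine le_of_mul_le_mul_left ?_ q0
      have := mul_le_mul_of_nonneg_left q1 hρ0
      have := mul_le_mul_of_nonneg_right this PP
      linarith
    have fin : permExp (fun π => ∏ l ∈ insert a s, |Real.cos (τ * dl x y f g l π / 2)|) = X := by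
      rw [hX]
      congr 1
      funext π
      rw [Finset.prod_insert ha, mul_comm]
      rfl
    rw [fin, Finset.card_insert_of_notMem ha, pow_succ, mul_comm]
    exact key.trans (mul_le_mul_of_nonneg_left ih (by linarith))

theorem decay_core (x y : Fin n → ℝ) (τ ρ : ℝ) (f g : Fin p → Fin n) (hf : Function.Injective f)
    (hg : Function.Injective g) (hfg : ∀ l l', f l ≠ g l') (hρ0 : 0 ≤ ρ) (hρ1 : ρ ≤ 1)
    (hρ : ∀ l, ∀ J : Finset (Fin n), n ≤ #J + 2 * p → 2 * ρ * (n : ℝ) ^ 2 ≤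
      ∑ a ∈ J, ∑ b ∈ J, Real.sin (τ * (x (f l) - x (g l)) * (y a - y b) / 2) ^ 2) :
    ‖ph τ x y‖ ≤ Real.exp (-(ρ * p)) := by
  rw [sym_step x y τ f g hf hg hfg univ]
  refine (norm_EC_le' (g := fun π => ∏ l, |Real.cos (τ * dl x y f g l π / 2)|) fun π => ?_).trans ?_
  · rw [norm_mul, Complex.norm_real, mul_comm Complex.I, Complex.norm_exp_ofReal_mul_I, mul_one,
      Real.norm_eq_abs, Finset.abs_prod]
  refine (seq_step x y τ ρ f g hf hg hfg hρ0 hρ1 (fun l J hJ => ?_) univ).trans ?_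
  · have := hρ l J hJ
    have h2 : ∑ a ∈ J, ∑ b ∈ J, Real.sin (τ * (x (f l) - x (g l)) * (y a - y b) / 2) ^ 2 ≤
        2 * ∑ a ∈ J, ∑ b ∈ J, (1 - |Real.cos (τ * ((x (f l) - x (g l)) * (y a - y b)) / 2)|) := by
      simp only [Finset.mul_sum]
      refine Finset.sum_le_sum fun a _ => Finset.sum_le_sum fun b _ => ?_
      rw [mul_assoc τ, Real.sin_sq, ← sq_abs]
      have := Real.abs_cos_le_one (τ * ((x (f l) - x (g l)) * (y a - y b)) / 2)
      nlinarith [sq_nonneg (1 - |Real.cos (τ * ((x (f l) - x (g l)) * (y a - y b)) / 2)|)]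
    linarith
  · rw [Finset.card_univ, Fintype.card_fin, mul_comm ρ, ← mul_neg, Real.exp_nat_mul]
    refine pow_le_pow_left₀ (by linarith) ?_ _
    have := Real.add_one_le_exp (-ρ)
    linarith

end RankEdge

namespace RankEdge
variable {n p : ℕ}

lemma trunc {s D ε : ℝ} (hs : 2 < s) (hε : 0 < ε) :
    ∃ K : ℝ, 1 ≤ K ∧ ∀ (n : ℕ) (z : Fin n → ℝ), ∑ j, |z j| ^ s ≤ D * n →
      ∑ j with K < |z j|, z j ^ 2 ≤ ε * n := by
  have lim : Filter.Tendsto (fun K : ℝ => K ^ (-(s - 2)) * D) Filter.atTop (nhds (0 * D)) :=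
    (tendsto_rpow_neg_atTop (by linarith)).mul_const D
  rw [zero_mul] at lim
  obtain ⟨K, hK1, hK⟩ := ((Filter.eventually_ge_atTop (1:ℝ)).and (lim.eventually (gt_mem_nhds hε))).exists
  refine ⟨K, hK1, fun n z hz => ?_⟩
  have K0 : 0 < K := by linarith
  have pt : ∀ j, K < |z j| → z j ^ 2 ≤ |z j| ^ s * K ^ (-(s - 2)) := by
    intro j hj
    have z0 : 0 < |z j| := K0.trans hj
    have e : z j ^ 2 = |z j| ^ s * |z j| ^ (-(s - 2)) := by
      rw [← Real.rpow_add z0, show s + -(s - 2) = ((2 : ℕ) : ℝ) by push_cast; ring, Real.rpow_natCast, sq_abs]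
    rw [e]
    refine mul_le_mul_of_nonneg_left ?_ (by positivity)
    exact Real.rpow_le_rpow_of_nonpos K0 hj.le (by linarith)
  calc ∑ j with K < |z j|, z j ^ 2 ≤ ∑ j with K < |z j|, |z j| ^ s * K ^ (-(s - 2)) :=
        Finset.sum_le_sum fun j hj => pt j (Finset.mem_filter.1 hj).2
    _ ≤ ∑ j, |z j| ^ s * K ^ (-(s - 2)) :=
        Finset.sum_le_sum_of_subset_of_nonneg (Finset.filter_subset _ _) fun j _ _ => by positivity
    _ = (∑ j, |z j| ^ s) * K ^ (-(s - 2)) := by rw [Finset.sum_mul]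
    _ ≤ D * n * K ^ (-(s - 2)) := mul_le_mul_of_nonneg_right hz (by positivity)
    _ = K ^ (-(s - 2)) * D * n := by ring
    _ ≤ ε * n := by gcongr

lemma trunc_card {z : Fin n → ℝ} {K ε : ℝ} (hK : 1 ≤ K) (h : ∑ j with K < |z j|, z j ^ 2 ≤ ε * n) :
    (#{j | K < |z j|} : ℝ) ≤ ε * n := by
  refine le_trans ?_ h
  rw [← nsmul_one, ← Finset.sum_const]
  refine Finset.sum_le_sum fun j hj => ?_
  have := (Finset.mem_filter.1 hj).2
  rw [← sq_abs]
  nlinarith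

lemma sin_sq_lower {θ : ℝ} (h : |θ| ≤ Real.pi / 2) : 4 / Real.pi ^ 2 * θ ^ 2 ≤ Real.sin θ ^ 2 := by
  have := Real.mul_abs_le_abs_sin h
  have p := Real.pi_pos
  have h2 := pow_le_pow_left₀ (by positivity) this 2
  rw [sq_abs, mul_pow, sq_abs, div_pow] at h2
  linarith

lemma good_card {z : Fin n → ℝ} {K ε κ : ℝ} (hT : (#{j | K < |z j|} : ℝ) ≤ ε * n) {J : Finset (Fin n)}
    (hJ : (n : ℝ) - #J ≤ κ * n) :
    (n : ℝ) - #(J.filter fun j => |z j| ≤ K) ≤ (ε + κ) * n := by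
  have h1 : J ⊆ (J.filter fun j => |z j| ≤ K) ∪ univ.filter fun j => K < |z j| := by
    intro j hj
    simp only [mem_union, mem_filter, mem_univ, true_and]
    rcases le_or_gt |z j| K with h | h
    · exact Or.inl ⟨hj, h⟩
    · exact Or.inr h
  have h2 := (Finset.card_le_card h1).trans (Finset.card_union_le _ _)
  have h3 : (#J : ℝ) ≤ #(J.filter fun j => |z j| ≤ K) + #{j | K < |z j|} := by exact_mod_cast h2
  linarith

lemma sin_small {z : Fin n → ℝ} {K ε κ b u : ℝ} (hK : 1 ≤ K) (hb : 0 < b) (hz : ∑ j, z j = 0) (hz2 : b * n ≤ ∑ j, z j ^ 2)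
    (hT : ∑ j with K < |z j|, z j ^ 2 ≤ ε * n) (hε : ε ≤ b / 16) (hε' : ε ≤ 1 / 4)
    (hκ : κ * K ^ 2 ≤ b / 16) (hκ' : κ ≤ 1 / 4) {J : Finset (Fin n)}
    (hJ : (n : ℝ) - #J ≤ κ * n) (hu : |u| * K ≤ Real.pi / 2) :
    u ^ 2 / Real.pi ^ 2 * (b * n ^ 2 / 2) ≤ ∑ a ∈ J, ∑ c ∈ J, Real.sin (u * (z a - z c) / 2) ^ 2 := by
  have n0 : (0 : ℝ) ≤ n := Nat.cast_nonneg n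
  set G := J.filter fun j => |z j| ≤ K with hG
  have c1 := good_card (trunc_card hK hT) hJ
  rw [← hG] at c1
  have cG : (n : ℝ) / 2 ≤ #G := by nlinarith
  have cGn : (#G : ℝ) ≤ n := by
    have := G.card_le_univ
    rw [Fintype.card_fin] at this
    exact_mod_cast this
  have cJc : (#(univ \ J) : ℝ) ≤ κ * n := by
    have h2 := Finset.card_sdiff_add_card_eq_card (Finset.subset_univ J)
    rw [Finset.card_univ, Fintype.card_fin] at h2
    have : (#(univ \ J) : ℝ) + #J = n := by exact_mod_cast h2
    linarith
  have tail : ∑ j ∈ univ \ G, z j ^ 2 ≤ b / 8 * n := by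
    have sub : univ \ G ⊆ (univ.filter fun j => K < |z j|) ∪ (univ \ J).filter fun j => |z j| ≤ K := by
      intro j hj
      simp only [hG, mem_sdiff, mem_univ, mem_filter, true_and, not_and, mem_union] at hj ⊢
      rcases le_or_gt |z j| K with h | h
      · exact Or.inr ⟨fun hJ' => hj hJ' h, h⟩
      · exact Or.inl h
    have h1 : ∑ j ∈ (univ \ J).filter (fun j => |z j| ≤ K), z j ^ 2 ≤ κ * n * K ^ 2 := by
      calc _ ≤ ∑ j ∈ (univ \ J).filter (fun j => |z j| ≤ K), K ^ 2 := by
            refine Finset.sum_le_sum fun j hj => ?_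
            rw [← sq_abs]
            exact pow_le_pow_left₀ (abs_nonneg _) (Finset.mem_filter.1 hj).2 2
        _ ≤ ∑ j ∈ univ \ J, K ^ 2 :=
            Finset.sum_le_sum_of_subset_of_nonneg (Finset.filter_subset _ _) fun _ _ _ => by positivity
        _ = #(univ \ J) * K ^ 2 := by rw [Finset.sum_const, nsmul_eq_mul]
        _ ≤ _ := by gcongr
    have h2 := Finset.sum_le_sum_of_subset_of_nonneg (f := fun j => z j ^ 2) sub fun _ _ _ => sq_nonneg _
    have h3 := Finset.sum_union_inter (s₁ := univ.filter fun j => K < |z j|)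
      (s₂ := (univ \ J).filter fun j => |z j| ≤ K) (f := fun j => z j ^ 2)
    have h4 : 0 ≤ ∑ j ∈ (univ.filter fun j => K < |z j|) ∩ (univ \ J).filter fun j => |z j| ≤ K, z j ^ 2 :=
      Finset.sum_nonneg fun _ _ => sq_nonneg _
    have h5 := mul_le_mul_of_nonneg_right hκ n0
    have h6 := mul_le_mul_of_nonneg_right hε n0
    nlinarith
  have sp2 := Finset.sum_sdiff (f := fun j => z j ^ 2) (Finset.subset_univ G)
  have sp1 := Finset.sum_sdiff (f := fun j => z j) (Finset.subset_univ G)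
  have v2 : b * n - b / 8 * n ≤ ∑ j ∈ G, z j ^ 2 := by linarith
  have v1 : (∑ j ∈ G, z j) ^ 2 ≤ n * (b / 8 * n) := by
    have e : ∑ j ∈ G, z j = -∑ j ∈ univ \ G, z j := by linarith
    rw [e, neg_sq]
    refine sq_sum_le_card_mul_sum_sq.trans ?_
    have : (#(univ \ G) : ℝ) ≤ n := by
      have := (univ \ G).card_le_univ
      rw [Fintype.card_fin] at this
      exact_mod_cast this
    exact mul_le_mul this tail (Finset.sum_nonneg fun _ _ => sq_nonneg _) n0
  have dbl : ∑ a ∈ G, ∑ c ∈ G, (z a - z c) ^ 2 = 2 * (#G * ∑ j ∈ G, z j ^ 2) - 2 * (∑ j ∈ G, z j) ^ 2 := by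
    simp only [sub_sq, Finset.sum_add_distrib, Finset.sum_sub_distrib, Finset.sum_const, nsmul_eq_mul]
    have : ∑ a ∈ G, ∑ c ∈ G, 2 * z a * z c = 2 * (∑ j ∈ G, z j) ^ 2 := by
      rw [sq, Finset.sum_mul_sum, Finset.mul_sum]
      refine Finset.sum_congr rfl fun a _ => ?_
      rw [Finset.mul_sum]
      exact Finset.sum_congr rfl fun c _ => by ring
    rw [this, ← Finset.mul_sum]
    ring
  have low : b * n ^ 2 / 2 ≤ ∑ a ∈ G, ∑ c ∈ G, (z a - z c) ^ 2 := by
    rw [dbl]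
    have : (n : ℝ) / 2 * (b * n - b / 8 * n) ≤ #G * ∑ j ∈ G, z j ^ 2 :=
      mul_le_mul cG v2 (by nlinarith [mul_nonneg hb.le n0]) (by positivity)
    nlinarith [mul_nonneg hb.le (mul_nonneg n0 n0)]
  calc u ^ 2 / Real.pi ^ 2 * (b * n ^ 2 / 2) ≤ u ^ 2 / Real.pi ^ 2 * ∑ a ∈ G, ∑ c ∈ G, (z a - z c) ^ 2 := by gcongr
    _ = ∑ a ∈ G, ∑ c ∈ G, u ^ 2 / Real.pi ^ 2 * (z a - z c) ^ 2 := by simp only [Finset.mul_sum]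
    _ ≤ ∑ a ∈ G, ∑ c ∈ G, Real.sin (u * (z a - z c) / 2) ^ 2 := by
        refine Finset.sum_le_sum fun a ha => Finset.sum_le_sum fun c hc => ?_
        have h1 := (Finset.mem_filter.1 ha).2
        have h2 := (Finset.mem_filter.1 hc).2
        have h3 : |z a - z c| ≤ 2 * K := (abs_sub _ _).trans (by linarith)
        refine le_trans (le_of_eq ?_) (sin_sq_lower (θ := u * (z a - z c) / 2) ?_)
        · ring
        · rw [abs_div, abs_mul, abs_two]
          have := mul_le_mul_of_nonneg_left h3 (abs_nonneg u)
          linarith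
    _ ≤ ∑ a ∈ J, ∑ c ∈ J, Real.sin (u * (z a - z c) / 2) ^ 2 := by
        have sub : G ⊆ J := Finset.filter_subset _ _
        refine (Finset.sum_le_sum fun a _ => Finset.sum_le_sum_of_subset_of_nonneg sub fun _ _ _ => sq_nonneg _).trans ?_
        exact Finset.sum_le_sum_of_subset_of_nonneg sub fun _ _ _ => Finset.sum_nonneg fun _ _ => sq_nonneg _

lemma sin_far {θ w : ℝ} (h : ∀ k : ℤ, w < |θ - k * Real.pi|) (hw : 0 ≤ w) : 4 / Real.pi ^ 2 * w ^ 2 ≤ Real.sin θ ^ 2 := by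
  set k := round (θ / Real.pi)
  have p := Real.pi_pos
  have h1 := abs_sub_round (θ / Real.pi)
  have h2 : |θ - k * Real.pi| ≤ Real.pi / 2 := by
    have : θ - k * Real.pi = (θ / Real.pi - k) * Real.pi := by field_simp
    rw [this, abs_mul, abs_of_pos p]
    nlinarith
  have h3 := sin_sq_lower h2
  have e : Real.sin (θ - k * Real.pi) ^ 2 = Real.sin θ ^ 2 := by
    rw [Real.sin_sub_int_mul_pi, mul_pow, ← zpow_natCast, ← zpow_mul]
    have : ((-1 : ℝ)) ^ (k * ((2 : ℕ) : ℤ)) = 1 := by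
      exact Even.neg_one_zpow ⟨k, by push_cast; ring⟩
    rw [this, one_mul]
  rw [e] at h3
  refine le_trans ?_ h3
  have := pow_le_pow_left₀ hw (h k).le 2
  rw [sq_abs] at this
  gcongr

lemma sin_large {y : Fin n → ℝ} {K ε κ δ u w ζ μ : ℝ} (hK : 1 ≤ K) (hδ : 0 < δ) (hζ : 0 < ζ) (hu : 0 < u) (hw : 0 ≤ w) (hw1 : w ≤ 1)
    (hT : (#{j | K < |y j - μ|} : ℝ) ≤ ε * n) (hεκ : ε + κ ≤ δ / 16) (hεκ' : ε + κ ≤ 1 / 2) {J : Finset (Fin n)}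
    (hJ : (n : ℝ) - #J ≤ κ * n)
    (hM : (2 * u * K + 3) * (4 * w / u + 2 * ζ) ≤ δ * n * ζ / 2)
    (hv : ENNReal.ofReal (δ * n * ζ) ≤ volume (⋃ j : Fin n, Metric.ball (y j) ζ)) :
    δ / (4 * Real.pi ^ 2) * n ^ 2 * w ^ 2 ≤ ∑ a ∈ J, ∑ c ∈ J, Real.sin (u * (y a - y c) / 2) ^ 2 := by
  have n0 : (0 : ℝ) ≤ n := Nat.cast_nonneg n
  have pi3 := Real.pi_gt_three
  set G := J.filter fun j => |y j - μ| ≤ K with hG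
  have c1 := good_card (z := fun j => y j - μ) hT hJ
  rw [← hG] at c1
  have cG : (n : ℝ) / 2 ≤ #G := by nlinarith
  have cGc : (#(univ \ G) : ℝ) ≤ δ / 16 * n := by
    have h2 := Finset.card_sdiff_add_card_eq_card (Finset.subset_univ G)
    rw [Finset.card_univ, Fintype.card_fin] at h2
    have : (#(univ \ G) : ℝ) + #G = n := by exact_mod_cast h2
    have := mul_le_mul_of_nonneg_right hεκ n0
    linarith
  have per : ∀ a ∈ G, δ / 8 * n * (4 / Real.pi ^ 2 * w ^ 2) ≤ ∑ c ∈ G, Real.sin (u * (y a - y c) / 2) ^ 2 := by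
    intro a ha
    classical
    set F := G.filter fun c => ∀ k : ℤ, w < |u * (y a - y c) / 2 - k * Real.pi| with hF
    set m : ℤ := ⌊u * K + 1⌋ with hm
    have uK : 0 < u * K := by positivity
    have m0 : 0 ≤ m := Int.floor_nonneg.2 (by linarith)
    have cover : (⋃ j : Fin n, Metric.ball (y j) ζ) ⊆ (⋃ j ∈ (univ \ G) ∪ F, Metric.ball (y j) ζ) ∪
        ⋃ k ∈ Finset.Icc (-m) m, Metric.ball (y a - 2 * Real.pi * k / u) (2 * w / u + ζ) := by
      intro t ht
      obtain ⟨j, hj⟩ := Set.mem_iUnion.1 ht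
      by_cases hjF : j ∈ (univ \ G) ∪ F
      · exact Or.inl (Set.mem_biUnion hjF hj)
      · right
        simp only [mem_union, mem_sdiff, mem_univ, true_and, not_or, not_not, hF, mem_filter, not_and, not_forall, not_lt] at hjF
        obtain ⟨hjG, hk⟩ := hjF
        obtain ⟨k, hk⟩ := hk hjG
        have h1 := (Finset.mem_filter.1 ha).2
        have h2 := (Finset.mem_filter.1 hjG).2
        have h3 : |y a - y j| ≤ 2 * K := by
          have := abs_sub (y a - μ) (y j - μ)
          rw [sub_sub_sub_cancel_right] at this
          linarith
        have h4 : |u * (y a - y j) / 2| ≤ u * K := by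
          rw [abs_div, abs_mul, abs_two, abs_of_pos hu]
          have := mul_le_mul_of_nonneg_left h3 hu.le
          linarith
        have h5 : |(k : ℝ)| ≤ u * K + 1 := by
          have : |(k : ℝ) * Real.pi| ≤ u * K + 1 := by
            have := abs_sub (u * (y a - y j) / 2) (u * (y a - y j) / 2 - k * Real.pi)
            rw [sub_sub_cancel] at this
            linarith
          rw [abs_mul, abs_of_pos Real.pi_pos] at this
          nlinarith [abs_nonneg (k : ℝ)]
        have h6 := abs_le.1 h5
        have hkm : k ∈ Finset.Icc (-m) m := by
          rw [Finset.mem_Icc]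
          constructor
          · rw [neg_le]; exact Int.le_floor.2 (by push_cast; linarith)
          · exact Int.le_floor.2 h6.2
        refine Set.mem_biUnion (x := k) (by exact_mod_cast hkm) ?_
        rw [Metric.mem_ball, Real.dist_eq] at hj ⊢
        have e : t - (y a - 2 * Real.pi * k / u) = (t - y j) - (2 / u) * (u * (y a - y j) / 2 - k * Real.pi) := by
          field_simp; ring
        rw [e]
        have h7 : |(2 / u) * (u * (y a - y j) / 2 - k * Real.pi)| ≤ 2 * w / u := by
          rw [abs_mul, abs_of_pos (by positivity), div_mul_eq_mul_div]
          gcongr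
        have := abs_sub (t - y j) ((2 / u) * (u * (y a - y j) / 2 - k * Real.pi))
        linarith
    have r0 : 0 ≤ 2 * w / u + ζ := by positivity
    have meas : volume (⋃ j : Fin n, Metric.ball (y j) ζ) ≤
        ENNReal.ofReal (#((univ \ G) ∪ F) * (2 * ζ) + #(Finset.Icc (-m) m) * (2 * (2 * w / u + ζ))) := by
      refine (measure_mono cover).trans ((measure_union_le _ _).trans ?_)
      rw [ENNReal.ofReal_add (by positivity) (by positivity)]
      refine add_le_add ((measure_biUnion_finset_le _ _).trans ?_) ((measure_biUnion_finset_le _ _).trans ?_)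
      · simp only [Real.volume_ball, Finset.sum_const, nsmul_eq_mul]
        rw [ENNReal.ofReal_mul (Nat.cast_nonneg _), ENNReal.ofReal_natCast]
      · simp only [Real.volume_ball, Finset.sum_const, nsmul_eq_mul]
        rw [ENNReal.ofReal_mul (Nat.cast_nonneg _), ENNReal.ofReal_natCast]
    have h8 := (ENNReal.ofReal_le_ofReal_iff (by positivity)).1 (hv.trans meas)
    have h9 : (#((univ \ G) ∪ F) : ℝ) ≤ #(univ \ G) + #F := by exact_mod_cast Finset.card_union_le _ _
    have h10 : (#(Finset.Icc (-m) m) : ℝ) ≤ 2 * u * K + 3 := by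
      rw [Int.card_Icc]
      have : ((m + 1 - -m).toNat : ℤ) = 2 * m + 1 := by rw [Int.toNat_of_nonneg (by linarith)]; ring
      have h' : (((m + 1 - -m).toNat : ℤ) : ℝ) = 2 * m + 1 := by rw [this]; push_cast; ring
      rw [Int.cast_natCast] at h'
      rw [h']
      have := Int.floor_le (u * K + 1)
      rw [← hm] at this
      linarith
    have h11 : (#(Finset.Icc (-m) m) : ℝ) * (2 * (2 * w / u + ζ)) ≤ δ * n * ζ / 2 := by
      refine le_trans ?_ hM
      rw [show 2 * (2 * w / u + ζ) = 4 * w / u + 2 * ζ by ring]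
      gcongr
    have h12 : (#((univ \ G) ∪ F) : ℝ) * (2 * ζ) ≤ (δ / 16 * n + #F) * (2 * ζ) := by
      gcongr; linarith
    have h13 : δ / 8 * n ≤ #F := by
      have : δ / 8 * n * (2 * ζ) ≤ #F * (2 * ζ) := by nlinarith [mul_nonneg hδ.le (mul_nonneg n0 hζ.le)]
      exact le_of_mul_le_mul_right this (by positivity)
    calc δ / 8 * n * (4 / Real.pi ^ 2 * w ^ 2) ≤ #F * (4 / Real.pi ^ 2 * w ^ 2) := by gcongr
      _ = ∑ c ∈ F, 4 / Real.pi ^ 2 * w ^ 2 := by rw [Finset.sum_const, nsmul_eq_mul]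
      _ ≤ ∑ c ∈ F, Real.sin (u * (y a - y c) / 2) ^ 2 :=
          Finset.sum_le_sum fun c hc => sin_far (Finset.mem_filter.1 hc).2 hw
      _ ≤ _ := Finset.sum_le_sum_of_subset_of_nonneg (Finset.filter_subset _ _) fun _ _ _ => sq_nonneg _
  calc δ / (4 * Real.pi ^ 2) * n ^ 2 * w ^ 2 = (n / 2) * (δ / 8 * n * (4 / Real.pi ^ 2 * w ^ 2)) := by
        field_simp; ring
    _ ≤ #G * (δ / 8 * n * (4 / Real.pi ^ 2 * w ^ 2)) := by gcongr
    _ = ∑ a ∈ G, (δ / 8 * n * (4 / Real.pi ^ 2 * w ^ 2)) := by rw [Finset.sum_const, nsmul_eq_mul]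
    _ ≤ ∑ a ∈ G, ∑ c ∈ G, Real.sin (u * (y a - y c) / 2) ^ 2 := Finset.sum_le_sum per
    _ ≤ ∑ a ∈ J, ∑ c ∈ J, Real.sin (u * (y a - y c) / 2) ^ 2 := by
        have sub : G ⊆ J := Finset.filter_subset _ _
        refine (Finset.sum_le_sum fun a _ => Finset.sum_le_sum_of_subset_of_nonneg sub fun _ _ _ => sq_nonneg _).trans ?_
        exact Finset.sum_le_sum_of_subset_of_nonneg sub fun _ _ _ => Finset.sum_nonneg fun _ _ => sq_nonneg _

end RankEdge

namespace RankEdge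
variable {n p : ℕ}

lemma pos_select {k E b : ℝ} (hk : 2 < k) (hb : 0 < b) :
    ∃ c C q : ℝ, 0 < c ∧ c ≤ C ∧ 0 < q ∧ ∀ (n : ℕ) (x : Fin n → ℝ), ∑ i, x i = 0 → b * n ≤ ∑ i, x i ^ 2 →
      ∑ i, |x i| ^ k ≤ E * n → q * n ≤ (#{i | c ≤ x i ∧ x i ≤ C} : ℝ) := by
  obtain ⟨K, hK, h1⟩ := trunc (D := E) hk (show 0 < b / 2 by positivity)
  have K0 : 0 < K := by linarith
  obtain ⟨C, hC, h2⟩ := trunc (D := E) hk (show 0 < b / (16 * K) by positivity)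
  have C0 : 0 < C := by linarith
  refine ⟨min (b / (16 * K)) 1, C, b / (8 * K * C), by positivity, (min_le_right _ _).trans hC, by positivity, ?_⟩
  intro n x hx hx2 hxk
  have a1 := h1 n x hxk
  have a2 := h2 n x hxk
  set c := min (b / (16 * K)) 1 with hc
  have c0 : 0 < c := by positivity
  have cle : c ≤ b / (16 * K) := min_le_left _ _
  have s1 : ∑ i, x i ^ 2 ≤ ∑ i with K < |x i|, x i ^ 2 + K * ∑ i, |x i| := by
    rw [Finset.sum_filter, Finset.mul_sum, ← Finset.sum_add_distrib]
    refine Finset.sum_le_sum fun i _ => ?_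
    have := abs_nonneg (x i)
    split_ifs with h
    · nlinarith
    · rw [← sq_abs]; nlinarith
  have s2 : b * n / (2 * K) ≤ ∑ i, |x i| := by
    rw [div_le_iff₀ (by positivity)]; nlinarith
  have s3 : ∑ i, |x i| = 2 * ∑ i, max (x i) 0 := by
    have : ∑ i, |x i| = ∑ i, (2 * max (x i) 0 - x i) := Finset.sum_congr rfl fun i _ => by
      rcases le_total (x i) 0 with h | h
      · rw [abs_of_nonpos h, max_eq_right h]; ring
      · rw [abs_of_nonneg h, max_eq_left h]; ring
    rw [this, Finset.sum_sub_distrib, hx, Finset.mul_sum, sub_zero]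
  have s4 : ∑ i, max (x i) 0 ≤ ∑ i with C < |x i|, x i ^ 2 + c * n + C * (#{i | c ≤ x i ∧ x i ≤ C} : ℝ) := by
    have e1 : c * n = ∑ i : Fin n, c := by simp [mul_comm]
    have e2 : C * (#{i | c ≤ x i ∧ x i ≤ C} : ℝ) = ∑ i, if c ≤ x i ∧ x i ≤ C then C else 0 := by
      rw [← Finset.sum_filter]; simp [mul_comm]
    rw [e1, e2, Finset.sum_filter, ← Finset.sum_add_distrib, ← Finset.sum_add_distrib]
    refine Finset.sum_le_sum fun i _ => ?_
    rcases le_total (x i) 0 with h | h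
    · rw [max_eq_right h]
      have : 0 ≤ if C < |x i| then x i ^ 2 else 0 := by split_ifs <;> positivity
      have : 0 ≤ if c ≤ x i ∧ x i ≤ C then C else 0 := by split_ifs <;> positivity
      linarith
    · rw [max_eq_left h, abs_of_nonneg h]
      split_ifs with p1 p2 p2
      · linarith [p2.2]
      · nlinarith
      · linarith [p2.2]
      · push Not at p2 p1
        have : x i < c := by
          by_contra hh
          push Not at hh
          exact absurd (p2 hh) (not_lt.2 p1)
        linarith
  have n0 : (0:ℝ) ≤ n := Nat.cast_nonneg n
  have s5 : c * n ≤ b / (16 * K) * n := mul_le_mul_of_nonneg_right cle n0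
  have s6 : b * n / (8 * K) ≤ C * (#{i | c ≤ x i ∧ x i ≤ C} : ℝ) := by
    have e1 : b * n / (2 * K) = 8 * (b / (16 * K) * n) := by field_simp; ring
    have e2 : b * n / (8 * K) = 2 * (b / (16 * K) * n) := by field_simp; ring
    rw [e1] at s2
    rw [e2]
    linarith
  have e3 : b / (8 * K * C) * n = (b * n / (8 * K)) / C := by field_simp
  rw [e3, div_le_iff₀ C0]
  linarith

lemma pair_select {k E b : ℝ} (hk : 2 < k) (hb : 0 < b) :
    ∃ c C q : ℝ, 0 < c ∧ c ≤ C ∧ 0 < q ∧ ∀ (n : ℕ) (x : Fin n → ℝ), ∑ i, x i = 0 → b * n ≤ ∑ i, x i ^ 2 →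
      ∑ i, |x i| ^ k ≤ E * n → ∀ p : ℕ, (p : ℝ) ≤ q * n → ∃ f g : Fin p → Fin n, Function.Injective f ∧
        Function.Injective g ∧ (∀ l l', f l ≠ g l') ∧ ∀ l, 2 * c ≤ x (f l) - x (g l) ∧ x (f l) - x (g l) ≤ 2 * C := by
  obtain ⟨c, C, q, hc, hC, hq, H⟩ := pos_select (E := E) hk hb
  refine ⟨c, C, q, hc, hC, hq, fun n x hx hx2 hxk p hp => ?_⟩
  have h1 := H n x hx hx2 hxk
  have h2 := H n (fun i => - x i) (by simp [hx]) (by simpa using hx2) (by simpa using hxk)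
  have g1 : p ≤ #{i | c ≤ x i ∧ x i ≤ C} := by exact_mod_cast hp.trans h1
  have g2 : p ≤ #{i | c ≤ - x i ∧ - x i ≤ C} := by exact_mod_cast hp.trans h2
  obtain ⟨P, hP, cP⟩ := Finset.exists_subset_card_eq g1
  obtain ⟨N, hN, cN⟩ := Finset.exists_subset_card_eq g2
  have mP : ∀ l, c ≤ x (P.orderEmbOfFin cP l) ∧ x (P.orderEmbOfFin cP l) ≤ C := fun l =>
    (Finset.mem_filter.1 (hP (Finset.orderEmbOfFin_mem P cP l))).2
  have mN : ∀ l, c ≤ - x (N.orderEmbOfFin cN l) ∧ - x (N.orderEmbOfFin cN l) ≤ C := fun l =>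
    (Finset.mem_filter.1 (hN (Finset.orderEmbOfFin_mem N cN l))).2
  refine ⟨P.orderEmbOfFin cP, N.orderEmbOfFin cN, (P.orderEmbOfFin cP).injective, (N.orderEmbOfFin cN).injective, ?_, ?_⟩
  · intro l l' h
    have := mP l
    rw [h] at this
    linarith [mN l', this.1, (mN l').1]
  · intro l
    constructor <;> linarith [(mP l).1, (mN l).1, (mP l).2, (mN l).2]

set_option maxHeartbeats 1600000 in
theorem decay {k s E D b δ : ℝ} (hk : 2 < k) (hs : 2 < s) (hb : 0 < b) (hb1 : b ≤ 1) (hδ : 0 < δ) (hδ1 : δ ≤ 1) :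
    ∃ c τ0 c2 : ℝ, ∃ N0 : ℕ, 0 < c ∧ 0 < τ0 ∧ 0 < c2 ∧ ∀ (n : ℕ), N0 ≤ n → 2 ≤ n → ∀ (x y : Fin n → ℝ) (μ ζ : ℝ), ∑ i, x i = 0 →
      b * n ≤ ∑ i, x i ^ 2 → ∑ i, |x i| ^ k ≤ E * n → ∑ i, (y i - μ) = 0 → b * n ≤ ∑ i, (y i - μ) ^ 2 →
      ∑ i, |y i - μ| ^ s ≤ D * n → (n : ℝ) ^ (-(3 : ℝ) / 2) * Real.log n ≤ ζ →
      ENNReal.ofReal (δ * n * ζ) ≤ volume (⋃ j : Fin n, Metric.ball (y j) ζ) → ∀ τ : ℝ,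
      (|τ| ≤ τ0 → ‖ph τ x y‖ ≤ Real.exp (-(c * n * τ ^ 2))) ∧
      (τ0 < |τ| → |τ| ≤ c2 * n → ‖ph τ x y‖ ≤ Real.exp (-(c * Real.log n ^ 2))) := by
  obtain ⟨c1, C1, q, hc1, hC1, hq, H⟩ := pair_select (E := E) hk hb
  have C10 : 0 < C1 := hc1.trans_le hC1
  obtain ⟨K, hK, hT⟩ := trunc (D := D) hs (show 0 < min b δ / 32 by positivity)
  have K0 : 0 < K := by linarith
  have pi3 := Real.pi_gt_three
  have pi0 := Real.pi_pos
  set κ := min b δ / (32 * K ^ 2) with hκ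
  have mb : min b δ ≤ b := min_le_left _ _
  have md : min b δ ≤ δ := min_le_right _ _
  have m0 : 0 < min b δ := by positivity
  have κ0 : 0 < κ := by positivity
  have κK : κ * K ^ 2 = min b δ / 32 := by rw [hκ]; field_simp
  have κle : κ ≤ min b δ / 32 := by rw [← κK]; nlinarith [one_le_pow₀ hK (n := 2)]
  set q' := min q (κ / 2) with hq'
  have q0 : 0 < q' := by positivity
  set τ0 := Real.pi / (4 * C1 * K) with hτ0
  have τ00 : 0 < τ0 := by positivity
  set u0 := 2 * c1 * τ0 with hu0
  have u00 : 0 < u0 := by positivity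
  set cw := δ / (16 * (2 * K + 3 / u0)) with hcw
  have cw0 : 0 < cw := by positivity
  have cw1 : cw ≤ 1 / 2 := by
    rw [hcw, div_le_iff₀ (by positivity)]
    have : 0 < 3 / u0 := by positivity
    linarith
  set r1 := (2 * c1) ^ 2 / Real.pi ^ 2 * (b / 4) with hr1
  set r2 := δ / (8 * Real.pi ^ 2) * cw ^ 2 with hr2
  have r10 : 0 < r1 := by positivity
  have r20 : 0 < r2 := by positivity
  refine ⟨min r1 r2 * (q' / 2), τ0, δ / (64 * C1 * K), ⌈48 / δ⌉₊ + ⌈2 / q'⌉₊, by positivity, τ00, by positivity, ?_⟩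
  intro n hn hn2 x y μ ζ x1 x2 xk y1 y2 ys hζ hv τ
  have n2 : (2:ℝ) ≤ n := by exact_mod_cast hn2
  have n0 : (0:ℝ) < n := by linarith
  have nN : (⌈48 / δ⌉₊ : ℝ) + ⌈2 / q'⌉₊ ≤ n := by exact_mod_cast hn
  have nδ : 48 / δ ≤ n := (Nat.le_ceil _).trans (by have : (0:ℝ) ≤ ⌈2 / q'⌉₊ := Nat.cast_nonneg _
                                                    linarith)
  have nq : 2 / q' ≤ n := (Nat.le_ceil _).trans (by have : (0:ℝ) ≤ ⌈48 / δ⌉₊ := Nat.cast_nonneg _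
                                                    linarith)
  rw [div_le_iff₀ hδ] at nδ
  rw [div_le_iff₀ q0] at nq
  set p := ⌊q' * n⌋₊ with hp
  have p1 : (p : ℝ) ≤ q' * n := Nat.floor_le (by positivity)
  have p2 : q' / 2 * n ≤ p := by
    have := Nat.lt_floor_add_one (q' * n)
    rw [← hp] at this
    linarith
  have qn : q' * n ≤ q * n := mul_le_mul_of_nonneg_right (min_le_left _ _) n0.le
  have qκ : q' * n ≤ κ / 2 * n := mul_le_mul_of_nonneg_right (min_le_right _ _) n0.le
  obtain ⟨f, g, hf, hg, hfg, hd⟩ := H n x x1 x2 xk p (p1.trans qn)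
  have hJ : ∀ J : Finset (Fin n), n ≤ #J + 2 * p → (n : ℝ) - #J ≤ κ * n := by
    intro J hJ
    have : (n : ℝ) ≤ #J + 2 * p := by exact_mod_cast hJ
    linarith
  have hTy := hT n (fun j => y j - μ) ys
  have L0 : 0 ≤ Real.log n := Real.log_nonneg (by linarith)
  constructor
  · intro hτ
    have key := decay_core x y τ (r1 * τ ^ 2) f g hf hg hfg (by positivity) ?_ ?_
    · refine key.trans (Real.exp_le_exp.2 ?_)
      have a1 : min r1 r2 ≤ r1 := min_le_left _ _
      have : min r1 r2 * (q' / 2) * n * τ ^ 2 ≤ r1 * τ ^ 2 * p := by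
        calc min r1 r2 * (q' / 2) * n * τ ^ 2 = min r1 r2 * τ ^ 2 * (q' / 2 * n) := by ring
          _ ≤ r1 * τ ^ 2 * p := by gcongr
      linarith
    · have h1 : 2 * c1 * |τ| ≤ Real.pi / 2 := by
        have : 2 * c1 * |τ| ≤ 2 * C1 * τ0 := by gcongr
        have e : 2 * C1 * τ0 * K = Real.pi / 2 := by rw [hτ0]; field_simp; norm_num
        have h0 : 0 ≤ 2 * C1 * τ0 := by positivity
        have := le_mul_of_one_le_right h0 hK
        linarith
      have h2 := pow_le_pow_left₀ (by positivity) h1 2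
      rw [mul_pow, sq_abs, div_pow] at h2
      have : r1 * τ ^ 2 = ((2 * c1) ^ 2 * τ ^ 2) * (b / (4 * Real.pi ^ 2)) := by rw [hr1]; field_simp
      rw [this]
      calc ((2 * c1) ^ 2 * τ ^ 2) * (b / (4 * Real.pi ^ 2)) ≤ (Real.pi ^ 2 / 2 ^ 2) * (b / (4 * Real.pi ^ 2)) := by gcongr
        _ = b / 16 := by field_simp; norm_num
        _ ≤ 1 := by linarith
    · intro l J hJ'
      obtain ⟨d1, d2⟩ := hd l
      set Δ := x (f l) - x (g l) with hΔ
      have Δ0 : 0 < Δ := by linarith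
      have := sin_small (u := τ * Δ) (z := fun j => y j - μ) (b := b) (κ := κ) hK hb y1 y2 hTy (by linarith) (by linarith)
        (by linarith) (by linarith) (hJ J hJ') ?_
      · refine le_trans ?_ (this.trans (le_of_eq ?_))
        · rw [hr1]
          calc 2 * ((2 * c1) ^ 2 / Real.pi ^ 2 * (b / 4) * τ ^ 2) * (n:ℝ) ^ 2
              = (2 * c1) ^ 2 * (τ ^ 2 / Real.pi ^ 2 * (b * n ^ 2 / 2)) := by ring
            _ ≤ Δ ^ 2 * (τ ^ 2 / Real.pi ^ 2 * (b * n ^ 2 / 2)) := by gcongr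
            _ = _ := by ring
        · refine Finset.sum_congr rfl fun a _ => Finset.sum_congr rfl fun c _ => ?_
          congr 2; ring
      · rw [abs_mul, abs_of_pos Δ0]
        calc |τ| * Δ * K ≤ τ0 * (2 * C1) * K := by gcongr
          _ = Real.pi / 2 := by rw [hτ0]; field_simp; norm_num
  · intro hτ hτn
    have sn : 0 < √(n:ℝ) := by positivity
    have ss : √(n:ℝ) * √(n:ℝ) = n := Real.mul_self_sqrt n0.le
    set w := cw * (Real.log n / √n) with hw
    have w0 : 0 ≤ w := by positivity
    have lg : Real.log n ≤ 2 * √n := by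
      have := Real.log_le_sub_one_of_pos sn
      rw [← ss, Real.log_mul sn.ne' sn.ne', ss]
      linarith
    have w1 : w ≤ 1 := by
      have : Real.log n / √n ≤ 2 := by rw [div_le_iff₀ sn]; exact lg
      have h0 : 0 ≤ Real.log n / √n := by positivity
      calc w ≤ 1 / 2 * 2 := by rw [hw]; gcongr
        _ = 1 := by norm_num
    have wz : Real.log n / √n ≤ n * ζ := by
      have e : (n:ℝ) * ((n : ℝ) ^ (-(3 : ℝ) / 2) * Real.log n) = Real.log n / √n := by
        have e1 : (n:ℝ) * (n:ℝ) ^ (-(3 : ℝ) / 2) = (√(n:ℝ))⁻¹ := by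
          rw [Real.sqrt_eq_rpow, ← Real.rpow_neg n0.le]
          nth_rewrite 1 [← Real.rpow_one (n:ℝ)]
          rw [← Real.rpow_add n0]; norm_num
        rw [← mul_assoc, e1]; field_simp
      rw [← e]; gcongr
    have L1 : 0 < Real.log n := Real.log_pos (by linarith)
    have ζ0 : 0 < ζ := lt_of_lt_of_le (by positivity) hζ
    have key := decay_core x y τ (δ / (8 * Real.pi ^ 2) * w ^ 2) f g hf hg hfg (by positivity) ?_ ?_
    · refine key.trans (Real.exp_le_exp.2 ?_)
      have a1 : min r1 r2 ≤ r2 := min_le_right _ _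
      have e : δ / (8 * Real.pi ^ 2) * w ^ 2 * n = r2 * Real.log n ^ 2 := by
        have e2 : w ^ 2 * n = cw ^ 2 * Real.log n ^ 2 := by
          rw [hw, mul_pow, div_pow (Real.log n), Real.sq_sqrt n0.le]
          field_simp
        rw [hr2, mul_assoc, e2]; ring
      have : min r1 r2 * (q' / 2) * Real.log n ^ 2 ≤ δ / (8 * Real.pi ^ 2) * w ^ 2 * p := by
        calc min r1 r2 * (q' / 2) * Real.log n ^ 2 ≤ r2 * (q' / 2) * Real.log n ^ 2 := by gcongr
          _ = (r2 * Real.log n ^ 2) * (q' / 2) := by ring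
          _ = δ / (8 * Real.pi ^ 2) * w ^ 2 * (q' / 2 * n) := by rw [← e]; ring
          _ ≤ _ := by gcongr
      linarith
    · have : δ / (8 * Real.pi ^ 2) ≤ 1 := by
        rw [div_le_one (by positivity)]; nlinarith only [pi3, hδ1]
      have h1 : w ^ 2 ≤ 1 := pow_le_one₀ w0 w1
      exact mul_le_one₀ this (by positivity) h1
    · intro l J hJ'
      obtain ⟨d1, d2⟩ := hd l
      set Δ := x (f l) - x (g l) with hΔ
      have Δ0 : 0 < Δ := by linarith
      have τp : 0 < |τ| := τ00.trans hτ
      have uu : u0 ≤ |τ| * Δ := by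
        rw [hu0, mul_comm (2 * c1)]; gcongr
      have := sin_large (u := |τ| * Δ) (y := y) (μ := μ) (ζ := ζ) (w := w) (κ := κ) hK hδ ζ0 (by positivity) w0 w1 (trunc_card hK hTy)
        (by linarith) (by linarith) (hJ J hJ') ?_ hv
      · refine le_trans (le_of_eq ?_) (this.trans (le_of_eq ?_))
        · field_simp; ring
        · refine Finset.sum_congr rfl fun a _ => Finset.sum_congr rfl fun c _ => ?_
          rcases abs_cases τ with ⟨h, _⟩ | ⟨h, _⟩
          · rw [h]
          · rw [h, show -τ * Δ * (y a - y c) / 2 = -(τ * Δ * (y a - y c) / 2) by ring, Real.sin_neg, neg_sq]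
      · set u := |τ| * Δ with hu
        have u1 : 0 < u := by positivity
        have un : u ≤ δ * n / (32 * K) := by
          calc u ≤ δ / (64 * C1 * K) * n * (2 * C1) := by rw [hu]; gcongr
            _ = δ * n / (32 * K) := by field_simp; norm_num
        rw [le_div_iff₀ (by positivity)] at un
        have z1 : (2 * u * K + 3) * (4 * w / u) ≤ δ * n * ζ / 4 := by
          have : (2 * u * K + 3) * (4 * w / u) = (2 * K + 3 / u) * (4 * w) := by field_simp
          rw [this]
          calc (2 * K + 3 / u) * (4 * w) ≤ (2 * K + 3 / u0) * (4 * w) := by gcongr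
            _ = δ / 4 * (Real.log n / √n) := by rw [hw, hcw]; field_simp; norm_num
            _ ≤ δ / 4 * (n * ζ) := by gcongr
            _ = _ := by ring
        have z2 : (2 * u * K + 3) * (2 * ζ) ≤ δ * n * ζ / 4 := by
          have : 2 * u * K + 3 ≤ δ * n / 8 := by linarith
          calc (2 * u * K + 3) * (2 * ζ) ≤ δ * n / 8 * (2 * ζ) := by gcongr
            _ = _ := by ring
        rw [mul_add]; linarith

end RankEdge

namespace RankEdge
variable {n p : ℕ}

lemma mom_lower {r k e E : ℝ} (hk : 2 < k) (hr : 0 < r) (hrk : r < k) (he : 0 < e) :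
    ∃ b : ℝ, 0 < b ∧ ∀ (n : ℕ) (x : Fin n → ℝ), e * n ≤ ∑ i, |x i| ^ r → ∑ i, |x i| ^ k ≤ E * n →
      b * n ≤ ∑ i, x i ^ 2 := by
  have lim : Filter.Tendsto (fun K : ℝ => K ^ (-(k - r)) * E) Filter.atTop (nhds (0 * E)) :=
    (tendsto_rpow_neg_atTop (by linarith)).mul_const E
  rw [zero_mul] at lim
  obtain ⟨K, hK1, hK⟩ := ((Filter.eventually_ge_atTop (1:ℝ)).and (lim.eventually (gt_mem_nhds (show 0 < e / 4 by positivity)))).exists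
  have K0 : 0 < K := by linarith
  set a := (e / 4) ^ (1 / r) with ha
  have a0 : 0 < a := by positivity
  have ar : a ^ r = e / 4 := by
    rw [ha, ← Real.rpow_mul (by positivity), one_div, inv_mul_cancel₀ hr.ne', Real.rpow_one]
  set C := a ^ (r - 2) + K ^ (r - 2) with hC
  have C0 : 0 < C := by positivity
  refine ⟨e / (2 * C), by positivity, fun n x h1 h2 => ?_⟩
  have pt : ∀ i, |x i| ^ r ≤ K ^ (-(k - r)) * |x i| ^ k + C * x i ^ 2 + e / 4 := by
    intro i
    rw [← sq_abs]
    have z0 := abs_nonneg (x i)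
    generalize |x i| = z at *
    have t1 : 0 ≤ K ^ (-(k - r)) * z ^ k := by positivity
    have t2 : 0 ≤ C * z ^ 2 := by positivity
    rcases lt_or_ge K z with h | h
    · have zp : 0 < z := K0.trans h
      have : z ^ r = z ^ (-(k - r)) * z ^ k := by rw [← Real.rpow_add zp]; ring_nf
      have h3 : z ^ (-(k - r)) ≤ K ^ (-(k - r)) := Real.rpow_le_rpow_of_nonpos K0 h.le (by linarith)
      have : z ^ r ≤ K ^ (-(k - r)) * z ^ k := by rw [this]; gcongr
      linarith
    · rcases lt_or_ge z a with h' | h'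
      · have : z ^ r ≤ a ^ r := by gcongr
        linarith
      · have zp : 0 < z := a0.trans_le h'
        have e1 : z ^ r = z ^ (r - 2) * z ^ 2 := by
          rw [← Real.rpow_natCast, ← Real.rpow_add zp]; norm_num
        have : z ^ (r - 2) ≤ C := by
          rcases le_total r 2 with h3 | h3
          · have := Real.rpow_le_rpow_of_nonpos a0 h' (by linarith : r - 2 ≤ 0)
            have : 0 ≤ K ^ (r - 2) := by positivity
            linarith
          · have := Real.rpow_le_rpow zp.le h (by linarith : 0 ≤ r - 2)
            have : 0 ≤ a ^ (r - 2) := by positivity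
            linarith
        have : z ^ r ≤ C * z ^ 2 := by rw [e1]; gcongr
        linarith
  have sum := Finset.sum_le_sum fun i (_ : i ∈ (univ : Finset (Fin n))) => pt i
  rw [Finset.sum_add_distrib, Finset.sum_add_distrib, ← Finset.mul_sum, ← Finset.mul_sum] at sum
  have n0 : (0:ℝ) ≤ n := Nat.cast_nonneg n
  have e3 : ∑ i : Fin n, e / 4 = e / 4 * n := by simp [mul_comm]
  have e4 : K ^ (-(k - r)) * ∑ i, |x i| ^ k ≤ e / 4 * n := by
    calc K ^ (-(k - r)) * ∑ i, |x i| ^ k ≤ K ^ (-(k - r)) * (E * n) := by gcongr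
      _ = K ^ (-(k - r)) * E * n := by ring
      _ ≤ _ := by gcongr
  rw [div_mul_eq_mul_div, div_le_iff₀ (by positivity)]
  linarith

lemma pow_le_one_add {z k p : ℝ} (z0 : 0 ≤ z) (hp : 0 ≤ p) (h : p ≤ k) : z ^ p ≤ 1 + z ^ k := by
  rcases le_total z 1 with h1 | h1
  · have := Real.rpow_le_one z0 h1 hp
    have : 0 ≤ z ^ k := by positivity
    linarith
  · have := Real.rpow_le_rpow_of_exponent_le h1 h
    linarith

lemma mom_upper2 {k E : ℝ} (hk : 2 < k) {x : Fin n → ℝ} (h : ∑ i, |x i| ^ k ≤ E * n) :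
    ∑ i, x i ^ 2 ≤ (1 + E) * n := by
  calc ∑ i, x i ^ 2 ≤ ∑ i, (1 + |x i| ^ k) := Finset.sum_le_sum fun i _ => by
        have := pow_le_one_add (abs_nonneg (x i)) (by norm_num : (0:ℝ) ≤ 2) hk.le
        rw [show ((2:ℝ)) = ((2:ℕ):ℝ) by norm_num, Real.rpow_natCast, sq_abs] at this
        exact this
    _ = n + ∑ i, |x i| ^ k := by rw [Finset.sum_add_distrib]; simp
    _ ≤ _ := by linarith

lemma mom_upper {k E : ℝ} (hk : 2 < k) (hE : 0 < E) (p : ℕ) (hn : 2 ≤ n) {x : Fin n → ℝ} (h : ∑ i, |x i| ^ k ≤ E * n) :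
    ∑ i, |x i| ^ p ≤ (1 + E + E ^ ((p:ℝ) / k)) * (n * (n:ℝ) ^ (max ((p:ℝ) / k - 1) 0)) := by
  have n0 : (0:ℝ) < n := by exact_mod_cast (by omega : 0 < n)
  have n1 : (1:ℝ) ≤ n := by exact_mod_cast (by omega : 1 ≤ n)
  have k0 : 0 < k := by linarith
  have Ep : 0 < E ^ ((p:ℝ) / k) := by positivity
  rcases le_or_gt (p:ℝ) k with hp | hp
  · have : (p:ℝ) / k - 1 ≤ 0 := by
      have : (p:ℝ) / k ≤ 1 := (div_le_one k0).2 hp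
      linarith
    rw [max_eq_right this, Real.rpow_zero, mul_one]
    calc ∑ i, |x i| ^ p ≤ ∑ i, (1 + |x i| ^ k) := Finset.sum_le_sum fun i _ => by
          have := pow_le_one_add (abs_nonneg (x i)) (Nat.cast_nonneg p) hp
          rwa [Real.rpow_natCast] at this
      _ = n + ∑ i, |x i| ^ k := by rw [Finset.sum_add_distrib]; simp
      _ ≤ (1 + E) * n := by linarith
      _ ≤ _ := mul_le_mul_of_nonneg_right (by linarith) n0.le
  · have hq : 0 ≤ (p:ℝ) / k - 1 := by
      have : 1 ≤ (p:ℝ) / k := (one_le_div k0).2 hp.le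
      linarith
    rw [max_eq_left hq]
    have pt : ∀ i, |x i| ^ p ≤ |x i| ^ k * (E * n) ^ ((p:ℝ) / k - 1) := by
      intro i
      have hi : |x i| ^ k ≤ E * n := (Finset.single_le_sum (f := fun i => |x i| ^ k) (fun i _ => by positivity) (Finset.mem_univ i)).trans h
      have z0 := abs_nonneg (x i)
      generalize |x i| = z at *
      have e1 : z ^ p = z ^ k * (z ^ k) ^ ((p:ℝ) / k - 1) := by
        rcases z0.eq_or_lt with h0 | h0
        · rw [← h0, Real.zero_rpow k0.ne', zero_mul, zero_pow]
          rintro rfl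
          norm_num at hp; linarith
        · rw [← Real.rpow_mul z0, ← Real.rpow_add h0, ← Real.rpow_natCast]
          congr 1; field_simp; ring
      rw [e1]
      gcongr
    calc ∑ i, |x i| ^ p ≤ ∑ i, |x i| ^ k * (E * n) ^ ((p:ℝ) / k - 1) := Finset.sum_le_sum fun i _ => pt i
      _ = (∑ i, |x i| ^ k) * (E * n) ^ ((p:ℝ) / k - 1) := by rw [Finset.sum_mul]
      _ ≤ (E * n) * (E * n) ^ ((p:ℝ) / k - 1) := by gcongr
      _ = E ^ ((p:ℝ) / k) * (n * (n:ℝ) ^ ((p:ℝ) / k - 1)) := by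
        rw [Real.mul_rpow hE.le n0.le, Real.rpow_sub_one hE.ne']; field_simp
      _ ≤ _ := by gcongr; linarith

lemma W4_mm {x : Fin n → ℝ} (hn : 2 ≤ n) (hx : Nrm x) : W 4 x ≤ 16 * mm 4 x := by
  have n0 : (0:ℝ) < n := by exact_mod_cast (by omega : 0 < n)
  unfold W mm
  rw [← mul_div_assoc]
  gcongr
  calc ∑ i, mj x i ^ 4 ≤ ∑ i, (16 * x i ^ 4 + 8 * (2 - 2 * x i ^ 2)) := Finset.sum_le_sum fun i _ => by
        unfold mj
        have : x i ^ 4 = |x i| ^ 4 := by rw [← abs_pow, abs_of_nonneg (by positivity)]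
        rw [this, ← sq_abs (x i)]
        have z0 := abs_nonneg (x i)
        generalize |x i| = z at *
        nlinarith [sq_nonneg (z ^ 2 - 1), sq_nonneg (z - 1), mul_nonneg z0 (sq_nonneg (z - 1)), sq_nonneg (z * (z - 1))]
    _ = 16 * ∑ i, x i ^ 4 := by
        rw [Finset.sum_add_distrib, ← Finset.mul_sum, ← Finset.mul_sum, Finset.sum_sub_distrib, ← Finset.mul_sum, hx.s2]
        simp; ring

/-- fifth absolute moment -/
noncomputable def am (x : Fin n → ℝ) : ℝ := (∑ i, |x i| ^ 5) / n

lemma W5_am {x : Fin n → ℝ} (hn : 2 ≤ n) (hx : Nrm x) : W 5 x ≤ 32 * am x := by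
  have n0 : (0:ℝ) < n := by exact_mod_cast (by omega : 0 < n)
  unfold W am
  rw [← mul_div_assoc]
  gcongr
  calc ∑ i, mj x i ^ 5 ≤ ∑ i, (32 * |x i| ^ 5 + 40 * (1 - x i ^ 2)) := Finset.sum_le_sum fun i _ => by
        unfold mj
        rw [← sq_abs (x i)]
        have z0 := abs_nonneg (x i)
        generalize |x i| = z at *
        have : 32 * z ^ 5 + 40 * (1 - z ^ 2) - (1 + z) ^ 5 = (z - 1) ^ 2 * (31 * z ^ 3 + 57 * z ^ 2 + 73 * z + 39) := by ring
        have : 0 ≤ (z - 1) ^ 2 * (31 * z ^ 3 + 57 * z ^ 2 + 73 * z + 39) := by positivity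
        linarith
    _ = 32 * ∑ i, |x i| ^ 5 := by
        rw [Finset.sum_add_distrib, ← Finset.mul_sum, ← Finset.mul_sum, Finset.sum_sub_distrib, hx.s2]
        simp

end RankEdge

namespace RankEdge
variable {n p : ℕ}

lemma dsum (f g : Fin n → ℝ) : ∑ i, ∑ j, f i * g j = (∑ i, f i) * ∑ j, g j := by
  rw [Finset.sum_mul_sum]

lemma ctr_eq (hn : 2 ≤ n) {A : Matrix (Fin n) (Fin n) ℝ} {ev dv : Fin n → ℝ} (hA : ∀ i j, A i j = ev i * dv j) (i j : Fin n) :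
    ctr A i j = (ev i - (∑ i', ev i') / n) * (dv j - (∑ j', dv j') / n) := by
  have n0 : (0:ℝ) < n := by exact_mod_cast (by omega : 0 < n)
  simp only [ctr, rowMean, colMean, totMean, hA]
  rw [dsum, ← Finset.mul_sum, ← Finset.sum_mul]
  field_simp; ring

lemma sum_ctr0 (hn : 2 ≤ n) (v : Fin n → ℝ) : ∑ i, (v i - (∑ i', v i') / n) = 0 := by
  have n0 : (0:ℝ) < n := by exact_mod_cast (by omega : 0 < n)
  rw [Finset.sum_sub_distrib]; simp; field_simp; ring

lemma nrm_of {a : Fin n → ℝ} (hn : 2 ≤ n) (h0 : ∑ i, a i = 0) (hv : 0 < ∑ i, a i ^ 2) :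
    Nrm (fun i => a i / √((∑ i, a i ^ 2) / n)) := by
  have n0 : (0:ℝ) < n := by exact_mod_cast (by omega : 0 < n)
  constructor
  · rw [← Finset.sum_div, h0, zero_div]
  · simp only [div_pow]
    rw [← Finset.sum_div, Real.sq_sqrt (by positivity)]
    field_simp

lemma normalize (hn : 2 ≤ n) {A : Matrix (Fin n) (Fin n) ℝ} {ev dv a b : Fin n → ℝ} (hA : ∀ i j, A i j = ev i * dv j)
    (ha : ∀ i, a i = ev i - (∑ i', ev i') / n) (hb : ∀ j, b j = dv j - (∑ j', dv j') / n)
    (va : 0 < ∑ i, a i ^ 2) (vb : 0 < ∑ i, b i ^ 2) :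
    ∃ x y : Fin n → ℝ, Nrm x ∧ Nrm y ∧ (∀ i, x i = a i / √((∑ i, a i ^ 2) / n)) ∧ (∀ i, y i = b i / √((∑ i, b i ^ 2) / n)) ∧
      (∀ i j, hatM A i j = cn n * (x i * y j)) ∧ (∀ t, chf (rankTstd A) t = cf x y t) ∧
      ∀ t, cf x y t = ph (t * (cn n / (√((∑ i, a i ^ 2) / n) * √((∑ i, b i ^ 2) / n)))) a dv := by
  have n0 : (0:ℝ) < n := by exact_mod_cast (by omega : 0 < n)
  have n2 : (2:ℝ) ≤ n := by exact_mod_cast hn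
  have n1 : (0:ℝ) < n - 1 := by linarith
  have a0 : ∑ i, a i = 0 := by simp only [ha]; exact sum_ctr0 hn ev
  have b0 : ∑ i, b i = 0 := by simp only [hb]; exact sum_ctr0 hn dv
  have hc : ∀ i j, ctr A i j = a i * b j := fun i j => by rw [ctr_eq hn hA, ha, hb]
  set va' := ∑ i, a i ^ 2 with hva
  set vb' := ∑ i, b i ^ 2 with hvb
  have s2 : sigma2 A = va' * vb' / (n - 1) := by
    unfold sigma2
    simp only [hc, mul_pow]
    rw [dsum]
  have sd0 : 0 < √(va' / n) := by positivity
  have sd1 : 0 < √(vb' / n) := by positivity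
  have sq1 : 0 < √((n:ℝ) - 1) := by positivity
  have sd : sdev A = n * (√(va' / n) * √(vb' / n)) / √((n:ℝ) - 1) := by
    unfold sdev
    rw [s2, Real.sqrt_eq_iff_mul_self_eq (by positivity) (by positivity)]
    rw [div_mul_div_comm, Real.mul_self_sqrt n1.le]
    have e1 : √(va' / n) * √(va' / n) = va' / n := Real.mul_self_sqrt (by positivity)
    have e2 : √(vb' / n) * √(vb' / n) = vb' / n := Real.mul_self_sqrt (by positivity)
    symm
    calc _ = n * n * ((√(va' / n) * √(va' / n)) * (√(vb' / n) * √(vb' / n))) / (n - 1) := by ring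
      _ = _ := by rw [e1, e2]; field_simp
  have rt : ∀ π, rankTstd A π = (S a b π) / sdev A := by
    intro π
    unfold rankTstd
    congr 1
    have e1 : S a b π = ∑ i, (ev i * dv (π i) - ev i * ((∑ j', dv j') / n) - (∑ i', ev i') / n * b (π i)) := by
      unfold S
      refine Finset.sum_congr rfl fun i _ => ?_
      rw [ha, hb]; ring
    rw [e1, Finset.sum_sub_distrib, Finset.sum_sub_distrib, ← Finset.mul_sum, ← Finset.sum_mul, Equiv.sum_comp π b, b0]
    simp only [rankT, muM, totMean, hA]
    rw [dsum]
    field_simp; ring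
  refine ⟨fun i => a i / √(va' / n), fun i => b i / √(vb' / n), nrm_of hn a0 va, nrm_of hn b0 vb, fun _ => rfl, fun _ => rfl, ?_, ?_, ?_⟩
  · intro i j
    unfold hatM cn
    rw [hc, sd]
    field_simp
  · intro t
    unfold chf cf ph ex
    congr 1; funext π
    rw [rt, sd]
    congr 3
    unfold S cn
    have : ∑ i, a i / √(va' / n) * (b (π i) / √(vb' / n)) = (∑ i, a i * b (π i)) / (√(va' / n) * √(vb' / n)) := by
      simp only [div_mul_div_comm]
      rw [← Finset.sum_div]
    rw [this]; field_simp
  · intro t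
    unfold cf ph ex
    congr 1; funext π
    congr 3
    have : S (fun i => a i / √(va' / n)) (fun i => b i / √(vb' / n)) π = S a dv π / (√(va' / n) * √(vb' / n)) := by
      have e2 : S a dv π = ∑ i, (a i * b (π i) + a i * ((∑ j', dv j') / n)) := by
        unfold S
        refine Finset.sum_congr rfl fun i _ => ?_
        rw [hb]; ring
      rw [e2, Finset.sum_add_distrib, ← Finset.sum_mul, a0, zero_mul, add_zero]
      unfold S
      simp only [div_mul_div_comm]
      rw [← Finset.sum_div]
    rw [this]; field_simp

lemma lam1_eq (hn : 2 ≤ n) {A : Matrix (Fin n) (Fin n) ℝ} {x y : Fin n → ℝ} (hA : ∀ i j, hatM A i j = cn n * (x i * y j)) :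
    lam1 A = l1 x y := by
  have n0 : (0:ℝ) < n := by exact_mod_cast (by omega : 0 < n)
  unfold lam1 l1 mm
  simp only [hA, mul_pow, ← Finset.mul_sum]
  rw [← Finset.sum_mul]
  field_simp

lemma lam2_eq (hn : 2 ≤ n) {A : Matrix (Fin n) (Fin n) ℝ} {x y : Fin n → ℝ} (hA : ∀ i j, hatM A i j = cn n * (x i * y j))
    (hx : Nrm x) (hy : Nrm y) :
    lam2 A = l2 x y := by
  have n0 : (0:ℝ) < n := by exact_mod_cast (by omega : 0 < n)
  unfold lam2 l2 mm
  have e1 : ∑ i, ∑ j, hatM A i j ^ 4 = cn n ^ 4 * ((∑ i, x i ^ 4) * ∑ j, y j ^ 4) := by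
    simp only [hA, mul_pow, ← Finset.mul_sum]
    rw [← Finset.sum_mul]
  have e2 : ∑ i, ∑ j, ∑ k, (hatM A i j ^ 2 * hatM A i k ^ 2 + hatM A i j ^ 2 * hatM A k j ^ 2) =
      cn n ^ 4 * ((∑ i, x i ^ 4) * n ^ 2) + cn n ^ 4 * ((∑ i, y i ^ 4) * n ^ 2) := by
    have : ∀ i j k, hatM A i j ^ 2 * hatM A i k ^ 2 + hatM A i j ^ 2 * hatM A k j ^ 2 =
      cn n ^ 4 * x i ^ 4 * y j ^ 2 * y k ^ 2 + cn n ^ 4 * x i ^ 2 * y j ^ 4 * x k ^ 2 := fun i j k => by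
        rw [hA, hA, hA]; ring
    simp only [this, Finset.sum_add_distrib, ← Finset.mul_sum, hx.s2, hy.s2, ← Finset.sum_mul]
    ring
  rw [e1, e2]
  field_simp; ring

lemma DM_eq (hn : 2 ≤ n) {A : Matrix (Fin n) (Fin n) ℝ} {x y : Fin n → ℝ} (hA : ∀ i j, hatM A i j = cn n * (x i * y j)) :
    DM A ^ 2 = n * cn n ^ 4 * (mm 4 x * mm 4 y) := by
  have n0 : (0:ℝ) < n := by exact_mod_cast (by omega : 0 < n)
  unfold DM
  have e1 : deltaM A = cn n ^ 4 * ((∑ i, x i ^ 4) * ∑ j, y j ^ 4) := by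
    have : ∀ z : ℝ, |z| ^ 4 = z ^ 4 := fun z => by rw [← abs_pow, abs_of_nonneg (by positivity)]
    unfold deltaM
    simp only [this, hA, mul_pow, ← Finset.mul_sum]
    rw [← Finset.sum_mul]
  have p0 : 0 ≤ deltaM A := Finset.sum_nonneg fun i _ => Finset.sum_nonneg fun j _ => by positivity
  rw [Real.sq_sqrt (by positivity), e1]
  unfold mm
  field_simp

lemma EM_eq (hn : 2 ≤ n) {A : Matrix (Fin n) (Fin n) ℝ} {x y : Fin n → ℝ} (hA : ∀ i j, hatM A i j = cn n * (x i * y j)) :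
    EM A ^ 3 = n * cn n ^ 5 * (am x * am y) := by
  have n0 : (0:ℝ) < n := by exact_mod_cast (by omega : 0 < n)
  obtain ⟨c0, -⟩ := cn_facts hn
  unfold EM
  have e1 : etaM A = cn n ^ 5 * ((∑ i, |x i| ^ 5) * ∑ j, |y j| ^ 5) := by
    unfold etaM
    simp only [hA, abs_mul, mul_pow, ← Finset.mul_sum, abs_of_pos c0]
    rw [← Finset.sum_mul]
  have p0 : 0 ≤ etaM A := Finset.sum_nonneg fun i _ => Finset.sum_nonneg fun j _ => by positivity
  rw [← Real.rpow_natCast, ← Real.rpow_mul (by positivity)]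
  norm_num
  rw [e1]
  unfold am
  field_simp

lemma mm4_nonneg (x : Fin n → ℝ) : 0 ≤ mm 4 x := div_nonneg (Finset.sum_nonneg fun i _ => by positivity) (Nat.cast_nonneg n)
lemma am_nonneg (x : Fin n → ℝ) : 0 ≤ am x := div_nonneg (Finset.sum_nonneg fun i _ => by positivity) (Nat.cast_nonneg n)

lemma cn_low (hn : 2 ≤ n) : 1 / √(n:ℝ) ≤ 3 / 2 * cn n := by
  obtain ⟨c0, c2, -, nr, r0, r1⟩ := cn_facts hn
  have n2 : (2:ℝ) ≤ n := by exact_mod_cast hn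
  have n0 : (0:ℝ) < n := by linarith
  refine le_of_sq_le_sq ?_ (by positivity)
  rw [mul_pow, c2, div_pow, one_pow, Real.sq_sqrt n0.le]
  rw [div_le_iff₀ n0]
  have : (3 / 2:ℝ) ^ 2 * (((n:ℝ) - 1) / n ^ 2) * n = 9 / 4 * ((n - 1) / n) := by field_simp; ring
  rw [this]
  have : 1 / 2 ≤ ((n:ℝ) - 1) / n := by rw [div_le_div_iff₀ (by norm_num) n0]; linarith
  linarith

end RankEdge

namespace RankEdge
variable {n p : ℕ}

lemma B4_DM (hn : 2 ≤ n) {A : Matrix (Fin n) (Fin n) ℝ} {x y : Fin n → ℝ} (hA : ∀ i j, hatM A i j = cn n * (x i * y j))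
    (hx : Nrm x) (hy : Nrm y) : B4 x y ≤ 1296 * DM A ^ 2 := by
  obtain ⟨c0, -, -, nr, r0, r1⟩ := cn_facts hn
  have cl := cn_low hn
  have n0 : (0:ℝ) < n := by exact_mod_cast (by omega : 0 < n)
  rw [DM_eq hn hA]
  unfold B4
  have e : 1 / (n:ℝ) = n * (1 / √(n:ℝ)) ^ 4 := by
    rw [show (1 / √(n:ℝ)) ^ 4 = (1 / √(n:ℝ)) ^ 2 * (1 / √(n:ℝ)) ^ 2 by ring, ← mul_assoc, nr, one_mul,
      div_pow, one_pow, Real.sq_sqrt n0.le]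
  have m1 := mm4_nonneg x
  have m2 := mm4_nonneg y
  calc W 4 x * W 4 y / n = W 4 x * W 4 y * (1 / n) := by ring
    _ = W 4 x * W 4 y * (n * (1 / √(n:ℝ)) ^ 4) := by rw [e]
    _ ≤ (16 * mm 4 x) * (16 * mm 4 y) * (n * (3 / 2 * cn n) ^ 4) := by
      have := W_nonneg 4 y
      gcongr
      · exact W4_mm hn hx
      · exact W4_mm hn hy
    _ = _ := by ring

lemma B5_EM (hn : 2 ≤ n) {A : Matrix (Fin n) (Fin n) ℝ} {x y : Fin n → ℝ} (hA : ∀ i j, hatM A i j = cn n * (x i * y j))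
    (hx : Nrm x) (hy : Nrm y) : B5 x y ≤ 7776 * EM A ^ 3 := by
  obtain ⟨c0, -, -, nr, r0, r1⟩ := cn_facts hn
  have cl := cn_low hn
  have n0 : (0:ℝ) < n := by exact_mod_cast (by omega : 0 < n)
  rw [EM_eq hn hA]
  unfold B5
  have e : (1 / √(n:ℝ)) ^ 3 = n * (1 / √(n:ℝ)) ^ 5 := by
    rw [show (1 / √(n:ℝ)) ^ 5 = (1 / √(n:ℝ)) ^ 2 * (1 / √(n:ℝ)) ^ 3 by ring, ← mul_assoc, nr, one_mul]
  have m1 := am_nonneg x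
  have m2 := am_nonneg y
  calc W 5 x * W 5 y * (1 / √(n:ℝ)) ^ 3 = W 5 x * W 5 y * (n * (1 / √(n:ℝ)) ^ 5) := by rw [e]
    _ ≤ (32 * am x) * (32 * am y) * (n * (3 / 2 * cn n) ^ 5) := by
      have := W_nonneg 5 y
      gcongr
      · exact W5_am hn hx
      · exact W5_am hn hy
    _ = _ := by ring

lemma DM_le (hn : 2 ≤ n) {A : Matrix (Fin n) (Fin n) ℝ} {x y : Fin n → ℝ} (hA : ∀ i j, hatM A i j = cn n * (x i * y j)) :
    DM A ^ 2 ≤ (n:ℝ) ^ (-1:ℝ) * (mm 4 x * mm 4 y) := by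
  obtain ⟨c0, -, cr, nr, r0, r1⟩ := cn_facts hn
  have n0 : (0:ℝ) < n := by exact_mod_cast (by omega : 0 < n)
  rw [DM_eq hn hA]
  have m1 := mm4_nonneg x
  have m2 := mm4_nonneg y
  have e : (n:ℝ) ^ (-1:ℝ) = n * (1 / √(n:ℝ)) ^ 4 := by
    rw [show (1 / √(n:ℝ)) ^ 4 = (1 / √(n:ℝ)) ^ 2 * (1 / √(n:ℝ)) ^ 2 by ring, ← mul_assoc, nr, one_mul,
      div_pow, one_pow, Real.sq_sqrt n0.le, Real.rpow_neg_one, one_div]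
  rw [e]; gcongr

lemma EM_le (hn : 2 ≤ n) {A : Matrix (Fin n) (Fin n) ℝ} {x y : Fin n → ℝ} (hA : ∀ i j, hatM A i j = cn n * (x i * y j)) :
    EM A ^ 3 ≤ (n:ℝ) ^ (-(3:ℝ) / 2) * (am x * am y) := by
  obtain ⟨c0, -, cr, nr, r0, r1⟩ := cn_facts hn
  have n0 : (0:ℝ) < n := by exact_mod_cast (by omega : 0 < n)
  rw [EM_eq hn hA]
  have m1 := am_nonneg x
  have m2 := am_nonneg y
  have e : (n:ℝ) ^ (-(3:ℝ) / 2) = n * (1 / √(n:ℝ)) ^ 5 := by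
    rw [show (1 / √(n:ℝ)) ^ 5 = (1 / √(n:ℝ)) ^ 2 * (1 / √(n:ℝ)) ^ 3 by ring, ← mul_assoc, nr, one_mul,
      Real.sqrt_eq_rpow, one_div, ← Real.rpow_neg n0.le, ← Real.rpow_natCast, ← Real.rpow_mul n0.le]
    norm_num
  rw [e]; gcongr

lemma nmom {k E b : ℝ} (hk : 2 < k) (hE : 0 < E) (hb : 0 < b) (p : ℕ) (hn : 2 ≤ n) {a x : Fin n → ℝ} (h : ∑ i, |a i| ^ k ≤ E * n)
    (h2 : b * n ≤ ∑ i, a i ^ 2) (hx : ∀ i, x i = a i / √((∑ i, a i ^ 2) / n)) :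
    (∑ i, |x i| ^ p) / n ≤ ((1 + E + E ^ ((p:ℝ) / k)) / (√b) ^ p) * (n:ℝ) ^ (max ((p:ℝ) / k - 1) 0) := by
  have n0 : (0:ℝ) < n := by exact_mod_cast (by omega : 0 < n)
  have u := mom_upper hk hE p hn h
  have sb : 0 < √b := by positivity
  have l : √b ≤ √((∑ i, a i ^ 2) / n) := Real.sqrt_le_sqrt (by rwa [le_div_iff₀ n0])
  set sa := √((∑ i, a i ^ 2) / n) with hsa
  clear_value sa
  have sa0 : 0 < sa := sb.trans_le l
  have e1 : ∑ i, |x i| ^ p = (∑ i, |a i| ^ p) / sa ^ p := by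
    rw [Finset.sum_div]
    refine Finset.sum_congr rfl fun i _ => ?_
    rw [hx, abs_div, abs_of_pos sa0, div_pow]
  rw [e1, div_le_iff₀ n0]
  calc (∑ i, |a i| ^ p) / sa ^ p ≤ (∑ i, |a i| ^ p) / √b ^ p := by
        gcongr
    _ ≤ ((1 + E + E ^ ((p:ℝ) / k)) * (n * (n:ℝ) ^ (max ((p:ℝ) / k - 1) 0))) / √b ^ p := by gcongr
    _ = _ := by ring

/-- the second inequalities -/
lemma upper_bounds {k E s D b : ℝ} (hk : 2 < k) (hE : 0 < E) (hs : 2 < s) (hD : 0 < D) (hb : 0 < b) :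
    ∃ C : ℝ, 0 < C ∧ ∀ (n : ℕ) (hn : 2 ≤ n) (A : Matrix (Fin n) (Fin n) ℝ) (a x b' y : Fin n → ℝ),
      (∀ i j, hatM A i j = cn n * (x i * y j)) → ∑ i, |a i| ^ k ≤ E * n → b * n ≤ ∑ i, a i ^ 2 →
      ∑ i, |b' i| ^ s ≤ D * n → b * n ≤ ∑ i, b' i ^ 2 → (∀ i, x i = a i / √((∑ i, a i ^ 2) / n)) →
      (∀ i, y i = b' i / √((∑ i, b' i ^ 2) / n)) →
      DM A ^ 2 ≤ C * (n : ℝ) ^ (-1 + max (4 / k - 1) 0 + max (4 / s - 1) 0) ∧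
      EM A ^ 3 ≤ C * (n : ℝ) ^ (-(3:ℝ) / 2 + max (5 / k - 1) 0 + max (5 / s - 1) 0) := by
  have sb : 0 < √b := by positivity
  refine ⟨(1 + E + E ^ (((4:ℕ):ℝ) / k)) / (√b) ^ 4 * ((1 + D + D ^ (((4:ℕ):ℝ) / s)) / (√b) ^ 4) +
    (1 + E + E ^ (((5:ℕ):ℝ) / k)) / (√b) ^ 5 * ((1 + D + D ^ (((5:ℕ):ℝ) / s)) / (√b) ^ 5), by positivity, ?_⟩
  intro n hn A a x b' y hA h1 h2 h3 h4 hx hy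
  have n0 : (0:ℝ) < n := by exact_mod_cast (by omega : 0 < n)
  have e4 : ∀ v : Fin n → ℝ, mm 4 v = (∑ i, |v i| ^ 4) / n := by
    intro v
    have : ∀ z : ℝ, |z| ^ 4 = z ^ 4 := fun z => by rw [← abs_pow, abs_of_nonneg (by positivity)]
    unfold mm; simp only [this]
  have a1 := nmom hk hE hb 4 hn h1 h2 hx
  have a2 := nmom hs hD hb 4 hn h3 h4 hy
  have a3 := nmom hk hE hb 5 hn h1 h2 hx
  have a4 := nmom hs hD hb 5 hn h3 h4 hy
  rw [← e4] at a1 a2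
  have m1 := mm4_nonneg x
  have m2 := mm4_nonneg y
  have m3 := am_nonneg x
  have m4 := am_nonneg y
  change am x ≤ _ at a3
  change am y ≤ _ at a4
  have p1 : 0 < (1 + E + E ^ (((4:ℕ):ℝ) / k)) / (√b) ^ 4 := by positivity
  have p2 : 0 < (1 + D + D ^ (((4:ℕ):ℝ) / s)) / (√b) ^ 4 := by positivity
  have p3 : 0 < (1 + E + E ^ (((5:ℕ):ℝ) / k)) / (√b) ^ 5 := by positivity
  have p4 : 0 < (1 + D + D ^ (((5:ℕ):ℝ) / s)) / (√b) ^ 5 := by positivity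
  generalize (1 + E + E ^ (((4:ℕ):ℝ) / k)) / (√b) ^ 4 = c1 at *
  generalize (1 + D + D ^ (((4:ℕ):ℝ) / s)) / (√b) ^ 4 = c2 at *
  generalize (1 + E + E ^ (((5:ℕ):ℝ) / k)) / (√b) ^ 5 = c3 at *
  generalize (1 + D + D ^ (((5:ℕ):ℝ) / s)) / (√b) ^ 5 = c4 at *
  norm_num at a1 a2 a3 a4
  constructor
  · calc DM A ^ 2 ≤ (n:ℝ) ^ (-1:ℝ) * (mm 4 x * mm 4 y) := DM_le hn hA
      _ ≤ (n:ℝ) ^ (-1:ℝ) * ((c1 * (n:ℝ) ^ max (4 / k - 1) 0) * (c2 * (n:ℝ) ^ max (4 / s - 1) 0)) := by gcongr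
      _ = c1 * c2 * (n : ℝ) ^ (-1 + max (4 / k - 1) 0 + max (4 / s - 1) 0) := by
        rw [Real.rpow_add n0, Real.rpow_add n0]; ring
      _ ≤ _ := by
        gcongr
        have : 0 ≤ c3 * c4 := by positivity
        linarith
  · calc EM A ^ 3 ≤ (n:ℝ) ^ (-(3:ℝ) / 2) * (am x * am y) := EM_le hn hA
      _ ≤ (n:ℝ) ^ (-(3:ℝ) / 2) * ((c3 * (n:ℝ) ^ max (5 / k - 1) 0) * (c4 * (n:ℝ) ^ max (5 / s - 1) 0)) := by gcongr
      _ = c3 * c4 * (n : ℝ) ^ (-(3:ℝ) / 2 + max (5 / k - 1) 0 + max (5 / s - 1) 0) := by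
        rw [Real.rpow_add n0, Real.rpow_add n0]; ring
      _ ≤ _ := by
        gcongr
        have : 0 ≤ c1 * c2 := by positivity
        linarith

end RankEdge

namespace RankEdge
variable {n p : ℕ}

lemma cf_decay {k s E D b δ : ℝ} (hk : 2 < k) (hs : 2 < s) (hE : 0 < E) (hD : 0 < D) (hb : 0 < b) (hb1 : b ≤ 1) (hδ : 0 < δ) (hδ1 : δ ≤ 1) :
    ∃ c c4 : ℝ, ∃ N0 : ℕ, 0 < c ∧ 0 < c4 ∧ ∀ (n : ℕ), N0 ≤ n → 2 ≤ n → ∀ (x y b' : Fin n → ℝ) (μ ζ : ℝ), ∑ i, x i = 0 →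
      b * n ≤ ∑ i, x i ^ 2 → ∑ i, |x i| ^ k ≤ E * n → (∀ i, b' i = y i - μ) → ∑ i, b' i = 0 → b * n ≤ ∑ i, b' i ^ 2 →
      ∑ i, |b' i| ^ s ≤ D * n → (n : ℝ) ^ (-(3 : ℝ) / 2) * Real.log n ≤ ζ →
      ENNReal.ofReal (δ * n * ζ) ≤ volume (⋃ j : Fin n, Metric.ball (y j) ζ) → ∀ t : ℝ, |t| ≤ c4 * (n:ℝ) ^ ((3:ℝ) / 2) →
      ‖ph (t * (cn n / (√((∑ i, x i ^ 2) / n) * √((∑ i, b' i ^ 2) / n)))) x y‖ ≤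
        Real.exp (-(c * t ^ 2)) + Real.exp (-(c * Real.log n ^ 2)) := by
  obtain ⟨c, τ0, c2, N0, hc, hτ0, hc2, H⟩ := decay (E := E) (D := D) hk hs hb hb1 hδ hδ1
  set q := 4 / 9 / ((1 + E) * (1 + D)) with hq
  have q0 : 0 < q := by positivity
  refine ⟨min (c * q) c, c2 * b, N0, by positivity, by positivity, ?_⟩
  intro n hn hn2 x y b' μ ζ x1 x2 xk hb' y1 y2 ys hζ hv t ht
  simp only [hb'] at y1
  have y2' := y2
  have ys' := ys
  simp only [hb'] at y2' ys'
  set τ := t * (cn n / (√((∑ i, x i ^ 2) / n) * √((∑ i, b' i ^ 2) / n))) with hτ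
  obtain ⟨h1, h2⟩ := H n hn hn2 x y μ ζ x1 x2 xk y1 y2' ys' hζ hv τ
  obtain ⟨c0, -, cr, nr, r0, r1⟩ := cn_facts hn2
  have cl := cn_low hn2
  have n0 : (0:ℝ) < n := by exact_mod_cast (by omega : 0 < n)
  have lx : b ≤ (∑ i, x i ^ 2) / n := by rwa [le_div_iff₀ n0]
  have ly : b ≤ (∑ i, b' i ^ 2) / n := by rwa [le_div_iff₀ n0]
  have ux : (∑ i, x i ^ 2) / n ≤ 1 + E := by rw [div_le_iff₀ n0]; exact mom_upper2 hk xk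
  have uy : (∑ i, b' i ^ 2) / n ≤ 1 + D := by rw [div_le_iff₀ n0]; exact mom_upper2 hs ys
  generalize (∑ i, x i ^ 2) / (n:ℝ) = vx at *
  generalize (∑ i, b' i ^ 2) / (n:ℝ) = vy at *
  have vx0 : 0 < vx := hb.trans_le lx
  have vy0 : 0 < vy := hb.trans_le ly
  have sv : b ≤ √vx * √vy := by
    rw [← Real.sqrt_mul vx0.le]
    apply Real.le_sqrt_of_sq_le
    rw [sq]; gcongr
  have e1 := Real.exp_pos (-(min (c * q) c * t ^ 2))
  have e2 := Real.exp_pos (-(min (c * q) c * Real.log n ^ 2))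
  rcases le_or_gt |τ| τ0 with h | h
  · refine (h1 h).trans (le_trans (Real.exp_le_exp.2 ?_) (le_add_of_nonneg_right e2.le))
    have t2 : n * τ ^ 2 ≥ q * t ^ 2 := by
      have p1 : τ ^ 2 = t ^ 2 * (cn n ^ 2 / (vx * vy)) := by
        rw [hτ, mul_pow, div_pow, mul_pow, Real.sq_sqrt vx0.le, Real.sq_sqrt vy0.le]
      have p2 : 4 / 9 ≤ n * cn n ^ 2 := by
        have := pow_le_pow_left₀ r0.le cl 2
        rw [mul_pow] at this
        have := mul_le_mul_of_nonneg_left this n0.le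
        rw [nr] at this
        linarith
      have p3 : q ≤ (n * cn n ^ 2) / (vx * vy) := by
        rw [hq]; gcongr
      calc (n:ℝ) * τ ^ 2 = (n * cn n ^ 2) / (vx * vy) * t ^ 2 := by rw [p1]; ring
        _ ≥ q * t ^ 2 := by gcongr
    have t3 : min (c * q) c * t ^ 2 ≤ c * q * t ^ 2 := by gcongr; exact min_le_left _ _
    have t4 : c * (q * t ^ 2) ≤ c * (n * τ ^ 2) := by gcongr
    linarith
  · have : |τ| ≤ c2 * n := by
      rw [hτ, abs_mul, abs_of_pos (by positivity : 0 < cn n / (√vx * √vy))]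
      calc |t| * (cn n / (√vx * √vy)) ≤ (c2 * b * (n:ℝ) ^ ((3:ℝ) / 2)) * ((1 / √n) / b) := by gcongr
        _ = c2 * ((n:ℝ) ^ ((3:ℝ) / 2) * (1 / √n)) := by field_simp
        _ = c2 * n := by
          congr 1
          rw [Real.sqrt_eq_rpow, one_div, ← Real.rpow_neg n0.le, ← Real.rpow_add n0]; norm_num
    refine (h2 h this).trans (le_trans (Real.exp_le_exp.2 ?_) (le_add_of_nonneg_left e1.le))
    have : min (c * q) c * Real.log n ^ 2 ≤ c * Real.log n ^ 2 := by gcongr; exact min_le_right _ _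
    linarith

lemma ev_exp {θ : ℝ} (hθ : 0 < θ) : ∀ᶠ v : ℝ in Filter.atTop, Real.exp (-(v ^ (2 * θ) / 4)) ≤ v ^ (-4:ℝ) := by
  have h1 := tendsto_rpow_mul_exp_neg_mul_atTop_nhds_zero (2 / θ) (1 / 4) (by norm_num)
  have h2 := h1.comp (tendsto_rpow_atTop (show 0 < 2 * θ by positivity))
  filter_upwards [h2.eventually (gt_mem_nhds (show (0:ℝ) < 1 by norm_num)), Filter.eventually_gt_atTop (0:ℝ)] with v hv v0
  simp only [Function.comp] at hv
  rw [← Real.rpow_mul v0.le, show 2 * θ * (2 / θ) = (4:ℝ) by field_simp; norm_num] at hv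
  rw [Real.rpow_neg v0.le, ← one_div, le_div_iff₀ (by positivity), mul_comm]
  rw [show -(v ^ (2 * θ) / 4) = -(1 / 4) * v ^ (2 * θ) by ring]
  exact hv.le

lemma rp_sq {v a : ℝ} (hv : 0 < v) : (v ^ a) ^ 2 = v ^ (2 * a) := by
  rw [← Real.rpow_natCast, ← Real.rpow_mul hv.le]; ring_nf

set_option maxHeartbeats 1000000 in
lemma assemble {c c4 θ : ℝ} (hc : 0 < c) (hc4 : 0 < c4) (hθ : 0 < θ) (hθ1 : θ ≤ 1 / 6) :
    ∃ K C : ℝ, ∃ N0 : ℕ, 1 ≤ K ∧ 0 < C ∧ ∀ (n : ℕ), N0 ≤ n → 2 ≤ n → 1 ≤ Real.log n ∧ ∀ (T : Equiv.Perm (Fin n) → ℝ),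
      (∀ t, |t| ≤ c4 * (n:ℝ) ^ ((3:ℝ) / 2) → ‖chf T t‖ ≤ Real.exp (-(c * t ^ 2)) + Real.exp (-(c * Real.log n ^ 2))) →
      ∀ a b d M : ℝ, 0 ≤ M → (∀ t, |t| ≤ K * √(Real.log n) → ‖chf T t - g2 a b d t‖ ≤ |t| * M) → ∀ z,
      |permExp (fun π => if T π ≤ z then (1:ℝ) else 0) - GG a b d z| ≤
        2 * (K * √(Real.log n)) * M + C * (1 + |a| + |b| + |d|) * (n:ℝ) ^ (-(3:ℝ) / 2 + 3 * θ) := by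
  obtain ⟨K, hK1, hK3, hKc⟩ : ∃ K : ℝ, 1 ≤ K ∧ 3 ≤ K ∧ 3 ≤ c * K ^ 2 := by
    refine ⟨3 + 3 / c, ?_, ?_, ?_⟩
    · have : 0 < 3 / c := by positivity
      linarith
    · have : 0 < 3 / c := by positivity
      linarith
    · have : c * (3 + 3 / c) ^ 2 = 9 * c + 18 + 9 / c := by field_simp; ring
      rw [this]
      have : 0 < 9 / c := by positivity
      linarith
  have ev : ∀ᶠ n : ℕ in Filter.atTop, (max 1 (3 / c) ≤ Real.log n ∧ (n:ℝ) ^ (-θ) ≤ c4) ∧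
      Real.exp (-((n:ℝ) ^ (2 * θ) / 4)) ≤ (n:ℝ) ^ (-4:ℝ) := by
    refine tendsto_natCast_atTop_atTop.eventually (p := fun v : ℝ => (max 1 (3 / c) ≤ Real.log v ∧ v ^ (-θ) ≤ c4) ∧
      Real.exp (-(v ^ (2 * θ) / 4)) ≤ v ^ (-4:ℝ)) ?_
    refine ((Real.tendsto_log_atTop.eventually_ge_atTop _).and ?_).and (ev_exp hθ)
    exact ((tendsto_rpow_neg_atTop hθ).eventually (gt_mem_nhds hc4)).mono fun _ h => h.le
  obtain ⟨N0, hN⟩ := Filter.eventually_atTop.1 ev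
  have cg := CG_nonneg
  refine ⟨K, 2 * K ^ 2 + 4 + 4 + 2 * CG + 2, N0, hK1, by positivity, ?_⟩
  intro n hn hn2
  obtain ⟨⟨hL, hc4'⟩, hexp⟩ := hN n hn
  have L1 : 1 ≤ Real.log n := (le_max_left _ _).trans hL
  have L3 : 3 / c ≤ Real.log n := (le_max_right _ _).trans hL
  rw [div_le_iff₀ hc] at L3
  refine ⟨L1, ?_⟩
  intro T hT a b d M hM hH z
  have n0 : (0:ℝ) < n := by exact_mod_cast (by omega : 0 < n)
  have n1 : (1:ℝ) ≤ n := by exact_mod_cast (by omega : 1 ≤ n)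
  set L := Real.log n with hLdef
  have expL : ∀ q : ℝ, Real.exp (q * L) = (n:ℝ) ^ q := fun q => by
    rw [Real.rpow_def_of_pos n0, mul_comm]
  set t0 := K * √L with ht0
  have t0sq : t0 ^ 2 = K ^ 2 * L := by rw [ht0, mul_pow, Real.sq_sqrt (by linarith)]
  have sL : 1 ≤ √L := Real.one_le_sqrt.2 L1
  have t01 : 1 ≤ t0 := by nlinarith only [sL, hK1, ht0]
  have H2 : ∀ t, t0 ≤ |t| → |t| ≤ (n:ℝ) ^ ((3:ℝ) / 2 - θ) → ‖chf T t‖ ≤ 2 * (n:ℝ) ^ (-3:ℝ) := by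
    intro t h1 h2
    have h3 : |t| ≤ c4 * (n:ℝ) ^ ((3:ℝ) / 2) := by
      refine h2.trans ?_
      rw [sub_eq_add_neg, Real.rpow_add n0, mul_comm]; gcongr
    refine (hT t h3).trans ?_
    have e1 : Real.exp (-(c * t ^ 2)) ≤ (n:ℝ) ^ (-3:ℝ) := by
      rw [← expL]
      refine Real.exp_le_exp.2 ?_
      have : t0 ^ 2 ≤ t ^ 2 := by rw [← sq_abs t]; gcongr
      rw [t0sq] at this
      have h5 := mul_le_mul_of_nonneg_left this hc.le
      have : 3 * L ≤ c * K ^ 2 * L := by gcongr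
      linarith
    have e2 : Real.exp (-(c * L ^ 2)) ≤ (n:ℝ) ^ (-3:ℝ) := by
      rw [← expL]
      refine Real.exp_le_exp.2 ?_
      have : 3 * L ≤ L * c * L := by gcongr
      linarith
    linarith
  have key := smoothing (M := M) (η := 2 * (n:ℝ) ^ (-3:ℝ)) (a := a) (b := b) (c := d) T (h := (n:ℝ) ^ (-(3:ℝ) / 2 + 2 * θ)) (ℓ := (n:ℝ) ^ (-(3:ℝ) / 2 + 3 * θ)) (t0 := t0)
    (t1 := (n:ℝ) ^ ((3:ℝ) / 2 - θ)) (by positivity) (by positivity) t01 (by positivity) hM (by positivity) hH H2 z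
  refine key.trans ?_
  have r1 : 0 < (n:ℝ) ^ (-(3:ℝ) / 2 + 3 * θ) := by positivity
  have mono : ∀ q : ℝ, q ≤ -(3:ℝ) / 2 + 3 * θ → (n:ℝ) ^ q ≤ (n:ℝ) ^ (-(3:ℝ) / 2 + 3 * θ) := fun q hq =>
    Real.rpow_le_rpow_of_exponent_le n1 hq
  set ℓ := (n:ℝ) ^ (-(3:ℝ) / 2 + 3 * θ) with hℓ
  have b1 : ((n:ℝ) ^ (-(3:ℝ) / 2 + 2 * θ)) ^ 2 * t0 ^ 2 ≤ K ^ 2 * ℓ := by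
    rw [rp_sq n0, t0sq]
    have Ln : L ≤ (n:ℝ) ^ (1:ℝ) := by
      rw [Real.rpow_one]; exact (Real.log_le_sub_one_of_pos n0).trans (by linarith)
    calc (n:ℝ) ^ (2 * (-(3:ℝ) / 2 + 2 * θ)) * (K ^ 2 * L) = K ^ 2 * ((n:ℝ) ^ (2 * (-(3:ℝ) / 2 + 2 * θ)) * L) := by ring
      _ ≤ K ^ 2 * ((n:ℝ) ^ (2 * (-(3:ℝ) / 2 + 2 * θ)) * (n:ℝ) ^ (1:ℝ)) := by gcongr
      _ = K ^ 2 * (n:ℝ) ^ (2 * (-(3:ℝ) / 2 + 2 * θ) + 1) := by rw [Real.rpow_add n0 (2 * (-(3:ℝ) / 2 + 2 * θ)) 1]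
      _ ≤ K ^ 2 * ℓ := by
        have := mono (2 * (-(3:ℝ) / 2 + 2 * θ) + 1) (by linarith)
        gcongr
  have b2 : (n:ℝ) ^ ((3:ℝ) / 2 - θ) * (n:ℝ) ^ (-3:ℝ) ≤ ℓ := by
    rw [← Real.rpow_add n0]; exact mono _ (by linarith)
  have b3 : (4 / (n:ℝ) ^ (-(3:ℝ) / 2 + 2 * θ)) * Real.exp (-(((n:ℝ) ^ (-(3:ℝ) / 2 + 2 * θ)) ^ 2 * ((n:ℝ) ^ ((3:ℝ) / 2 - θ)) ^ 2 / 4)) ≤ 4 * ℓ := by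
    have : ((n:ℝ) ^ (-(3:ℝ) / 2 + 2 * θ)) ^ 2 * ((n:ℝ) ^ ((3:ℝ) / 2 - θ)) ^ 2 = (n:ℝ) ^ (2 * θ) := by
      rw [rp_sq n0, rp_sq n0, ← Real.rpow_add n0]; ring_nf
    rw [this]
    calc (4 / (n:ℝ) ^ (-(3:ℝ) / 2 + 2 * θ)) * Real.exp (-((n:ℝ) ^ (2 * θ) / 4)) ≤ (4 / (n:ℝ) ^ (-(3:ℝ) / 2 + 2 * θ)) * (n:ℝ) ^ (-4:ℝ) := by gcongr
      _ = 4 * (n:ℝ) ^ (-(-(3:ℝ) / 2 + 2 * θ) + -4) := by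
        rw [Real.rpow_add n0 (-(-(3:ℝ) / 2 + 2 * θ)) (-4), Real.rpow_neg n0.le (-(3:ℝ) / 2 + 2 * θ)]; ring
      _ ≤ 4 * ℓ := by
        have := mono (-(-(3:ℝ) / 2 + 2 * θ) + -4) (by linarith)
        gcongr
  have b4 : Real.exp (-(t0 ^ 2 / 4)) ≤ ℓ := by
    refine le_trans ?_ (mono (-2) (by linarith))
    rw [← expL, t0sq]
    refine Real.exp_le_exp.2 ?_
    have : 9 * L ≤ K ^ 2 * L := by
      have : 9 ≤ K ^ 2 := by nlinarith only [hK3]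
      gcongr
    linarith
  have b5 : Real.exp (-((ℓ / (n:ℝ) ^ (-(3:ℝ) / 2 + 2 * θ)) ^ 2) / 4) ≤ ℓ := by
    have e : (ℓ / (n:ℝ) ^ (-(3:ℝ) / 2 + 2 * θ)) ^ 2 = (n:ℝ) ^ (2 * θ) := by
      rw [hℓ, ← Real.rpow_sub n0, rp_sq n0]; ring_nf
    rw [e, neg_div]
    exact hexp.trans (mono _ (by linarith))
  have s1 : 1 ≤ 1 + |a| + |b| + |d| := by linarith [abs_nonneg a, abs_nonneg b, abs_nonneg d]
  set A := 1 + |a| + |b| + |d| with hA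
  clear_value A
  have f1 : CG * A * (Real.exp (-(t0 ^ 2 / 4)) + ℓ) ≤ 2 * CG * A * ℓ := by
    calc CG * A * (Real.exp (-(t0 ^ 2 / 4)) + ℓ) ≤ CG * A * (ℓ + ℓ) := by gcongr
      _ = _ := by ring
  have f2 : ℓ ≤ A * ℓ := le_mul_of_one_le_left r1.le s1
  have f3 : K ^ 2 * ℓ ≤ K ^ 2 * (A * ℓ) := by gcongr
  clear_value ℓ L
  linarith

end RankEdge

namespace RankEdge
variable {n p : ℕ}

/-- decay property of the characteristic function -/
def Dec (c c4 : ℝ) (T : Equiv.Perm (Fin n) → ℝ) : Prop :=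
  ∀ t, |t| ≤ c4 * (n:ℝ) ^ ((3:ℝ) / 2) → ‖chf T t‖ ≤ Real.exp (-(c * t ^ 2)) + Real.exp (-(c * Real.log n ^ 2))

lemma triv_bd (T : Equiv.Perm (Fin n) → ℝ) (a b c z : ℝ) :
    |permExp (fun π => if T π ≤ z then (1:ℝ) else 0) - GG a b c z| ≤ 2 + CG * (|a| + |b| + |c|) := by
  have h1 : 0 ≤ permExp (fun π => if T π ≤ z then (1:ℝ) else 0) := PE_nonneg fun π => by split_ifs <;> norm_num
  have h2 : permExp (fun π => if T π ≤ z then (1:ℝ) else 0) ≤ 1 := by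
    refine (PE_mono (g := fun _ => (1:ℝ)) fun π => ?_).trans (le_of_eq (PE_const 1))
    split_ifs <;> norm_num
  have h3 := abs_le.1 (GG_bd a b c z)
  rw [abs_le]; constructor <;> linarith [h3.1, h3.2]

lemma B4_low (hn : 2 ≤ n) (x y : Fin n → ℝ) : 1 / (n:ℝ) ≤ B4 x y := by
  unfold B4
  have a := W_one (by omega : 0 < n) 4 x
  have b := W_one (by omega : 0 < n) 4 y
  gcongr
  nlinarith

lemma B5_low (hn : 2 ≤ n) (x y : Fin n → ℝ) : (n:ℝ) ^ (-(3:ℝ) / 2) ≤ B5 x y := by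
  have n0 : (0:ℝ) < n := by exact_mod_cast (by omega : 0 < n)
  unfold B5
  have e : (n:ℝ) ^ (-(3:ℝ) / 2) = (1 / √(n:ℝ)) ^ 3 := by
    rw [Real.sqrt_eq_rpow, one_div, ← Real.rpow_neg n0.le, ← Real.rpow_natCast, ← Real.rpow_mul n0.le]
    norm_num
  have a := W_one (by omega : 0 < n) 5 x
  have b := W_one (by omega : 0 < n) 5 y
  rw [e]
  exact le_mul_of_one_le_left (by positivity) (by nlinarith)

lemma first_order {c c4 : ℝ} (hc : 0 < c) (hc4 : 0 < c4) (N1 : ℕ) :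
    ∃ C : ℝ, 0 < C ∧ ∀ (n : ℕ), 2 ≤ n → ∀ (T : Equiv.Perm (Fin n) → ℝ) (x y : Fin n → ℝ), Nrm x → Nrm y →
      (∀ t, chf T t = cf x y t) → (N1 ≤ n → Dec c c4 T) → ∀ z,
      |permExp (fun π => if T π ≤ z then (1:ℝ) else 0) - GG (l1 x y) 0 0 z| ≤ C * Real.log n ^ 2 * B4 x y := by
  obtain ⟨K, C0, N0, hK, hC0, H⟩ := assemble hc hc4 (show (0:ℝ) < 1 / 6 by norm_num) le_rfl
  have cg := CG_nonneg
  have kk := KK_one 4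
  have l2 : 0 < Real.log 2 := Real.log_pos (by norm_num)
  set N : ℝ := N0 + N1 + 1 with hN
  have N00 : 0 < N := by positivity
  refine ⟨(16 * K ^ 4 * (2 * KK 4 + 5) + 3 * C0) + ((2 + CG) * N + CG) / Real.log 2 ^ 2, by positivity, ?_⟩
  intro n hn T x y hx hy hT hD z
  have n2 : (2:ℝ) ≤ n := by exact_mod_cast hn
  have n0 : (0:ℝ) < n := by linarith
  have bl := B4_low hn x y
  have b0 := B4_nonneg x y
  have lsq : l1 x y ^ 2 ≤ B4 x y := l1_sq hn hx hy
  have la : |l1 x y| ≤ 1 + B4 x y := by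
    rw [← sq_abs] at lsq
    nlinarith [sq_nonneg (|l1 x y| - 1)]
  have Lp : 0 < Real.log n := Real.log_pos (by linarith)
  rcases le_or_gt (max N0 N1) n with hbig | hsmall
  · obtain ⟨L1, H'⟩ := H n ((le_max_left _ _).trans hbig) hn
    have Dn := hD ((le_max_right _ _).trans hbig)
    set L := Real.log n with hL
    have sL : 1 ≤ √L := Real.one_le_sqrt.2 L1
    set t0 := K * √L with ht0
    have t01 : 1 ≤ t0 := by nlinarith only [sL, hK, ht0]
    have key := H' T Dn (l1 x y) 0 0 ((1 + t0) ^ 3 * ((2 * KK 4 + 5) * B4 x y)) (by positivity) ?_ z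
    · refine key.trans ?_
      have s1 : 2 * t0 * ((1 + t0) ^ 3 * ((2 * KK 4 + 5) * B4 x y)) ≤ 16 * K ^ 4 * (2 * KK 4 + 5) * (L ^ 2 * B4 x y) := by
        have e : t0 ^ 4 = K ^ 4 * L ^ 2 := by
          rw [ht0, mul_pow, show √L ^ 4 = (√L ^ 2) ^ 2 by ring, Real.sq_sqrt Lp.le]
        calc 2 * t0 * ((1 + t0) ^ 3 * ((2 * KK 4 + 5) * B4 x y)) ≤ 2 * t0 * ((t0 + t0) ^ 3 * ((2 * KK 4 + 5) * B4 x y)) := by gcongr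
          _ = 16 * t0 ^ 4 * (2 * KK 4 + 5) * B4 x y := by ring
          _ = _ := by rw [e]; ring
      have s2 : C0 * (1 + |l1 x y| + |0| + |0|) * (n:ℝ) ^ (-(3:ℝ) / 2 + 3 * (1 / 6)) ≤ 3 * C0 * (L ^ 2 * B4 x y) := by
        have e : (n:ℝ) ^ (-(3:ℝ) / 2 + 3 * (1 / 6)) = 1 / n := by
          rw [show -(3:ℝ) / 2 + 3 * (1 / 6) = -1 by norm_num, Real.rpow_neg_one, one_div]
        rw [e, abs_zero]
        have i1 : (1 / (n:ℝ)) ≤ 1 := by rw [div_le_one n0]; linarith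
        have i2 : (1 + |l1 x y| + 0 + 0) * (1 / (n:ℝ)) ≤ 3 * B4 x y := by
          calc (1 + |l1 x y| + 0 + 0) * (1 / (n:ℝ)) ≤ (2 + B4 x y) * (1 / n) := by
                refine mul_le_mul_of_nonneg_right ?_ (by positivity)
                linarith
            _ = 2 * (1 / n) + B4 x y * (1 / n) := by ring
            _ ≤ 2 * B4 x y + B4 x y * 1 := by gcongr
            _ = _ := by ring
        have i3 : B4 x y ≤ L ^ 2 * B4 x y := le_mul_of_one_le_left b0 (one_le_pow₀ L1)
        calc C0 * (1 + |l1 x y| + 0 + 0) * (1 / (n:ℝ)) = C0 * ((1 + |l1 x y| + 0 + 0) * (1 / (n:ℝ))) := by ring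
          _ ≤ C0 * (3 * (L ^ 2 * B4 x y)) := by
            refine mul_le_mul_of_nonneg_left ?_ hC0.le
            linarith
          _ = _ := by ring
      have s3 : 0 ≤ ((2 + CG) * N + CG) / Real.log 2 ^ 2 * (L ^ 2 * B4 x y) := by positivity
      calc _ ≤ 16 * K ^ 4 * (2 * KK 4 + 5) * (L ^ 2 * B4 x y) + 3 * C0 * (L ^ 2 * B4 x y) := add_le_add s1 s2
        _ ≤ _ := by linarith
    · intro t ht
      rw [hT]
      refine (cf_fin1 hn hx hy t).trans ?_
      gcongr
  · refine (triv_bd T _ _ _ z).trans ?_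
    rw [abs_zero]
    have nN : (n:ℝ) ≤ N := by
      have : n ≤ N0 + N1 := by
        rcases le_total N0 N1 with h | h
        · rw [max_eq_right h] at hsmall; omega
        · rw [max_eq_left h] at hsmall; omega
      have : (n:ℝ) ≤ N0 + N1 := by exact_mod_cast this
      linarith
    have one : 1 ≤ N * B4 x y := by
      calc (1:ℝ) = n * (1 / n) := by field_simp
        _ ≤ N * B4 x y := by gcongr
    have LL : 1 ≤ Real.log n ^ 2 / Real.log 2 ^ 2 := by
      rw [one_le_div (by positivity)]
      gcongr
    have i1 : 2 + CG * (|l1 x y| + 0 + 0) ≤ ((2 + CG) * N + CG) * B4 x y := by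
      calc 2 + CG * (|l1 x y| + 0 + 0) ≤ 2 + CG * (1 + B4 x y) := by
            have := mul_le_mul_of_nonneg_left la cg
            linarith
        _ = (2 + CG) * 1 + CG * B4 x y := by ring
        _ ≤ (2 + CG) * (N * B4 x y) + CG * B4 x y := by gcongr
        _ = _ := by ring
    have i2 : ((2 + CG) * N + CG) * B4 x y ≤ ((2 + CG) * N + CG) * B4 x y * (Real.log n ^ 2 / Real.log 2 ^ 2) :=
      le_mul_of_one_le_right (by positivity) LL
    have i3 : 0 ≤ (16 * K ^ 4 * (2 * KK 4 + 5) + 3 * C0) * Real.log n ^ 2 * B4 x y := by positivity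
    calc _ ≤ ((2 + CG) * N + CG) * B4 x y * (Real.log n ^ 2 / Real.log 2 ^ 2) := i1.trans i2
      _ = ((2 + CG) * N + CG) / Real.log 2 ^ 2 * Real.log n ^ 2 * B4 x y := by ring
      _ ≤ _ := by rw [add_mul, add_mul]; linarith

lemma log_ev {q ε C : ℝ} (hε : 0 < ε) (hC : 0 < C) : ∀ᶠ v : ℝ in Filter.atTop, Real.log v ^ q * v ^ (-ε) ≤ C := by
  have h := (isLittleO_log_rpow_rpow_atTop q hε).bound hC
  filter_upwards [h, Filter.eventually_gt_atTop (1:ℝ)] with v hv v1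
  have v0 : 0 < v := by linarith
  have L := Real.log_pos v1
  rw [Real.norm_of_nonneg (by positivity), Real.norm_of_nonneg (by positivity)] at hv
  rw [Real.rpow_neg v0.le, ← div_eq_mul_inv, div_le_iff₀ (by positivity)]
  exact hv

set_option maxHeartbeats 1000000 in
lemma second_order {c c4 : ℝ} (hc : 0 < c) (hc4 : 0 < c4) (N1 : ℕ) {ε : ℝ} (hε : 0 < ε) :
    ∃ C : ℝ, 0 < C ∧ ∀ (n : ℕ), 2 ≤ n → ∀ (T : Equiv.Perm (Fin n) → ℝ) (x y : Fin n → ℝ), Nrm x → Nrm y →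
      (∀ t, chf T t = cf x y t) → (N1 ≤ n → Dec c c4 T) → ∀ z,
      |permExp (fun π => if T π ≤ z then (1:ℝ) else 0) - GG (l1 x y) (l2 x y) (l1 x y ^ 2) z| ≤ C * (n:ℝ) ^ ε * B5 x y := by
  have θ0 : 0 < min ε (1 / 2) / 3 := by positivity
  have θ1 : min ε (1 / 2) / 3 ≤ 1 / 6 := by linarith [min_le_right ε (1 / 2)]
  have θε : 3 * (min ε (1 / 2) / 3) ≤ ε := by linarith [min_le_left ε (1 / 2)]
  obtain ⟨K, C0, N0, hK, hC0, H⟩ := assemble hc hc4 θ0 θ1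
  generalize min ε (1 / 2) / 3 = θ at *
  have cg := CG_nonneg
  have kk := KK_one 5
  have K0 : 0 < K := by linarith
  have ev : ∀ᶠ n : ℕ in Filter.atTop, Real.log n ^ (5:ℝ) * (n:ℝ) ^ (-ε) ≤ 1 ∧
      Real.log n ^ (3:ℝ) * (n:ℝ) ^ (-(2 * ε)) ≤ (6 / (10 * K ^ 2)) ^ 3 / 16 := by
    refine tendsto_natCast_atTop_atTop.eventually (p := fun v : ℝ => Real.log v ^ (5:ℝ) * v ^ (-ε) ≤ 1 ∧
      Real.log v ^ (3:ℝ) * v ^ (-(2 * ε)) ≤ (6 / (10 * K ^ 2)) ^ 3 / 16) ?_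
    exact (log_ev hε one_pos).and (log_ev (by positivity) (by positivity))
  obtain ⟨N2, hN2⟩ := Filter.eventually_atTop.1 ev
  set N : ℝ := N0 + N1 + N2 + 1 with hN
  have N00 : 0 < N := by positivity
  refine ⟨(2 * K * (2 * K) ^ 9 * (6 * KK 5 + 520) + C0 * 14) + (2 + 37 * CG) * N ^ ((3:ℝ) / 2) + (2 + 37 * CG), by positivity, ?_⟩
  intro n hn T x y hx hy hT hD z
  have n2 : (2:ℝ) ≤ n := by exact_mod_cast hn
  have n0 : (0:ℝ) < n := by linarith
  have n1 : (1:ℝ) ≤ n := by linarith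
  have bl := B5_low hn x y
  have b0 := B4_nonneg x y
  have b50 := B5_nonneg x y
  have lsq : l1 x y ^ 2 ≤ B4 x y := l1_sq hn hx hy
  have la : |l1 x y| ≤ 1 + B4 x y := by
    rw [← sq_abs] at lsq
    nlinarith [sq_nonneg (|l1 x y| - 1)]
  have l2b : |l2 x y| ≤ 10 * B4 x y := l2_abs hn
  have lsq' : |l1 x y ^ 2| ≤ B4 x y := by rwa [abs_of_nonneg (sq_nonneg _)]
  have cube := B4_cube hn hx hy
  have ne1 : 1 ≤ (n:ℝ) ^ ε := Real.one_le_rpow n1 hε.le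
  have ne0 : 0 < (n:ℝ) ^ ε := by positivity
  have Lp : 0 < Real.log n := Real.log_pos (by linarith)
  have tb := triv_bd T (l1 x y) (l2 x y) (l1 x y ^ 2) z
  have tb2 : 2 + CG * (|l1 x y| + |l2 x y| + |l1 x y ^ 2|) ≤ 2 + CG * (1 + 12 * B4 x y) := by
    have := mul_le_mul_of_nonneg_left (show |l1 x y| + |l2 x y| + |l1 x y ^ 2| ≤ 1 + 12 * B4 x y by linarith) cg
    linarith
  have P1 : 0 ≤ (2 * K * (2 * K) ^ 9 * (6 * KK 5 + 520) + C0 * 14) * ((n:ℝ) ^ ε * B5 x y) := by positivity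
  have P2 : 0 ≤ (2 + 37 * CG) * N ^ ((3:ℝ) / 2) * ((n:ℝ) ^ ε * B5 x y) := by positivity
  have P3 : 0 ≤ (2 + 37 * CG) * ((n:ℝ) ^ ε * B5 x y) := by positivity
  have goal_eq : ((2 * K * (2 * K) ^ 9 * (6 * KK 5 + 520) + C0 * 14) + (2 + 37 * CG) * N ^ ((3:ℝ) / 2) + (2 + 37 * CG)) * (n:ℝ) ^ ε * B5 x y =
    (2 * K * (2 * K) ^ 9 * (6 * KK 5 + 520) + C0 * 14) * ((n:ℝ) ^ ε * B5 x y) + (2 + 37 * CG) * N ^ ((3:ℝ) / 2) * ((n:ℝ) ^ ε * B5 x y) +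
      (2 + 37 * CG) * ((n:ℝ) ^ ε * B5 x y) := by ring
  rw [goal_eq]
  rcases le_or_gt 1 ((n:ℝ) ^ ε * B5 x y) with hX | hX
  · -- trivial regime
    have b43 : B4 x y ≤ 3 * ((n:ℝ) ^ ε * B5 x y) := by
      have h5 : B5 x y ≤ (n:ℝ) ^ ε * B5 x y := le_mul_of_one_le_left b50 ne1
      generalize (n:ℝ) ^ ε * B5 x y = X at *
      by_contra hh
      push Not at hh
      have i1 : (3 * X) ^ 3 < B4 x y ^ 3 := by gcongr
      have i2 : (4 * B5 x y) ^ 2 ≤ (4 * X) ^ 2 := by gcongr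
      have i3 : (4 * X) ^ 2 ≤ (3 * X) ^ 3 := by nlinarith only [hX, mul_nonneg (sq_nonneg X) (sub_nonneg.2 hX)]
      linarith
    have : 2 + CG * (1 + 12 * B4 x y) ≤ (2 + 37 * CG) * ((n:ℝ) ^ ε * B5 x y) := by
      have i1 := mul_le_mul_of_nonneg_left b43 cg
      have i2 := mul_le_mul_of_nonneg_left hX cg
      linarith
    linarith
  · have B5s : B5 x y ≤ (n:ℝ) ^ (-ε) := by
      rw [Real.rpow_neg n0.le, ← one_div, le_div_iff₀ ne0, mul_comm]; exact hX.le
    have cube2 : B4 x y ^ 3 ≤ 16 * (n:ℝ) ^ (-(2 * ε)) := by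
      refine cube.trans ?_
      rw [mul_pow, show -(2 * ε) = 2 * (-ε) by ring, ← rp_sq n0]
      have : B5 x y ^ 2 ≤ ((n:ℝ) ^ (-ε)) ^ 2 := by gcongr
      linarith
    rcases le_or_gt (max N0 (max N1 N2)) n with hbig | hsmall
    · obtain ⟨L1, H'⟩ := H n ((le_max_left _ _).trans hbig) hn
      have Dn := hD (((le_max_left _ _).trans (le_max_right _ _)).trans hbig)
      obtain ⟨q1, q2⟩ := hN2 n (((le_max_right _ _).trans (le_max_right _ _)).trans hbig)
      set L := Real.log n with hL
      have sL : 1 ≤ √L := Real.one_le_sqrt.2 L1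
      set t0 := K * √L with ht0
      have t01 : 1 ≤ t0 := by nlinarith only [sL, hK, ht0]
      have t0sq : t0 ^ 2 = K ^ 2 * L := by rw [ht0, mul_pow, Real.sq_sqrt Lp.le]
      have r5 : L ^ (5:ℝ) = L ^ 5 := by exact_mod_cast Real.rpow_natCast L 5
      have r3 : L ^ (3:ℝ) = L ^ 3 := by exact_mod_cast Real.rpow_natCast L 3
      rw [r5, Real.rpow_neg n0.le, ← div_eq_mul_inv, div_le_one ne0] at q1
      rw [r3] at q2
      have BL : L * B4 x y ≤ 6 / (10 * K ^ 2) := by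
        refine le_of_pow_le_pow_left₀ (n := 3) (by norm_num) (by positivity) ?_
        rw [mul_pow]
        calc L ^ 3 * B4 x y ^ 3 ≤ L ^ 3 * (16 * (n:ℝ) ^ (-(2 * ε))) := by gcongr
          _ = 16 * (L ^ 3 * (n:ℝ) ^ (-(2 * ε))) := by ring
          _ ≤ 16 * ((6 / (10 * K ^ 2)) ^ 3 / 16) := by gcongr
          _ = _ := by ring
      have hb0 : 10 * B4 x y * t0 ^ 2 ≤ 6 := by
        rw [t0sq]
        calc 10 * B4 x y * (K ^ 2 * L) = 10 * K ^ 2 * (L * B4 x y) := by ring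
          _ ≤ 10 * K ^ 2 * (6 / (10 * K ^ 2)) := by gcongr
          _ = 6 := by field_simp
      have B41 : B4 x y ≤ 1 := by
        have : 10 * B4 x y * 1 ≤ 10 * B4 x y * t0 ^ 2 := by
          have := one_le_pow₀ t01 (n := 2)
          gcongr
        linarith
      have key := H' T Dn (l1 x y) (l2 x y) (l1 x y ^ 2) ((1 + t0) ^ 9 * ((6 * KK 5 + 520) * B5 x y)) (by positivity) ?_ z
      · refine key.trans ?_
        have s1 : 2 * t0 * ((1 + t0) ^ 9 * ((6 * KK 5 + 520) * B5 x y)) ≤ 2 * K * (2 * K) ^ 9 * (6 * KK 5 + 520) * ((n:ℝ) ^ ε * B5 x y) := by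
          have e : t0 ^ 10 = K ^ 10 * L ^ 5 := by
            rw [show t0 ^ 10 = (t0 ^ 2) ^ 5 by ring, t0sq]; ring
          calc 2 * t0 * ((1 + t0) ^ 9 * ((6 * KK 5 + 520) * B5 x y)) ≤ 2 * t0 * ((t0 + t0) ^ 9 * ((6 * KK 5 + 520) * B5 x y)) := by gcongr
            _ = 2 * 2 ^ 9 * t0 ^ 10 * (6 * KK 5 + 520) * B5 x y := by ring
            _ = 2 * 2 ^ 9 * K ^ 10 * (6 * KK 5 + 520) * (L ^ 5 * B5 x y) := by rw [e]; ring
            _ ≤ 2 * 2 ^ 9 * K ^ 10 * (6 * KK 5 + 520) * ((n:ℝ) ^ ε * B5 x y) := by gcongr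
            _ = _ := by ring
        have s2 : C0 * (1 + |l1 x y| + |l2 x y| + |l1 x y ^ 2|) * (n:ℝ) ^ (-(3:ℝ) / 2 + 3 * θ) ≤ C0 * 14 * ((n:ℝ) ^ ε * B5 x y) := by
          have e : (n:ℝ) ^ (-(3:ℝ) / 2 + 3 * θ) ≤ (n:ℝ) ^ ε * B5 x y := by
            rw [Real.rpow_add n0, mul_comm]
            gcongr
          have i : 1 + |l1 x y| + |l2 x y| + |l1 x y ^ 2| ≤ 14 := by linarith
          gcongr
        linarith
      · intro t ht
        rw [hT]
        have tt : 10 * B4 x y * t ^ 2 ≤ 6 := by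
          refine le_trans ?_ hb0
          have : t ^ 2 ≤ t0 ^ 2 := by rw [← sq_abs t]; gcongr
          gcongr
        refine (cf_fin2 hn hx hy t tt B41).trans ?_
        gcongr
    · have nN : (n:ℝ) ≤ N := by
        have : n ≤ N0 + N1 + N2 := by
          rcases lt_max_iff.1 hsmall with h | h
          · omega
          · rcases lt_max_iff.1 h with h | h <;> omega
        have : (n:ℝ) ≤ N0 + N1 + N2 := by exact_mod_cast this
        linarith
      have one : 1 ≤ N ^ ((3:ℝ) / 2) * ((n:ℝ) ^ ε * B5 x y) := by
        calc (1:ℝ) = (n:ℝ) ^ ((3:ℝ) / 2) * (1 * (n:ℝ) ^ (-(3:ℝ) / 2)) := by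
              rw [one_mul, ← Real.rpow_add n0]; norm_num
          _ ≤ _ := by gcongr
      have B43 : B4 x y ≤ 3 := by
        by_contra hh
        push Not at hh
        have i1 : (3:ℝ) ^ 3 < B4 x y ^ 3 := by gcongr
        have : (n:ℝ) ^ (-(2 * ε)) ≤ 1 := Real.rpow_le_one_of_one_le_of_nonpos n1 (by linarith)
        linarith
      have i1 : 2 + CG * (1 + 12 * B4 x y) ≤ 2 + 37 * CG := by
        have := mul_le_mul_of_nonneg_left B43 cg
        linarith
      have i2 := mul_le_mul_of_nonneg_left one (by positivity : 0 ≤ 2 + 37 * CG)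
      linarith

end RankEdge

/-- van Zwet's conditions imply first- and second-order Edgeworth expansions
for simple linear rank statistics `a_{ij} = e_i·d_j`, with constants depending only on
`e, E, d, D, δ, r, k, m, s` (and additionally on `ε` for the second order). -/
theorem simple_rank_statistic_edgeworth
    (e E d D δ r k m s : ℝ)
    (he : 0 < e) (hE : 0 < E) (hd : 0 < d) (hD : 0 < D) (hδ : 0 < δ)
    (hk : 2 < k) (hr : 0 < r) (hrk : r < k) (hs : 2 < s) (hm : 0 < m) (hms : m < s) :
    ∃ E1 : ℝ, 0 < E1 ∧ ∃ E2 : ℝ, 0 < E2 ∧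
      ∀ ε : ℝ, 0 < ε → ∃ E3 : ℝ, 0 < E3 ∧ ∃ E4 : ℝ, 0 < E4 ∧
        ∀ (n : ℕ), 2 ≤ n → ∀ ev dv : Fin n → ℝ,
          e * (n : ℝ) ≤ (∑ i, |ev i - (∑ i', ev i') / (n : ℝ)| ^ r) →
          (∑ i, |ev i - (∑ i', ev i') / (n : ℝ)| ^ k) ≤ E * (n : ℝ) →
          d * (n : ℝ) ≤ (∑ j, |dv j - (∑ j', dv j') / (n : ℝ)| ^ m) →
          (∑ j, |dv j - (∑ j', dv j') / (n : ℝ)| ^ s) ≤ D * (n : ℝ) →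
          (∃ ζ : ℝ, (n : ℝ) ^ (-(3 : ℝ) / 2) * Real.log n ≤ ζ ∧
            ENNReal.ofReal (δ * (n : ℝ) * ζ) ≤
              volume (⋃ j : Fin n, Metric.ball (dv j) ζ)) →
          ∀ A : Matrix (Fin n) (Fin n) ℝ, (∀ i j, A i j = ev i * dv j) →
            ((∀ z : ℝ, |Fstd A z - edge1 A z| ≤ E1 * Real.log n ^ 2 * DM A ^ 2) ∧
              E1 * Real.log n ^ 2 * DM A ^ 2 ≤
                E2 * Real.log n ^ 2 *
                  (n : ℝ) ^ (-1 + max (4 / k - 1) 0 + max (4 / s - 1) 0)) ∧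
            ((∀ z : ℝ, |Fstd A z - edge2 A z| ≤ E3 * (n : ℝ) ^ ε * EM A ^ 3) ∧
              E3 * (n : ℝ) ^ ε * EM A ^ 3 ≤
                E4 * (n : ℝ) ^ (-(3 : ℝ) / 2 + ε + max (5 / k - 1) 0 + max (5 / s - 1) 0)) := by
  obtain ⟨b1, hb1, H1⟩ := RankEdge.mom_lower (E := E) hk hr hrk he
  obtain ⟨b2, hb2, H2⟩ := RankEdge.mom_lower (E := D) hs hm hms hd
  obtain ⟨b, hb, hbb1, hbb2, hbl⟩ : ∃ b : ℝ, 0 < b ∧ b ≤ b1 ∧ b ≤ b2 ∧ b ≤ 1 :=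
    ⟨min (min b1 b2) 1, by positivity, (min_le_left _ _).trans (min_le_left _ _),
      (min_le_left _ _).trans (min_le_right _ _), min_le_right _ _⟩
  obtain ⟨δ', hδ', hδδ, hδ1⟩ : ∃ δ' : ℝ, 0 < δ' ∧ δ' ≤ δ ∧ δ' ≤ 1 :=
    ⟨min δ 1, by positivity, min_le_left _ _, min_le_right _ _⟩
  obtain ⟨c, c4, N1, hc, hc4, HD⟩ := RankEdge.cf_decay hk hs hE hD hb hbl hδ' hδ1
  obtain ⟨C, hC, HU⟩ := RankEdge.upper_bounds hk hE hs hD hb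
  obtain ⟨C1, hC1, HF⟩ := RankEdge.first_order hc hc4 N1
  refine ⟨1296 * C1, by positivity, 1296 * C1 * C, by positivity, fun ε hε => ?_⟩
  obtain ⟨C2, hC2, HS⟩ := RankEdge.second_order hc hc4 N1 hε
  refine ⟨7776 * C2, by positivity, 7776 * C2 * C, by positivity, ?_⟩
  intro n hn ev dv h1 h2 h3 h4 h5 A hA
  obtain ⟨ζ, hζ, hvol⟩ := h5
  have n0 : (0:ℝ) < n := by exact_mod_cast (by omega : 0 < n)
  have n1 : (1:ℝ) ≤ n := by exact_mod_cast (by omega : 1 ≤ n)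
  have hlog : 0 ≤ Real.log n := Real.log_nonneg n1
  have hζ0 : 0 ≤ ζ := le_trans (by positivity) hζ
  obtain ⟨a, ha⟩ : ∃ a : Fin n → ℝ, ∀ i, a i = ev i - (∑ i', ev i') / (n : ℝ) := ⟨_, fun _ => rfl⟩
  obtain ⟨b', hb'⟩ : ∃ a : Fin n → ℝ, ∀ i, a i = dv i - (∑ i', dv i') / (n : ℝ) := ⟨_, fun _ => rfl⟩
  simp only [← ha] at h1 h2
  simp only [← hb'] at h3 h4
  have va : b * n ≤ ∑ i, a i ^ 2 := le_trans (by gcongr) (H1 n a h1 h2)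
  have vb : b * n ≤ ∑ i, b' i ^ 2 := le_trans (by gcongr) (H2 n b' h3 h4)
  have bn : 0 < b * n := by positivity
  have sa : ∑ i, a i = 0 := by simp only [ha]; exact RankEdge.sum_ctr0 hn ev
  have sb : ∑ i, b' i = 0 := by simp only [hb']; exact RankEdge.sum_ctr0 hn dv
  obtain ⟨x, y, hx, hy, xe, ye, hh, hchf, hcf⟩ :=
    RankEdge.normalize hn hA ha hb' (bn.trans_le va) (bn.trans_le vb)
  have hvol' : ENNReal.ofReal (δ' * n * ζ) ≤ volume (⋃ j : Fin n, Metric.ball (dv j) ζ) :=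
    (ENNReal.ofReal_le_ofReal (by gcongr)).trans hvol
  have dec : N1 ≤ n → RankEdge.Dec c c4 (rankTstd A) := by
    intro hN t ht
    rw [hchf, hcf]
    exact HD n hN hn a dv b' _ ζ sa va h2 hb' sb vb h4 hζ hvol' t ht
  obtain ⟨u1, u2⟩ := HU n hn A a x b' y hh h2 va h4 vb xe ye
  refine ⟨⟨fun z => ?_, ?_⟩, ⟨fun z => ?_, ?_⟩⟩
  · have h := HF n hn (rankTstd A) x y hx hy hchf dec z
    have e1 : edge1 A z = RankEdge.GG (RankEdge.l1 x y) 0 0 z := by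
      rw [← RankEdge.lam1_eq hn hh]; unfold edge1 RankEdge.GG; ring
    rw [e1]
    calc _ ≤ C1 * Real.log n ^ 2 * RankEdge.B4 x y := h
      _ ≤ C1 * Real.log n ^ 2 * (1296 * DM A ^ 2) := by
          gcongr; exact RankEdge.B4_DM hn hh hx hy
      _ = _ := by ring
  · calc 1296 * C1 * Real.log n ^ 2 * DM A ^ 2
        ≤ 1296 * C1 * Real.log n ^ 2 *
          (C * (n : ℝ) ^ (-1 + max (4 / k - 1) 0 + max (4 / s - 1) 0)) := by gcongr
      _ = _ := by ring
  · have h := HS n hn (rankTstd A) x y hx hy hchf dec z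
    have e1 : edge2 A z =
        RankEdge.GG (RankEdge.l1 x y) (RankEdge.l2 x y) (RankEdge.l1 x y ^ 2) z := by
      rw [← RankEdge.lam1_eq hn hh, ← RankEdge.lam2_eq hn hh hx hy]; rfl
    rw [e1]
    calc _ ≤ C2 * (n : ℝ) ^ ε * RankEdge.B5 x y := h
      _ ≤ C2 * (n : ℝ) ^ ε * (7776 * EM A ^ 3) := by
          gcongr; exact RankEdge.B5_EM hn hh hx hy
      _ = _ := by ring
  · have e2 : (n : ℝ) ^ (-(3 : ℝ) / 2 + ε + max (5 / k - 1) 0 + max (5 / s - 1) 0) =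
        (n : ℝ) ^ ε * (n : ℝ) ^ (-(3 : ℝ) / 2 + max (5 / k - 1) 0 + max (5 / s - 1) 0) := by
      rw [← Real.rpow_add n0]; congr 1; ring
    calc 7776 * C2 * (n : ℝ) ^ ε * EM A ^ 3
        ≤ 7776 * C2 * (n : ℝ) ^ ε *
          (C * (n : ℝ) ^ (-(3 : ℝ) / 2 + max (5 / k - 1) 0 + max (5 / s - 1) 0)) := by gcongr
      _ = _ := by rw [e2]; ring
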